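/- Let Δ_1, …, Δ_k be integral polytopes in ℝ^n that are independent, i.e., dim(Σ_{i∈J} Δ_i) ≥ |J| for all nonempty J ⊆ {1,…,k}, and let Z be the zero set in (ℂ*)^n of generic Laurent polynomials f_1, …, f_k with Newton polytopes Δ_1, …, Δ_k. If for every nonempty J ⊆ {1,…,k} such that the relative interior of Δ_J = Σ_{i∈J} Δ_i contains a lattice point one has dim(Δ_J) − |J| ≠ 0, then Z is irreducible (equivalently h^{0,0}(Z) = 1). -/

import Mathlib

open Pointwise Module

namespace Khov

open Polynomial in
theorem entire_ext (S0 : Finset ℂ) (C : ℝ) (B : ℕ) (S : Finset ℂ) : S ⊆ S0 → ∀ f : ℂ → ℂ,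
    DifferentiableOn ℂ f (↑S : Set ℂ)ᶜ → (∀ s ∉ S0, ‖f s‖ ≤ C * (1 + ‖s‖) ^ B) →
    ∃ g : ℂ → ℂ, Differentiable ℂ g ∧ ∀ s ∉ S0, g s = f s := by
  classical
  induction S using Finset.induction_on with
  | empty =>
    intro _ f hf _
    exact ⟨f, by simpa [differentiableOn_univ] using hf, fun _ _ => rfl⟩
  | insert a S ha ih =>
    intro hS f hf hb
    have haS0 : a ∈ S0 := hS (Finset.mem_insert_self _ _)
    have hSS : S ⊆ S0 := fun x hx => hS (Finset.mem_insert_of_mem hx)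
    set f' := Function.update f a (Filter.limUnder (nhdsWithin a {a}ᶜ) f) with hf'
    have heq : ∀ s, s ≠ a → f' s = f s := fun s hs => by simp [hf', Function.update_of_ne hs]
    -- neighbourhood
    set N : Set ℂ := Metric.ball a 1 ∩ (↑(S0.erase a) : Set ℂ)ᶜ with hN
    have hNopen : IsOpen N := Metric.isOpen_ball.inter (S0.erase a).finite_toSet.isClosed.isOpen_compl
    have haN : a ∈ N := ⟨Metric.mem_ball_self one_pos, by simp⟩
    have hNd : ∀ s ∈ N \ {a}, s ∉ S0 := by
      rintro s ⟨⟨_, h1⟩, h2⟩ h3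
      exact h1 (by simpa using ⟨h3, h2⟩)
    have hd : DifferentiableOn ℂ f' N := by
      apply Complex.differentiableOn_update_limUnder_of_bddAbove (hNopen.mem_nhds haN)
      · refine hf.mono fun s hs h => hNd s hs (hS h)
      · refine ⟨|C| * (1 + (‖a‖ + 1)) ^ B, ?_⟩
        rintro _ ⟨s, hs, rfl⟩
        refine (hb s (hNd s hs)).trans ?_
        have h1 : ‖s‖ ≤ ‖a‖ + 1 := by
          have := hs.1.1
          rw [Metric.mem_ball, dist_eq_norm] at this
          calc ‖s‖ = ‖a + (s - a)‖ := by ring_nf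
            _ ≤ ‖a‖ + ‖s - a‖ := norm_add_le _ _
            _ ≤ _ := by linarith
        calc C * (1 + ‖s‖) ^ B ≤ |C| * (1 + ‖s‖) ^ B := by gcongr; exact le_abs_self C
          _ ≤ _ := by gcongr
    obtain ⟨g, hg, hgf⟩ := ih hSS f' (by
      intro s hs
      by_cases hsa : s = a
      · subst hsa
        exact (hd.differentiableAt (hNopen.mem_nhds haN)).differentiableWithinAt
      · have hs' : s ∈ (↑(insert a S) : Set ℂ)ᶜ := by
          simpa [hsa] using hs
        have hopen : IsOpen (↑(insert a S) : Set ℂ)ᶜ := (insert a S).finite_toSet.isClosed.isOpen_compl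
        have h1 := hf.differentiableAt (hopen.mem_nhds hs')
        refine (h1.congr_of_eventuallyEq ?_).differentiableWithinAt
        filter_upwards [isOpen_ne.mem_nhds hsa] with z hz using heq z hz)
      (fun s hs => by rw [heq s (fun h => hs (h ▸ haS0))]; exact hb s hs)
    exact ⟨g, hg, fun s hs => (hgf s hs).trans (heq s (fun h => hs (h ▸ haS0)))⟩

open Polynomial in
theorem poly_of_entire_growth (g : ℂ → ℂ) (hg : Differentiable ℂ g) (C : ℝ) (B : ℕ)
    (hb : ∀ s, ‖g s‖ ≤ C * (1 + ‖s‖) ^ B) :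
    ∃ A : ℂ[X], A.natDegree ≤ B ∧ ∀ s, g s = A.eval s := by
  have hz : ∀ m, B < m → iteratedDeriv m g 0 = 0 := by
    intro m hm
    have h1 : ∀ R : ℝ, 1 ≤ R → ‖iteratedDeriv m g 0‖ ≤ (m.factorial * (|C| * 2 ^ B)) * R⁻¹ := by
      intro R hR
      have hR0 : 0 < R := by linarith
      have h2 := Complex.norm_iteratedDeriv_le_of_forall_mem_sphere_norm_le (c := 0) (R := R)
        (C := |C| * (2 * R) ^ B) m hR0 hg.diffContOnCl (by
          intro z hz
          have hz' : ‖z‖ = R := by simpa using hz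
          refine (hb z).trans ?_
          rw [hz']
          calc C * (1 + R) ^ B ≤ |C| * (1 + R) ^ B := by gcongr; exact le_abs_self C
            _ ≤ |C| * (2 * R) ^ B := by gcongr; linarith)
      refine h2.trans ?_
      rw [div_le_iff₀ (by positivity)]
      have h3 : R ^ (B + 1) ≤ R ^ m := pow_le_pow_right₀ hR hm
      have h4 : (m.factorial * (|C| * 2 ^ B)) * R⁻¹ * R ^ (B+1)
          = m.factorial * (|C| * (2 * R) ^ B) := by
        rw [mul_pow, pow_succ]; field_simp
      rw [← h4]
      gcongr
    have h2 : Filter.Tendsto (fun R : ℝ => (m.factorial * (|C| * 2 ^ B)) * R⁻¹) Filter.atTop (nhds 0) := by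
      simpa using tendsto_inv_atTop_zero.const_mul (m.factorial * (|C| * 2 ^ B) : ℝ)
    have h3 : ‖iteratedDeriv m g 0‖ ≤ 0 := ge_of_tendsto h2 (by
      filter_upwards [Filter.eventually_ge_atTop 1] with R hR using h1 R hR)
    simpa using h3
  refine ⟨∑ m ∈ Finset.range (B+1), Polynomial.monomial m ((m.factorial : ℂ)⁻¹ * iteratedDeriv m g 0), ?_, ?_⟩
  · refine Polynomial.natDegree_sum_le_of_forall_le _ _ fun m hm => ?_
    refine (Polynomial.natDegree_monomial_le _).trans ?_
    have := Finset.mem_range.1 hm; omega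
  · intro s
    have h := (Complex.hasSum_taylorSeries_of_entire hg 0 s).unique (hasSum_sum_of_ne_finset_zero (s := Finset.range (B+1)) (by
      intro m hm
      rw [hz m (by simpa using hm)]; simp))
    rw [h, Polynomial.eval_finsetSum]
    refine Finset.sum_congr rfl fun m _ => ?_
    simp; ring

open Polynomial in
theorem poly_of_growth (S : Finset ℂ) (f : ℂ → ℂ) (C : ℝ) (B : ℕ)
    (hf : DifferentiableOn ℂ f (↑S : Set ℂ)ᶜ) (hb : ∀ s ∉ S, ‖f s‖ ≤ C * (1 + ‖s‖) ^ B) :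
    ∃ A : ℂ[X], A.natDegree ≤ B ∧ ∀ s ∉ S, f s = A.eval s := by
  obtain ⟨g, hg, hgf⟩ := entire_ext S C B S subset_rfl f hf hb
  obtain ⟨A, hA, hgA⟩ := poly_of_entire_growth g hg C B (by
    have hcl : IsClosed {s : ℂ | ‖g s‖ ≤ C * (1 + ‖s‖) ^ B} :=
      isClosed_le hg.continuous.norm (by fun_prop)
    have hd : Dense (↑S : Set ℂ)ᶜ := S.finite_toSet.countable.dense_compl ℝ
    intro s
    have : closure (↑S : Set ℂ)ᶜ ⊆ {s : ℂ | ‖g s‖ ≤ C * (1 + ‖s‖) ^ B} :=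
      hcl.closure_subset_iff.2 fun z hz => by
        have := hgf z hz
        show ‖g z‖ ≤ _
        rw [this]; exact hb z hz
    exact this (hd s))
  exact ⟨A, hA, fun s hs => (hgf s hs).symm.trans (hgA s)⟩

end Khov

open Pointwise Module
namespace Khov
open Polynomial

theorem local_root (P : ℂ[X][X]) (s0 T0 : ℂ)
    (h0 : (P.map (evalRingHom s0)).eval T0 = 0)
    (h1 : (derivative (P.map (evalRingHom s0))).eval T0 ≠ 0) :
    ∃ τ : ℂ → ℂ, τ s0 = T0 ∧ DifferentiableAt ℂ τ s0 ∧
      ∀ᶠ s in nhds s0, (P.map (evalRingHom s)).eval (τ s) = 0 := by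
  set f : ℂ × ℂ → ℂ := fun z => (P.map (evalRingHom z.1)).eval z.2 with hf
  have hf' : f = fun z => ∑ i ∈ Finset.range (P.natDegree + 1), (P.coeff i).eval z.1 * z.2 ^ i := by
    funext z
    simp only [hf, eval_map, eval₂_eq_sum_range, coe_evalRingHom]
  have cdf : ContDiffAt ℂ 1 f (s0, T0) := by
    rw [hf']
    apply ContDiff.contDiffAt
    refine ContDiff.sum fun i _ => ContDiff.mul ?_ (contDiff_snd.pow i)
    exact ((Polynomial.contDiff_aeval (P.coeff i) 1).comp contDiff_fst)
  have hd : HasFDerivAt f (fderiv ℂ f (s0, T0)) (s0, T0) :=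
    (cdf.differentiableAt one_ne_zero).hasFDerivAt
  set d := (derivative (P.map (evalRingHom s0))).eval T0 with hdd
  have h2 : fderiv ℂ f (s0, T0) ∘L .inr ℂ ℂ ℂ = ContinuousLinearMap.toSpanSingleton ℂ d := by
    have ha : HasFDerivAt (fun t => f (s0, t)) (fderiv ℂ f (s0, T0) ∘L .inr ℂ ℂ ℂ) T0 :=
      HasFDerivAt.comp T0 hd (hasFDerivAt_prodMk_right s0 T0)
    have hb : HasDerivAt (fun t => f (s0, t)) d T0 :=
      (P.map (evalRingHom s0)).hasDerivAt T0
    exact ha.unique hb.hasFDerivAt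
  have hinv : (fderiv ℂ f (s0, T0) ∘L .inr ℂ ℂ ℂ).IsInvertible := by
    rw [h2]
    refine ContinuousLinearMap.IsInvertible.of_inverse (g := ContinuousLinearMap.toSpanSingleton ℂ d⁻¹) ?_ ?_ <;>
    · ext; simp [h1]
  refine ⟨cdf.implicitFunction one_ne_zero hinv, cdf.implicitFunction_apply_self one_ne_zero hinv,
    (cdf.hasStrictFDerivAt_implicitFunction one_ne_zero hinv).differentiableAt, ?_⟩
  filter_upwards [cdf.eventually_apply_implicitFunction one_ne_zero hinv] with s hs
  exact hs.trans h0

/-- The polynomial with simple roots at the roots of `P_s` lying in `u`. -/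
noncomputable def NW (P : ℂ[X][X]) (u : Set (ℂ × ℂ)) (s : ℂ) : Finset ℂ :=
  open Classical in (P.map (evalRingHom s)).roots.toFinset.filter (fun T => (s, T) ∈ u)

theorem mem_NW {P : ℂ[X][X]} (hP : P.Monic) {u : Set (ℂ × ℂ)} {s T : ℂ} :
    T ∈ NW P u s ↔ (P.map (evalRingHom s)).eval T = 0 ∧ (s, T) ∈ u := by
  classical
  have : P.map (evalRingHom s) ≠ 0 := (hP.map _).ne_zero
  simp [NW, this]

theorem coeff_prod_diff {ι : Type*} (S : Finset ι) (τ : ι → ℂ → ℂ) (s0 : ℂ)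
    (h : ∀ i ∈ S, DifferentiableAt ℂ (τ i) s0) (m : ℕ) :
    DifferentiableAt ℂ (fun s => (∏ i ∈ S, (X - C (τ i s))).coeff m) s0 := by
  classical
  induction S using Finset.induction_on generalizing m with
  | empty => simp
  | insert a S ha ih =>
    have ih' := fun m => ih (fun i hi => h i (Finset.mem_insert_of_mem hi)) m
    have ha' := h a (Finset.mem_insert_self _ _)
    simp only [Finset.prod_insert ha]
    cases m with
    | zero => simp only [sub_mul, coeff_sub, coeff_C_zero, mul_coeff_zero, coeff_X_zero, zero_mul]
              exact (differentiableAt_const _).sub (ha'.mul (ih' 0))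
    | succ m => simp only [sub_mul, coeff_sub, coeff_C_mul, coeff_X_mul]
                exact (ih' m).sub (ha'.mul (ih' (m+1)))

theorem roots_card {P : ℂ[X][X]} (hP : P.Monic) {s : ℂ}
    (hsep : ∀ T, (P.map (evalRingHom s)).eval T = 0 →
      (derivative (P.map (evalRingHom s))).eval T ≠ 0) :
    (P.map (evalRingHom s)).roots.Nodup := by
  rw [Multiset.nodup_iff_count_le_one]
  intro T
  rw [count_roots]
  by_contra hlt
  have h1 := (one_lt_rootMultiplicity_iff_isRoot (p := P.map (evalRingHom s)) (hP.map _).ne_zero).1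
    (not_le.1 hlt)
  exact hsep T h1.1 h1.2

theorem local_NW (P : ℂ[X][X]) (hP : P.Monic) (q : ℂ[X])
    (hsep : ∀ s T, q.eval s ≠ 0 → (P.map (evalRingHom s)).eval T = 0 →
      (derivative (P.map (evalRingHom s))).eval T ≠ 0)
    (u v : Set (ℂ × ℂ)) (hu : IsOpen u) (hv : IsOpen v)
    (hcov : ∀ s T, q.eval s ≠ 0 → (P.map (evalRingHom s)).eval T = 0 → (s, T) ∈ u ∪ v)
    (hdis : ∀ s T, q.eval s ≠ 0 → (P.map (evalRingHom s)).eval T = 0 → (s, T) ∉ u ∩ v)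
    (s0 : ℂ) (hs0 : q.eval s0 ≠ 0) :
    ∃ τ : ℂ → ℂ → ℂ, (∀ T ∈ NW P u s0, DifferentiableAt ℂ (τ T) s0) ∧
      ∀ᶠ s in nhds s0, ∏ T ∈ NW P u s, (X - C T) = ∏ T ∈ NW P u s0, (X - C (τ T s)) ∧
        (NW P u s).card = (NW P u s0).card := by
  classical
  set R : ℂ → Finset ℂ := fun s => (P.map (evalRingHom s)).roots.toFinset with hR
  have hmemR : ∀ s T, T ∈ R s ↔ (P.map (evalRingHom s)).eval T = 0 := fun s T => by
    have : P.map (evalRingHom s) ≠ 0 := (hP.map _).ne_zero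
    simp [hR, this]
  have hRcard : ∀ s, q.eval s ≠ 0 → (R s).card = P.natDegree := fun s hs => by
    rw [hR]
    simp only
    rw [Multiset.toFinset_card_of_nodup (roots_card hP (hsep s · hs)),
      IsAlgClosed.card_roots_eq_natDegree, hP.natDegree_map]
  have hloc : ∀ T : ℂ, ∃ τ : ℂ → ℂ, T ∈ R s0 → (τ s0 = T ∧ DifferentiableAt ℂ τ s0 ∧
      ∀ᶠ s in nhds s0, (P.map (evalRingHom s)).eval (τ s) = 0) := fun T => by
    by_cases hT : T ∈ R s0
    · obtain ⟨τ, h⟩ := local_root P s0 T ((hmemR _ _).1 hT) (hsep _ _ hs0 ((hmemR _ _).1 hT))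
      exact ⟨τ, fun _ => h⟩
    · exact ⟨0, fun h => absurd h hT⟩
  choose τ hτ using hloc
  have hsub : NW P u s0 ⊆ R s0 := Finset.filter_subset _ _
  refine ⟨τ, fun T hT => (hτ T (hsub hT)).2.1, ?_⟩
  have e1 : ∀ᶠ s in nhds s0, ∀ T ∈ R s0, (P.map (evalRingHom s)).eval (τ T s) = 0 :=
    (Filter.eventually_all_finset _).2 fun T hT => (hτ T hT).2.2
  have e2 : ∀ᶠ s in nhds s0, ∀ T ∈ R s0, ∀ T' ∈ R s0, T ≠ T' → τ T s ≠ τ T' s := by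
    refine (Filter.eventually_all_finset _).2 fun T hT => (Filter.eventually_all_finset _).2 fun T' hT' => ?_
    by_cases hTT : T = T'
    · simp [hTT]
    · have h1 := (hτ T hT).2.1.continuousAt
      have h2 := (hτ T' hT').2.1.continuousAt
      have h3 : τ T s0 ≠ τ T' s0 := by rw [(hτ T hT).1, (hτ T' hT').1]; exact hTT
      filter_upwards [(h1.sub h2).eventually_ne (sub_ne_zero.2 h3)] with s hs _ using sub_ne_zero.1 hs
  have e3 : ∀ᶠ s in nhds s0, ∀ T ∈ R s0, ((s0, T) ∈ u → (s, τ T s) ∈ u) ∧ ((s0, T) ∈ v → (s, τ T s) ∈ v) := by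
    refine (Filter.eventually_all_finset _).2 fun T hT => ?_
    have hc : ContinuousAt (fun s => (s, τ T s)) s0 :=
      continuousAt_id.prodMk (hτ T hT).2.1.continuousAt
    have key : ∀ w : Set (ℂ × ℂ), IsOpen w → ∀ᶠ s in nhds s0, (s0, T) ∈ w → (s, τ T s) ∈ w := by
      intro w hw
      by_cases hTw : (s0, T) ∈ w
      · have : w ∈ nhds ((fun s => (s, τ T s)) s0) := by
          simp only [(hτ T hT).1]; exact hw.mem_nhds hTw
        filter_upwards [hc this] with s hs _ using hs
      · simp [hTw]
    exact (key u hu).and (key v hv)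
  have e4 : ∀ᶠ s in nhds s0, q.eval s ≠ 0 := q.continuous.continuousAt.eventually_ne hs0
  filter_upwards [e1, e2, e3, e4] with s h1 h2 h3 h4
  have hinj : Set.InjOn (fun T => τ T s) (R s0) := fun T hT T' hT' h => by
    by_contra hne; exact h2 T hT T' hT' hne h
  have himg : (R s0).image (fun T => τ T s) = R s := by
    apply Finset.eq_of_subset_of_card_le
    · intro z hz
      obtain ⟨T, hT, rfl⟩ := Finset.mem_image.1 hz
      exact (hmemR _ _).2 (h1 T hT)
    · rw [Finset.card_image_of_injOn hinj, hRcard s h4, hRcard s0 hs0]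
  have hNW : NW P u s = (NW P u s0).image (fun T => τ T s) := by
    ext z
    rw [mem_NW hP, Finset.mem_image]
    constructor
    · rintro ⟨hz, hzu⟩
      have : z ∈ R s := (hmemR _ _).2 hz
      rw [← himg] at this
      obtain ⟨T, hT, rfl⟩ := Finset.mem_image.1 this
      refine ⟨T, (mem_NW hP).2 ⟨(hmemR _ _).1 hT, ?_⟩, rfl⟩
      rcases hcov s0 T hs0 ((hmemR _ _).1 hT) with h | h
      · exact h
      · exact absurd ⟨hzu, (h3 T hT).2 h⟩ (hdis s _ h4 hz)
    · rintro ⟨T, hT, rfl⟩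
      exact ⟨h1 T (hsub hT), (h3 T (hsub hT)).1 ((mem_NW hP).1 hT).2⟩
  have hinj' : Set.InjOn (fun T => τ T s) (NW P u s0) := hinj.mono (by exact_mod_cast hsub)
  rw [hNW, Finset.prod_image hinj', Finset.card_image_of_injOn hinj']
  exact ⟨rfl, rfl⟩

theorem root_bound (P : ℂ[X][X]) (hP : P.Monic) (D : ℕ) (hD : ∀ i, (P.coeff i).natDegree ≤ D) :
    ∃ C : ℝ, 1 ≤ C ∧ ∀ s T, (P.map (evalRingHom s)).eval T = 0 → ‖T‖ ≤ C * (1 + ‖s‖) ^ D := by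
  have hA : ∀ A : ℂ[X], A.natDegree ≤ D → ∃ c : ℝ, 0 ≤ c ∧ ∀ s, ‖A.eval s‖ ≤ c * (1 + ‖s‖) ^ D := by
    intro A hA
    refine ⟨∑ i ∈ Finset.range (A.natDegree + 1), ‖A.coeff i‖, by positivity, fun s => ?_⟩
    rw [eval_eq_sum_range, Finset.sum_mul]
    refine (norm_sum_le _ _).trans (Finset.sum_le_sum fun i hi => ?_)
    rw [norm_mul, norm_pow]
    have h1 : i ≤ D := by have := Finset.mem_range.1 hi; omega
    have h2 : ‖s‖ ^ i ≤ (1 + ‖s‖) ^ D := by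
      calc ‖s‖ ^ i ≤ (1 + ‖s‖) ^ i := by gcongr; linarith
        _ ≤ _ := pow_le_pow_right₀ (by linarith [norm_nonneg s]) h1
    gcongr
  choose c hc0 hc using fun i => hA (P.coeff i) (hD i)
  refine ⟨∑ i ∈ Finset.range P.natDegree, c i + 1, by
    have : 0 ≤ ∑ i ∈ Finset.range P.natDegree, c i := Finset.sum_nonneg fun i _ => hc0 i
    linarith, fun s T hT => ?_⟩
  have hm : (P.map (evalRingHom s)).Monic := hP.map _
  have h1 := (IsRoot.norm_lt_cauchyBound (p := P.map (evalRingHom s)) hm.ne_zero hT).le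
  have h2 : (cauchyBound (P.map (evalRingHom s)) : ℝ) ≤
      (∑ i ∈ Finset.range P.natDegree, c i) * (1 + ‖s‖) ^ D + 1 := by
    simp only [cauchyBound, hm.leadingCoeff, nnnorm_one, div_one, hP.natDegree_map]
    push_cast
    gcongr
    have h0 : 0 ≤ (∑ i ∈ Finset.range P.natDegree, c i) * (1 + ‖s‖) ^ D := by
      have : 0 ≤ ∑ i ∈ Finset.range P.natDegree, c i := Finset.sum_nonneg fun i _ => hc0 i
      positivity
    rw [← Real.coe_toNNReal _ h0, NNReal.coe_le_coe]
    have h3 : ((Finset.range P.natDegree).sup fun x => ‖(P.map (evalRingHom s)).coeff x‖₊) ≤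
        Real.toNNReal ((∑ i ∈ Finset.range P.natDegree, c i) * (1 + ‖s‖) ^ D) := by
      refine Finset.sup_le fun i hi => ?_
      rw [← NNReal.coe_le_coe, Real.coe_toNNReal _ h0]
      simp only [coe_nnnorm, coeff_map, coe_evalRingHom]
      refine (hc i s).trans ?_
      gcongr
      exact Finset.single_le_sum (f := c) (fun i _ => hc0 i) hi
    exact h3
  have h4 : (1 : ℝ) ≤ (1 + ‖s‖) ^ D := one_le_pow₀ (by linarith [norm_nonneg s])
  have h5 : ‖T‖ ≤ (cauchyBound (P.map (evalRingHom s)) : ℝ) := by exact_mod_cast h1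
  calc ‖T‖ ≤ _ := h5.trans h2
    _ ≤ _ := by rw [add_mul, one_mul]; linarith

theorem prod_coeff_bound (S : Finset ℂ) (R : ℝ) (hR : 1 ≤ R) (N : ℕ) (hN : S.card ≤ N)
    (h : ∀ z ∈ S, ‖z‖ ≤ R) (m : ℕ) :
    ‖(∏ z ∈ S, (X - C z)).coeff m‖ ≤ 2 ^ N * R ^ N := by
  set p := ∏ z ∈ S, (X - C z) with hp
  have hm : p.Monic := monic_prod_of_monic _ _ fun z _ => monic_X_sub_C z
  have hroots : p.roots = S.val := by
    rw [hp]; exact roots_prod_X_sub_C S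
  have hdeg : p.natDegree = S.card := by
    rw [hp, natDegree_prod_of_monic _ _ fun z _ => monic_X_sub_C z]; simp
  have h1 := coeff_le_of_roots_le (f := RingHom.id ℂ) (B := R) m hm
    (IsAlgClosed.splits _) (by
      intro z hz
      rw [map_id, hroots] at hz
      exact h z hz)
  rw [map_id, hdeg] at h1
  refine h1.trans ?_
  rw [mul_comm]
  gcongr
  · calc ((S.card.choose m : ℕ) : ℝ) ≤ ((2 ^ S.card : ℕ) : ℝ) := by
          exact_mod_cast Nat.choose_le_two_pow _ _
      _ = 2 ^ S.card := by push_cast; rfl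
      _ ≤ 2 ^ N := pow_le_pow_right₀ (by norm_num) hN
  omega

theorem AN_aux (P : ℂ[X][X]) (hP : P.Monic) (q : ℂ[X]) (hq : q ≠ 0)
    (D : ℕ) (hD : ∀ i, (P.coeff i).natDegree ≤ D)
    (hsep : ∀ s T, q.eval s ≠ 0 → (P.map (evalRingHom s)).eval T = 0 →
      (derivative (P.map (evalRingHom s))).eval T ≠ 0)
    (u v : Set (ℂ × ℂ)) (hu : IsOpen u) (hv : IsOpen v)
    (hcov : ∀ s T, q.eval s ≠ 0 → (P.map (evalRingHom s)).eval T = 0 → (s, T) ∈ u ∪ v)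
    (hdis : ∀ s T, q.eval s ≠ 0 → (P.map (evalRingHom s)).eval T = 0 → (s, T) ∉ u ∩ v) :
    ∃ G : ℂ[X][X], G.Monic ∧ (∀ m, (G.coeff m).natDegree ≤ P.natDegree * D) ∧
      ∀ s, q.eval s ≠ 0 → G.map (evalRingHom s) = ∏ T ∈ NW P u s, (X - C T) ∧
        (NW P u s).card = G.natDegree := by
  classical
  obtain ⟨K, hK1, hK⟩ := root_bound P hP D hD
  have hloc := local_NW P hP q hsep u v hu hv hcov hdis
  have hU : ∀ s, s ∉ q.roots.toFinset ↔ q.eval s ≠ 0 := fun s => by simp [hq]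
  have hcardle : ∀ s, (NW P u s).card ≤ P.natDegree := fun s =>
    (Finset.card_filter_le _ _).trans ((Multiset.toFinset_card_le _).trans
      ((card_roots' _).trans (by rw [hP.natDegree_map])))
  have hex : ∀ m, ∃ A : ℂ[X], A.natDegree ≤ P.natDegree * D ∧ ∀ s ∉ q.roots.toFinset,
      (∏ T ∈ NW P u s, (X - C T)).coeff m = A.eval s := by
    intro m
    refine poly_of_growth q.roots.toFinset (fun s => (∏ T ∈ NW P u s, (X - C T)).coeff m)
      (2 ^ P.natDegree * K ^ P.natDegree) (P.natDegree * D) ?_ ?_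
    · intro s hs
      obtain ⟨τ, hτ, hev⟩ := hloc s ((hU s).1 hs)
      refine DifferentiableAt.differentiableWithinAt ?_
      refine (coeff_prod_diff (NW P u s) τ s hτ m).congr_of_eventuallyEq ?_
      filter_upwards [hev] with z hz
      rw [hz.1]
    · intro s hs
      have h1 : (1 : ℝ) ≤ (1 + ‖s‖) ^ D := one_le_pow₀ (by linarith [norm_nonneg s])
      have := prod_coeff_bound (NW P u s) (K * (1 + ‖s‖) ^ D) (by nlinarith) P.natDegree (hcardle s)
        (fun z hz => hK s z ((mem_NW hP).1 hz).1) m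
      refine this.trans (le_of_eq ?_)
      rw [mul_pow, ← pow_mul, mul_comm D]; ring
  choose A hAdeg hA using hex
  -- constancy of the number of roots
  have hconn : IsPreconnected ((↑q.roots.toFinset : Set ℂ)ᶜ) :=
    (Set.Countable.isConnected_compl_of_one_lt_rank (by simp) q.roots.toFinset.finite_toSet.countable).isPreconnected
  have hcont : ContinuousOn (fun s => (NW P u s).card) ((↑q.roots.toFinset : Set ℂ)ᶜ) := by
    intro s hs
    obtain ⟨τ, hτ, hev⟩ := hloc s ((hU s).1 hs)
    refine ContinuousAt.continuousWithinAt ?_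
    refine (continuousAt_const (y := (NW P u s).card)).congr ?_
    filter_upwards [hev] with z hz using hz.2.symm
  obtain ⟨s1, hs1⟩ : ((↑q.roots.toFinset : Set ℂ)ᶜ).Nonempty :=
    (Set.Countable.isConnected_compl_of_one_lt_rank (by simp) q.roots.toFinset.finite_toSet.countable).nonempty
  set d := (NW P u s1).card with hd
  have hconst : ∀ s, q.eval s ≠ 0 → (NW P u s).card = d := fun s hs =>
    hconn.constant hcont ((hU s).2 hs) hs1
  have hcoeff : ∀ s, q.eval s ≠ 0 → (∏ T ∈ NW P u s, (X - C T)).natDegree = d := fun s hs => by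
    rw [natDegree_prod_of_monic _ _ fun z _ => monic_X_sub_C z]; simp [hconst s hs]
  set G : ℂ[X][X] := X ^ d + ∑ m ∈ Finset.range d, C (A m) * X ^ m with hG
  have hlt : (∑ m ∈ Finset.range d, C (A m) * X ^ m : ℂ[X][X]).degree < d := by
    refine (degree_sum_le _ _).trans_lt ((Finset.sup_lt_iff (WithBot.bot_lt_coe d)).2 fun m hm => ?_)
    exact (degree_C_mul_X_pow_le _ _).trans_lt (Nat.cast_lt.2 (Finset.mem_range.1 hm))
  have hGm : G.Monic := monic_X_pow_add hlt
  have hGd : G.natDegree = d := by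
    refine natDegree_eq_of_degree_eq_some ?_
    rw [hG, degree_add_eq_left_of_degree_lt (by rwa [degree_X_pow]), degree_X_pow]
  have hGc : ∀ m, G.coeff m = if m < d then A m else if m = d then 1 else 0 := by
    intro m
    simp only [hG, coeff_add, coeff_X_pow, finsetSum_coeff, coeff_C_mul]
    by_cases h1 : m < d
    · simp [h1, h1.ne]
    · simp [h1]
  refine ⟨G, hGm, fun m => ?_, fun s hs => ⟨?_, by rw [hGd, hconst s hs]⟩⟩
  · rw [hGc]; split_ifs
    · exact hAdeg m
    · simp
    · simp
  · ext m
    rw [coeff_map, hGc, coe_evalRingHom]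
    have hmon : (∏ T ∈ NW P u s, (X - C T)).Monic :=
      monic_prod_of_monic _ _ fun z _ => monic_X_sub_C z
    split_ifs with h1 h2
    · exact (hA m s ((hU s).2 hs)).symm
    · subst h2
      have := hmon.coeff_natDegree
      rw [hcoeff s hs] at this
      simp [this]
    · rw [coeff_eq_zero_of_natDegree_lt (by rw [hcoeff s hs]; omega)]; simp

/-- Connectedness of an irreducible plane curve (finite over the line) minus finitely many fibres. -/
theorem AN_lemma (P : ℂ[X][X]) (hP : P.Monic) (q : ℂ[X]) (hq : q ≠ 0)
    (D : ℕ) (hD : ∀ i, (P.coeff i).natDegree ≤ D)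
    (hsep : ∀ s T, q.eval s ≠ 0 → (P.map (evalRingHom s)).eval T = 0 →
      (derivative (P.map (evalRingHom s))).eval T ≠ 0)
    (hirr : ∀ G H : ℂ[X][X], G.Monic → H.Monic → (∀ m, (G.coeff m).natDegree ≤ P.natDegree * D) →
      (∀ m, (H.coeff m).natDegree ≤ P.natDegree * D) → P = G * H → G.natDegree = 0 ∨ H.natDegree = 0) :
    IsPreconnected {z : ℂ × ℂ | q.eval z.1 ≠ 0 ∧ (P.map (evalRingHom z.1)).eval z.2 = 0} := by
  classical
  rw [isPreconnected_iff_subset_of_disjoint]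
  intro u v hu hv hcov hdis
  have hcov' : ∀ s T, q.eval s ≠ 0 → (P.map (evalRingHom s)).eval T = 0 → (s, T) ∈ u ∪ v :=
    fun s T h1 h2 => hcov ⟨h1, h2⟩
  have hdis' : ∀ s T, q.eval s ≠ 0 → (P.map (evalRingHom s)).eval T = 0 → (s, T) ∉ u ∩ v :=
    fun s T h1 h2 h3 => by
      have : (s, T) ∈ (∅ : Set (ℂ × ℂ)) := hdis ▸ ⟨⟨h1, h2⟩, h3⟩
      exact this
  obtain ⟨G, hGm, hGd, hG⟩ := AN_aux P hP q hq D hD hsep u v hu hv hcov' hdis'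
  obtain ⟨H, hHm, hHd, hH⟩ := AN_aux P hP q hq D hD hsep v u hv hu
    (fun s T h1 h2 => (hcov' s T h1 h2).symm) (fun s T h1 h2 h3 => hdis' s T h1 h2 h3.symm)
  have hprod : ∀ s, q.eval s ≠ 0 → P.map (evalRingHom s) = G.map (evalRingHom s) * H.map (evalRingHom s) := by
    intro s hs
    rw [(hG s hs).1, (hH s hs).1, ← Finset.prod_union]
    · have hnd := roots_card hP (hsep s · hs)
      have h1 : P.map (evalRingHom s) = ∏ T ∈ (P.map (evalRingHom s)).roots.toFinset, (X - C T) := by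
        conv_lhs => rw [(IsAlgClosed.splits (P.map (evalRingHom s))).eq_prod_roots_of_monic (hP.map _)]
        rw [Finset.prod, Multiset.toFinset_val, Multiset.dedup_eq_self.2 hnd]
      have h2 : NW P u s ∪ NW P v s = (P.map (evalRingHom s)).roots.toFinset := by
        ext T
        have hne : P.map (evalRingHom s) ≠ 0 := (hP.map _).ne_zero
        rw [Finset.mem_union, mem_NW hP, mem_NW hP, Multiset.mem_toFinset, mem_roots hne]
        constructor
        · rintro (h | h) <;> exact h.1
        · intro h
          rcases hcov' s T hs h with h' | h'
          · exact Or.inl ⟨h, h'⟩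
          · exact Or.inr ⟨h, h'⟩
      rw [h2]; exact h1
    · rw [Finset.disjoint_left]
      intro T h1 h2
      rw [mem_NW hP] at h1 h2
      exact hdis' s T hs h1.1 ⟨h1.2, h2.2⟩
  have hPGH : P = G * H := by
    ext1 m
    refine Polynomial.eq_of_infinite_eval_eq _ _ ?_
    refine Set.Infinite.mono (s := (↑q.roots.toFinset : Set ℂ)ᶜ) ?_ (Set.Finite.infinite_compl q.roots.toFinset.finite_toSet)
    intro s hs
    have hs' : q.eval s ≠ 0 := by simpa [hq] using hs
    have := congrArg (fun p => p.coeff m) (hprod s hs')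
    simp only [← Polynomial.map_mul, coeff_map, coe_evalRingHom] at this
    exact this
  rcases hirr G H hGm hHm hGd hHd hPGH with h | h
  · right
    rintro ⟨s, T⟩ ⟨h1, h2⟩
    rcases hcov' s T h1 h2 with h' | h'
    · have hc := (hG s h1).2
      rw [h, Finset.card_eq_zero] at hc
      have : T ∈ NW P u s := (mem_NW hP).2 ⟨h2, h'⟩
      simp [hc] at this
    · exact h'
  · left
    rintro ⟨s, T⟩ ⟨h1, h2⟩
    rcases hcov' s T h1 h2 with h' | h'
    · exact h'
    · have hc := (hH s h1).2
      rw [h, Finset.card_eq_zero] at hc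
      have : T ∈ NW P v s := (mem_NW hP).2 ⟨h2, h'⟩
      simp [hc] at this

end Khov

open Pointwise Module
namespace Khov

section RealConv

theorem intrinsicInterior_mono' {E : Type*} [NormedAddCommGroup E] [NormedSpace ℝ E] {s t : Set E} (h : s ⊆ t) (hs : affineSpan ℝ s = affineSpan ℝ t) :
    intrinsicInterior ℝ s ⊆ intrinsicInterior ℝ t := by
  unfold intrinsicInterior
  rw [hs]
  exact Set.image_mono (interior_mono (Set.preimage_mono h))

variable {E : Type*} [NormedAddCommGroup E] [NormedSpace ℝ E] [FiniteDimensional ℝ E]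

/-- criterion for relative interior -/
theorem mem_intrinsicInterior_of_ray {P : Set E} (hP : Convex ℝ P) {W : E} (hW : W ∈ P)
    (h : ∀ p ∈ P, ∃ ε : ℝ, 0 < ε ∧ W + ε • (-(p - W)) ∈ P) : W ∈ intrinsicInterior ℝ P := by
  obtain ⟨y, hy⟩ := Set.Nonempty.intrinsicInterior hP ⟨W, hW⟩
  have hyP := intrinsicInterior_subset hy
  obtain ⟨ε, hε, hq⟩ := h y hyP
  set q := W + ε • (-(y - W)) with hqd
  have h1 : (0 : ℝ) < 1 + ε := by linarith
  have ht : ε / (1 + ε) ≠ 0 := by positivity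
  let φ := AffineEquiv.homothetyUnitsMulHom (R := ℝ) q (Units.mk0 (ε / (1 + ε)) ht)
  have hφ : ∀ z, φ z = (ε / (1 + ε)) • (z - q) + q := fun z => by
    simp [φ, AffineMap.homothety_apply]
  have hφs : ∀ z, φ.symm z = (ε / (1 + ε))⁻¹ • (z - q) + q := fun z => by
    have := congrFun (AffineEquiv.coe_homothetyUnitsMulHom_apply_symm (R := ℝ) q (Units.mk0 (ε / (1 + ε)) ht)) z
    simp only [φ, this, AffineMap.homothety_apply]
    simp
  have hsub : φ '' P ⊆ P := by
    rintro _ ⟨z, hz, rfl⟩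
    rw [hφ]
    have := hP hz hq (a := ε / (1 + ε)) (b := 1 / (1 + ε)) (by positivity) (by positivity)
      (by field_simp; ring)
    convert this using 1
    have : (1 / (1 + ε)) = 1 - ε / (1 + ε) := by field_simp; ring
    rw [this]; module
  have hspan : affineSpan ℝ (φ '' P) = affineSpan ℝ P := by
    apply le_antisymm (affineSpan_mono ℝ hsub)
    have hm := AffineSubspace.map_span (k := ℝ) (φ : E →ᵃ[ℝ] E) P
    have hco : ⇑(φ : E →ᵃ[ℝ] E) '' P = φ '' P := rfl
    rw [hco] at hm
    rw [← hm]
    intro z hz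
    refine (AffineSubspace.mem_map).2 ⟨φ.symm z, ?_, by simp⟩
    rw [hφs]
    have hqs : q ∈ affineSpan ℝ P := subset_affineSpan ℝ P hq
    have := AffineSubspace.smul_vsub_vadd_mem (affineSpan ℝ P) ((ε / (1 + ε))⁻¹) hz hqs hqs
    simpa using this
  have hWφ : W = φ y := by
    rw [hφ, hqd]
    have : ε / (1 + ε) * (1 + ε) = ε := by field_simp
    have : (ε / (1 + ε)) • (y - (W + ε • (-(y - W)))) = (ε / (1 + ε) * (1 + ε)) • (y - W) := by module
    rw [this, ‹ε / (1 + ε) * (1 + ε) = ε›]; module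
  rw [hWφ]
  refine intrinsicInterior_mono' hsub hspan ?_
  rw [AffineEquiv.intrinsicInterior_image]
  exact ⟨y, hy, rfl⟩
end RealConv

section Cone
variable {E : Type*} [AddCommGroup E] [Module ℝ E]

theorem ray_smaller {P : Set E} (hP : Convex ℝ P) {δ r : E} (hδ : δ ∈ P) {ε : ℝ} (hε : 0 < ε)
    (h : δ + ε • r ∈ P) {η : ℝ} (hη : 0 ≤ η) (hηε : η ≤ ε) : δ + η • r ∈ P := by
  have := hP hδ h (a := 1 - η / ε) (b := η / ε) (by rw [sub_nonneg, div_le_one hε]; exact hηε)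
    (by positivity) (by ring)
  convert this using 1
  rw [smul_add, smul_smul, div_mul_cancel₀ _ hε.ne']; module

theorem mem_span_fin {R M ι : Type*} [Ring R] [AddCommGroup M] [Module R M] (e : ι → M) (S : Finset ι)
    (x : M) : x ∈ Submodule.span R (e '' (S : Set ι)) ↔ ∃ s : ι → R, ∑ i ∈ S, s i • e i = x := by
  classical
  rw [Submodule.mem_span_image_finset_iff_exists_fun]
  constructor
  · rintro ⟨c, rfl⟩
    refine ⟨fun i => if h : i ∈ S then c ⟨i, h⟩ else 0, ?_⟩
    rw [← Finset.sum_coe_sort]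
    simp
  · rintro ⟨s, rfl⟩
    exact ⟨fun i => s i, Finset.sum_coe_sort S fun i => s i • e i⟩

/-- the cone of feasible directions -/
def FD (P : Set E) (δ : E) : Set E := {r | ∃ ε : ℝ, 0 < ε ∧ δ + ε • r ∈ P}

theorem FD_add {P : Set E} (hP : Convex ℝ P) {δ r s : E} (hr : r ∈ FD P δ)
    (hs : s ∈ FD P δ) (hδ : δ ∈ P) : r + s ∈ FD P δ := by
  obtain ⟨ε, hε, h1⟩ := hr
  obtain ⟨η, hη, h2⟩ := hs
  have hm : 0 < min ε η := lt_min hε hη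
  have h1' := ray_smaller hP hδ hε h1 hm.le (min_le_left _ _)
  have h2' := ray_smaller hP hδ hη h2 hm.le (min_le_right _ _)
  refine ⟨min ε η / 2, by positivity, ?_⟩
  have := hP h1' h2' (a := 1 / 2) (b := 1 / 2) (by norm_num) (by norm_num) (by norm_num)
  convert this using 1
  module

theorem FD_smul {P : Set E} {δ r : E} (hδ : δ ∈ P) (hr : r ∈ FD P δ) {c : ℝ} (hc : 0 ≤ c) :
    c • r ∈ FD P δ := by
  obtain ⟨ε, hε, h⟩ := hr
  rcases hc.eq_or_lt with rfl | hc
  · exact ⟨1, one_pos, by simpa using hδ⟩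
  · refine ⟨ε / c, by positivity, ?_⟩
    rwa [smul_smul, div_mul_cancel₀ _ hc.ne']

variable {ι : Type*}

/-- Minkowski sums of convex hulls -/
def PJ (B : ι → Set E) (J : Finset ι) : Set E := ∑ i ∈ J, convexHull ℝ (B i)

theorem PJ_convex (B : ι → Set E) (J : Finset ι) : Convex ℝ (PJ B J) :=
  convex_sum _ fun i _ => convex_convexHull ℝ _

/-- span of the differences -/
def VJ (B : ι → Set E) (J : Finset ι) : Submodule ℝ E :=
  Submodule.span ℝ {v | ∃ i ∈ J, ∃ a ∈ B i, ∃ b ∈ B i, v = b - a}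

theorem mem_PJ {B : ι → Set E} {J : Finset ι} {x : E} :
    x ∈ PJ B J ↔ ∃ g : ι → E, (∀ i ∈ J, g i ∈ convexHull ℝ (B i)) ∧ ∑ i ∈ J, g i = x := by
  rw [PJ, Set.mem_finsetSum]
  constructor
  · rintro ⟨g, hg, h⟩; exact ⟨g, fun i hi => hg hi, h⟩
  · rintro ⟨g, hg, h⟩; exact ⟨g, fun {i} hi => hg i hi, h⟩

theorem conv_sub_mem (B : Set E) (V : Submodule ℝ E) (h : ∀ a ∈ B, ∀ b ∈ B, b - a ∈ V) :
    ∀ p ∈ convexHull ℝ B, ∀ q ∈ convexHull ℝ B, q - p ∈ V := by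
  intro p hp q hq
  have h1 : ∀ a ∈ B, ∀ q ∈ convexHull ℝ B, q - a ∈ V := by
    intro a ha q hq
    have : convexHull ℝ B ⊆ (fun x => x - a) ⁻¹' (V : Set E) := by
      refine convexHull_min (fun b hb => h a ha b hb) ?_
      intro x hx y hy s t hs ht hst
      have := V.add_mem (V.smul_mem s hx) (V.smul_mem t hy)
      simp only [Set.mem_preimage, SetLike.mem_coe]
      convert this using 1
      rw [show s = 1 - t by linarith]; module
    exact this hq
  obtain ⟨a, ha⟩ : B.Nonempty := by
    rw [← convexHull_nonempty_iff (𝕜 := ℝ)]; exact ⟨p, hp⟩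
  have := V.sub_mem (h1 a ha q hq) (h1 a ha p hp)
  simpa using this

theorem PJ_sub_mem (B : ι → Set E) (J : Finset ι) : ∀ p ∈ PJ B J, ∀ q ∈ PJ B J, q - p ∈ VJ B J := by
  intro p hp q hq
  obtain ⟨g, hg, rfl⟩ := mem_PJ.1 hp
  obtain ⟨g', hg', rfl⟩ := mem_PJ.1 hq
  rw [← Finset.sum_sub_distrib]
  refine Submodule.sum_mem _ fun i hi => ?_
  exact conv_sub_mem (B i) (VJ B J) (fun a ha b hb => Submodule.subset_span ⟨i, hi, a, ha, b, hb, rfl⟩)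
    _ (hg i hi) _ (hg' i hi)

theorem vectorSpan_PJ (B : ι → Set E) (hB : ∀ i, (B i).Nonempty) (J : Finset ι) :
    vectorSpan ℝ (PJ B J) = VJ B J := by
  classical
  apply le_antisymm
  · rw [vectorSpan, Submodule.span_le]
    rintro _ ⟨q, hq, p, hp, rfl⟩
    exact PJ_sub_mem B J p hp q hq
  · rw [VJ, Submodule.span_le]
    rintro _ ⟨i, hi, a, ha, b, hb, rfl⟩
    choose g hg using hB
    have h1 : ∀ a ∈ B i, ∑ j ∈ J, Function.update g i a j ∈ PJ B J := fun a ha =>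
      mem_PJ.2 ⟨_, fun j hj => subset_convexHull ℝ _ (by
        by_cases hji : j = i
        · subst hji; simpa using ha
        · simpa [hji] using hg j), rfl⟩
    have h2 := vsub_mem_vectorSpan ℝ (h1 b hb) (h1 a ha)
    rw [vsub_eq_sub, ← Finset.sum_sub_distrib, Finset.sum_eq_single i] at h2
    · simpa using h2
    · intro j _ hji; simp [hji]
    · exact fun h => absurd hi h

theorem FD_lift {Q R : Set E} {δ δ' u : E} (hu : u ∈ FD Q δ) (hδ' : δ' ∈ R) :
    u ∈ FD (Q + R) (δ + δ') := by
  obtain ⟨ε, hε, h⟩ := hu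
  exact ⟨ε, hε, _, h, δ', hδ', by simp only []; abel⟩

theorem FD_sum {P : Set E} (hP : Convex ℝ P) {δ : E} (hδ : δ ∈ P) (S : Finset ι) (u : ι → E)
    (h : ∀ i ∈ S, u i ∈ FD P δ) : ∑ i ∈ S, u i ∈ FD P δ := by
  classical
  induction S using Finset.induction_on with
  | empty => exact ⟨1, one_pos, by simpa using hδ⟩
  | insert a S ha ih =>
    rw [Finset.sum_insert ha]
    exact FD_add hP (h a (by simp)) (ih fun i hi => h i (by simp [hi])) hδ

theorem step_T [DecidableEq ι] (B : ι → Set E) (I J S : Finset ι) (hS : S ⊆ I \ J) (e : ι → E)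
    (δ : E) (hδ : δ ∈ PJ B J) (w : ι → E) (hw : ∀ i ∈ S, w i ∈ convexHull ℝ (B i))
    (ρ : ι → ℝ) (hρ : ∑ i ∈ S, ρ i • e i ∈ FD (PJ B J) δ)
    (hl : ∀ i ∈ S, ∀ y : ℝ, ∃ l0 : ℝ, ∀ l, l0 ≤ l → (y - l * ρ i) • e i ∈ FD (convexHull ℝ (B i)) (w i))
    (hT : ∀ r ∈ VJ B I, ∃ s : ι → ℝ, r - ∑ i ∈ I \ J, s i • e i ∈ FD (PJ B J) δ) :
    δ + ∑ i ∈ S, w i ∈ PJ B (J ∪ S) ∧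
    ∀ r ∈ VJ B I, ∃ s : ι → ℝ, r - ∑ i ∈ I \ (J ∪ S), s i • e i ∈ FD (PJ B (J ∪ S)) (δ + ∑ i ∈ S, w i) := by
  have hdisj : Disjoint J S := by
    rw [Finset.disjoint_left]; intro a ha hS'; exact (Finset.mem_sdiff.1 (hS hS')).2 ha
  have hPU : PJ B (J ∪ S) = PJ B J + PJ B S := Finset.sum_union hdisj
  have hwS : ∑ i ∈ S, w i ∈ PJ B S := mem_PJ.2 ⟨w, hw, rfl⟩
  have hmem : δ + ∑ i ∈ S, w i ∈ PJ B (J ∪ S) := by rw [hPU]; exact Set.add_mem_add hδ hwS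
  have hconv := PJ_convex B (J ∪ S)
  refine ⟨hmem, fun r hr => ?_⟩
  obtain ⟨y, hy⟩ := hT r hr
  have hl' : ∀ i, ∃ l0 : ℝ, i ∈ S → ∀ l, l0 ≤ l → (y i - l * ρ i) • e i ∈ FD (convexHull ℝ (B i)) (w i) := by
    intro i
    by_cases hi : i ∈ S
    · obtain ⟨l0, h⟩ := hl i hi (y i); exact ⟨l0, fun _ => h⟩
    · exact ⟨0, fun h => absurd h hi⟩
  choose l0 hl0 using hl'
  set l : ℝ := ∑ i ∈ S, |l0 i| with hld
  have hlge : ∀ i ∈ S, l0 i ≤ l := fun i hi => (le_abs_self _).trans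
    (Finset.single_le_sum (f := fun i => |l0 i|) (fun i _ => abs_nonneg _) hi)
  have hlnn : 0 ≤ l := Finset.sum_nonneg fun i _ => abs_nonneg _
  refine ⟨y, ?_⟩
  have hsplit : ∑ i ∈ I \ J, y i • e i = ∑ i ∈ I \ (J ∪ S), y i • e i + ∑ i ∈ S, y i • e i := by
    rw [← Finset.sum_sdiff hS]
    congr 2
    ext i; simp only [Finset.mem_sdiff, Finset.mem_union]; tauto
  have key : r - ∑ i ∈ I \ (J ∪ S), y i • e i =
      ((r - ∑ i ∈ I \ J, y i • e i) + l • ∑ i ∈ S, ρ i • e i) + ∑ i ∈ S, (y i - l * ρ i) • e i := by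
    rw [hsplit]
    simp only [sub_smul, Finset.sum_sub_distrib, Finset.smul_sum, smul_smul]
    abel
  rw [key]
  refine FD_add hconv ?_ (FD_sum hconv hmem S _ fun i hi => ?_) hmem
  · rw [hPU]
    exact FD_lift (FD_add (PJ_convex B J) hy (FD_smul hδ hρ hlnn) hδ) hwS
  · have h1 : PJ B (J ∪ S) = convexHull ℝ (B i) + PJ B ((J ∪ S).erase i) :=
      (Finset.add_sum_erase _ _ (Finset.mem_union_right _ hi)).symm
    have h2 : δ + ∑ i ∈ S, w i = w i + (δ + ∑ i ∈ S.erase i, w i) := by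
      rw [← Finset.add_sum_erase _ _ hi]; abel
    rw [h1, h2]
    refine FD_lift (hl0 i hi l (hlge i hi)) ?_
    have h3 : (J ∪ S).erase i = J ∪ S.erase i := by
      rw [Finset.erase_union_distrib, Finset.erase_eq_of_notMem (Finset.disjoint_right.1 hdisj hi)]
    rw [h3, PJ, Finset.sum_union (hdisj.mono_right (Finset.erase_subset _ _))]
    exact Set.add_mem_add hδ (mem_PJ.2 ⟨w, fun j hj => hw j (Finset.mem_of_mem_erase hj), rfl⟩)

theorem FD_seg {B : Set E} {a b : E} (ha : a ∈ B) (hb : b ∈ B) {t z : ℝ} (ht0 : 0 ≤ t) (ht1 : t ≤ 1)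
    (h0 : t = 0 → 0 ≤ z) (h1 : t = 1 → z ≤ 0) :
    z • (b - a) ∈ FD (convexHull ℝ B) (a + t • (b - a)) := by
  have hmem : ∀ u : ℝ, 0 ≤ u → u ≤ 1 → a + u • (b - a) ∈ convexHull ℝ B := fun u hu0 hu1 => by
    have := (convex_convexHull ℝ B) (subset_convexHull ℝ B ha) (subset_convexHull ℝ B hb)
      (a := 1 - u) (b := u) (by linarith) hu0 (by ring)
    convert this using 1; module
  have : ∃ ε : ℝ, 0 < ε ∧ 0 ≤ t + ε * z ∧ t + ε * z ≤ 1 := by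
    rcases lt_trichotomy z 0 with hz | hz | hz
    · have ht : 0 < t := lt_of_le_of_ne ht0 fun h => by linarith [h0 h.symm]
      refine ⟨t / (-z), div_pos ht (by linarith), ?_, ?_⟩
      · have : t / (-z) * z = -t := by rw [div_neg, neg_mul, div_mul_cancel₀ _ hz.ne]
        rw [this]; linarith
      · have : t / (-z) * z = -t := by rw [div_neg, neg_mul, div_mul_cancel₀ _ hz.ne]
        rw [this]; linarith
    · exact ⟨1, one_pos, by simp [hz, ht0], by simp [hz, ht1]⟩
    · have ht : t < 1 := lt_of_le_of_ne ht1 fun h => by linarith [h1 h]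
      have : (1 - t) / z * z = 1 - t := by field_simp
      refine ⟨(1 - t) / z, div_pos (by linarith) hz, ?_, ?_⟩ <;> rw [this] <;> linarith
  obtain ⟨ε, hε, hh0, hh1⟩ := this
  refine ⟨ε, hε, ?_⟩
  have := hmem _ hh0 hh1
  convert this using 1; module

/-- the combinatorial condition leading to criticality -/
def Good [DecidableEq ι] (V : Submodule ℝ E) (Γ : AddSubgroup E) (B : ι → Set E) (I : Finset ι) : Prop :=
  ∃ J ⊆ I, J.Nonempty ∧ ∃ e : ι → E, (∀ i ∈ I \ J, ∃ a ∈ B i, ∃ b ∈ B i, e i = b - a) ∧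
    LinearIndepOn ℝ e ((I \ J : Finset ι) : Set ι) ∧ ∃ W ∈ Γ, ∀ r ∈ V, ∃ ε : ℝ, 0 < ε ∧
      ∃ p ∈ PJ B J, ∃ s : ι → ℝ, W + ε • r = p + ∑ i ∈ I \ J, s i • e i

end Cone

section Crit
variable {E : Type*} [NormedAddCommGroup E] [NormedSpace ℝ E] [FiniteDimensional ℝ E] {ι : Type*}

def Crit (Γ : AddSubgroup E) (B : ι → Set E) : Prop :=
  ∃ J : Finset ι, J.Nonempty ∧ finrank ℝ (vectorSpan ℝ (PJ B J)) = J.card ∧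
    ∃ W ∈ Γ, W ∈ intrinsicInterior ℝ (PJ B J)

theorem crit_base [DecidableEq ι] (Γ : AddSubgroup E) (B : ι → Set E) (hB : ∀ i, (B i).Nonempty)
    (I : Finset ι) (hI : finrank ℝ (VJ B I) = I.card) (J : Finset ι) (hJI : J ⊆ I)
    (hJ : J.Nonempty) (e : ι → E) (he : ∀ i ∈ I \ J, ∃ a ∈ B i, ∃ b ∈ B i, e i = b - a)
    (hli : LinearIndepOn ℝ e ((I \ J : Finset ι) : Set ι)) (W : E) (hW : W ∈ Γ) (hWP : W ∈ PJ B J)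
    (hT : ∀ r ∈ VJ B I, ∃ s : ι → ℝ, r - ∑ i ∈ I \ J, s i • e i ∈ FD (PJ B J) W)
    (hdis : ∀ s : ι → ℝ, ∑ i ∈ I \ J, s i • e i ∈ FD (PJ B J) W → ∑ i ∈ I \ J, s i • e i = 0) :
    Crit Γ B := by
  have hconv := PJ_convex B J
  have hFDV : ∀ r ∈ FD (PJ B J) W, r ∈ VJ B J := by
    rintro r ⟨ε, hε, h⟩
    have := PJ_sub_mem B J _ hWP _ h
    rw [add_sub_cancel_left] at this
    exact (Submodule.smul_mem_iff _ hε.ne').1 this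
  have hVle : VJ B J ≤ VJ B I := Submodule.span_mono (by
    rintro _ ⟨i, hi, h⟩; exact ⟨i, hJI hi, h⟩)
  have hneg : ∀ r ∈ FD (PJ B J) W, -r ∈ FD (PJ B J) W := by
    intro r hr
    obtain ⟨s, hs⟩ := hT (-r) (Submodule.neg_mem _ (hVle (hFDV r hr)))
    have h1 := FD_add hconv hr hs hWP
    have h2 : r + (-r - ∑ i ∈ I \ J, s i • e i) = ∑ i ∈ I \ J, (fun i => - s i) i • e i := by
      simp only [neg_smul, Finset.sum_neg_distrib]; abel
    rw [h2] at h1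
    have h3 := hdis _ h1
    have h4 : ∑ i ∈ I \ J, s i • e i = 0 := by simpa using h3
    rwa [h4, sub_zero] at hs
  let T : Submodule ℝ E :=
    { carrier := FD (PJ B J) W
      add_mem' := fun ha hb => FD_add hconv ha hb hWP
      zero_mem' := ⟨1, one_pos, by simpa using hWP⟩
      smul_mem' := fun c x hx => by
        rcases le_total 0 c with hc | hc
        · exact FD_smul hWP hx hc
        · have := FD_smul hWP (hneg x hx) (c := -c) (by linarith)
          simpa using this }
  have hsub : ∀ p ∈ PJ B J, p - W ∈ T := fun p hp => ⟨1, one_pos, by simpa using hp⟩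
  have hTV : vectorSpan ℝ (PJ B J) = T := by
    apply le_antisymm
    · rw [vectorSpan, Submodule.span_le]
      rintro _ ⟨q, hq, p, hp, rfl⟩
      have := T.sub_mem (hsub q hq) (hsub p hp)
      simpa using this
    · rw [vectorSpan_PJ B hB]; exact hFDV
  refine ⟨J, hJ, ?_, W, hW, mem_intrinsicInterior_of_ray hconv hWP fun p hp => ?_⟩
  · set N := Submodule.span ℝ (e '' ((I \ J : Finset ι) : Set ι)) with hN
    have hmemN : ∀ x, x ∈ N ↔ ∃ s : ι → ℝ, ∑ i ∈ I \ J, s i • e i = x := mem_span_fin e _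
    have hNV : N ≤ VJ B I := by
      rw [hN, Submodule.span_le]
      rintro _ ⟨i, hi, rfl⟩
      obtain ⟨a, ha, b, hb, h⟩ := he i hi
      exact Submodule.subset_span ⟨i, (Finset.mem_sdiff.1 hi).1, a, ha, b, hb, h⟩
    have hsup : T ⊔ N = VJ B I := by
      apply le_antisymm (sup_le (fun r hr => hVle (hFDV r hr)) hNV)
      intro r hr
      obtain ⟨s, hs⟩ := hT r hr
      have h2 := Submodule.add_mem_sup (S := T) (T := N) hs ((hmemN _).2 ⟨s, rfl⟩)
      simpa using h2
    have hinf : T ⊓ N = ⊥ := by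
      rw [eq_bot_iff]
      rintro x ⟨hx1, hx2⟩
      obtain ⟨s, rfl⟩ := (hmemN _).1 hx2
      exact hdis s hx1
    have h1 := Submodule.finrank_sup_add_finrank_inf_eq T N
    rw [hsup, hinf, finrank_bot, hI] at h1
    have h2 : finrank ℝ N = (I \ J).card := by
      have := finrank_span_eq_card (R := ℝ) (b := fun i : ((I \ J : Finset ι) : Set ι) => e i) hli
      rw [hN, Set.image_eq_range, this]; exact Fintype.card_coe (I \ J)
    rw [Finset.card_sdiff_of_subset hJI] at h2
    have := Finset.card_le_card hJI
    rw [hTV]; omega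
  · have := hneg _ (hsub p hp)
    exact this

theorem crit_ind [DecidableEq ι] (Γ : AddSubgroup E) (B : ι → Set E) (hB : ∀ i, (B i).Nonempty)
    (I : Finset ι) (hBΓ : ∀ i ∈ I, ∀ a ∈ B i, a ∈ Γ)
    (hI : finrank ℝ (VJ B I) = I.card) (m : ℕ) : ∀ (J : Finset ι), (I \ J).card = m → J ⊆ I →
    J.Nonempty → ∀ (e : ι → E), (∀ i ∈ I \ J, ∃ a ∈ B i, ∃ b ∈ B i, e i = b - a) →
    (LinearIndepOn ℝ e ((I \ J : Finset ι) : Set ι)) → ∀ (W : E), W ∈ Γ → W ∈ PJ B J →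
    (∀ r ∈ VJ B I, ∃ s : ι → ℝ, r - ∑ i ∈ I \ J, s i • e i ∈ FD (PJ B J) W) → Crit Γ B := by
  induction m using Nat.strong_induction_on with
  | _ m ih =>
  intro J hm hJI hJ e he hli W hW hWP hT
  by_cases hdis : ∀ s : ι → ℝ, ∑ i ∈ I \ J, s i • e i ∈ FD (PJ B J) W → ∑ i ∈ I \ J, s i • e i = 0
  · exact crit_base Γ B hB I hI J hJI hJ e he hli W hW hWP hT hdis
  push Not at hdis
  obtain ⟨s, hs, hs0⟩ := hdis
  have he' : ∀ i, ∃ a b, i ∈ I \ J → a ∈ B i ∧ b ∈ B i ∧ e i = b - a := by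
    intro i
    by_cases hi : i ∈ I \ J
    · obtain ⟨a, ha, b, hb, h⟩ := he i hi; exact ⟨a, b, fun _ => ⟨ha, hb, h⟩⟩
    · exact ⟨0, 0, fun h => absurd h hi⟩
  choose a b hab using he'
  set S := (I \ J).filter fun i => s i ≠ 0 with hSd
  have hS : S ⊆ I \ J := Finset.filter_subset _ _
  have hsumS : ∑ i ∈ I \ J, s i • e i = ∑ i ∈ S, s i • e i := by
    rw [hSd, Finset.sum_filter_of_ne]
    intro i _ h h0; simp [h0] at h
  have hSne : S.Nonempty := by
    by_contra h
    rw [Finset.not_nonempty_iff_eq_empty] at h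
    rw [hsumS, h] at hs0; simp at hs0
  set t : ι → ℝ := fun i => if 0 < s i then 1 else 0 with ht
  have hst := step_T B I J S hS e W hWP (fun i => a i + t i • (b i - a i)) (by
      intro i hi
      obtain ⟨h1, h2, h3⟩ := hab i (hS hi)
      by_cases h : 0 < s i
      · simpa [ht, h] using subset_convexHull ℝ _ h2
      · simpa [ht, h] using subset_convexHull ℝ _ h1) s (hsumS ▸ hs) (by
      intro i hi y
      obtain ⟨h1, h2, h3⟩ := hab i (hS hi)
      refine ⟨y / s i, fun l hl => ?_⟩
      have hsi : s i ≠ 0 := (Finset.mem_filter.1 hi).2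
      rw [h3]
      refine FD_seg h1 h2 (by simp only [ht]; split_ifs <;> norm_num)
        (by simp only [ht]; split_ifs <;> norm_num) ?_ ?_
      · intro h0
        have : s i < 0 := lt_of_le_of_ne (not_lt.1 fun h => by simp [ht, h] at h0) hsi
        rw [div_le_iff_of_neg this] at hl; linarith
      · intro h0
        have : 0 < s i := by by_contra h; simp [ht, h] at h0
        rw [div_le_iff₀ this] at hl; linarith) hT
  refine ih (I \ (J ∪ S)).card ?_ (J ∪ S) rfl (Finset.union_subset hJI (hS.trans Finset.sdiff_subset))
    (hJ.mono Finset.subset_union_left) e ?_ ?_ _ ?_ hst.1 hst.2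
  · rw [← hm]
    refine Finset.card_lt_card ⟨Finset.sdiff_subset_sdiff le_rfl Finset.subset_union_left, fun h => ?_⟩
    obtain ⟨i, hi⟩ := hSne
    have := h (hS hi)
    simp [hi] at this
  · exact fun i hi => he i (Finset.sdiff_subset_sdiff le_rfl Finset.subset_union_left hi)
  · exact hli.mono (by exact_mod_cast Finset.sdiff_subset_sdiff le_rfl Finset.subset_union_left)
  · refine Γ.add_mem hW (Γ.sum_mem fun i hi => ?_)
    obtain ⟨h1, h2, h3⟩ := hab i (hS hi)
    have hiI := (Finset.mem_sdiff.1 (hS hi)).1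
    by_cases h : 0 < s i
    · simpa [ht, h] using hBΓ i hiI _ h2
    · simpa [ht, h] using hBΓ i hiI _ h1

theorem fract_step [DecidableEq ι] (Γ : AddSubgroup E) (B : ι → Set E)
    (I : Finset ι) (hBΓ : ∀ i ∈ I, ∀ a ∈ B i, a ∈ Γ) (J : Finset ι) (e : ι → E)
    (he : ∀ i ∈ I \ J, ∃ a ∈ B i, ∃ b ∈ B i, e i = b - a) (δ : E) (hδ : δ ∈ PJ B J)
    (s : ι → ℝ) (hW : δ + ∑ i ∈ I \ J, s i • e i ∈ Γ)
    (hT : ∀ r ∈ VJ B I, ∃ s : ι → ℝ, r - ∑ i ∈ I \ J, s i • e i ∈ FD (PJ B J) δ) :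
    ∃ S : Finset ι, S = (I \ J).filter (fun i => Int.fract (s i) ≠ 0) ∧ ∃ W ∈ Γ, W ∈ PJ B (J ∪ S) ∧
      ∀ r ∈ VJ B I, ∃ s : ι → ℝ, r - ∑ i ∈ I \ (J ∪ S), s i • e i ∈ FD (PJ B (J ∪ S)) W := by
  have he' : ∀ i, ∃ a b, i ∈ I \ J → a ∈ B i ∧ b ∈ B i ∧ e i = b - a := by
    intro i
    by_cases hi : i ∈ I \ J
    · obtain ⟨a, ha, b, hb, h⟩ := he i hi; exact ⟨a, b, fun _ => ⟨ha, hb, h⟩⟩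
    · exact ⟨0, 0, fun h => absurd h hi⟩
  choose a b hab using he'
  set S := (I \ J).filter fun i => Int.fract (s i) ≠ 0 with hSd
  have hS : S ⊆ I \ J := Finset.filter_subset _ _
  have hst := step_T B I J S hS e δ hδ (fun i => a i + Int.fract (s i) • (b i - a i)) (by
      intro i hi
      obtain ⟨h1, h2, h3⟩ := hab i (hS hi)
      have := (convex_convexHull ℝ (B i)) (subset_convexHull ℝ _ h1) (subset_convexHull ℝ _ h2)
        (a := 1 - Int.fract (s i)) (b := Int.fract (s i)) (by linarith [Int.fract_lt_one (s i)])
        (Int.fract_nonneg _) (by ring)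
      convert this using 1; module) 0 (by
      simp only [Pi.zero_apply, zero_smul, Finset.sum_const_zero]
      exact ⟨1, one_pos, by simpa using hδ⟩) (by
      intro i hi y
      obtain ⟨h1, h2, h3⟩ := hab i (hS hi)
      refine ⟨0, fun l hl => ?_⟩
      rw [h3]
      refine FD_seg h1 h2 (Int.fract_nonneg _) (Int.fract_lt_one _).le ?_ ?_
      · intro h0; exact absurd h0 (Finset.mem_filter.1 hi).2
      · intro h0; exact absurd h0 (Int.fract_lt_one _).ne) hT
  refine ⟨S, rfl, _, ?_, hst.1, hst.2⟩
  have hfloor : ∑ i ∈ I \ J, (⌊s i⌋ : ℝ) • e i ∈ Γ := by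
    refine Γ.sum_mem fun i hi => ?_
    obtain ⟨h1, h2, h3⟩ := hab i hi
    have hiI := (Finset.mem_sdiff.1 hi).1
    rw [Int.cast_smul_eq_zsmul, h3]
    exact Γ.zsmul_mem (Γ.sub_mem (hBΓ i hiI _ h2) (hBΓ i hiI _ h1)) _
  have ha : ∑ i ∈ S, a i ∈ Γ := Γ.sum_mem fun i hi =>
    hBΓ i (Finset.mem_sdiff.1 (hS hi)).1 _ (hab i (hS hi)).1
  have h1 : ∑ i ∈ S, Int.fract (s i) • (b i - a i) = ∑ i ∈ I \ J, s i • e i - ∑ i ∈ I \ J, (⌊s i⌋ : ℝ) • e i := by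
    rw [← Finset.sum_sub_distrib, hSd, Finset.sum_filter_of_ne]
    · refine Finset.sum_congr rfl fun i hi => ?_
      rw [← sub_smul, (hab i hi).2.2]; rfl
    · intro i _ h h0; simp [h0] at h
  have h2 : δ + ∑ i ∈ S, (a i + Int.fract (s i) • (b i - a i)) =
      (δ + ∑ i ∈ I \ J, s i • e i) - ∑ i ∈ I \ J, (⌊s i⌋ : ℝ) • e i + ∑ i ∈ S, a i := by
    rw [Finset.sum_add_distrib, h1]; abel
  rw [h2]
  exact Γ.add_mem (Γ.sub_mem hW hfloor) ha

theorem good_crit [DecidableEq ι] (Γ : AddSubgroup E) (B : ι → Set E) (hB : ∀ i, (B i).Nonempty)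
    (I : Finset ι) (hBΓ : ∀ i ∈ I, ∀ a ∈ B i, a ∈ Γ)
    (hI : finrank ℝ (VJ B I) = I.card) (h : Good (VJ B I) Γ B I) : Crit Γ B := by
  obtain ⟨J, hJI, hJ, e, he, hli, W, hW, hr⟩ := h
  obtain ⟨ε, hε, p, hp, s, hps⟩ := hr 0 (Submodule.zero_mem _)
  rw [smul_zero, add_zero] at hps
  have hT : ∀ r ∈ VJ B I, ∃ s : ι → ℝ, r - ∑ i ∈ I \ J, s i • e i ∈ FD (PJ B J) p := by
    intro r hrV
    obtain ⟨ε, hε, p', hp', s', hps'⟩ := hr r hrV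
    refine ⟨fun i => ε⁻¹ * (s' i - s i), ε, hε, ?_⟩
    have h1 : ε • ∑ i ∈ I \ J, (ε⁻¹ * (s' i - s i)) • e i = ∑ i ∈ I \ J, s' i • e i - ∑ i ∈ I \ J, s i • e i := by
      rw [Finset.smul_sum, ← Finset.sum_sub_distrib]
      refine Finset.sum_congr rfl fun i _ => ?_
      rw [smul_smul, mul_inv_cancel_left₀ hε.ne', sub_smul]
    have h2 : p + ε • (r - ∑ i ∈ I \ J, (ε⁻¹ * (s' i - s i)) • e i) = p' := by
      rw [smul_sub, h1]
      have : ε • r = p' + ∑ i ∈ I \ J, s' i • e i - W := by rw [← hps']; abel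
      rw [this, hps]; abel
    rw [h2]; exact hp'
  obtain ⟨S, hSd, W', hW', hWP, hT'⟩ := fract_step Γ B I hBΓ J e he p hp s (hps ▸ hW) hT
  have hS : S ⊆ I \ J := hSd ▸ Finset.filter_subset _ _
  exact crit_ind Γ B hB I hBΓ hI _ (J ∪ S) rfl (Finset.union_subset hJI (hS.trans Finset.sdiff_subset))
    (hJ.mono Finset.subset_union_left) e
    (fun i hi => he i (Finset.sdiff_subset_sdiff le_rfl Finset.subset_union_left hi))
    (hli.mono (by exact_mod_cast Finset.sdiff_subset_sdiff le_rfl Finset.subset_union_left))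
    W' hW' hWP hT'

/-- Claim 1: non-saturation produces criticality. -/
theorem crit_of_nonsat [DecidableEq ι] (Γ : AddSubgroup E) (B : ι → Set E) (hB : ∀ i, (B i).Nonempty)
    (I : Finset ι) (hBΓ : ∀ i ∈ I, ∀ a ∈ B i, a ∈ Γ)
    (hI : finrank ℝ (VJ B I) = I.card) (e : ι → E)
    (he : ∀ i ∈ I, ∃ a ∈ B i, ∃ b ∈ B i, e i = b - a)
    (hli : LinearIndepOn ℝ e (I : Set ι)) (hsp : VJ B I ≤ Submodule.span ℝ (e '' (I : Set ι)))
    (W : E) (hW : W ∈ Γ) (hWV : W ∈ VJ B I) (hWn : W ∉ AddSubgroup.closure (e '' (I : Set ι))) :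
    Crit Γ B := by
  have hT : ∀ r ∈ VJ B I, ∃ s : ι → ℝ, r - ∑ i ∈ I \ ∅, s i • e i ∈ FD (PJ B ∅) 0 := by
    intro r hr
    obtain ⟨s, hs⟩ := (mem_span_fin e I r).1 (hsp hr)
    refine ⟨s, 1, one_pos, ?_⟩
    simp [hs, PJ]
  obtain ⟨s, hs⟩ := (mem_span_fin e I W).1 (hsp hWV)
  obtain ⟨S, hSd, W', hW', hWP, hT'⟩ := fract_step Γ B I hBΓ ∅ e (by simpa using he) 0 (by simp [PJ]) s
    (by simpa [hs] using hW) hT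
  have hS : S ⊆ I := by rw [hSd]; exact (Finset.filter_subset _ _).trans Finset.sdiff_subset
  have hSne : S.Nonempty := by
    by_contra h
    rw [Finset.not_nonempty_iff_eq_empty, hSd, Finset.filter_eq_empty_iff] at h
    apply hWn
    rw [← hs]
    refine AddSubgroup.sum_mem _ fun i hi => ?_
    have h1 := h (x := i) (by simpa using hi)
    push Not at h1
    have h2 : s i = (⌊s i⌋ : ℝ) := by
      have := Int.floor_add_fract (s i); rw [h1] at this; linarith
    rw [h2, Int.cast_smul_eq_zsmul]
    exact AddSubgroup.zsmul_mem _ (AddSubgroup.subset_closure (Set.mem_image_of_mem e hi)) _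
  rw [Finset.empty_union] at hWP hT'
  exact crit_ind Γ B hB I hBΓ hI _ S rfl hS hSne e
    (fun i hi => he i (Finset.mem_sdiff.1 hi).1)
    (hli.mono (by exact_mod_cast Finset.sdiff_subset)) W' hW' hWP hT'

end Crit
end Khov

open Pointwise Module
namespace Khov

theorem PJ_map {E E' ι : Type*} [AddCommGroup E] [Module ℝ E] [AddCommGroup E'] [Module ℝ E']
    (π : E →ₗ[ℝ] E') (B : ι → Set E) (J : Finset ι) : PJ (fun i => π '' B i) J = π '' PJ B J := by
  ext x
  simp only [mem_PJ, Set.mem_image]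
  simp only [← LinearMap.image_convexHull, Set.mem_image]
  constructor
  · rintro ⟨g, hg, rfl⟩
    have : ∀ i, ∃ y, i ∈ J → y ∈ convexHull ℝ (B i) ∧ π y = g i := by
      intro i
      by_cases hi : i ∈ J
      · obtain ⟨y, hy⟩ := hg i hi; exact ⟨y, fun _ => hy⟩
      · exact ⟨0, fun h => absurd h hi⟩
    choose y hy using this
    refine ⟨_, ⟨y, fun i hi => (hy i hi).1, rfl⟩, ?_⟩
    rw [map_sum]; exact Finset.sum_congr rfl fun i hi => (hy i hi).2
  · rintro ⟨_, ⟨g, hg, rfl⟩, rfl⟩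
    exact ⟨fun i => π (g i), fun i hi => ⟨g i, hg i hi, rfl⟩, (map_sum _ _ _).symm⟩

theorem good_lift {E E' ι : Type*} [AddCommGroup E] [Module ℝ E] [AddCommGroup E'] [Module ℝ E']
    [DecidableEq ι] (V : Submodule ℝ E) (Γ : AddSubgroup E) (B : ι → Set E) (I I0 : Finset ι)
    (hI0 : I0 ⊆ I) (π : E →ₗ[ℝ] E') (V' : Submodule ℝ E') (Γ' : AddSubgroup E')
    (hΓ : ∀ w ∈ Γ', ∃ W ∈ Γ, π W = w) (hΓV : ∀ W ∈ Γ, W ∈ V) (hBV : ∀ i ∈ I, ∀ a ∈ B i, a ∈ V)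
    (hV : ∀ r ∈ V, π r ∈ V') (e0 : ι → E) (he0 : ∀ i ∈ I0, ∃ a ∈ B i, ∃ b ∈ B i, e0 i = b - a)
    (hli0 : LinearIndepOn ℝ e0 (I0 : Set ι)) (hπe0 : ∀ i ∈ I0, π (e0 i) = 0)
    (hker : ∀ x ∈ V, π x = 0 → ∃ s : ι → ℝ, x = ∑ i ∈ I0, s i • e0 i)
    (h : Good V' Γ' (fun i => π '' B i) (I \ I0)) : Good V Γ B I := by
  obtain ⟨J, hJI, hJ, e', he', hli', W', hW', hr'⟩ := h
  have he'' : ∀ i, ∃ a b, i ∈ (I \ I0) \ J → a ∈ B i ∧ b ∈ B i ∧ π (b - a) = e' i := by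
    intro i
    by_cases hi : i ∈ (I \ I0) \ J
    · obtain ⟨_, ⟨a, ha, rfl⟩, _, ⟨b, hb, rfl⟩, h⟩ := he' i hi
      exact ⟨a, b, fun _ => ⟨ha, hb, by rw [h, map_sub]⟩⟩
    · exact ⟨0, 0, fun h => absurd h hi⟩
  choose a b hab using he''
  set e : ι → E := fun i => if i ∈ I0 then e0 i else b i - a i with hed
  have hJI0 : Disjoint J I0 := by
    rw [Finset.disjoint_left]; intro i hi; exact (Finset.mem_sdiff.1 (hJI hi)).2
  have hI0J : I0 ⊆ I \ J := fun i hi => Finset.mem_sdiff.2 ⟨hI0 hi, Finset.disjoint_right.1 hJI0 hi⟩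
  have hset : (I \ J) \ I0 = (I \ I0) \ J := by
    ext i; simp only [Finset.mem_sdiff]; tauto
  have hsplit : ∀ s : ι → ℝ, ∑ i ∈ I \ J, s i • e i =
      ∑ i ∈ (I \ I0) \ J, s i • (b i - a i) + ∑ i ∈ I0, s i • e0 i := by
    intro s
    rw [← Finset.sum_sdiff hI0J, hset]
    congr 1
    · refine Finset.sum_congr rfl fun i hi => ?_
      simp [hed, (Finset.mem_sdiff.1 (Finset.mem_sdiff.1 hi).1).2]
    · refine Finset.sum_congr rfl fun i hi => ?_
      simp [hed, hi]
  have hπ1 : ∀ s : ι → ℝ, π (∑ i ∈ (I \ I0) \ J, s i • (b i - a i)) = ∑ i ∈ (I \ I0) \ J, s i • e' i := by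
    intro s
    rw [map_sum]
    exact Finset.sum_congr rfl fun i hi => by rw [map_smul, (hab i hi).2.2]
  have hπ0 : ∀ s : ι → ℝ, π (∑ i ∈ I0, s i • e0 i) = 0 := by
    intro s
    rw [map_sum]
    exact Finset.sum_eq_zero fun i hi => by rw [map_smul, hπe0 i hi, smul_zero]
  obtain ⟨W, hW, hWW'⟩ := hΓ W' hW'
  refine ⟨J, hJI.trans Finset.sdiff_subset, hJ, e, ?_, ?_, W, hW, ?_⟩
  · intro i hi
    by_cases hi0 : i ∈ I0
    · simpa [hed, hi0] using he0 i hi0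
    · have : i ∈ (I \ I0) \ J := by rw [← hset]; exact Finset.mem_sdiff.2 ⟨hi, hi0⟩
      exact ⟨a i, (hab i this).1, b i, (hab i this).2.1, by simp [hed, hi0]⟩
  · rw [linearIndepOn_finset_iff] at hli' hli0 ⊢
    intro s hs
    rw [hsplit] at hs
    have h1 := congrArg π hs
    rw [map_add, hπ1, hπ0, add_zero, map_zero] at h1
    have h2 := hli' s h1
    rw [Finset.sum_eq_zero (s := (I \ I0) \ J) (fun i hi => by rw [h2 i hi, zero_smul]), zero_add] at hs
    have h3 := hli0 s hs
    intro i hi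
    by_cases hi0 : i ∈ I0
    · exact h3 i hi0
    · exact h2 i (by rw [← hset]; exact Finset.mem_sdiff.2 ⟨hi, hi0⟩)
  · intro r hr
    obtain ⟨ε, hε, p', hp', s, hs⟩ := hr' (π r) (hV r hr)
    rw [PJ_map] at hp'
    obtain ⟨p, hp, rfl⟩ := hp'
    have hpV : p ∈ V := by
      obtain ⟨g, hg, rfl⟩ := mem_PJ.1 hp
      refine Submodule.sum_mem _ fun i hi => ?_
      exact convexHull_min (fun x hx => hBV i (Finset.mem_sdiff.1 (hJI hi)).1 x hx) V.convex (hg i hi)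
    have hsV : ∑ i ∈ (I \ I0) \ J, s i • (b i - a i) ∈ V := by
      refine Submodule.sum_mem _ fun i hi => V.smul_mem _ ?_
      have hiI := (Finset.mem_sdiff.1 (Finset.mem_sdiff.1 hi).1).1
      exact V.sub_mem (hBV i hiI _ (hab i hi).2.1) (hBV i hiI _ (hab i hi).1)
    obtain ⟨s0, hs0⟩ := hker (W + ε • r - p - ∑ i ∈ (I \ I0) \ J, s i • (b i - a i))
      (V.sub_mem (V.sub_mem (V.add_mem (hΓV W hW) (V.smul_mem _ hr)) hpV) hsV) (by
        rw [map_sub, map_sub, map_add, map_smul, hπ1, hWW', hs]; abel)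
    refine ⟨ε, hε, p, hp, fun i => if i ∈ I0 then s0 i else s i, ?_⟩
    rw [hsplit]
    have h1 : ∑ i ∈ (I \ I0) \ J, (if i ∈ I0 then s0 i else s i) • (b i - a i) =
        ∑ i ∈ (I \ I0) \ J, s i • (b i - a i) := Finset.sum_congr rfl fun i hi => by
      rw [if_neg (Finset.mem_sdiff.1 (Finset.mem_sdiff.1 hi).1).2]
    have h2 : ∑ i ∈ I0, (if i ∈ I0 then s0 i else s i) • e0 i = ∑ i ∈ I0, s0 i • e0 i :=
      Finset.sum_congr rfl fun i hi => by rw [if_pos hi]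
    rw [h1, h2, ← hs0]; abel

/-- Choice of independent vectors from spanning sets. -/
theorem exists_choice {K M ι : Type*} [Field K] [AddCommGroup M] [Module K M] [DecidableEq ι]
    (w : ι → M) (S : ι → Set M) (I : Finset ι) (hw : LinearIndepOn K w (I : Set ι))
    (hS : ∀ i ∈ I, w i ∈ Submodule.span K (S i)) :
    ∃ s : ι → M, (∀ i ∈ I, s i ∈ S i) ∧ LinearIndepOn K s (I : Set ι) := by
  suffices H : ∀ F : Finset ι, F ⊆ I → ∃ s : ι → M, (∀ i ∈ F, s i ∈ S i) ∧ (∀ i ∉ F, s i = w i) ∧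
      LinearIndepOn K s (I : Set ι) by
    obtain ⟨s, h1, -, h2⟩ := H I le_rfl
    exact ⟨s, h1, h2⟩
  intro F
  induction F using Finset.induction_on with
  | empty => exact fun _ => ⟨w, by simp, by simp, hw⟩
  | insert a F ha ih =>
    intro hF
    obtain ⟨s, h1, h2, h3⟩ := ih ((Finset.subset_insert _ _).trans hF)
    have haI : a ∈ I := hF (Finset.mem_insert_self _ _)
    have hIns : (I : Set ι) = insert a ((I.erase a : Finset ι) : Set ι) := by
      rw [← Finset.coe_insert, Finset.insert_erase haI]
    have hna : a ∉ ((I.erase a : Finset ι) : Set ι) := by simp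
    rw [hIns, linearIndepOn_insert hna] at h3
    have : ∃ x ∈ S a, x ∉ Submodule.span K (s '' ((I.erase a : Finset ι) : Set ι)) := by
      by_contra hcon
      push Not at hcon
      apply h3.2
      rw [h2 a ha]
      exact (Submodule.span_le.2 hcon) (hS a haI)
    obtain ⟨x, hx, hxn⟩ := this
    have himg : Function.update s a x '' ((I.erase a : Finset ι) : Set ι) = s '' ((I.erase a : Finset ι) : Set ι) := by
      refine Set.image_congr fun i hi => ?_
      have : i ≠ a := by rintro rfl; exact hna hi
      simp [this]
    refine ⟨Function.update s a x, ?_, ?_, ?_⟩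
    · intro i hi
      by_cases hia : i = a
      · subst hia; simpa using hx
      · simpa [hia] using h1 i ((Finset.mem_insert.1 hi).resolve_left hia)
    · intro i hi
      rw [Finset.mem_insert, not_or] at hi
      simpa [hi.1] using h2 i hi.2
    · rw [hIns, linearIndepOn_insert hna, himg]
      refine ⟨h3.1.congr fun i hi => ?_, by simpa using hxn⟩
      have : i ≠ a := by rintro rfl; exact hna hi
      simp [this]

end Khov

open Pointwise Module
namespace Khov

/-- cast of integer vectors -/
def cz (R : Type*) [Ring R] {κ : Type*} (x : κ → ℤ) : κ → R := fun k => (x k : R)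

theorem cz_add (R : Type*) [Ring R] {κ : Type*} (x y : κ → ℤ) : cz R (x + y) = cz R x + cz R y := by
  ext k; simp [cz]
theorem cz_sub (R : Type*) [Ring R] {κ : Type*} (x y : κ → ℤ) : cz R (x - y) = cz R x - cz R y := by
  ext k; simp [cz]
theorem cz_smul (R : Type*) [Ring R] {κ : Type*} (n : ℤ) (x : κ → ℤ) : cz R (n • x) = (n : R) • cz R x := by
  ext k; simp [cz]
theorem cz_zero (R : Type*) [Ring R] {κ : Type*} : cz R (0 : κ → ℤ) = 0 := by
  ext k; simp [cz]
theorem cz_sum (R : Type*) [Ring R] {κ ι : Type*} (S : Finset ι) (x : ι → κ → ℤ) :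
    cz R (∑ i ∈ S, x i) = ∑ i ∈ S, cz R (x i) := by
  ext k; simp [cz]
theorem cz_inj (R : Type*) [Ring R] [CharZero R] {κ : Type*} {x y : κ → ℤ} (h : cz R x = cz R y) : x = y := by
  ext k; exact Int.cast_injective (congrFun h k)

/-- base change of integer linear maps -/
noncomputable def bc (R : Type*) [CommRing R] {κ κ' : Type*} [Fintype κ] [DecidableEq κ]
    (ψ : (κ → ℤ) →ₗ[ℤ] (κ' → ℤ)) : (κ → R) →ₗ[R] (κ' → R) :=
  Matrix.mulVecLin ((LinearMap.toMatrix' ψ).map (Int.cast : ℤ → R))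

theorem bc_cz (R : Type*) [CommRing R] {κ κ' : Type*} [Fintype κ] [DecidableEq κ]
    (ψ : (κ → ℤ) →ₗ[ℤ] (κ' → ℤ)) (x : κ → ℤ) : bc R ψ (cz R x) = cz R (ψ x) := by
  ext k
  have h : ψ x k = ∑ j, LinearMap.toMatrix' ψ k j * x j := by
    conv_lhs => rw [← LinearMap.toMatrix'_mulVec]
    rfl
  simp only [bc, Matrix.mulVecLin_apply, Matrix.mulVec, dotProduct, Matrix.map_apply, cz, h]
  push_cast; rfl

theorem ext_cz (R : Type*) [CommRing R] {κ M : Type*} [Fintype κ] [DecidableEq κ] [AddCommGroup M]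
    [Module R M] (f g : (κ → R) →ₗ[R] M) (h : ∀ x : κ → ℤ, f (cz R x) = g (cz R x)) : f = g := by
  refine LinearMap.pi_ext' fun k => LinearMap.ext_ring ?_
  have := h (Pi.single k 1)
  have h2 : cz R (Pi.single k 1 : κ → ℤ) = Pi.single k 1 := by
    ext j; by_cases hj : j = k
    · subst hj; simp [cz]
    · simp [cz, hj]
  rw [h2] at this
  simpa using this

/-- primitive vectors -/
def Prim {κ : Type*} (P : κ → ℤ) : Prop := ∃ e : (κ → ℤ) →ₗ[ℤ] ℤ, e P = 1

theorem exists_prim {κ : Type*} [Fintype κ] [DecidableEq κ] (E : κ → ℤ) (hE : E ≠ 0) :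
    ∃ (P : κ → ℤ) (k : ℤ), k ≠ 0 ∧ E = k • P ∧ Prim P := by
  obtain ⟨d, hd⟩ := (IsPrincipalIdealRing.principal (Ideal.span (Set.range E))).principal
  have h1 : d ∈ Ideal.span (Set.range E) := by rw [hd]; exact Submodule.mem_span_singleton_self d
  obtain ⟨c, hc⟩ := (Ideal.mem_span_range_iff_exists_fun).1 h1
  have h2 : ∀ k, ∃ m, m * d = E k := fun k => by
    have : E k ∈ Ideal.span (Set.range E) := Ideal.subset_span ⟨k, rfl⟩
    rw [hd] at this
    exact Submodule.mem_span_singleton.1 this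
  choose P hP using h2
  have hd0 : d ≠ 0 := by
    rintro rfl
    apply hE; ext k; simpa using (hP k).symm
  refine ⟨P, d, hd0, by ext k; simp [← hP k, mul_comm], ∑ k, c k • LinearMap.proj k, ?_⟩
  have : d * (∑ k, c k * P k) = d * 1 := by
    rw [Finset.mul_sum, mul_one]
    conv_rhs => rw [← hc]
    refine Finset.sum_congr rfl fun k _ => ?_
    rw [← hP k]; ring
  have h3 := mul_left_cancel₀ hd0 this
  simpa using h3

theorem prim_split {m : ℕ} (P : Fin (m + 1) → ℤ) (hP : Prim P) :
    ∃ (e : (Fin (m + 1) → ℤ) →ₗ[ℤ] ℤ) (ψ : (Fin (m + 1) → ℤ) →ₗ[ℤ] (Fin m → ℤ))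
      (σ : (Fin m → ℤ) →ₗ[ℤ] (Fin (m + 1) → ℤ)), e P = 1 ∧ ψ P = 0 ∧ (∀ y, ψ (σ y) = y) ∧
      ∀ x, x = e x • P + σ (ψ x) := by
  obtain ⟨e, he⟩ := hP
  have hfr : finrank ℤ (LinearMap.ker e) = m := by
    have h1 := Submodule.finrank_quotient_add_finrank (LinearMap.ker e)
    rw [e.quotKerEquivRange.finrank_eq] at h1
    have h2 : LinearMap.range e = ⊤ := LinearMap.range_eq_top.2 fun z => ⟨z • P, by rw [map_smul, he]; simp⟩
    rw [h2, finrank_top, finrank_self, finrank_fin_fun] at h1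
    omega
  let b := Module.finBasisOfFinrankEq ℤ (LinearMap.ker e) hfr
  let pr : (Fin (m + 1) → ℤ) →ₗ[ℤ] LinearMap.ker e :=
    LinearMap.codRestrict _ (LinearMap.id - e.smulRight P) (fun x => by
      show e (x - e x • P) = 0
      rw [map_sub, map_smul, he]; simp)
  have hpr : ∀ x, (pr x : Fin (m + 1) → ℤ) = x - e x • P := fun x => rfl
  refine ⟨e, b.equivFun.toLinearMap ∘ₗ pr, (LinearMap.ker e).subtype ∘ₗ b.equivFun.symm.toLinearMap,
    he, ?_, ?_, ?_⟩
  · have : pr P = 0 := by ext; simp [hpr, he]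
    simp [this]
  · intro y
    have : pr (b.equivFun.symm y : LinearMap.ker e) = b.equivFun.symm y := by
      apply Subtype.ext
      rw [hpr, (b.equivFun.symm y).2]; simp
    show b.equivFun (pr (b.equivFun.symm y : LinearMap.ker e)) = y
    rw [this, LinearEquiv.apply_symm_apply]
  · intro x
    show x = e x • P + ((b.equivFun.symm (b.equivFun (pr x)) : LinearMap.ker e) : Fin (m + 1) → ℤ)
    rw [LinearEquiv.symm_apply_apply, hpr]; abel

/-- parallel vectors -/
def Par {κ : Type*} (x y : κ → ℤ) : Prop := ∃ m n : ℤ, m ≠ 0 ∧ n ≠ 0 ∧ m • x = n • y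

theorem Par.symm {κ : Type*} {x y : κ → ℤ} (h : Par x y) : Par y x := by
  obtain ⟨m, n, hm, hn, h⟩ := h; exact ⟨n, m, hn, hm, h.symm⟩
theorem Par.trans {κ : Type*} {x y z : κ → ℤ} (h : Par x y) (h' : Par y z) : Par x z := by
  obtain ⟨m, n, hm, hn, h⟩ := h
  obtain ⟨m', n', hm', hn', h'⟩ := h'
  refine ⟨m' * m, n * n', mul_ne_zero hm' hm, mul_ne_zero hn hn', ?_⟩
  rw [mul_smul, h, mul_smul, ← h', smul_comm]

noncomputable def prim {κ : Type*} (E : κ → ℤ) : κ → ℤ := Classical.epsilon fun P => Prim P ∧ Par P E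

theorem prim_spec {κ : Type*} [Fintype κ] [DecidableEq κ] {E : κ → ℤ} (hE : E ≠ 0) :
    Prim (prim E) ∧ ∃ k : ℤ, k ≠ 0 ∧ E = k • prim E := by
  have hex : ∃ P, Prim P ∧ Par P E := by
    obtain ⟨P, k, hk, h, hP⟩ := exists_prim E hE
    exact ⟨P, hP, k, 1, hk, one_ne_zero, by rw [one_smul, h]⟩
  obtain ⟨h1, m, n, hm, hn, h⟩ := Classical.epsilon_spec hex
  refine ⟨h1, ?_⟩
  obtain ⟨e, he⟩ := h1
  have h2 := congrArg e h
  rw [map_smul, map_smul, he, smul_eq_mul, mul_one, smul_eq_mul] at h2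
  have h3 : E = e E • prim E := by
    have h4 : n • E = n • (e E • prim E) := by
      rw [← h, h2, mul_smul]; rfl
    exact smul_right_injective _ hn h4
  refine ⟨e E, ?_, h3⟩
  rintro h0
  rw [h0, mul_zero] at h2
  exact hm h2

theorem prim_eq_of_par {κ : Type*} {E E' : κ → ℤ} (h : Par E E') : prim E = prim E' := by
  have : (fun P => Prim P ∧ Par P E) = fun P => Prim P ∧ Par P E' := by
    ext P
    exact and_congr_right fun _ => ⟨fun h' => h'.trans h, fun h' => h'.trans h.symm⟩
  rw [prim, prim, this]

/-! ### group ring -/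
abbrev GR (n : ℕ) := AddMonoidAlgebra ℂ (Fin n → ℤ)
noncomputable def mo {n : ℕ} (g : Fin n → ℤ) : GR n := AddMonoidAlgebra.single g 1

theorem mo_mul {n : ℕ} (g h : Fin n → ℤ) : mo g * mo h = mo (g + h) := by
  simp [mo, AddMonoidAlgebra.single_mul_single]
theorem mo_zero {n : ℕ} : mo (0 : Fin n → ℤ) = 1 := rfl

theorem mo_inj {n : ℕ} {g h : Fin n → ℤ} (hh : mo g = mo h) : g = h := by
  have := congrArg (fun x => x.coeff g) hh
  simp only [mo, AddMonoidAlgebra.coeff_single, Finsupp.single_apply] at this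
  by_contra hne
  simp [Ne.symm hne] at this

instance (n : ℕ) : IsDomain (GR n) := NoZeroDivisors.to_isDomain _

noncomputable def gmap {n m : ℕ} (ψ : (Fin n → ℤ) →ₗ[ℤ] (Fin m → ℤ)) : GR n →+* GR m :=
  AddMonoidAlgebra.mapDomainRingHom ℂ ψ.toAddMonoidHom

theorem gmap_single {n m : ℕ} (ψ : (Fin n → ℤ) →ₗ[ℤ] (Fin m → ℤ)) (g) (a : ℂ) :
    gmap ψ (AddMonoidAlgebra.single g a) = AddMonoidAlgebra.single (ψ g) a := by
  simp [gmap]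

theorem gmap_mo {n m : ℕ} (ψ : (Fin n → ℤ) →ₗ[ℤ] (Fin m → ℤ)) (g) :
    gmap ψ (mo g) = mo (ψ g) := gmap_single _ _ _

theorem mo_sub_one_dvd_nsmul {n : ℕ} (P : Fin n → ℤ) (k : ℕ) : mo P - 1 ∣ mo (k • P) - 1 := by
  have : mo (k • P) = mo P ^ k := by
    induction k with
    | zero => simp [mo_zero]
    | succ k ih => rw [add_smul, one_smul, ← mo_mul, ih, pow_succ]
  rw [this]
  simpa using sub_dvd_pow_sub_pow (mo P) 1 k

theorem mo_sub_one_dvd_neg {n : ℕ} (P : Fin n → ℤ) : mo (-P) - 1 ∣ mo P - 1 := by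
  refine ⟨- mo P, ?_⟩
  have : mo (-P) * mo P = 1 := by rw [mo_mul]; simp [mo_zero]
  linear_combination (1 : GR n) * this

theorem mo_sub_one_dvd_zsmul {n : ℕ} (P : Fin n → ℤ) (k : ℤ) : mo P - 1 ∣ mo (k • P) - 1 := by
  obtain ⟨k, rfl | rfl⟩ := k.eq_nat_or_neg
  · simpa using mo_sub_one_dvd_nsmul P k
  · have h1 := mo_sub_one_dvd_nsmul P k
    have h2 := mo_sub_one_dvd_neg (-((k : ℤ) • P))
    rw [neg_neg] at h2
    have h3 := mo_sub_one_dvd_neg ((k : ℤ) • P)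
    have h4 : mo ((k : ℤ) • P) - 1 ∣ mo (-((k : ℤ) • P)) - 1 := by
      have := mo_sub_one_dvd_neg (-((k : ℤ) • P))
      rwa [neg_neg] at this
    rw [neg_smul]
    refine dvd_trans ?_ h4
    simpa using h1

theorem dvd_of_gmap_eq_zero {m : ℕ} {P : Fin (m + 1) → ℤ} {e : (Fin (m + 1) → ℤ) →ₗ[ℤ] ℤ}
    {ψ : (Fin (m + 1) → ℤ) →ₗ[ℤ] (Fin m → ℤ)} {σ : (Fin m → ℤ) →ₗ[ℤ] (Fin (m + 1) → ℤ)}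
    (h : ∀ x, x = e x • P + σ (ψ x)) (D : GR (m + 1)) (hD : gmap ψ D = 0) : mo P - 1 ∣ D := by
  have key : ∀ D : GR (m + 1), mo P - 1 ∣ D - gmap σ (gmap ψ D) := by
    intro D
    induction D using AddMonoidAlgebra.induction_linear with
    | zero => simp
    | add f g hf hg =>
      rw [map_add, map_add]
      convert dvd_add hf hg using 1; ring
    | single g a =>
      rw [gmap_single, gmap_single]
      have h1 : (AddMonoidAlgebra.single g a : GR (m + 1)) = mo (e g • P) * AddMonoidAlgebra.single (σ (ψ g)) a := by
        rw [mo, AddMonoidAlgebra.single_mul_single, ← h g, one_mul]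
      rw [h1]
      refine (mo_sub_one_dvd_zsmul P (e g)).trans ⟨AddMonoidAlgebra.single (σ (ψ g)) a, by ring⟩
  have := key D
  rwa [hD, map_zero, sub_zero] at this

theorem prod_dvd_of {n : ℕ} (S : Finset (Fin n → ℤ)) (D : GR n)
    (hd : ∀ P ∈ S, mo P - 1 ∣ D)
    (hp : ∀ P ∈ S, ∀ P' ∈ S, P ≠ P' → ∀ h : GR n, mo P - 1 ∣ (mo P' - 1) * h → mo P - 1 ∣ h) :
    ∏ P ∈ S, (mo P - 1) ∣ D := by
  classical
  induction S using Finset.induction_on generalizing D with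
  | empty => simp
  | insert a S ha ih =>
    rw [Finset.prod_insert ha]
    obtain ⟨h, rfl⟩ := hd a (by simp)
    refine mul_dvd_mul_left _ (ih h (fun P hP => ?_) fun P hP P' hP' => hp P (by simp [hP]) P' (by simp [hP']))
    exact hp P (by simp [hP]) a (by simp) (by rintro rfl; exact ha hP) h (hd P (by simp [hP]))

theorem coeff_mo_sub_one_mul {n : ℕ} (E g : Fin n → ℤ) (h : GR n) :
    ((mo E - 1) * h).coeff g = h.coeff (g - E) - h.coeff g := by
  rw [sub_mul, one_mul, AddMonoidAlgebra.coeff_sub, Finsupp.sub_apply]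
  congr 1
  rw [mo, sub_eq_neg_add]
  simp

theorem max_run {n : ℕ} (h : GR n) (w E : Fin n → ℤ) (hE : E ≠ 0) (hw : h.coeff w ≠ 0) :
    ∃ k : ℕ, h.coeff (w + k • E) ≠ 0 ∧ h.coeff (w + (k + 1) • E) = 0 := by
  by_contra hcon
  push Not at hcon
  have hall : ∀ k : ℕ, h.coeff (w + k • E) ≠ 0 := by
    intro k
    induction k with
    | zero => simpa using hw
    | succ k ih => exact hcon k ih
  have hinj : Function.Injective fun k : ℕ => w + k • E := by
    intro a b hab
    have h1 : a • E = b • E := add_left_cancel hab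
    obtain ⟨i, hi⟩ : ∃ i, E i ≠ 0 := by
      by_contra hc; push Not at hc; exact hE (funext hc)
    have h2 := congrFun h1 i
    simpa [hi] using h2
  have hfin : (Set.range fun k : ℕ => w + k • E).Finite :=
    h.coeff.support.finite_toSet.subset (by
      rintro _ ⟨k, rfl⟩; exact Finsupp.mem_support_iff.2 (hall k))
  exact Set.infinite_range_of_injective hinj hfin

theorem zono_step {n : ℕ} (z : (Fin n → ℝ) →ₗ[ℝ] ℝ) (h : GR n) (w E : Fin n → ℤ) (hE : E ≠ 0)
    (hw : h.coeff w ≠ 0) :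
    ∃ g, ((mo E - 1) * h).coeff g ≠ 0 ∧ z (cz ℝ w) ≤ z (cz ℝ g) ∧
      (0 < z (cz ℝ E) → z (cz ℝ w) < z (cz ℝ g)) := by
  rcases le_or_gt 0 (z (cz ℝ E)) with hz | hz
  · obtain ⟨k, hk, hk1⟩ := max_run h w E hE hw
    refine ⟨w + (k + 1) • E, ?_, ?_, ?_⟩
    · rw [coeff_mo_sub_one_mul, hk1, sub_zero]
      convert hk using 2
      rw [add_smul, one_smul]; abel
    · rw [← natCast_zsmul, cz_add, cz_smul, map_add, map_smul]
      have : 0 ≤ (((k + 1 : ℕ) : ℤ) : ℝ) • z (cz ℝ E) := by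
        rw [smul_eq_mul]; positivity
      linarith
    · intro hz'
      rw [← natCast_zsmul, cz_add, cz_smul, map_add, map_smul]
      have : 0 < (((k + 1 : ℕ) : ℤ) : ℝ) • z (cz ℝ E) := by
        rw [smul_eq_mul]; exact mul_pos (by positivity) hz'
      linarith
  · obtain ⟨k, hk, hk1⟩ := max_run h w (-E) (neg_ne_zero.2 hE) hw
    refine ⟨w + k • (-E), ?_, ?_, fun h0 => absurd h0 hz.not_gt⟩
    · rw [coeff_mo_sub_one_mul]
      have : w + k • -E - E = w + (k + 1) • -E := by rw [add_smul, one_smul]; abel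
      rw [this, hk1, zero_sub]
      exact neg_ne_zero.2 hk
    · rw [← natCast_zsmul, smul_neg, ← neg_smul, cz_add, cz_smul, map_add, map_smul]
      have : 0 ≤ ((-(k : ℤ) : ℤ) : ℝ) • z (cz ℝ E) := by
        rw [smul_eq_mul]; push_cast
        have : (0 : ℝ) ≤ k := by positivity
        nlinarith
      linarith

theorem zono {n : ℕ} (z : (Fin n → ℝ) →ₗ[ℝ] ℝ) {ι : Type*} (S : Finset ι) (E : ι → Fin n → ℤ)
    (hE : ∀ i ∈ S, E i ≠ 0) (h : GR n) (w : Fin n → ℤ) (hw : h.coeff w ≠ 0) :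
    ∃ g, ((∏ i ∈ S, (mo (E i) - 1)) * h).coeff g ≠ 0 ∧ z (cz ℝ w) ≤ z (cz ℝ g) ∧
      ((∃ i ∈ S, 0 < z (cz ℝ (E i))) → z (cz ℝ w) < z (cz ℝ g)) := by
  classical
  induction S using Finset.induction_on with
  | empty => exact ⟨w, by simpa using hw, le_rfl, by simp⟩
  | insert a S ha ih =>
    obtain ⟨g, h1, h2, h3⟩ := ih fun i hi => hE i (by simp [hi])
    obtain ⟨g', h1', h2', h3'⟩ := zono_step z _ g (E a) (hE a (by simp)) h1
    refine ⟨g', by rwa [Finset.prod_insert ha, mul_assoc], h2.trans h2', ?_⟩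
    rintro ⟨i, hi, hz⟩
    rcases Finset.mem_insert.1 hi with rfl | hi
    · exact h2.trans_lt (h3' hz)
    · exact (h3 ⟨i, hi, hz⟩).trans_le h2'

end Khov

open Pointwise Module
namespace Khov

theorem li_map (F K : Type*) [Field F] [Field K] (φ : F →+* K) {ι κ : Type*} [Fintype κ] [DecidableEq κ]
    (v : ι → κ → F) (I : Finset ι) (h : LinearIndepOn F v (I : Set ι)) :
    LinearIndepOn K (fun i k => φ (v i k)) (I : Set ι) := by
  classical
  have h' : LinearIndependent F (fun i : I => v i) := h
  have hinj : LinearMap.ker (Fintype.linearCombination F (fun i : I => v i)) = ⊥ :=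
    LinearMap.ker_eq_bot.2 (linearIndependent_iff_injective_fintypeLinearCombination.1 h')
  obtain ⟨g, hg⟩ := LinearMap.exists_leftInverse_of_injective _ hinj
  have hdual : ∀ i j : I, ∑ k, v j k * g (Pi.single k 1) i = if i = j then 1 else 0 := by
    intro i j
    have h1 := congrFun (LinearMap.congr_fun hg (Pi.single j 1)) i
    simp only [LinearMap.comp_apply, Fintype.linearCombination_apply_single, one_smul, LinearMap.id_apply] at h1
    have h2 : v j = ∑ k, v j k • (Pi.single k 1 : κ → F) := by
      ext k; simp [Finset.sum_apply, Pi.single_apply]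
    rw [h2, map_sum] at h1
    simp only [map_smul, Finset.sum_apply, Pi.smul_apply, smul_eq_mul, Pi.single_apply] at h1
    exact h1
  show LinearIndependent K (fun (i : I) k => φ (v i k))
  rw [Fintype.linearIndependent_iff]
  intro c hc i
  have h1 : ∑ k, (∑ j, c j * φ (v j k)) * φ (g (Pi.single k 1) i) = 0 := by
    refine Finset.sum_eq_zero fun k _ => ?_
    have := congrFun hc k
    simp only [Finset.sum_apply, Pi.smul_apply, smul_eq_mul, Pi.zero_apply] at this
    rw [this, zero_mul]
  have h2 : ∑ k, (∑ j, c j * φ (v j k)) * φ (g (Pi.single k 1) i) =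
      ∑ j, c j * φ (∑ k, v j k * g (Pi.single k 1) i) := by
    simp only [map_sum, map_mul, Finset.sum_mul, Finset.mul_sum]
    rw [Finset.sum_comm]
    simp only [mul_assoc]
  rw [h2] at h1
  simp only [hdual] at h1
  simpa using h1

theorem li_cz (K : Type*) [Field K] [CharZero K] {ι κ : Type*} [Fintype κ] [DecidableEq κ]
    (v : ι → κ → ℤ) (I : Finset ι) (h : LinearIndepOn ℤ v (I : Set ι)) :
    LinearIndepOn K (fun i => cz K (v i)) (I : Set ι) := by
  classical
  have h1 : LinearIndepOn ℚ (fun i => cz ℚ (v i)) (I : Set ι) := by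
    unfold LinearIndepOn
    rw [← LinearIndependent.iff_fractionRing ℤ ℚ]
    let f : (κ → ℤ) →ₗ[ℤ] (κ → ℚ) := { toFun := cz ℚ, map_add' := cz_add ℚ, map_smul' := fun n x => by
                                            rw [cz_smul]; ext k; simp }
    refine LinearIndependent.map' (show LinearIndependent ℤ (fun i : (I : Set ι) => v i) from h) f
      (LinearMap.ker_eq_bot.2 fun x y hxy => cz_inj ℚ hxy)
  have := li_map ℚ K (algebraMap ℚ K) _ I h1
  convert this using 3
  simp [cz]

theorem li_of_cz (K : Type*) [CommRing K] [CharZero K] {ι κ : Type*}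
    (v : ι → κ → ℤ) (I : Finset ι) (h : LinearIndepOn K (fun i => cz K (v i)) (I : Set ι)) :
    LinearIndepOn ℤ v (I : Set ι) := by
  rw [linearIndepOn_finset_iff] at h ⊢
  intro f hf i hi
  have := h (fun i => (f i : K)) (by
    simp only [← cz_smul, ← cz_sum, hf, cz_zero]) i hi
  exact_mod_cast this

/-- edges of a triangle -/
def ed {n : ℕ} (T : Fin 3 → Fin n → ℤ) (c : Fin 3) : Fin n → ℤ := T (c + 1) - T (c + 2)

theorem ed_sum {n : ℕ} (T : Fin 3 → Fin n → ℤ) : ∑ c, ed T c = 0 := by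
  simp only [Fin.sum_univ_three, ed]
  show T 1 - T 2 + (T 2 - T 0) + (T 0 - T 1) = 0
  abel

noncomputable def wv {n : ℕ} (T : Fin 3 → Fin n → ℤ) : Fin n → GR n :=
  ∑ c : Fin 3, mo (T c) • cz (GR n) (ed T c)

theorem wv_eq {n : ℕ} (T : Fin 3 → Fin n → ℤ) (c : Fin 3) :
    wv T = (mo (T c) - mo (T (c + 2))) • cz (GR n) (ed T c) +
      (mo (T (c + 1)) - mo (T (c + 2))) • cz (GR n) (ed T (c + 1)) := by
  have h0 : cz (GR n) (ed T 0) + cz (GR n) (ed T 1) + cz (GR n) (ed T 2) = 0 := by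
    rw [← cz_add, ← cz_add, ← Fin.sum_univ_three, ed_sum, cz_zero]
  have h2 : wv T = mo (T 0) • cz (GR n) (ed T 0) + mo (T 1) • cz (GR n) (ed T 1) +
    mo (T 2) • cz (GR n) (ed T 2) := by rw [wv, Fin.sum_univ_three]
  rw [h2]
  fin_cases c
  · show _ = (mo (T 0) - mo (T 2)) • cz (GR n) (ed T 0) + (mo (T 1) - mo (T 2)) • cz (GR n) (ed T 1)
    rw [eq_neg_of_add_eq_zero_right h0]; module
  · show _ = (mo (T 1) - mo (T 0)) • cz (GR n) (ed T 1) + (mo (T 2) - mo (T 0)) • cz (GR n) (ed T 2)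
    rw [add_assoc] at h0
    rw [eq_neg_of_add_eq_zero_left h0]; module
  · show _ = (mo (T 2) - mo (T 1)) • cz (GR n) (ed T 2) + (mo (T 0) - mo (T 1)) • cz (GR n) (ed T 0)
    rw [add_right_comm] at h0
    rw [eq_neg_of_add_eq_zero_right h0]; module

theorem wv_zero_of_ed {n : ℕ} (T : Fin 3 → Fin n → ℤ) (c : Fin 3) (h : ed T c = 0) : wv T = 0 := by
  rw [wv_eq T c, h, cz_zero]
  have : T (c + 1) = T (c + 2) := sub_eq_zero.1 h
  rw [this]; simp

/-- the independence hypothesis -/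
def LIw {n : ℕ} {ι : Type*} (I : Finset ι) (T : ι → Fin 3 → Fin n → ℤ) : Prop :=
  ∀ v : ι → GR n, (∑ i ∈ I, v i • wv (T i) = 0) → ∀ i ∈ I, v i = 0

theorem LIw.ed_ne {n : ℕ} {ι : Type*} {I : Finset ι} {T : ι → Fin 3 → Fin n → ℤ} (h : LIw I T)
    {j : ι} (hj : j ∈ I) (c : Fin 3) : ed (T j) c ≠ 0 := by
  classical
  intro h0
  have := h (Pi.single j 1) (Finset.sum_eq_zero fun i _ => by
    by_cases hij : i = j
    · subst hij; rw [wv_zero_of_ed _ c h0, smul_zero]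
    · simp [hij]) j hj
  simp at this

/-- the lattice -/
def latt (κ : Type*) : AddSubgroup (κ → ℝ) where
  carrier := Set.range (cz ℝ)
  zero_mem' := ⟨0, cz_zero ℝ⟩
  add_mem' := by rintro _ _ ⟨a, rfl⟩ ⟨b, rfl⟩; exact ⟨a + b, cz_add ℝ a b⟩
  neg_mem' := by rintro _ ⟨a, rfl⟩; exact ⟨-a, by ext; simp [cz]⟩

theorem LIw.exists_edges {n : ℕ} {ι : Type*} [DecidableEq ι] {I : Finset ι} {T : ι → Fin 3 → Fin n → ℤ}
    (h : LIw I T) : ∃ c : ι → Fin 3, LinearIndepOn ℝ (fun i => cz ℝ (ed (T i) (c i))) (I : Set ι) := by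
  let K := FractionRing (GR n)
  have h1 : LinearIndepOn K (fun i (k : Fin n) => algebraMap (GR n) K (wv (T i) k)) (I : Set ι) := by
    unfold LinearIndepOn
    rw [← LinearIndependent.iff_fractionRing (GR n) K]
    let f : (Fin n → GR n) →ₗ[GR n] (Fin n → K) :=
      { toFun := fun x k => algebraMap (GR n) K (x k)
        map_add' := fun x y => by ext; simp
        map_smul' := fun a x => by ext; simp [Algebra.smul_def] }
    have h2 : LinearIndepOn (GR n) (fun i => wv (T i)) (I : Set ι) := linearIndepOn_finset_iff.2 fun v hv i hi => h v hv i hi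
    refine LinearIndependent.map' (show LinearIndependent (GR n) (fun i : (I : Set ι) => wv (T i)) from h2) f
      (LinearMap.ker_eq_bot.2 fun x y hxy => ?_)
    ext1 k
    exact IsFractionRing.injective (GR n) K (congrFun hxy k)
  obtain ⟨s, hs, hli⟩ := exists_choice _ (fun i => Set.range fun c => cz K (ed (T i) c)) I h1 (by
    intro i _
    have : (fun (k : Fin n) => algebraMap (GR n) K (wv (T i) k)) =
      ∑ c, algebraMap (GR n) K (mo (T i c)) • cz K (ed (T i) c) := by
      ext k; simp [wv, Finset.sum_apply, cz, Algebra.smul_def]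
    rw [this]
    exact Submodule.sum_mem _ fun c _ => Submodule.smul_mem _ _ (Submodule.subset_span ⟨c, rfl⟩))
  have : ∀ i, ∃ c, i ∈ I → s i = cz K (ed (T i) c) := fun i => by
    by_cases hi : i ∈ I
    · obtain ⟨c, hc⟩ := hs i hi; exact ⟨c, fun _ => hc.symm⟩
    · exact ⟨0, fun h => absurd h hi⟩
  choose c hc using this
  haveI : CharZero (GR n) := charZero_of_injective_algebraMap (R := ℂ) (A := GR n) (algebraMap ℂ (GR n)).injective
  haveI : CharZero K := charZero_of_injective_algebraMap (IsFractionRing.injective (GR n) K)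
  refine ⟨c, li_cz ℝ _ I (li_of_cz K _ I ?_)⟩
  exact hli.congr (fun i hi => hc i hi)

end Khov

open Pointwise Module
namespace Khov

theorem core_B {n : ℕ} {ι : Type*} [DecidableEq ι] {I : Finset ι} (hI : I.card = n)
    {T : ι → Fin 3 → Fin n → ℤ} (h : LIw I T) (j : ι) (hj : j ∈ I) (P : Fin n → ℤ) (k : Fin 3 → ℤ)
    (hk : ∀ c, ed (T j) c = k c • P) :
    Good ⊤ (latt (Fin n)) (fun i => cz ℝ '' Set.range (T i)) I := by
  obtain ⟨c, hc⟩ := h.exists_edges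
  have hk0 : ∀ c, k c ≠ 0 := fun c h0 => h.ed_ne hj c (by rw [hk, h0, zero_smul])
  have hP0 : P ≠ 0 := fun h0 => h.ed_ne hj 0 (by rw [hk, h0, smul_zero])
  have hsum : k 0 + k 1 + k 2 = 0 := by
    have h1 := ed_sum (T j)
    rw [Fin.sum_univ_three, hk, hk, hk, ← add_smul, ← add_smul] at h1
    exact (smul_eq_zero.1 h1).resolve_right hP0
  obtain ⟨q, hq⟩ : ∃ q : Fin 3, 0 < k q * k (q + 1) := by
    by_contra hcon
    push Not at hcon
    have a0 : k 0 * k 1 ≤ 0 := hcon 0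
    have a1 : k 1 * k 2 ≤ 0 := hcon 1
    have a2 : k 2 * k 0 ≤ 0 := hcon 2
    rcases lt_or_gt_of_ne (hk0 0) with b0 | b0 <;> rcases lt_or_gt_of_ne (hk0 1) with b1 | b1 <;>
      rcases lt_or_gt_of_ne (hk0 2) with b2 | b2 <;> nlinarith
  have hqk : 0 < (k (q + 1) : ℝ) / ((k q : ℝ) + k (q + 1)) ∧ (k (q + 1) : ℝ) / ((k q : ℝ) + k (q + 1)) < 1
      ∧ ((k q : ℝ) + k (q + 1)) ≠ 0 := by
    have hq' : (0 : ℝ) < k q * k (q + 1) := by exact_mod_cast hq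
    rcases (mul_pos_iff.1 hq') with ⟨h1, h2⟩ | ⟨h1, h2⟩
    · exact ⟨by positivity, by rw [div_lt_one (by positivity)]; linarith, by positivity⟩
    · refine ⟨div_pos_of_neg_of_neg h2 (by linarith), by rw [div_lt_one_of_neg (by linarith)]; linarith, by linarith⟩
  obtain ⟨ht0, ht1, hne⟩ := hqk
  have hcP : cz ℝ P ≠ 0 := fun h0 => hP0 (cz_inj ℝ (by rw [h0, cz_zero]))
  have hba : cz ℝ (T j (q + 1)) - cz ℝ (T j q) = ((k q : ℝ) + k (q + 1)) • cz ℝ P := by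
    have h1 := hk q
    have h2 := hk (q + 1)
    simp only [ed] at h1 h2
    have e1 : q + 1 + 1 = q + 2 := by fin_cases q <;> rfl
    have e2 : q + 1 + 2 = q := by fin_cases q <;> rfl
    rw [e1, e2] at h2
    rw [← cz_sub, add_smul, ← cz_smul, ← cz_smul, ← cz_add, ← h1, ← h2]
    congr 1; abel
  have hW : cz ℝ (T j (q + 2)) = cz ℝ (T j q) + ((k (q + 1) : ℝ) / ((k q : ℝ) + k (q + 1))) •
      (cz ℝ (T j (q + 1)) - cz ℝ (T j q)) := by
    have h2 := hk (q + 1)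
    simp only [ed] at h2
    have e1 : q + 1 + 1 = q + 2 := by fin_cases q <;> rfl
    have e2 : q + 1 + 2 = q := by fin_cases q <;> rfl
    rw [e1, e2] at h2
    rw [hba, smul_smul, div_mul_cancel₀ _ hne, ← cz_smul, ← h2, cz_sub]; abel
  refine ⟨{j}, by simpa using hj, by simp, fun i => cz ℝ (ed (T i) (c i)), ?_, ?_,
    cz ℝ (T j (q + 2)), ⟨_, rfl⟩, ?_⟩
  · intro i _
    exact ⟨_, ⟨_, ⟨c i + 2, rfl⟩, rfl⟩, _, ⟨_, ⟨c i + 1, rfl⟩, rfl⟩, cz_sub ℝ _ _⟩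
  · exact hc.mono (by simp)
  · intro r _
    have hspan : Submodule.span ℝ ((fun i => cz ℝ (ed (T i) (c i))) '' (I : Set ι)) = ⊤ := by
      have h1 : LinearIndependent ℝ (fun i : I => cz ℝ (ed (T i) (c i))) := hc
      have h2 := h1.span_eq_top_of_card_eq_finrank' (by simp [hI])
      rw [Set.image_eq_range]; exact h2
    have hr : r ∈ Submodule.span ℝ ((fun i => cz ℝ (ed (T i) (c i))) '' (I : Set ι)) := by
      rw [hspan]; trivial
    obtain ⟨s, hs⟩ := (mem_span_fin _ _ _).1 hr
    have hseg := FD_seg (B := cz ℝ '' Set.range (T j)) (a := cz ℝ (T j q)) (b := cz ℝ (T j (q + 1)))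
      ⟨_, ⟨_, rfl⟩, rfl⟩ ⟨_, ⟨_, rfl⟩, rfl⟩
      (t := (k (q + 1) : ℝ) / ((k q : ℝ) + k (q + 1)))
      (z := s j * k (c j) / ((k q : ℝ) + k (q + 1))) ht0.le ht1.le (fun h => absurd h ht0.ne') (fun h => absurd h ht1.ne)
    rw [← hW, hba, smul_smul, div_mul_cancel₀ _ hne, mul_smul, ← cz_smul, ← hk] at hseg
    obtain ⟨ε, hε, hp⟩ := hseg
    refine ⟨ε, hε, _, by rw [PJ, Finset.sum_singleton]; exact hp, fun i => ε * s i, ?_⟩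
    rw [← hs, ← Finset.add_sum_erase _ _ hj, Finset.sdiff_singleton_eq_erase]
    simp only [mul_smul, ← Finset.smul_sum, smul_add]
    abel

theorem bc_split (R : Type*) [CommRing R] {m : ℕ} {P : Fin (m + 1) → ℤ} {e : (Fin (m + 1) → ℤ) →ₗ[ℤ] ℤ}
    {ψ : (Fin (m + 1) → ℤ) →ₗ[ℤ] (Fin m → ℤ)} {σ : (Fin m → ℤ) →ₗ[ℤ] (Fin (m + 1) → ℤ)}
    (h : ∀ x, x = e x • P + σ (ψ x)) (y : Fin (m + 1) → R) :
    ∃ a : R, y = a • cz R P + bc R σ (bc R ψ y) := by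
  let e1 : (Fin (m + 1) → ℤ) →ₗ[ℤ] (Fin 1 → ℤ) := LinearMap.pi fun _ => e
  refine ⟨bc R e1 y 0, ?_⟩
  have : LinearMap.id = (LinearMap.proj 0 ∘ₗ bc R e1).smulRight (cz R P) + bc R σ ∘ₗ bc R ψ := by
    refine ext_cz R _ _ fun x => ?_
    simp only [LinearMap.id_apply, LinearMap.add_apply, LinearMap.smulRight_apply, LinearMap.comp_apply,
      bc_cz, LinearMap.proj_apply]
    conv_lhs => rw [h x]
    rw [cz_add, cz_smul]; rfl
  exact LinearMap.congr_fun this y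

theorem wv_gmap {m n : ℕ} (ψ : (Fin n → ℤ) →ₗ[ℤ] (Fin m → ℤ)) (T : Fin 3 → Fin n → ℤ) :
    (fun k => gmap ψ (wv T k)) = ∑ c, mo (ψ (T c)) • cz (GR m) (ed T c) := by
  ext1 k
  simp only [wv, Finset.sum_apply, map_sum, Pi.smul_apply, smul_eq_mul, map_mul, gmap_mo, cz, map_intCast]

theorem ed_map {m n : ℕ} (ψ : (Fin n → ℤ) →ₗ[ℤ] (Fin m → ℤ)) (T : Fin 3 → Fin n → ℤ) (c) :
    ed (fun c => ψ (T c)) c = ψ (ed T c) := by simp [ed]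

theorem core_C1 {m : ℕ} {ι : Type*} [DecidableEq ι] {I : Finset ι}
    {T : ι → Fin 3 → Fin (m + 1) → ℤ} (j : ι) (hj : j ∈ I) (c : Fin 3)
    {P : Fin (m + 1) → ℤ} {e : (Fin (m + 1) → ℤ) →ₗ[ℤ] ℤ}
    {ψ : (Fin (m + 1) → ℤ) →ₗ[ℤ] (Fin m → ℤ)} {σ : (Fin m → ℤ) →ₗ[ℤ] (Fin (m + 1) → ℤ)}
    (hψP : ψ P = 0) (hψσ : ∀ y, ψ (σ y) = y)
    (h : ∀ x, x = e x • P + σ (ψ x)) (k : ℤ) (hk0 : k ≠ 0) (hP0 : P ≠ 0) (hk : ed (T j) c = k • P)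
    (hD : ∀ v : ι → GR m, (∑ i ∈ I, v i • (fun k => gmap ψ (wv (T i) k)) = 0) → ∀ i ∈ I, v i = 0)
    (ih : LIw (I.erase j) (fun i c => ψ (T i c)) →
      Good ⊤ (latt (Fin m)) (fun i => cz ℝ '' Set.range (fun c => ψ (T i c))) (I.erase j)) :
    Good ⊤ (latt (Fin (m + 1))) (fun i => cz ℝ '' Set.range (T i)) I := by
  have hψE : ψ (ed (T j) c) = 0 := by rw [hk, map_smul, hψP, smul_zero]
  have hbm : ∀ i, bc (GR m) ψ (fun k => gmap ψ (wv (T i) k)) = wv (fun c => ψ (T i c)) := fun i => by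
    rw [wv_gmap, map_sum, wv]
    refine Finset.sum_congr rfl fun c _ => ?_
    rw [map_smul, bc_cz, ed_map]
  haveI : CharZero (GR m) := charZero_of_injective_algebraMap (R := ℂ) (A := GR m) (algebraMap ℂ (GR m)).injective
  have hmj : (fun k => gmap ψ (wv (T j) k)) =
      ((mo (ψ (T j c)) - mo (ψ (T j (c + 2)))) * (k : GR m)) • cz (GR m) P := by
    have h1 : ψ (T j (c + 1)) = ψ (T j (c + 2)) := by
      rw [ed, map_sub] at hψE; exact sub_eq_zero.1 hψE
    rw [wv_eq (T j) c]
    have : ∀ (E : Fin (m + 1) → ℤ) x, gmap ψ (cz (GR (m + 1)) E x) = cz (GR m) E x := fun E x => by simp [cz]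
    ext1 x
    simp only [Pi.add_apply, Pi.smul_apply, smul_eq_mul, map_add, map_mul, map_sub, gmap_mo, h1, this]
    rw [hk, cz_smul]
    simp; ring
  set u : GR m := (mo (ψ (T j c)) - mo (ψ (T j (c + 2)))) * (k : GR m) with hu
  have hu0 : u ≠ 0 := by
    intro h0
    rw [h0, zero_smul] at hmj
    have := hD (Pi.single j 1) (Finset.sum_eq_zero fun i _ => by
      by_cases hij : i = j
      · subst hij; rw [hmj, smul_zero]
      · simp [hij]) j hj
    simp at this
  have hLI : LIw (I.erase j) (fun i c => ψ (T i c)) := by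
    intro v hv
    obtain ⟨a, ha⟩ := bc_split (GR m) h (∑ i ∈ I.erase j, v i • (fun k => gmap ψ (wv (T i) k)))
    have hz : bc (GR m) ψ (∑ i ∈ I.erase j, v i • (fun k => gmap ψ (wv (T i) k))) = 0 := by
      simp only [map_sum, map_smul, hbm]; exact hv
    rw [hz, map_zero, add_zero] at ha
    have h1 := hD (fun i => if i = j then -a else u * v i) (by
      rw [← Finset.add_sum_erase _ _ hj]
      have : ∑ x ∈ I.erase j, (if x = j then -a else u * v x) • (fun k => gmap ψ (wv (T x) k)) =
        u • ∑ i ∈ I.erase j, v i • (fun k => gmap ψ (wv (T i) k)) := by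
        rw [Finset.smul_sum]
        refine Finset.sum_congr rfl fun i hi => ?_
        rw [if_neg (Finset.ne_of_mem_erase hi), mul_smul]
      rw [this, ha, hmj]; simp only [if_true]; module)
    intro i hi
    have h2 := h1 i (Finset.mem_of_mem_erase hi)
    simp only [if_neg (Finset.ne_of_mem_erase hi)] at h2
    exact (mul_eq_zero.1 h2).resolve_left hu0
  have hcP : cz ℝ P ≠ 0 := fun h0 => hP0 (cz_inj ℝ (by rw [h0, cz_zero]))
  have hkR : (k : ℝ) ≠ 0 := by exact_mod_cast hk0
  have hE : cz ℝ (ed (T j) c) = (k : ℝ) • cz ℝ P := by rw [hk, cz_smul]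
  refine good_lift ⊤ (latt _) _ I {j} (by simpa using hj) (bc ℝ ψ) ⊤ (latt (Fin m)) ?_ (fun _ _ => trivial)
    (fun _ _ _ _ => trivial) (fun _ _ => trivial) (fun _ => cz ℝ (ed (T j) c)) ?_ ?_ ?_ ?_ ?_
  · rintro _ ⟨x, rfl⟩
    exact ⟨cz ℝ (σ x), ⟨_, rfl⟩, by rw [bc_cz, hψσ]⟩
  · intro i hi
    obtain rfl := Finset.mem_singleton.1 hi
    exact ⟨_, ⟨_, ⟨c + 2, rfl⟩, rfl⟩, _, ⟨_, ⟨c + 1, rfl⟩, rfl⟩, by rw [ed, cz_sub]⟩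
  · rw [Finset.coe_singleton]
    exact LinearIndepOn.singleton (by rw [hE]; exact smul_ne_zero hkR hcP)
  · intro i _
    show bc ℝ ψ (cz ℝ (ed (T j) c)) = 0
    rw [bc_cz, hψE, cz_zero]
  · intro x _ hx
    obtain ⟨a, ha⟩ := bc_split ℝ h x
    rw [hx, map_zero, add_zero] at ha
    refine ⟨fun _ => a / k, ?_⟩
    rw [Finset.sum_singleton, hE, smul_smul, div_mul_cancel₀ _ hkR, ← ha]
  · have := ih hLI
    rw [Finset.sdiff_singleton_eq_erase]
    convert this using 2 with i
    rw [← Set.range_comp, ← Set.range_comp, ← Set.range_comp]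
    congr 1; ext1 c'
    simp only [Function.comp_apply, bc_cz]

end Khov

open Pointwise Module
namespace Khov

theorem supp_det {n : ℕ} (T : Fin n → Fin 3 → Fin n → ℤ) (g : Fin n → ℤ)
    (h : (Matrix.det (Matrix.of fun a => wv (T a))).coeff g ≠ 0) :
    ∃ c : Fin n → Fin 3, g = ∑ a, T a (c a) := by
  have h1 : Matrix.det (Matrix.of fun a => wv (T a)) = ∑ c : Fin n → Fin 3,
      mo (∑ a, T a (c a)) * ((Matrix.det (Matrix.of fun a => ed (T a) (c a)) : ℤ) : GR n) := by
    have h2 := (Matrix.detRowAlternating (R := GR n) (n := Fin n)).toMultilinearMap.map_sum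
      (fun a c => mo (T a c) • cz (GR n) (ed (T a) c))
    refine h2.trans (Finset.sum_congr rfl fun c _ => ?_)
    refine ((Matrix.detRowAlternating (R := GR n) (n := Fin n)).toMultilinearMap.map_smul_univ
      (fun a => mo (T a (c a))) (fun a => cz (GR n) (ed (T a) (c a)))).trans ?_
    rw [smul_eq_mul]
    congr 1
    · have : ∀ S : Finset (Fin n), ∏ a ∈ S, mo (T a (c a)) = mo (∑ a ∈ S, T a (c a)) := fun S => by
        induction S using Finset.induction_on with
        | empty => simp [mo_zero]
        | insert a S ha ih => rw [Finset.prod_insert ha, ih, mo_mul, Finset.sum_insert ha]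
      exact this _
    · have h3 := (Int.castRingHom (GR n)).map_det (Matrix.of fun a => ed (T a) (c a))
      exact h3.symm
  rw [h1] at h
  have h4 : ∃ c : Fin n → Fin 3, (mo (∑ a, T a (c a)) *
      ((Matrix.det (Matrix.of fun a => ed (T a) (c a)) : ℤ) : GR n)).coeff g ≠ 0 := by
    by_contra hcon
    push Not at hcon
    apply h
    rw [AddMonoidAlgebra.coeff_sum, Finsupp.finset_sum_apply]
    exact Finset.sum_eq_zero fun c _ => hcon c
  obtain ⟨c, hc⟩ := h4
  refine ⟨c, ?_⟩
  by_contra hne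
  apply hc
  rw [mul_comm, ← zsmul_eq_mul, AddMonoidAlgebra.coeff_smul, Finsupp.smul_apply, mo,
    AddMonoidAlgebra.coeff_single, Finsupp.single_apply, if_neg (Ne.symm hne), smul_zero]

theorem mem_interior_of_sep {n : ℕ} (Q : Set (Fin n → ℝ)) (hQ : Convex ℝ Q) (hne : Q.Nonempty)
    (W : Fin n → ℝ)
    (h : ∀ z : (Fin n → ℝ) →ₗ[ℝ] ℝ, z ≠ 0 → ∃ g ∈ Q, z W < z g) : W ∈ interior Q := by
  by_contra hW
  have hinn : (interior Q).Nonempty := by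
    rw [hQ.interior_nonempty_iff_affineSpan_eq_top]
    by_contra hsp
    have hv : vectorSpan ℝ Q < ⊤ := by
      rw [lt_top_iff_ne_top]
      intro ht
      exact hsp ((AffineSubspace.affineSpan_eq_top_iff_vectorSpan_eq_top_of_nonempty ℝ _ _ hne).2 ht)
    obtain ⟨z, hz, hker⟩ := Submodule.exists_le_ker_of_lt_top _ hv
    obtain ⟨g, hg, h1⟩ := h z hz
    obtain ⟨g', hg', h2⟩ := h (-z) (neg_ne_zero.2 hz)
    have h3 := hker (vsub_mem_vectorSpan ℝ hg hg')
    rw [LinearMap.mem_ker, vsub_eq_sub, map_sub] at h3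
    simp only [LinearMap.neg_apply] at h2
    linarith
  obtain ⟨f, hf⟩ := geometric_hahn_banach_point_open hQ.interior isOpen_interior hW
  obtain ⟨x0, hx0⟩ := hinn
  obtain ⟨g, hg, h1⟩ := h (-f.toLinearMap) (by
    intro h0
    have h2 := LinearMap.congr_fun h0 (x0 - W)
    have h3 := hf x0 hx0
    simp at h2; linarith)
  have hcl : Q ⊆ closure (interior Q) := by
    rw [hQ.closure_interior_eq_closure_of_nonempty_interior ⟨x0, hx0⟩]; exact subset_closure
  have h2 : f W ≤ f g := by
    have : closure (interior Q) ⊆ {y | f W ≤ f y} :=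
      closure_minimal (fun y hy => (hf y hy).le) (isClosed_le continuous_const f.continuous)
    exact this (hcl hg)
  simp at h1; linarith

theorem core_C2 {m : ℕ} {ι : Type*} [DecidableEq ι] {I : Finset ι} (hI : I.card = m + 1)
    {T : ι → Fin 3 → Fin (m + 1) → ℤ} (h : LIw I T) (f : Fin (m + 1) ≃ I)
    (hinj : ∀ j ∈ I, ∀ c c', prim (ed (T j) c) = prim (ed (T j) c') → c = c')
    (hdvd : ∀ j ∈ I, ∀ c, mo (prim (ed (T j) c)) - 1 ∣ Matrix.det (Matrix.of fun a => wv (T (f a))))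
    (hD0 : Matrix.det (Matrix.of fun a => wv (T (f a))) ≠ 0) :
    Good ⊤ (latt (Fin (m + 1))) (fun i => cz ℝ '' Set.range (T i)) I := by
  set D := Matrix.det (Matrix.of fun a => wv (T (f a))) with hD
  have hk' : ∀ j c, ∃ k : ℤ, j ∈ I → k ≠ 0 ∧ ed (T j) c = k • prim (ed (T j) c) := fun j c => by
    by_cases hj : j ∈ I
    · obtain ⟨k, hk⟩ := (prim_spec (h.ed_ne hj c)).2; exact ⟨k, fun _ => hk⟩
    · exact ⟨0, fun h => absurd h hj⟩
  choose k hk using hk'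
  set S : Finset (Fin (m + 1) → ℤ) := (I ×ˢ Finset.univ).image fun p : ι × Fin 3 => prim (ed (T p.1) p.2) with hS
  have hSm : ∀ j ∈ I, ∀ c, prim (ed (T j) c) ∈ S := fun j hj c =>
    Finset.mem_image.2 ⟨(j, c), by simp [hj], rfl⟩
  have hSp : ∀ P ∈ S, Prim P ∧ prim P = P ∧ P ≠ 0 ∧ mo P - 1 ∣ D := by
    intro P hP
    obtain ⟨⟨j, c⟩, hjc, rfl⟩ := Finset.mem_image.1 hP
    have hj : j ∈ I := by simpa using hjc
    obtain ⟨h1, k', hk', h2⟩ := prim_spec (h.ed_ne hj c)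
    refine ⟨h1, prim_eq_of_par ⟨k', 1, hk', one_ne_zero, ?_⟩, ?_, hdvd j hj c⟩
    · simp only; rw [one_smul]; exact h2.symm
    · rintro h0
      obtain ⟨e, he⟩ := h1
      simp only at h0 he
      rw [h0] at he; simp at he
  -- generic combination
  let cf : (Fin (m + 1) → ℤ) → Module.Dual ℝ (ι → ℝ) := fun P =>
    ∑ j ∈ I, ∑ c, (if prim (ed (T j) c) = P then (k j c : ℝ) else 0) • LinearMap.proj j
  have hcf : ∀ P : S, ∃ x, cf P x ≠ 0 := by
    rintro ⟨P, hP⟩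
    obtain ⟨⟨j, c⟩, hjc, rfl⟩ := Finset.mem_image.1 hP
    have hj : j ∈ I := by simpa using hjc
    refine ⟨Pi.single j 1, ?_⟩
    have : cf (prim (ed (T j) c)) (Pi.single j 1) = k j c := by
      simp only [cf, LinearMap.sum_apply, LinearMap.smul_apply, LinearMap.proj_apply, smul_eq_mul]
      rw [Finset.sum_eq_single j, Finset.sum_eq_single c]
      · simp
      · intro c' _ hc'
        rw [if_neg (fun h => hc' (hinj j hj _ _ h)), zero_mul]
      · simp
      · intro j' _ hj'
        simp [Pi.single_eq_of_ne hj']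
      · exact fun h => absurd hj h
    simp only
    rw [this]
    exact_mod_cast (hk j c hj).1
  obtain ⟨lam, hlam⟩ := Module.Dual.exists_forall_ne_zero_of_forall_exists (fun P : S => cf P) hcf
  have hlam' : ∀ P ∈ S, cf P lam ≠ 0 := fun P hP => hlam ⟨P, hP⟩
  -- the relation
  have hrel : ∀ z : (Fin (m + 1) → ℝ) →ₗ[ℝ] ℝ, ∑ P ∈ S, cf P lam * z (cz ℝ P) = 0 := by
    intro z
    have h1 : ∀ P ∈ S, cf P lam * z (cz ℝ P) = ∑ j ∈ I, ∑ c, if prim (ed (T j) c) = P then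
        lam j * z (cz ℝ (ed (T j) c)) else 0 := by
      intro P _
      simp only [cf, LinearMap.sum_apply, LinearMap.smul_apply, LinearMap.proj_apply, smul_eq_mul,
        Finset.sum_mul]
      refine Finset.sum_congr rfl fun j hj => Finset.sum_congr rfl fun c _ => ?_
      split_ifs with hh
      · conv_rhs => rw [(hk j c hj).2, cz_smul, map_smul, hh, smul_eq_mul]
        ring
      · simp
    rw [Finset.sum_congr rfl h1, Finset.sum_comm]
    refine Finset.sum_eq_zero fun j hj => ?_
    rw [Finset.sum_comm]
    have h2 : ∀ c : Fin 3, (∑ P ∈ S, if prim (ed (T j) c) = P then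
        lam j * z (cz ℝ (ed (T j) c)) else 0) = lam j * z (cz ℝ (ed (T j) c)) := fun c => by
      rw [Finset.sum_ite_eq, if_pos (hSm j hj c)]
    rw [Finset.sum_congr rfl fun c _ => h2 c, ← Finset.mul_sum, ← map_sum, ← cz_sum, ed_sum, cz_zero,
      map_zero, mul_zero]
  let sg : (Fin (m + 1) → ℤ) → ℤ := fun P => if 0 < cf P lam then 1 else -1
  have hsg : ∀ P, sg P = 1 ∨ sg P = -1 := fun P => by simp only [sg]; split_ifs <;> simp
  let Q : (Fin (m + 1) → ℤ) → (Fin (m + 1) → ℤ) := fun P => sg P • P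
  set S' := S.image Q with hS'
  have hQd : ∀ x ∈ S', mo x - 1 ∣ D := by
    intro x hx
    obtain ⟨P, hP, rfl⟩ := Finset.mem_image.1 hx
    refine dvd_trans ?_ (hSp P hP).2.2.2
    rcases hsg P with h1 | h1
    · simp only [Q, h1, one_smul]; exact dvd_rfl
    · simp only [Q, h1, neg_smul, one_smul]; exact mo_sub_one_dvd_neg P
  have hQ0 : ∀ x ∈ S', x ≠ 0 := by
    intro x hx
    obtain ⟨P, hP, rfl⟩ := Finset.mem_image.1 hx
    exact smul_ne_zero (by rcases hsg P with h1 | h1 <;> simp [h1]) (hSp P hP).2.2.1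
  have hQpar : ∀ P, Par P (Q P) := fun P => by
    rcases hsg P with h1 | h1
    · exact ⟨1, 1, one_ne_zero, one_ne_zero, by simp [Q, h1]⟩
    · exact ⟨1, -1, one_ne_zero, by simp, by simp [Q, h1]⟩
  have hprod : ∏ x ∈ S', (mo x - 1) ∣ D := by
    refine prod_dvd_of S' D hQd ?_
    intro x hx y hy hxy g hg
    obtain ⟨P, hP, rfl⟩ := Finset.mem_image.1 hx
    obtain ⟨P', hP', rfl⟩ := Finset.mem_image.1 hy
    have hpr : Prim (Q P) := by
      obtain ⟨e, he⟩ := (hSp P hP).1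
      rcases hsg P with h1 | h1
      · exact ⟨e, by simp [Q, h1, he]⟩
      · exact ⟨-e, by simp [Q, h1, he]⟩
    obtain ⟨e, ψ, σ, he, hψ, hψσ, hx⟩ := prim_split _ hpr
    apply dvd_of_gmap_eq_zero hx
    have h1 : gmap ψ (mo (Q P) - 1) = 0 := by
      rw [map_sub, gmap_mo, hψ, mo_zero, map_one, sub_self]
    obtain ⟨q, hq⟩ := hg
    have h2 := congrArg (gmap ψ) hq
    rw [map_mul, map_mul, h1, zero_mul] at h2
    refine (mul_eq_zero.1 h2).resolve_left fun h3 => hxy ?_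
    rw [map_sub, gmap_mo, map_one, ← mo_zero] at h3
    have h4 : ψ (Q P') = 0 := mo_inj (sub_eq_zero.1 h3)
    have h5 := hx (Q P')
    rw [h4, map_zero, add_zero] at h5
    have h6 : Par (Q P') (Q P) := by
      refine ⟨1, e (Q P'), one_ne_zero, fun h0 => hQ0 _ hy ?_, by rw [one_smul]; exact h5⟩
      rw [h5, h0, zero_smul]
    have h7 : Par P P' := (hQpar P).trans (h6.symm.trans (hQpar P').symm)
    have h8 := prim_eq_of_par h7
    rw [(hSp P hP).2.1, (hSp P' hP').2.1] at h8
    rw [h8]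
  obtain ⟨g, hg⟩ := hprod
  have hg0 : g ≠ 0 := by rintro rfl; exact hD0 (by rw [hg, mul_zero])
  obtain ⟨w0, hw0⟩ : ∃ w0, g.coeff w0 ≠ 0 := by
    by_contra hcon
    push Not at hcon
    exact hg0 (by ext x; simpa using hcon x)
  obtain ⟨ce, hce⟩ := h.exists_edges
  have hpos : ∀ z : (Fin (m + 1) → ℝ) →ₗ[ℝ] ℝ, z ≠ 0 → ∃ x ∈ S', 0 < z (cz ℝ (id x)) := by
    intro z hz
    by_contra hcon
    push Not at hcon
    have h1 : ∀ P ∈ S, cf P lam * z (cz ℝ P) ≤ 0 := by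
      intro P hP
      have h2 := hcon (Q P) (Finset.mem_image_of_mem Q hP)
      simp only [id, Q, cz_smul, map_smul, smul_eq_mul] at h2
      by_cases hp : 0 < cf P lam
      · simp only [sg, if_pos hp] at h2
        push_cast at h2
        nlinarith
      · simp only [sg, if_neg hp] at h2
        push_cast at h2
        nlinarith
    have h2 := (Finset.sum_eq_zero_iff_of_nonpos h1).1 (hrel z)
    have h3 : ∀ P ∈ S, z (cz ℝ P) = 0 := fun P hP => (mul_eq_zero.1 (h2 P hP)).resolve_left (hlam' P hP)
    apply hz
    have hspan : Submodule.span ℝ ((fun i => cz ℝ (ed (T i) (ce i))) '' (I : Set ι)) = ⊤ := by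
      have h1 : LinearIndependent ℝ (fun i : I => cz ℝ (ed (T i) (ce i))) := hce
      have h2 := h1.span_eq_top_of_card_eq_finrank' (by simp [hI])
      rw [Set.image_eq_range]; exact h2
    refine LinearMap.ext_on hspan ?_
    rintro _ ⟨i, hi, rfl⟩
    simp only
    rw [(hk i (ce i) hi).2, cz_smul, map_smul, h3 _ (hSm i hi _), smul_zero, LinearMap.zero_apply]
  have hDsupp : ∀ x, D.coeff x ≠ 0 → cz ℝ x ∈ PJ (fun i => cz ℝ '' Set.range (T i)) I := by
    intro x hx
    obtain ⟨c, hc⟩ := supp_det (fun a => T (f a)) x hx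
    rw [mem_PJ]
    refine ⟨fun i => if hi : i ∈ I then cz ℝ (T i (c (f.symm ⟨i, hi⟩))) else 0, ?_, ?_⟩
    · intro i hi
      simp only [dif_pos hi]
      exact subset_convexHull ℝ _ ⟨_, ⟨_, rfl⟩, rfl⟩
    · rw [hc, cz_sum, ← Finset.sum_coe_sort I, ← f.sum_comp]
      refine Finset.sum_congr rfl fun a _ => ?_
      simp
  have hinn : cz ℝ w0 ∈ interior (PJ (fun i => cz ℝ '' Set.range (T i)) I) := by
    refine mem_interior_of_sep _ (PJ_convex _ _) ?_ _ ?_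
    · obtain ⟨x, hx, -⟩ := zono 0 S' id hQ0 g w0 hw0
      simp only [id] at hx
      rw [← hg] at hx
      exact ⟨_, hDsupp x hx⟩
    · intro z hz
      obtain ⟨x, hx, -, h2⟩ := zono z S' id hQ0 g w0 hw0
      simp only [id] at hx
      rw [← hg] at hx
      exact ⟨_, hDsupp x hx, h2 (hpos z hz)⟩
  refine ⟨I, le_rfl, Finset.card_pos.1 (by omega), fun _ => 0, by simp, by simp, cz ℝ w0, ⟨_, rfl⟩, ?_⟩
  intro r _
  have hcont : Filter.Tendsto (fun ε : ℝ => cz ℝ w0 + ε • r) (nhdsWithin 0 (Set.Ioi 0)) (nhds (cz ℝ w0)) := by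
    have : Continuous fun ε : ℝ => cz ℝ w0 + ε • r := by fun_prop
    have h1 := this.tendsto 0
    simp only [zero_smul, add_zero] at h1
    exact h1.mono_left nhdsWithin_le_nhds
  have hev := hcont.eventually (mem_interior_iff_mem_nhds.1 hinn)
  obtain ⟨ε, hε, hε0⟩ := (hev.and self_mem_nhdsWithin).exists
  exact ⟨ε, hε0, _, hε, 0, by simp⟩

theorem core (m : ℕ) : ∀ {ι : Type} [DecidableEq ι] (I : Finset ι) (_ : I.card = m + 1)
    (T : ι → Fin 3 → Fin (m + 1) → ℤ) (_ : LIw I T),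
    Good ⊤ (latt (Fin (m + 1))) (fun i => cz ℝ '' Set.range (T i)) I := by
  induction m with
  | zero =>
    intro ι _ I hI T h
    obtain ⟨j, hj⟩ : I.Nonempty := Finset.card_pos.1 (by omega)
    refine core_B hI h j hj (fun _ => 1) (fun c => ed (T j) c 0) fun c => ?_
    ext x; fin_cases x; simp
  | succ m ih =>
    intro ι _ I hI T h
    by_cases hinj : ∀ j ∈ I, ∀ c c', prim (ed (T j) c) = prim (ed (T j) c') → c = c'
    swap
    · push Not at hinj
      obtain ⟨j, hj, c, c', hcc, hne⟩ := hinj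
      obtain ⟨-, k, hk0, hk⟩ := prim_spec (h.ed_ne hj c)
      obtain ⟨-, k', hk0', hk'⟩ := prim_spec (h.ed_ne hj c')
      rw [← hcc] at hk'
      set P := prim (ed (T j) c)
      have hs := ed_sum (T j)
      rw [Fin.sum_univ_three] at hs
      have : ∀ d, ∃ k : ℤ, ed (T j) d = k • P := by
        intro d
        by_cases hd : d = c
        · exact ⟨k, hd ▸ hk⟩
        by_cases hd' : d = c'
        · exact ⟨k', hd' ▸ hk'⟩
        refine ⟨-k - k', ?_⟩
        have : ed (T j) d = - ed (T j) c - ed (T j) c' := by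
          have h3 : ed (T j) d + ed (T j) c + ed (T j) c' = 0 := by
            rw [← hs]
            fin_cases d <;> fin_cases c <;> fin_cases c' <;> first | exact absurd rfl hd | exact absurd rfl hd' | exact absurd rfl hne | (simp; done) | (simp; abel)
          rw [← sub_eq_zero, ← h3]; abel
        rw [this, hk, hk']; module
      choose k hk using this
      exact core_B hI h j hj P k hk
    let f : Fin (m + 1 + 1) ≃ I := (Fintype.equivFinOfCardEq (by simp [hI])).symm
    have hD0 : Matrix.det (Matrix.of fun a => wv (T (f a))) ≠ 0 := by
      intro h0
      obtain ⟨v, hv0, hv⟩ := Matrix.exists_vecMul_eq_zero_iff.2 h0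
      apply hv0
      ext1 a
      have := h (fun i => if hi : i ∈ I then v (f.symm ⟨i, hi⟩) else 0) (by
        rw [← Finset.sum_coe_sort I, ← f.sum_comp, ← hv, Matrix.vecMul_eq_sum]
        refine Finset.sum_congr rfl fun a _ => ?_
        simp; rfl) (f a) (f a).2
      simpa using this
    by_cases hC : ∀ j ∈ I, ∀ c, mo (prim (ed (T j) c)) - 1 ∣ Matrix.det (Matrix.of fun a => wv (T (f a)))
    · exact core_C2 hI h f hinj hC hD0
    push Not at hC
    obtain ⟨j, hj, c, hC⟩ := hC
    obtain ⟨hP, k, hk0, hk⟩ := prim_spec (h.ed_ne hj c)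
    obtain ⟨e, ψ, σ, he, hψ, hψσ, hx⟩ := prim_split _ hP
    have hP0 : prim (ed (T j) c) ≠ 0 := by
      intro h0; rw [h0] at he; simp at he
    refine core_C1 j hj c hψ hψσ hx k hk0 hP0 hk ?_ (fun hLI => ih (I.erase j) (by
      rw [Finset.card_erase_of_mem hj, hI]; rfl) _ hLI)
    intro v hv i hi
    by_contra hvi
    apply hC
    apply dvd_of_gmap_eq_zero hx
    rw [RingHom.map_det]
    refine Matrix.exists_vecMul_eq_zero_iff.1 ⟨fun a => v (f a), fun h0 => hvi ?_, ?_⟩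
    · have := congrFun h0 (f.symm ⟨i, hi⟩)
      simpa using this
    · rw [Matrix.vecMul_eq_sum, ← hv, ← Finset.sum_coe_sort I, ← f.sum_comp]
      rfl

end Khov

open Pointwise Module
namespace Khov

/-- Rado's theorem for vectors -/
theorem rado {V ι : Type*} [AddCommGroup V] [Module ℝ V] [FiniteDimensional ℝ V] [Fintype ι] [DecidableEq ι]
    [DecidableEq V] : ∀ (N : ℕ) (S : ι → Finset V), ∑ i, (S i).card = N →
    (∀ J : Finset ι, J.card ≤ finrank ℝ (Submodule.span ℝ (⋃ i ∈ J, (S i : Set V)))) →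
    ∃ s : ι → V, (∀ i, s i ∈ S i) ∧ LinearIndependent ℝ s := by
  intro N
  induction N using Nat.strong_induction_on with
  | _ N ih =>
  intro S hN h
  by_cases hS : ∀ i, (S i).card ≤ 1
  · have h1 : ∀ i, ∃ v, S i = {v} := by
      intro i
      have h2 := h {i}
      have h3 : (S i).card = 1 := by
        refine le_antisymm (hS i) ?_
        by_contra hc
        have : S i = ∅ := by rw [← Finset.card_eq_zero]; omega
        simp [this] at h2
      exact Finset.card_eq_one.1 h3
    choose s hs using h1
    refine ⟨s, fun i => by rw [hs]; simp, ?_⟩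
    rw [linearIndependent_iff_card_le_finrank_span]
    have := h Finset.univ
    have h4 : (⋃ i ∈ (Finset.univ : Finset ι), (S i : Set V)) = Set.range s := by
      ext v; simp [hs, eq_comm]
    rw [h4] at this
    rw [Finset.card_univ] at this; exact this
  · push Not at hS
    obtain ⟨i, hi⟩ := hS
    obtain ⟨x1, hx1, x2, hx2, hne⟩ := Finset.one_lt_card.1 hi
    have key : ∀ x ∈ S i, (∃ s : ι → V, (∀ i, s i ∈ S i) ∧ LinearIndependent ℝ s) ∨
        ∃ J : Finset ι, i ∉ J ∧ finrank ℝ (Submodule.span ℝ (((S i).erase x : Set V) ∪ ⋃ l ∈ J, (S l : Set V))) ≤ J.card := by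
      intro x hx
      by_cases hc : ∀ J : Finset ι, J.card ≤ finrank ℝ (Submodule.span ℝ
          (⋃ l ∈ J, (Function.update S i ((S i).erase x) l : Set V)))
      · left
        obtain ⟨s, hs, hli⟩ := ih _ (by
          rw [← hN]
          refine Finset.sum_lt_sum (fun l _ => ?_) ⟨i, Finset.mem_univ _, ?_⟩
          · by_cases hl : l = i
            · subst hl; simpa using Finset.card_le_card (Finset.erase_subset _ _)
            · rw [Function.update_of_ne hl]
          · rw [Function.update_self]; exact Finset.card_erase_lt_of_mem hx) _ rfl hc
        refine ⟨s, fun l => ?_, hli⟩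
        have := hs l
        by_cases hl : l = i
        · subst hl; rw [Function.update_self] at this; exact Finset.mem_of_mem_erase this
        · rwa [Function.update_of_ne hl] at this
      · right
        push Not at hc
        obtain ⟨J, hJ⟩ := hc
        have hiJ : i ∈ J := by
          by_contra hiJ
          have : (⋃ l ∈ J, (Function.update S i ((S i).erase x) l : Set V)) = ⋃ l ∈ J, (S l : Set V) := by
            refine Set.iUnion₂_congr fun l hl => ?_
            rw [Function.update_of_ne (by rintro rfl; exact hiJ hl)]
          rw [this] at hJ
          exact absurd (h J) (not_le.2 hJ)
        refine ⟨J.erase i, by simp, ?_⟩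
        have : (⋃ l ∈ J, (Function.update S i ((S i).erase x) l : Set V)) =
          ((S i).erase x : Set V) ∪ ⋃ l ∈ J.erase i, (S l : Set V) := by
          conv_lhs => rw [← Finset.insert_erase hiJ]
          rw [Finset.set_biUnion_insert, Function.update_self]
          congr 1
          refine Set.iUnion₂_congr fun l hl => ?_
          rw [Function.update_of_ne (Finset.ne_of_mem_erase hl)]
        rw [← this, Finset.card_erase_of_mem hiJ]; omega
    rcases key x1 hx1 with h1 | ⟨J, hJi, hJ⟩
    · exact h1
    rcases key x2 hx2 with h2 | ⟨K, hKi, hK⟩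
    · exact h2
    exfalso
    set U1 := Submodule.span ℝ (((S i).erase x1 : Set V) ∪ ⋃ l ∈ J, (S l : Set V))
    set U2 := Submodule.span ℝ (((S i).erase x2 : Set V) ∪ ⋃ l ∈ K, (S l : Set V))
    have hsup := Submodule.finrank_sup_add_finrank_inf_eq U1 U2
    have h1 : (insert i (J ∪ K)).card ≤ finrank ℝ ↥(U1 ⊔ U2) := by
      refine (h _).trans (Submodule.finrank_mono ?_)
      rw [Submodule.span_le]
      intro v hv
      simp only [Set.mem_iUnion, Finset.mem_insert, Finset.mem_union] at hv
      obtain ⟨l, hl, hv⟩ := hv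
      rcases hl with rfl | hl | hl
      · by_cases hvx : v = x1
        · exact Submodule.mem_sup_right (Submodule.subset_span (Or.inl (by
            simp only [Finset.coe_erase, Set.mem_diff, Set.mem_singleton_iff]
            exact ⟨hv, by rw [hvx]; exact hne⟩)))
        · exact Submodule.mem_sup_left (Submodule.subset_span (Or.inl (by
            simp only [Finset.coe_erase, Set.mem_diff, Set.mem_singleton_iff]
            exact ⟨hv, hvx⟩)))
      · exact Submodule.mem_sup_left (Submodule.subset_span (Or.inr (Set.mem_biUnion hl hv)))
      · exact Submodule.mem_sup_right (Submodule.subset_span (Or.inr (Set.mem_biUnion hl hv)))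
    have h2 : (J ∩ K).card ≤ finrank ℝ ↥(U1 ⊓ U2) := by
      refine (h _).trans (Submodule.finrank_mono ?_)
      rw [Submodule.span_le]
      intro v hv
      simp only [Set.mem_iUnion, Finset.mem_inter] at hv
      obtain ⟨l, ⟨hl, hl'⟩, hv⟩ := hv
      exact ⟨Submodule.subset_span (Or.inr (Set.mem_biUnion hl hv)),
        Submodule.subset_span (Or.inr (Set.mem_biUnion hl' hv))⟩
    rw [Finset.card_insert_of_notMem (by simp [hJi, hKi])] at h1
    have := Finset.card_union_add_card_inter J K
    omega

theorem exists_der {σ E : Type*} [Field E] [Algebra ℂ E] [Algebra (MvPolynomial σ ℂ) E]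
    [IsScalarTower ℂ (MvPolynomial σ ℂ) E] [IsFractionRing (MvPolynomial σ ℂ) E] (u : σ → E) :
    ∃ D : Derivation ℂ E E, ∀ v, D (algebraMap (MvPolynomial σ ℂ) E (MvPolynomial.X v)) = u v := by
  let R := MvPolynomial σ ℂ
  let φ : R →ₐ[ℂ] DualNumber E := MvPolynomial.aeval fun v =>
    (TrivSqZeroExt.inl (algebraMap R E (MvPolynomial.X v)) + TrivSqZeroExt.inr (u v) : TrivSqZeroExt E E)
  have hfst : ∀ r, (φ r).fst = algebraMap R E r := by
    have : ((TrivSqZeroExt.fstHom ℂ E E).comp φ) = IsScalarTower.toAlgHom ℂ R E := by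
      refine MvPolynomial.algHom_ext fun v => ?_
      simp only [AlgHom.comp_apply, φ, MvPolynomial.aeval_X]
      simp; rfl
    intro r
    exact DFunLike.congr_fun this r
  have hunit : ∀ y : nonZeroDivisors R, IsUnit (φ.toRingHom y) := by
    intro y
    rw [TrivSqZeroExt.isUnit_iff_isUnit_fst]
    show IsUnit (φ y).fst
    rw [hfst]
    exact IsLocalization.map_units E y
  let Φ : E →+* TrivSqZeroExt E E := IsLocalization.lift hunit
  have hΦ : ∀ r, Φ (algebraMap R E r) = φ r := fun r => IsLocalization.lift_eq hunit r
  have hΦf : ∀ z, (Φ z).fst = z := by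
    have : ((TrivSqZeroExt.fstHom ℂ E E).toRingHom.comp Φ) = RingHom.id E := by
      refine IsLocalization.ringHom_ext (nonZeroDivisors R) ?_
      refine RingHom.ext fun r => ?_
      simp only [RingHom.comp_apply, RingHom.id_apply]
      rw [hΦ]; exact hfst _
    intro z
    exact DFunLike.congr_fun this z
  have hΦC : ∀ a : ℂ, Φ (algebraMap ℂ E a) = TrivSqZeroExt.inl (algebraMap ℂ E a) := by
    intro a
    rw [IsScalarTower.algebraMap_apply ℂ R E, hΦ, AlgHom.commutes, ← IsScalarTower.algebraMap_apply ℂ R E]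
    rfl
  let Dl : E →ₗ[ℂ] E :=
    { toFun := fun z => (Φ z).snd
      map_add' := fun a b => by simp
      map_smul' := fun a z => by
        rw [Algebra.smul_def, map_mul, TrivSqZeroExt.snd_mul, hΦC]
        simp [Algebra.smul_def] }
  refine ⟨Derivation.mk' Dl fun a b => ?_, fun v => ?_⟩
  · show (Φ (a * b)).snd = a • (Φ b).snd + b • (Φ a).snd
    rw [map_mul, TrivSqZeroExt.snd_mul, hΦf, hΦf]
    simp [mul_comm]
  · show (Φ _).snd = _
    rw [hΦ]; simp only [φ]; erw [MvPolynomial.aeval_X]; simp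

section der
variable {E : Type*} [Field E] [Algebra ℂ E]

/-- Laurent monomial -/
def xm {κ F : Type*} [Fintype κ] [Field F] (x : κ → F) (a : κ → ℤ) : F := ∏ j, x j ^ a j

section xm
variable {κ F : Type*} [Fintype κ] [Field F] {x : κ → F}
theorem xm_ne (hx : ∀ j, x j ≠ 0) (a) : xm x a ≠ 0 := Finset.prod_ne_zero_iff.2 fun j _ => zpow_ne_zero _ (hx j)
theorem xm_zero : xm x 0 = 1 := by simp [xm]
theorem xm_add (hx : ∀ j, x j ≠ 0) (a b) : xm x (a + b) = xm x a * xm x b := by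
  simp [xm, zpow_add₀ (hx _), Finset.prod_mul_distrib]
theorem xm_neg (a) : xm x (-a) = (xm x a)⁻¹ := by
  simp [xm, zpow_neg, Finset.prod_inv_distrib]
theorem xm_sub (hx : ∀ j, x j ≠ 0) (a b) : xm x (a - b) = xm x a / xm x b := by
  rw [sub_eq_add_neg, xm_add hx, xm_neg, div_eq_mul_inv]
theorem xm_zsmul (k : ℤ) (a) : xm x (k • a) = xm x a ^ k := by
  simp only [xm, Pi.smul_apply, smul_eq_mul]
  rw [← Finset.prod_zpow]
  refine Finset.prod_congr rfl fun j _ => ?_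
  rw [mul_comm, zpow_mul]
theorem xm_map {F' : Type*} [Field F'] (φ : F →+* F') (a) : φ (xm x a) = xm (fun j => φ (x j)) a := by
  simp [xm, map_prod, map_zpow₀]
end xm

theorem der_zpow (D : Derivation ℂ E E) {y : E} (hy : y ≠ 0) (k : ℤ) :
    D (y ^ k) = k * y ^ k * (D y / y) := by
  have hn : ∀ n : ℕ, D (y ^ n) = n * y ^ n * (D y / y) := by
    intro n
    rw [D.leibniz_pow]
    rcases n with _ | n
    · simp
    · simp only [Nat.add_sub_cancel, smul_eq_mul, nsmul_eq_mul, pow_succ]; field_simp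
  obtain ⟨n, rfl | rfl⟩ := k.eq_nat_or_neg
  · simpa using hn n
  · have h1 : D (y ^ (n : ℤ) * y ^ (-(n : ℤ))) = 0 := by
      rw [← zpow_add₀ hy]; simp
    rw [D.leibniz, smul_eq_mul, smul_eq_mul, zpow_natCast, hn] at h1
    have h2 : y ^ n ≠ 0 := pow_ne_zero _ hy
    have h3 : y ^ (-(n : ℤ)) = (y ^ n)⁻¹ := by simp
    rw [h3] at h1 ⊢
    have h4 : y ^ n * D ((y ^ n)⁻¹) = y ^ n * (((-(n : ℤ) : ℤ) : E) * (y ^ n)⁻¹ * (D y / y)) := by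
      push_cast
      linear_combination h1
    exact mul_left_cancel₀ h2 h4

theorem der_prod {α : Type*} (D : Derivation ℂ E E) (S : Finset α) (f : α → E) (hf : ∀ i ∈ S, f i ≠ 0) :
    D (∏ i ∈ S, f i) = (∏ i ∈ S, f i) * ∑ i ∈ S, D (f i) / f i := by
  classical
  induction S using Finset.induction_on with
  | empty => simp
  | insert a S ha ih =>
    rw [Finset.prod_insert ha, D.leibniz, ih (fun i hi => hf i (by simp [hi])), Finset.sum_insert ha]
    have := hf a (by simp)
    simp only [smul_eq_mul]; field_simp; ring

theorem der_xm {κ : Type*} [Fintype κ] (D : Derivation ℂ E E) {x : κ → E} (hx : ∀ j, x j ≠ 0) (a : κ → ℤ) :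
    D (xm x a) = xm x a * ∑ j, a j * (D (x j) / x j) := by
  rw [xm, der_prod D _ _ fun j _ => zpow_ne_zero _ (hx j)]
  congr 1
  refine Finset.sum_congr rfl fun j _ => ?_
  rw [der_zpow D (hx j)]
  have := zpow_ne_zero (a j) (hx j)
  field_simp

/-- a derivation kills algebraic elements if it kills the base -/
theorem der_alg_mem (K : IntermediateField ℂ E) (D : Derivation ℂ E E) (F : IntermediateField K E)
    (hD : ∀ y ∈ K, D y ∈ K) {θ : E} (hθ : IsAlgebraic K θ) (hF : θ ∈ F) : D θ ∈ F := by
  haveI : CharZero K := algebraRat.charZero K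
  set p := minpoly K θ
  have hp : Polynomial.aeval θ p = 0 := minpoly.aeval K θ
  have hsep : Polynomial.aeval θ p.derivative ≠ 0 :=
    ((minpoly.irreducible hθ.isIntegral).separable).aeval_derivative_ne_zero hp
  have hpow : ∀ k : ℕ, θ ^ k ∈ F := fun k => pow_mem hF k
  have haev : ∀ q : Polynomial K, Polynomial.aeval θ q ∈ F := fun q => by
    rw [Polynomial.aeval_eq_sum_range]
    exact F.sum_mem fun k _ => F.smul_mem (hpow k)
  have h1 : ∀ q : Polynomial K, ∃ s ∈ F, D (Polynomial.aeval θ q) = s + Polynomial.aeval θ q.derivative * D θ := by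
    intro q
    induction q using Polynomial.induction_on' with
    | add q r hq hr =>
      obtain ⟨s, hs, h1⟩ := hq
      obtain ⟨t, ht, h2⟩ := hr
      refine ⟨s + t, F.add_mem hs ht, ?_⟩
      simp only [map_add, h1, h2]; ring
    | monomial k a =>
      refine ⟨θ ^ k * D (algebraMap K E a), F.mul_mem (hpow k) (F.algebraMap_mem ⟨_, hD _ a.2⟩), ?_⟩
      rw [Polynomial.derivative_monomial, Polynomial.aeval_monomial, Polynomial.aeval_monomial, D.leibniz,
        D.leibniz_pow]
      simp only [smul_eq_mul, nsmul_eq_mul, map_mul, map_natCast]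
      ring
  obtain ⟨s, hs, h2⟩ := h1 p
  rw [hp, map_zero] at h2
  have h3 : D θ = - s / Polynomial.aeval θ p.derivative := by
    rw [eq_div_iff hsep]; linear_combination -h2
  rw [h3]
  exact F.div_mem (F.neg_mem hs) (haev _)

theorem der_alg_zero (K : IntermediateField ℂ E) (D : Derivation ℂ E E)
    (hD : ∀ y ∈ K, D y = 0) {θ : E} (hθ : IsAlgebraic K θ) : D θ = 0 := by
  haveI : CharZero K := algebraRat.charZero K
  set p := minpoly K θ
  let DK : Derivation K E E := Derivation.mk'
    { toFun := D, map_add' := map_add D, map_smul' := fun a z => by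
        rw [Algebra.smul_def, D.leibniz]
        have : D (algebraMap K E a) = 0 := hD _ a.2
        rw [this]; simp [Algebra.smul_def] } (fun a b => D.leibniz a b)
  have hp : Polynomial.aeval θ p = 0 := minpoly.aeval K θ
  have hsep : Polynomial.aeval θ p.derivative ≠ 0 :=
    ((minpoly.irreducible hθ.isIntegral).separable).aeval_derivative_ne_zero hp
  have h1 := DK.map_aeval p θ
  rw [hp, map_zero, smul_eq_mul] at h1
  exact (mul_eq_zero.1 h1.symm).resolve_left hsep

end der
end Khov

open Pointwise Module
namespace Khov

/-- index type of the coefficients -/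
abbrev Sg {ι κ : Type} (A : ι → Finset (κ → ℤ)) := (i : ι) × {a // a ∈ A i}

/-- generic point data -/
structure GP {ι κ : Type} [Fintype κ] (A : ι → Finset (κ → ℤ)) (E : Type) [Field E] [Algebra ℂ E] where
  x : κ → E
  c : Sg A → E
  x0 : ∀ j, x j ≠ 0
  rel : ∀ i, ∑ a : {a // a ∈ A i}, c ⟨i, a⟩ * xm x a.1 = 0
  der : ∀ (u : κ → E) (w : Sg A → E), ∃ D : Derivation ℂ E E,
    (∀ j, D (x j) = u j) ∧ ∀ s : Sg A, s.2.1 ≠ 0 → D (c s) = w s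
  hA0 : ∀ i, (0 : κ → ℤ) ∈ A i
  ai : ι → κ → ℤ
  hai : ∀ i, ai i ∈ A i
  hli : LinearIndependent ℤ ai

namespace GP
variable {ι κ : Type} [Fintype ι] [DecidableEq ι] [Fintype κ] [DecidableEq κ] {A : ι → Finset (κ → ℤ)}
  {E : Type} [Field E] [Algebra ℂ E] (G : GP A E)

theorem charZ (E : Type) [Field E] [Algebra ℂ E] : CharZero E :=
  charZero_of_injective_algebraMap (algebraMap ℂ E).injective

noncomputable def gh (i : ι) : κ → E := ∑ a : {a // a ∈ A i}, (G.c ⟨i, a⟩ * xm G.x a.1) • cz E a.1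

theorem gh_dot (i : ι) (η : κ → E) : ∑ j, G.gh i j * η j =
    ∑ a : {a // a ∈ A i}, (G.c ⟨i, a⟩ * xm G.x a.1) * ∑ j, (a.1 j : E) * η j := by
  simp only [gh, Finset.sum_apply, Pi.smul_apply, smul_eq_mul, Finset.sum_mul, Finset.mul_sum, cz]
  rw [Finset.sum_comm]
  simp only [mul_assoc]

theorem der_rel (D : Derivation ℂ E E) (i : ι) :
    ∑ a : {a // a ∈ A i}, D (G.c ⟨i, a⟩) * xm G.x a.1 + ∑ j, G.gh i j * (D (G.x j) / G.x j) = 0 := by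
  have h := congrArg D (G.rel i)
  rw [map_sum, map_zero] at h
  rw [gh_dot, ← Finset.sum_add_distrib, ← h]
  refine Finset.sum_congr rfl fun a _ => ?_
  rw [D.leibniz, der_xm D G.x0]
  simp only [smul_eq_mul]; ring

theorem ai_ne (i : ι) : G.ai i ≠ 0 := G.hli.ne_zero i

theorem li_ai (R : Type*) [Field R] [CharZero R] (I : Finset ι) :
    LinearIndepOn R (fun i => cz R (G.ai i)) (I : Set ι) :=
  li_cz R _ I (G.hli.linearIndepOn _)

theorem gh_li (I : Finset ι) : LinearIndepOn E G.gh (I : Set ι) := by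
  haveI := charZ E
  suffices H : ∀ F : Finset ι, LinearIndepOn E (fun i => if i ∈ F then G.gh i else cz E (G.ai i)) (I : Set ι) by
    have := H I
    exact this.congr fun i hi => by simp [Finset.mem_coe.1 hi]
  intro F
  induction F using Finset.induction_on with
  | empty => simpa using G.li_ai E I
  | insert l F hl ih =>
    by_cases hlI : l ∈ I
    swap
    · refine ih.congr fun i hi => ?_
      have : i ≠ l := by rintro rfl; exact hlI hi
      simp [this]
    rw [linearIndepOn_finset_iff] at ih ⊢
    intro μ hμ
    have hsame : ∀ i ∈ I.erase l, (if i ∈ insert l F then G.gh i else cz E (G.ai i)) =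
        if i ∈ F then G.gh i else cz E (G.ai i) := fun i hi => by
      simp [Finset.ne_of_mem_erase hi]
    have hμ' : ∑ i ∈ I.erase l, μ i • (if i ∈ F then G.gh i else cz E (G.ai i)) + μ l • G.gh l = 0 := by
      rw [← hμ, ← Finset.sum_erase_add _ _ hlI]
      congr 1
      · exact (Finset.sum_congr rfl fun i hi => by rw [hsame i hi]).symm
      · simp
    by_cases hμl : μ l = 0
    · rw [hμl, zero_smul, add_zero] at hμ'
      have := ih (fun i => if i = l then 0 else μ i) (by
        rw [← Finset.sum_erase_add _ _ hlI]
        simp only [if_true, zero_smul, add_zero]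
        rw [← hμ']
        exact Finset.sum_congr rfl fun i hi => by rw [if_neg (Finset.ne_of_mem_erase hi)])
      intro i hi
      by_cases hil : i = l
      · rw [hil, hμl]
      · have h2 := this i hi; rwa [if_neg hil] at h2
    exfalso
    -- normalise and differentiate
    obtain ⟨D, hDx, hDc⟩ := G.der 0 (Pi.single ⟨l, ⟨G.ai l, G.hai l⟩⟩ 1)
    have hDm : ∀ a, D (xm G.x a) = 0 := fun a => by rw [der_xm D G.x0]; simp [hDx]
    have hDv : ∀ i ∈ I.erase l, ∀ j, D ((if i ∈ F then G.gh i else cz E (G.ai i)) j) = 0 := by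
      intro i hi j
      have hil := Finset.ne_of_mem_erase hi
      split_ifs
      · simp only [gh, Finset.sum_apply, Pi.smul_apply, smul_eq_mul, map_sum, cz]
        refine Finset.sum_eq_zero fun a _ => ?_
        by_cases ha : a.1 = 0
        · simp [ha]
        · rw [D.leibniz, D.leibniz, hDm, hDc _ ha, Pi.single_eq_of_ne (fun h => hil (by rw [Sigma.mk.injEq] at h; exact h.1))]
          simp
      · simp [cz]
    have hDl : ∀ j, D (G.gh l j) = xm G.x (G.ai l) * (G.ai l j : E) := by
      intro j
      simp only [gh, Finset.sum_apply, Pi.smul_apply, smul_eq_mul, map_sum, cz]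
      rw [Finset.sum_eq_single ⟨G.ai l, G.hai l⟩]
      · rw [D.leibniz, D.leibniz, hDm, hDc _ (G.ai_ne l), Pi.single_eq_same]
        simp [mul_comm]
      · intro a _ hne
        by_cases ha : a.1 = 0
        · simp [ha]
        · rw [D.leibniz, D.leibniz, hDm, hDc _ ha, Pi.single_eq_of_ne (fun h => hne (by simpa using h))]
          simp
      · simp
    have h1 : ∀ j, ∑ i ∈ I.erase l, (μ i / μ l) * (if i ∈ F then G.gh i else cz E (G.ai i)) j + G.gh l j = 0 := by
      intro j
      have h2 := congrFun hμ' j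
      simp only [Pi.add_apply, Finset.sum_apply, Pi.smul_apply, smul_eq_mul, Pi.zero_apply] at h2
      have h3 : μ l * (∑ i ∈ I.erase l, (μ i / μ l) * (if i ∈ F then G.gh i else cz E (G.ai i)) j + G.gh l j) = 0 := by
        rw [mul_add, Finset.mul_sum, ← h2]
        congr 1
        refine Finset.sum_congr rfl fun i _ => ?_
        field_simp
      exact (mul_eq_zero.1 h3).resolve_left hμl
    have h2 := ih (fun i => if i = l then xm G.x (G.ai l) else D (μ i / μ l)) (by
      rw [← Finset.sum_erase_add _ _ hlI]
      ext1 j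
      have h3 := congrArg D (h1 j)
      rw [map_add, map_sum, map_zero, hDl] at h3
      simp only [if_true, if_neg hl, Pi.add_apply, Finset.sum_apply, Pi.smul_apply, smul_eq_mul, Pi.zero_apply]
      rw [← h3]
      congr 1
      refine Finset.sum_congr rfl fun i hi => ?_
      rw [if_neg (Finset.ne_of_mem_erase hi), D.leibniz, hDv i hi, smul_zero, zero_add, smul_eq_mul, mul_comm]) l hlI
    simp only [if_true] at h2
    exact xm_ne G.x0 _ h2

theorem exists_xi : ∃ ξ : ι → κ → E, ∀ l i, ∑ j, G.gh l j * ξ i j = if l = i then -1 else 0 := by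
  have h' : LinearIndependent E G.gh := by
    have := G.gh_li Finset.univ
    rw [Finset.coe_univ] at this
    exact linearIndepOn_univ.1 this
  have hinj : LinearMap.ker (Fintype.linearCombination E G.gh) = ⊥ :=
    LinearMap.ker_eq_bot.2 (linearIndependent_iff_injective_fintypeLinearCombination.1 h')
  obtain ⟨g, hg⟩ := LinearMap.exists_leftInverse_of_injective _ hinj
  refine ⟨fun i k => - g (Pi.single k 1) i, fun l i => ?_⟩
  have h1 := congrFun (LinearMap.congr_fun hg (Pi.single l 1)) i
  simp only [LinearMap.comp_apply, Fintype.linearCombination_apply_single, one_smul, LinearMap.id_apply] at h1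
  have h2 : G.gh l = ∑ k, G.gh l k • (Pi.single k 1 : κ → E) := by
    ext k; simp [Finset.sum_apply, Pi.single_apply]
  rw [h2, map_sum] at h1
  simp only [map_smul, Finset.sum_apply, Pi.smul_apply, smul_eq_mul, Pi.single_apply] at h1
  simp only [mul_neg, Finset.sum_neg_distrib, h1]
  by_cases h : l = i <;> simp [h, eq_comm]

noncomputable def xi : ι → κ → E := G.exists_xi.choose
theorem xi_spec (l i) : ∑ j, G.gh l j * G.xi i j = if l = i then -1 else 0 := G.exists_xi.choose_spec l i

/-- isolate the constant coefficient -/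
theorem der_c0 (D : Derivation ℂ E E) (i : ι) :
    D (G.c ⟨i, ⟨0, G.hA0 i⟩⟩) = - (∑ a ∈ Finset.univ.erase (⟨0, G.hA0 i⟩ : {a // a ∈ A i}),
      D (G.c ⟨i, a⟩) * xm G.x a.1) - ∑ j, G.gh i j * (D (G.x j) / G.x j) := by
  have h := G.der_rel D i
  rw [← Finset.sum_erase_add _ _ (Finset.mem_univ (⟨0, G.hA0 i⟩ : {a // a ∈ A i}))] at h
  simp only [xm_zero, mul_one] at h
  linear_combination h

theorem exists_pd (v : Sg A) : ∃ D : Derivation ℂ E E, (∀ s, D (G.c s) = if s = v then 1 else 0) ∧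
    ∀ j, D (G.x j) = xm G.x v.2.1 * G.xi v.1 j * G.x j := by
  obtain ⟨D, hx, hc⟩ := G.der (fun j => xm G.x v.2.1 * G.xi v.1 j * G.x j) (fun s => if s = v then 1 else 0)
  refine ⟨D, ?_, hx⟩
  rintro ⟨i, ⟨a, ha⟩⟩
  by_cases h0 : a = 0
  swap
  · exact hc _ h0
  subst h0
  rw [G.der_c0 D i]
  have h1 : ∀ j, D (G.x j) / G.x j = xm G.x v.2.1 * G.xi v.1 j := fun j => by
    rw [hx, mul_div_assoc, div_self (G.x0 j), mul_one]
  have h2 : ∑ j, G.gh i j * (D (G.x j) / G.x j) = xm G.x v.2.1 * (if i = v.1 then -1 else 0) := by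
    rw [← G.xi_spec, Finset.mul_sum]
    exact Finset.sum_congr rfl fun j _ => by rw [h1]; ring
  rw [h2]
  have h3 : ∑ a ∈ Finset.univ.erase (⟨0, G.hA0 i⟩ : {a // a ∈ A i}), D (G.c ⟨i, a⟩) * xm G.x a.1 =
      ∑ a ∈ Finset.univ.erase (⟨0, G.hA0 i⟩ : {a // a ∈ A i}), (if (⟨i, a⟩ : Sg A) = v then 1 else 0) * xm G.x a.1 := by
    refine Finset.sum_congr rfl fun a ha => ?_
    rw [hc _ (fun h => Finset.ne_of_mem_erase ha (Subtype.ext h))]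
  rw [h3]
  obtain ⟨i', ⟨b, hb⟩⟩ := v
  by_cases hi : i = i'
  · subst hi
    simp only [if_true, Sigma.mk.injEq, heq_eq_eq, true_and, Subtype.mk.injEq]
    by_cases hb0 : b = 0
    · subst hb0
      rw [Finset.sum_eq_zero]
      · simp [xm_zero]
      · intro a ha
        rw [if_neg (Finset.ne_of_mem_erase ha), zero_mul]
    · rw [Finset.sum_eq_single ⟨b, hb⟩]
      · simp [Ne.symm hb0]
      · intro a _ hne; rw [if_neg hne, zero_mul]
      · intro hh; exact absurd (Finset.mem_erase.2 ⟨fun h => hb0 (by simpa using h), Finset.mem_univ _⟩) hh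
  · rw [Finset.sum_eq_zero]
    · simp [hi]
    · intro a _
      rw [if_neg (fun h => hi (by rw [Sigma.mk.injEq] at h; exact h.1)), zero_mul]

noncomputable def pd (v : Sg A) : Derivation ℂ E E := (G.exists_pd v).choose
theorem pd_c (v s : Sg A) : G.pd v (G.c s) = if s = v then 1 else 0 := (G.exists_pd v).choose_spec.1 s
theorem pd_x (v : Sg A) (j) : G.pd v (G.x j) = xm G.x v.2.1 * G.xi v.1 j * G.x j := (G.exists_pd v).choose_spec.2 j

theorem pd_xm (v : Sg A) (a : κ → ℤ) :
    G.pd v (xm G.x a) = xm G.x a * xm G.x v.2.1 * ∑ j, (a j : E) * G.xi v.1 j := by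
  rw [der_xm _ G.x0, mul_assoc]
  congr 1
  rw [Finset.mul_sum]
  refine Finset.sum_congr rfl fun j _ => ?_
  rw [pd_x]; have := G.x0 j; field_simp

/-- the coefficient field -/
noncomputable def K : IntermediateField ℂ E := IntermediateField.adjoin ℂ (Set.range G.c)

theorem c_mem (s) : G.c s ∈ G.K := IntermediateField.subset_adjoin _ _ ⟨s, rfl⟩

theorem der_K_mem (D : Derivation ℂ E E) (h : ∀ s, D (G.c s) ∈ G.K) : ∀ y ∈ G.K, D y ∈ G.K := by
  intro y hy
  have hy' : y ∈ IntermediateField.adjoin ℂ (Set.range G.c) := hy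
  induction hy' using IntermediateField.adjoin_induction with
  | mem z hz => obtain ⟨s, rfl⟩ := hz; exact h s
  | algebraMap a => rw [D.map_algebraMap]; exact zero_mem _
  | add a b _ _ ha hb => rw [map_add]; exact add_mem (ha ‹_›) (hb ‹_›)
  | inv a _ ha =>
    by_cases h0 : a = 0
    · simp [h0]
    · have := der_zpow D h0 (-1)
      rw [zpow_neg_one] at this
      rw [this]
      have ha' : a ∈ G.K := ‹_›
      exact mul_mem (mul_mem (intCast_mem _ _) (inv_mem ha')) (div_mem (ha ha') ha')
  | mul a b _ _ ha hb =>
    rw [D.leibniz]; exact add_mem (mul_mem ‹_› (hb ‹_›)) (mul_mem ‹_› (ha ‹_›))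

theorem der_K_zero (D : Derivation ℂ E E) (h : ∀ s, D (G.c s) = 0) : ∀ y ∈ G.K, D y = 0 := by
  intro y hy
  have hy' : y ∈ IntermediateField.adjoin ℂ (Set.range G.c) := hy
  clear hy
  induction hy' using IntermediateField.adjoin_induction with
  | mem z hz => obtain ⟨s, rfl⟩ := hz; exact h s
  | algebraMap a => rw [D.map_algebraMap]
  | add a b _ _ ha hb => rw [map_add, ha, hb, add_zero]
  | inv a _ ha =>
    by_cases h0 : a = 0
    · simp [h0]
    · have := der_zpow D h0 (-1)
      rw [zpow_neg_one] at this
      rw [this, ha]; simp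
  | mul a b _ _ ha hb => rw [D.leibniz, ha, hb]; simp

theorem pd_K (v) : ∀ y ∈ G.K, G.pd v y ∈ G.K := G.der_K_mem _ fun s => by
  rw [pd_c]; split_ifs <;> simp

theorem lam_eq (lam : κ → ℤ) (h : IsAlgebraic G.K (xm G.x lam)) :
    cz E lam = - ∑ l, (∑ j, (lam j : E) * G.xi l j) • G.gh l := by
  have key : ∀ η : κ → E, (∀ l, ∑ j, G.gh l j * η j = 0) → ∑ j, (lam j : E) * η j = 0 := by
    intro η hη
    obtain ⟨D, hx, hc⟩ := G.der (fun j => η j * G.x j) 0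
    have hq : ∀ j, D (G.x j) / G.x j = η j := fun j => by rw [hx, mul_div_assoc, div_self (G.x0 j), mul_one]
    have hc' : ∀ s, D (G.c s) = 0 := by
      rintro ⟨i, ⟨a, ha⟩⟩
      by_cases h0 : a = 0
      · subst h0
        rw [G.der_c0]
        simp only [hq, hη, sub_zero, neg_eq_zero]
        refine Finset.sum_eq_zero fun a ha => ?_
        rw [hc _ (fun h => Finset.ne_of_mem_erase ha (Subtype.ext h))]; simp
      · exact hc _ h0
    have h1 := der_alg_zero G.K D (G.der_K_zero D hc') h
    rw [der_xm D G.x0] at h1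
    simp only [hq] at h1
    exact (mul_eq_zero.1 h1).resolve_left (xm_ne G.x0 _)
  ext1 k
  have h2 := key (fun j => (if j = k then 1 else 0) + ∑ l, G.gh l k * G.xi l j) (by
    intro l
    simp only [mul_add, Finset.sum_add_distrib, Finset.mul_sum]
    rw [Finset.sum_comm]
    have : ∀ m, ∑ j, G.gh l j * (G.gh m k * G.xi m j) = G.gh m k * (if l = m then -1 else 0) := fun m => by
      rw [← G.xi_spec, Finset.mul_sum]; exact Finset.sum_congr rfl fun j _ => by ring
    simp [this])
  simp only [mul_add, Finset.sum_add_distrib, Finset.mul_sum] at h2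
  rw [Finset.sum_comm (s := Finset.univ (α := κ))] at h2
  have h3 : ∀ l, ∑ j, (lam j : E) * (G.gh l k * G.xi l j) = (∑ j, (lam j : E) * G.xi l j) * G.gh l k := fun l => by
    rw [Finset.sum_mul]; exact Finset.sum_congr rfl fun j _ => by ring
  simp only [h3] at h2
  simp only [Pi.neg_apply, Finset.sum_apply, Pi.smul_apply, smul_eq_mul, cz]
  simp at h2
  linear_combination h2

open Classical in
/-- the indices seen by a field -/
noncomputable def IF (F : IntermediateField G.K E) : Finset ι :=
  Finset.univ.filter fun i => ∀ a ∈ A i, xm G.x a ∈ F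

theorem mem_IF {F : IntermediateField G.K E} {i : ι} : i ∈ G.IF F ↔ ∀ a ∈ A i, xm G.x a ∈ F := by
  simp [IF]

theorem lam_span (F : IntermediateField G.K E) (lam : κ → ℤ) (hF : xm G.x lam ∈ F)
    (h : IsAlgebraic G.K (xm G.x lam)) : cz E lam ∈ Submodule.span E (G.gh '' (G.IF F : Set ι)) := by
  rw [G.lam_eq lam h]
  refine Submodule.neg_mem _ (Submodule.sum_mem _ fun l _ => ?_)
  by_cases h0 : ∑ j, (lam j : E) * G.xi l j = 0
  · rw [h0, zero_smul]; exact Submodule.zero_mem _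
  refine Submodule.smul_mem _ _ (Submodule.subset_span ⟨l, ?_, rfl⟩)
  rw [Finset.mem_coe, mem_IF]
  intro a ha
  have h1 := der_alg_mem G.K (G.pd ⟨l, a, ha⟩) F (G.pd_K _) h hF
  have h2 := der_alg_mem G.K (G.pd ⟨l, 0, G.hA0 l⟩) F (G.pd_K _) h hF
  rw [pd_xm] at h1 h2
  have h3 := F.div_mem h1 h2
  simp only [xm_zero] at h3
  have := xm_ne G.x0 lam
  convert h3 using 1
  field_simp

/-- real points -/
def B (A : ι → Finset (κ → ℤ)) (i : ι) : Set (κ → ℝ) := cz ℝ '' (A i : Set (κ → ℤ))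

theorem li_card_le {K M ι ι' : Type*} [Field K] [AddCommGroup M] [Module K M] (v : ι → M) (g : ι' → M)
    (I : Finset ι) (J : Finset ι') (h : LinearIndepOn K v (I : Set ι))
    (hs : ∀ i ∈ I, v i ∈ Submodule.span K (g '' (J : Set ι'))) : I.card ≤ J.card := by
  classical
  have h1 : LinearIndependent K (fun i : I => v i) := h
  have h2 := linearIndependent_le_span_aux' _ h1 ((J.image g : Finset M) : Set M) (by
    rintro _ ⟨i, rfl⟩
    rw [Finset.coe_image]
    exact hs i i.2)
  simp only [Fintype.card_coe, Finset.coe_sort_coe] at h2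
  exact h2.trans Finset.card_image_le

theorem lam_real (F : IntermediateField G.K E) (hal : ∀ z ∈ F, IsAlgebraic G.K z) (lam : κ → ℤ)
    (hF : xm G.x lam ∈ F) :
    cz ℝ lam ∈ Submodule.span ℝ ((fun i => cz ℝ (G.ai i)) '' (G.IF F : Set ι)) := by
  haveI := charZ E
  by_contra hn
  let f : Option ι → κ → ℤ := fun o => o.elim lam G.ai
  let S : Finset (Option ι) := insert none ((G.IF F).map Function.Embedding.some)
  have hR : LinearIndepOn ℝ (fun o => cz ℝ (f o)) (S : Set (Option ι)) := by
    simp only [S, Finset.coe_insert, Finset.coe_map]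
    rw [linearIndepOn_insert (by simp)]
    refine ⟨?_, ?_⟩
    · exact LinearIndepOn.image_of_comp _ _ (G.li_ai ℝ (G.IF F))
    · rw [Set.image_image]; exact hn
  have hE := li_cz E f S (li_of_cz ℝ f S hR)
  have := li_card_le _ G.gh S (G.IF F) hE (by
    intro o ho
    rcases o with _ | i
    · exact G.lam_span F lam hF (hal _ hF)
    · have hi : i ∈ G.IF F := by simpa [S] using ho
      have := G.mem_IF.1 hi _ (G.hai i)
      exact G.lam_span F _ this (hal _ this))
  simp [S] at this

theorem B_zero (G : GP A E) (i : ι) : (0 : κ → ℝ) ∈ B A i := ⟨0, G.hA0 i, by ext; simp [cz]⟩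

theorem ai_mem_VJ (G : GP A E) {I : Finset ι} {i : ι} (hi : i ∈ I) : cz ℝ (G.ai i) ∈ VJ (B A) I :=
  Submodule.subset_span ⟨i, hi, 0, G.B_zero i, _, ⟨_, G.hai i, rfl⟩, by simp⟩

theorem VJ_eq (F : IntermediateField G.K E) (hal : ∀ z ∈ F, IsAlgebraic G.K z) :
    VJ (B A) (G.IF F) = Submodule.span ℝ ((fun i => cz ℝ (G.ai i)) '' (G.IF F : Set ι)) := by
  apply le_antisymm
  · refine Submodule.span_le.2 ?_
    rintro _ ⟨i, hi, _, ⟨a, ha, rfl⟩, _, ⟨b, hb, rfl⟩, rfl⟩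
    exact Submodule.sub_mem _ (G.lam_real F hal _ (G.mem_IF.1 hi _ hb)) (G.lam_real F hal _ (G.mem_IF.1 hi _ ha))
  · refine Submodule.span_le.2 ?_
    rintro _ ⟨i, hi, rfl⟩
    exact G.ai_mem_VJ hi

theorem finrank_VJ (F : IntermediateField G.K E) (hal : ∀ z ∈ F, IsAlgebraic G.K z) :
    finrank ℝ (VJ (B A) (G.IF F)) = (G.IF F).card := by
  rw [G.VJ_eq F hal]
  have h : LinearIndependent ℝ (fun i : G.IF F => cz ℝ (G.ai i)) := G.li_ai ℝ (G.IF F)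
  have := finrank_span_eq_card h
  rw [Fintype.card_coe] at this
  rw [← this]
  rw [Set.image_eq_range]
  rfl

theorem sat (hnc : ¬ Crit (latt κ) (B A)) (F : IntermediateField G.K E)
    (hal : ∀ z ∈ F, IsAlgebraic G.K z) (lam : κ → ℤ) (h : cz ℝ lam ∈ VJ (B A) (G.IF F)) : xm G.x lam ∈ F := by
  by_contra hn
  refine hnc (crit_of_nonsat (latt κ) (B A) (fun i => ⟨0, G.B_zero i⟩) (G.IF F) ?_ (G.finrank_VJ F hal)
    (fun i => cz ℝ (G.ai i)) ?_ (G.li_ai ℝ _) (G.VJ_eq F hal).le (cz ℝ lam) ⟨_, rfl⟩ h ?_)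
  · rintro i _ _ ⟨a, _, rfl⟩; exact ⟨a, rfl⟩
  · intro i _; exact ⟨0, G.B_zero i, _, ⟨_, G.hai i, rfl⟩, by simp⟩
  · intro hc
    have key : ∀ y ∈ AddSubgroup.closure ((fun i => cz ℝ (G.ai i)) '' (G.IF F : Set ι)),
        ∃ μ : κ → ℤ, cz ℝ μ = y ∧ xm G.x μ ∈ F := by
      intro y hy
      induction hy using AddSubgroup.closure_induction with
      | mem z hz => obtain ⟨i, hi, rfl⟩ := hz; exact ⟨_, rfl, G.mem_IF.1 hi _ (G.hai i)⟩
      | zero => exact ⟨0, by ext; simp [cz], by rw [xm_zero]; exact F.one_mem⟩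
      | add a b _ _ ha hb =>
        obtain ⟨μ, rfl, h1⟩ := ha
        obtain ⟨ν, rfl, h2⟩ := hb
        exact ⟨μ + ν, by rw [cz_add], by rw [xm_add G.x0]; exact F.mul_mem h1 h2⟩
      | neg a _ ha =>
        obtain ⟨μ, rfl, h1⟩ := ha
        exact ⟨-μ, by ext; simp [cz], by rw [xm_neg]; exact F.inv_mem h1⟩
    obtain ⟨μ, h1, h2⟩ := key _ hc
    have : μ = lam := cz_inj ℝ h1
    rw [this] at h2
    exact hn h2

end GP
end Khov

open Pointwise Module
namespace Khov

theorem lattice_proj {κ : Type} [Fintype κ] [DecidableEq κ] (N0 N1 : Submodule ℤ (κ → ℤ)) (h01 : N0 ≤ N1)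
    (h0 : ∀ (k : ℤ) x, k ≠ 0 → k • x ∈ N0 → x ∈ N0) (h1 : ∀ (k : ℤ) x, k ≠ 0 → k • x ∈ N1 → x ∈ N1) :
    ∃ (r : ℕ) (ψ : (κ → ℤ) →ₗ[ℤ] (Fin r → ℤ)) (s : (Fin r → ℤ) →ₗ[ℤ] (κ → ℤ)),
      (∀ y, ψ (s y) = y) ∧ (∀ y, s y ∈ N1) ∧ (∀ x ∈ N0, ψ x = 0) ∧ ∀ x ∈ N1, x - s (ψ x) ∈ N0 := by
  have tf : ∀ {M : Type} [AddCommGroup M] (N : Submodule ℤ M) (_ : ∀ (k : ℤ) x, k ≠ 0 → k • x ∈ N → x ∈ N),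
      IsTorsionFree ℤ (M ⧸ N) := by
    intro M _ N h
    refine ⟨fun k hk => ?_⟩
    have hk0 : k ≠ 0 := hk.ne_zero
    refine fun x y hxy => ?_
    obtain ⟨x, rfl⟩ := N.mkQ_surjective x
    obtain ⟨y, rfl⟩ := N.mkQ_surjective y
    have hxy' : N.mkQ (k • (x - y)) = 0 := by
      rw [map_smul, map_sub, smul_sub, sub_eq_zero]; exact hxy
    rw [Submodule.mkQ_apply, Submodule.Quotient.mk_eq_zero] at hxy'
    have := h k _ hk0 hxy'
    rw [← sub_eq_zero, ← map_sub, Submodule.mkQ_apply, Submodule.Quotient.mk_eq_zero]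
    exact this
  haveI := tf N1 h1
  obtain ⟨g, hg⟩ := Module.projective_lifting_property N1.mkQ LinearMap.id N1.mkQ_surjective
  have hρ : ∀ x, x - g (N1.mkQ x) ∈ N1 := fun x => by
    rw [← Submodule.Quotient.mk_eq_zero N1, ← Submodule.mkQ_apply, map_sub, sub_eq_zero]
    exact (LinearMap.congr_fun hg (N1.mkQ x)).symm
  let ρ : (κ → ℤ) →ₗ[ℤ] N1 := LinearMap.codRestrict N1 (LinearMap.id - g ∘ₗ N1.mkQ) hρ
  have hρ1 : ∀ x : N1, ρ x = x := fun x => by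
    apply Subtype.ext
    show (x : κ → ℤ) - g (N1.mkQ x) = x
    have : N1.mkQ (x : κ → ℤ) = 0 := by simp
    rw [this, map_zero, sub_zero]
  let N0' : Submodule ℤ N1 := N0.comap N1.subtype
  haveI := tf N0' (fun k x hk hx => h0 k x hk (by simpa [N0'] using hx))
  let b := Module.finBasis ℤ (N1 ⧸ N0')
  let r := finrank ℤ (N1 ⧸ N0')
  obtain ⟨s, hs⟩ := Module.projective_lifting_property N0'.mkQ LinearMap.id N0'.mkQ_surjective
  have hs' : ∀ y, N0'.mkQ (s y) = y := fun y => LinearMap.congr_fun hs y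
  refine ⟨r, b.equivFun.toLinearMap ∘ₗ N0'.mkQ ∘ₗ ρ, N1.subtype ∘ₗ s ∘ₗ b.equivFun.symm.toLinearMap, ?_, ?_, ?_, ?_⟩
  · intro y
    show b.equivFun (N0'.mkQ (ρ (s (b.equivFun.symm y)))) = y
    rw [hρ1, hs', LinearEquiv.apply_symm_apply]
  · intro y; exact (s (b.equivFun.symm y)).2
  · intro x hx
    show b.equivFun (N0'.mkQ (ρ x)) = 0
    have h2 : ρ x = ⟨x, h01 hx⟩ := hρ1 ⟨x, h01 hx⟩
    have h3 : N0'.mkQ ⟨x, h01 hx⟩ = 0 := by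
      rw [Submodule.mkQ_apply, Submodule.Quotient.mk_eq_zero]; exact hx
    rw [h2, h3, map_zero]
  · intro x hx
    show x - (s (b.equivFun.symm (b.equivFun (N0'.mkQ (ρ x)))) : κ → ℤ) ∈ N0
    have h2 : ρ x = ⟨x, hx⟩ := hρ1 ⟨x, hx⟩
    rw [LinearEquiv.symm_apply_apply, h2]
    have h3 : (⟨x, hx⟩ : N1) - s (N0'.mkQ ⟨x, hx⟩) ∈ N0' := by
      rw [← Submodule.Quotient.mk_eq_zero N0', ← Submodule.mkQ_apply, map_sub, sub_eq_zero, hs']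
    exact h3

theorem LIw_of_ev {r : ℕ} {ι Ω : Type} [DecidableEq ι] [Field Ω] (ev : GR r →+* Ω) (I : Finset ι) (hI : I.card = r)
    (T : ι → Fin 3 → Fin r → ℤ) (h : LinearIndepOn Ω (fun i k => ev (wv (T i) k)) (I : Set ι)) : LIw I T := by
  let f : Fin r ≃ I := (Fintype.equivFinOfCardEq (by rw [Fintype.card_coe, hI])).symm
  let Mt : Matrix (Fin r) (Fin r) (GR r) := Matrix.of fun a => wv (T (f a))
  have h1 : LinearIndependent Ω (fun i : I => (fun k => ev (wv (T i) k))) := h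
  have h2 : (Mt.map ev).det ≠ 0 := by
    intro h0
    obtain ⟨v, hv, hv0⟩ := Matrix.exists_vecMul_eq_zero_iff.2 h0
    have h3 := h1.comp f f.injective
    rw [Fintype.linearIndependent_iff] at h3
    refine hv (funext fun a => h3 v ?_ a)
    rw [← hv0]
    ext k
    simp [Matrix.vecMul, dotProduct, Mt]
  have h3 : Mt.det ≠ 0 := by
    intro h0; apply h2
    rw [← RingHom.mapMatrix_apply, ← RingHom.map_det, h0, map_zero]
  intro v hv i hi
  have h4 : Matrix.vecMul (fun a => v (f a)) Mt = 0 := by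
    rw [← hv, ← Finset.sum_coe_sort I, ← Equiv.sum_comp f]
    ext k
    simp [Matrix.vecMul, dotProduct, Mt]
  have h5 : (fun a => v (f a)) = 0 := by
    by_contra hne
    exact h3 (Matrix.exists_vecMul_eq_zero_iff.1 ⟨_, hne, h4⟩)
  have := congrFun h5 (f.symm ⟨i, hi⟩)
  simpa using this

theorem PJ_mono {E ι : Type*} [AddCommGroup E] [Module ℝ E] {B B' : ι → Set E} (h : ∀ i, B i ⊆ B' i)
    (J : Finset ι) : PJ B J ⊆ PJ B' J := by
  unfold PJ
  exact Set.finsetSum_subset_finsetSum J _ _ fun i _ => convexHull_mono (h i)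

theorem Good.mono {E ι : Type*} [AddCommGroup E] [Module ℝ E] [DecidableEq ι] {V : Submodule ℝ E} {Γ : AddSubgroup E}
    {B B' : ι → Set E} {I : Finset ι} (hG : Good V Γ B I) (h : ∀ i ∈ I, B i ⊆ B' i) : Good V Γ B' I := by
  obtain ⟨J, hJI, hJ, e, he, hli, W, hW, hr⟩ := hG
  refine ⟨J, hJI, hJ, e, fun i hi => ?_, hli, W, hW, fun r hrV => ?_⟩
  · obtain ⟨a, ha, b, hb, h2⟩ := he i hi
    have := h i (Finset.mem_sdiff.1 hi).1
    exact ⟨a, this ha, b, this hb, h2⟩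
  · obtain ⟨ε, hε, p, hp, s, hs⟩ := hr r hrV
    refine ⟨ε, hε, p, ?_, s, hs⟩
    unfold PJ at hp ⊢
    exact Set.finsetSum_subset_finsetSum J _ _ (fun i hi => convexHull_mono (h i (hJI hi))) hp

end Khov

open Pointwise Module
namespace Khov
namespace GP
variable {ι κ : Type} [Fintype ι] [DecidableEq ι] [Fintype κ] [DecidableEq κ] {A : ι → Finset (κ → ℤ)}
  {E : Type} [Field E] [Algebra ℂ E] (G : GP A E)

/-- exponents of monomials in a field -/
def Lat (F : IntermediateField G.K E) : Submodule ℤ (κ → ℤ) where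
  carrier := {l | xm G.x l ∈ F}
  zero_mem' := by show xm G.x 0 ∈ F; rw [xm_zero]; exact F.one_mem
  add_mem' := fun {a b} ha hb => by
    show xm G.x (a + b) ∈ F
    rw [xm_add G.x0]; exact F.mul_mem ha hb
  smul_mem' := fun k a ha => by
    show xm G.x (k • a) ∈ F
    rw [xm_zsmul]; exact zpow_mem (S := IntermediateField G.K E) ha k

theorem mem_Lat {F : IntermediateField G.K E} {l : κ → ℤ} : l ∈ G.Lat F ↔ xm G.x l ∈ F := Iff.rfl

/-- the algebraic closure of the coefficient field -/
noncomputable def M : IntermediateField G.K E := algebraicClosure G.K E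

theorem mem_M {z : E} : z ∈ G.M ↔ IsAlgebraic G.K z := mem_algebraicClosure_iff

theorem lat_F_sat (hnc : ¬ Crit (latt κ) (B A)) (F : IntermediateField G.K E)
    (hal : ∀ z ∈ F, IsAlgebraic G.K z) (k : ℤ) (l : κ → ℤ) (hk : k ≠ 0) (h : k • l ∈ G.Lat F) : l ∈ G.Lat F := by
  refine G.sat hnc F hal l ?_
  have h1 := G.lam_real F hal _ h
  rw [← G.VJ_eq F hal, cz_smul] at h1
  have h2 := Submodule.smul_mem _ ((k : ℝ)⁻¹) h1
  rwa [smul_smul, inv_mul_cancel₀ (by exact_mod_cast hk), one_smul] at h2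

theorem IF_eq (hnc : ¬ Crit (latt κ) (B A)) {Ω : Type} [Field Ω] [Algebra E Ω] (σ : G.M →+* Ω)
    (hσ : ∀ y : G.K, σ (algebraMap G.K G.M y) = algebraMap E Ω y)
    (F : IntermediateField G.K E) (hF : ∀ z, z ∈ F ↔ ∃ hz : z ∈ G.M, σ ⟨z, hz⟩ = algebraMap E Ω z) :
    G.IF F = G.IF G.M := by
  classical
  haveI := charZ E
  have hFM : F ≤ G.M := fun z hz => ((hF z).1 hz).1
  have hal : ∀ z ∈ F, IsAlgebraic G.K z := fun z hz => G.mem_M.1 (hFM hz)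
  have halM : ∀ z ∈ G.M, IsAlgebraic G.K z := fun z hz => G.mem_M.1 hz
  set I := G.IF F with hI
  set J1 := G.IF G.M with hJ1
  have hIJ : I ⊆ J1 := fun i hi => G.mem_IF.2 fun a ha => hFM (G.mem_IF.1 hi a ha)
  by_contra hne
  obtain ⟨r, ψ, s, hψs, hs1, hψ0, hN⟩ := lattice_proj (G.Lat F) (G.Lat G.M) (fun l hl => hFM hl)
    (G.lat_F_sat hnc F hal) (G.lat_F_sat hnc G.M halM)
  -- linear independence of projected gh
  have hgM : ∀ i ∈ J1, G.gh i ∈ Submodule.span E (cz E '' (G.Lat G.M : Set (κ → ℤ))) := by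
    intro i hi
    exact Submodule.sum_mem _ fun a _ => Submodule.smul_mem _ _ (Submodule.subset_span ⟨a.1, G.mem_IF.1 hi _ a.2, rfl⟩)
  have hdiff : ∀ y ∈ Submodule.span E (cz E '' (G.Lat G.M : Set (κ → ℤ))),
      y - bc E s (bc E ψ y) ∈ Submodule.span E (G.gh '' (I : Set ι)) := by
    intro y hy
    induction hy using Submodule.span_induction with
    | mem z hz =>
      obtain ⟨l, hl, rfl⟩ := hz
      rw [bc_cz, bc_cz, ← cz_sub]
      have := hN l hl
      exact G.lam_span F _ this (hal _ this)
    | zero => simp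
    | add a b _ _ ha hb => rw [map_add, map_add, add_sub_add_comm]; exact Submodule.add_mem _ ha hb
    | smul t a _ ha => rw [map_smul, map_smul, ← smul_sub]; exact Submodule.smul_mem _ _ ha
  have hliE : LinearIndepOn E (fun i => bc E ψ (G.gh i)) ((J1 \ I : Finset ι) : Set ι) := by
    rw [linearIndepOn_finset_iff]
    intro μ hμ
    have hy : ∑ i ∈ J1 \ I, μ i • G.gh i ∈ Submodule.span E (cz E '' (G.Lat G.M : Set (κ → ℤ))) :=
      Submodule.sum_mem _ fun i hi => Submodule.smul_mem _ _ (hgM i (Finset.mem_sdiff.1 hi).1)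
    have h1 := hdiff _ hy
    have h2 : bc E ψ (∑ i ∈ J1 \ I, μ i • G.gh i) = 0 := by rw [map_sum, ← hμ]; simp
    rw [h2, map_zero, sub_zero] at h1
    obtain ⟨t, ht⟩ := (mem_span_fin _ _ _).1 h1
    have h3 := linearIndepOn_finset_iff.1 (G.gh_li J1) (fun i => if i ∈ I then - t i else μ i) (by
      rw [← Finset.sum_sdiff hIJ, ← sub_eq_zero.2 ht.symm, sub_eq_add_neg, ← Finset.sum_neg_distrib]
      congr 1
      · exact Finset.sum_congr rfl fun i hi => by rw [if_neg (Finset.mem_sdiff.1 hi).2]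
      · exact Finset.sum_congr rfl fun i hi => by rw [if_pos hi, neg_smul])
    intro i hi
    have h4 := h3 i (Finset.mem_sdiff.1 hi).1
    rwa [if_neg (Finset.mem_sdiff.1 hi).2] at h4
  have hspan : ∀ (K' : Type) [Field K'] (y : Fin r → K'), y ∈ Submodule.span K'
      ((fun k : Fin r => cz K' (Pi.single k 1)) '' ((Finset.univ : Finset (Fin r)) : Set (Fin r))) := by
    intro K' _ y
    rw [mem_span_fin]
    refine ⟨y, ?_⟩
    ext k
    simp [Finset.sum_apply, cz, Pi.single_apply]
  have hcard1 : (J1 \ I).card ≤ r := by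
    have := li_card_le _ _ _ _ hliE (fun i _ => hspan E _)
    simpa using this
  have hcard2 : r ≤ (J1 \ I).card := by
    have hl : LinearIndepOn ℝ (fun k : Fin r => cz ℝ (Pi.single k 1)) ((Finset.univ : Finset (Fin r)) : Set (Fin r)) := by
      rw [linearIndepOn_finset_iff]
      intro μ hμ k _
      have := congrFun hμ k
      simpa [Finset.sum_apply, cz, Pi.single_apply] using this
    have := li_card_le _ (fun i => cz ℝ (ψ (G.ai i))) _ (J1 \ I) hl (fun k _ => by
      have h1 := G.lam_real G.M halM (s (Pi.single k 1)) (hs1 _)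
      obtain ⟨t, ht⟩ := (mem_span_fin _ _ _).1 h1
      have h2 := congrArg (bc ℝ ψ) ht
      rw [bc_cz, hψs, map_sum] at h2
      rw [← h2]
      refine Submodule.sum_mem _ fun i hi => ?_
      rw [map_smul, bc_cz]
      by_cases hiI : i ∈ I
      · rw [hψ0 _ (G.mem_IF.1 hiI _ (G.hai i)), cz_zero, smul_zero]; exact Submodule.zero_mem _
      · exact Submodule.smul_mem _ _ (Submodule.subset_span ⟨i, Finset.mem_coe.2 (Finset.mem_sdiff.2 ⟨hi, hiI⟩), rfl⟩))
    simpa using this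
  have hcard : (J1 \ I).card = r := le_antisymm hcard1 hcard2
  have hrpos : 0 < r := by
    rw [← hcard, Finset.card_pos, Finset.sdiff_nonempty]
    exact fun h => hne (hIJ.antisymm h)
  -- the character
  let m : Multiplicative (κ → ℤ) → E := fun l => xm G.x l.toAdd
  let τ : G.Lat G.M → Ω := fun l => σ ⟨xm G.x l.1, l.2⟩ / algebraMap E Ω (xm G.x l.1)
  have hxΩ : ∀ l, algebraMap E Ω (xm G.x l) ≠ 0 := fun l => by
    rw [Ne, map_eq_zero]; exact xm_ne G.x0 l
  have hτadd : ∀ a b, τ (a + b) = τ a * τ b := by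
    intro a b
    have h1 : (⟨xm G.x (a + b).1, (a + b).2⟩ : G.M) = ⟨xm G.x a.1, a.2⟩ * ⟨xm G.x b.1, b.2⟩ :=
      Subtype.ext (xm_add G.x0 _ _)
    simp only [τ]
    rw [h1, map_mul]
    have h2 : algebraMap E Ω (xm G.x (a + b).1) = algebraMap E Ω (xm G.x a.1) * algebraMap E Ω (xm G.x b.1) := by
      rw [← map_mul, ← xm_add G.x0]; rfl
    rw [h2]
    have := hxΩ a.1; have := hxΩ b.1
    field_simp
  have hτF : ∀ a, a.1 ∈ G.Lat F ↔ τ a = 1 := by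
    intro a
    rw [mem_Lat, hF]
    simp only [τ]
    rw [div_eq_one_iff_eq (hxΩ _)]
    exact ⟨fun ⟨_, h⟩ => h, fun h => ⟨a.2, h⟩⟩
  have hτ0 : τ 0 = 1 := (hτF 0).1 (Submodule.zero_mem _)
  let τ' : Multiplicative (Fin r → ℤ) →* Ω :=
    { toFun := fun y => τ ⟨s y.toAdd, hs1 _⟩
      map_one' := by
        rw [← hτ0]; congr 1; apply Subtype.ext; simp
      map_mul' := fun y z => by
        rw [← hτadd]; congr 1; apply Subtype.ext; simp }
  have hττ' : ∀ a : G.Lat G.M, τ a = τ' (Multiplicative.ofAdd (ψ a.1)) := by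
    intro a
    have h1 : a = ⟨a.1 - s (ψ a.1), hFM (hN _ a.2)⟩ + ⟨s (ψ a.1), hs1 _⟩ := by
      apply Subtype.ext; simp
    have h2 : τ ⟨a.1 - s (ψ a.1), hFM (hN _ a.2)⟩ = 1 := (hτF _).1 (hN _ a.2)
    conv_lhs => rw [h1, hτadd, h2, one_mul]
    rfl
  let ev : GR r →+* Ω := AddMonoidAlgebra.liftNCRingHom ((algebraMap E Ω).comp (algebraMap ℂ E)) τ'
    (fun _ _ => Commute.all _ _)
  have hev : ∀ g, ev (mo g) = τ' (Multiplicative.ofAdd g) := by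
    intro g
    show AddMonoidAlgebra.liftNC _ _ (AddMonoidAlgebra.single g 1) = _
    rw [AddMonoidAlgebra.liftNC_single]; simp
  have hevw : ∀ T : Fin 3 → Fin r → ℤ, (fun k => ev (wv T k)) =
      τ' (Multiplicative.ofAdd (T 0)) • cz Ω (T 1 - T 2) + τ' (Multiplicative.ofAdd (T 1)) • cz Ω (T 2 - T 0) +
      τ' (Multiplicative.ofAdd (T 2)) • cz Ω (T 0 - T 1) := by
    intro T
    ext k
    simp only [wv, Fin.sum_univ_three, Pi.add_apply, Pi.smul_apply, smul_eq_mul, map_add, map_mul, hev, cz, ed,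
      map_intCast]
    rfl
  have hliΩ := li_map E Ω (algebraMap E Ω) _ _ hliE
  -- choice of triples
  have hb : ∀ i, ∃ b, i ∈ J1 \ I → b ∈ A i ∧ b ∉ G.Lat F := by
    intro i
    by_cases hi : i ∈ J1 \ I
    · have := (Finset.mem_sdiff.1 hi).2
      rw [G.mem_IF] at this
      push Not at this
      obtain ⟨b, h1, h2⟩ := this
      exact ⟨b, fun _ => ⟨h1, h2⟩⟩
    · exact ⟨0, fun h => absurd h hi⟩
  choose b hb using hb
  obtain ⟨w, hw, hwli⟩ := exists_choice _ (fun i => Set.range fun a : {a // a ∈ A i} =>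
    (fun k => ev (wv ![0, ψ (b i), ψ a.1] k))) (J1 \ I) hliΩ (by
    intro i hi
    have hiJ : i ∈ J1 := (Finset.mem_sdiff.1 hi).1
    obtain ⟨hbA, hbF⟩ := hb i hi
    have hL : ∀ a ∈ A i, a ∈ G.Lat G.M := fun a ha => G.mem_IF.1 hiJ a ha
    have hτb : τ ⟨b i, hL _ hbA⟩ ≠ 1 := fun h => hbF ((hτF _).2 h)
    let X : {a // a ∈ A i} → Ω := fun a => algebraMap E Ω (G.c ⟨i, a⟩ * xm G.x a.1)
    have hX1 : ∑ a, X a = 0 := by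
      simp only [X]; rw [← map_sum, G.rel, map_zero]
    have hX2 : ∑ a, X a * τ ⟨a.1, hL _ a.2⟩ = 0 := by
      have h1 : ∑ a : {a // a ∈ A i}, algebraMap G.K G.M ⟨G.c ⟨i, a⟩, G.c_mem _⟩ * ⟨xm G.x a.1, hL _ a.2⟩ = 0 := by
        apply Subtype.ext
        have := G.rel i
        simp only [AddSubmonoidClass.coe_finsetSum, MulMemClass.coe_mul, ZeroMemClass.coe_zero]
        exact this
      have h2 := congrArg σ h1
      rw [map_sum, map_zero] at h2
      rw [← h2]
      refine Finset.sum_congr rfl fun a _ => ?_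
      rw [map_mul, hσ]
      simp only [X, τ, map_mul]
      have := hxΩ a.1
      field_simp
    have hgh : (fun k => algebraMap E Ω (bc E ψ (G.gh i) k)) = ∑ a, X a • cz Ω (ψ a.1) := by
      ext k
      simp only [gh, map_sum, map_smul, bc_cz, Finset.sum_apply, Pi.smul_apply, smul_eq_mul, X, cz, map_mul, map_intCast]
    have hkey : (τ ⟨b i, hL _ hbA⟩ - 1) • (∑ a, X a • cz Ω (ψ a.1)) =
        ∑ a : {a // a ∈ A i}, X a • (fun k => ev (wv ![0, ψ (b i), ψ a.1] k)) := by
      have h1 : ∀ a : {a // a ∈ A i}, (fun k => ev (wv ![0, ψ (b i), ψ a.1] k)) =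
          cz Ω (ψ (b i)) - cz Ω (ψ a.1) + τ ⟨b i, hL _ hbA⟩ • cz Ω (ψ a.1) - τ ⟨a.1, hL _ a.2⟩ • cz Ω (ψ (b i)) := by
        intro a
        rw [hevw, hττ' ⟨b i, hL _ hbA⟩, hττ' ⟨a.1, hL _ a.2⟩]
        have : τ' (Multiplicative.ofAdd 0) = 1 := τ'.map_one
        simp only [Matrix.cons_val_zero, Matrix.cons_val_one, Matrix.cons_val, this, cz_sub, cz_zero]
        module
      have h2 : ∀ a : {a // a ∈ A i}, X a • (fun k => ev (wv ![0, ψ (b i), ψ a.1] k)) =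
          X a • cz Ω (ψ (b i)) + (τ ⟨b i, hL _ hbA⟩ - 1) • (X a • cz Ω (ψ a.1)) -
            (X a * τ ⟨a.1, hL _ a.2⟩) • cz Ω (ψ (b i)) := by
        intro a; rw [h1]; module
      rw [Finset.sum_congr rfl fun a _ => h2 a, Finset.sum_sub_distrib, Finset.sum_add_distrib, ← Finset.sum_smul,
        ← Finset.sum_smul, hX1, hX2, ← Finset.smul_sum]
      simp
    rw [hgh]
    have h3 : ∑ a, X a • cz Ω (ψ a.1) = (τ ⟨b i, hL _ hbA⟩ - 1)⁻¹ •
        ∑ a : {a // a ∈ A i}, X a • (fun k => ev (wv ![0, ψ (b i), ψ a.1] k)) := by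
      rw [← hkey, smul_smul, inv_mul_cancel₀ (sub_ne_zero.2 hτb), one_smul]
    rw [h3]
    exact Submodule.smul_mem _ _ (Submodule.sum_mem _ fun a _ => Submodule.smul_mem _ _ (Submodule.subset_span ⟨a, rfl⟩)))
  have hw' : ∀ i, ∃ a, i ∈ J1 \ I → a ∈ A i ∧ w i = fun k => ev (wv ![0, ψ (b i), ψ a] k) := by
    intro i
    by_cases hi : i ∈ J1 \ I
    · obtain ⟨a, ha⟩ := hw i hi
      exact ⟨a.1, fun _ => ⟨a.2, ha.symm⟩⟩
    · exact ⟨0, fun h => absurd h hi⟩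
  choose a ha using hw'
  let T : ι → Fin 3 → Fin r → ℤ := fun i => ![0, ψ (b i), ψ (a i)]
  have hLI : LIw (J1 \ I) T := LIw_of_ev ev _ hcard T (hwli.congr fun i hi => (ha i hi).2)
  obtain ⟨q, rfl⟩ : ∃ q, r = q + 1 := ⟨r - 1, by omega⟩
  have hgood := core q (J1 \ I) hcard T hLI
  have hgood2 : Good ⊤ (latt (Fin (q + 1))) (fun i => bc ℝ ψ '' B A i) (J1 \ I) := by
    refine hgood.mono fun i hi => ?_
    rintro _ ⟨_, ⟨c, rfl⟩, rfl⟩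
    have hmem : ∃ l ∈ A i, ψ l = T i c := by
      fin_cases c
      · exact ⟨0, G.hA0 i, by simp [T]⟩
      · exact ⟨b i, (hb i hi).1, by simp [T]⟩
      · exact ⟨a i, (ha i hi).1, by simp [T]⟩
    obtain ⟨l, hl, h2⟩ := hmem
    rw [← h2]
    exact ⟨cz ℝ l, ⟨l, hl, rfl⟩, bc_cz _ _ _⟩
  have hVM := G.VJ_eq G.M halM
  let Γ : AddSubgroup (κ → ℝ) := AddSubgroup.map
    (AddMonoidHom.mk' (cz ℝ) (cz_add ℝ)) (G.Lat G.M).toAddSubgroup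
  have hΓ : ∀ W, W ∈ Γ ↔ ∃ l ∈ G.Lat G.M, cz ℝ l = W := fun W => Iff.rfl
  have hlift : Good (VJ (B A) J1) Γ (B A) J1 := by
    refine good_lift (VJ (B A) J1) Γ (B A) J1 I hIJ (bc ℝ ψ) ⊤ (latt (Fin (q + 1))) ?_ ?_ ?_ (fun _ _ => trivial)
      (fun i => cz ℝ (G.ai i)) ?_ (G.li_ai ℝ I) ?_ ?_ hgood2
    · rintro _ ⟨y, rfl⟩
      exact ⟨cz ℝ (s y), (hΓ _).2 ⟨_, hs1 y, rfl⟩, by rw [bc_cz, hψs]⟩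
    · intro W hW
      obtain ⟨l, hl, rfl⟩ := (hΓ _).1 hW
      rw [hVM]; exact G.lam_real G.M halM l hl
    · rintro i hi _ ⟨l, hl, rfl⟩
      rw [hVM]; exact G.lam_real G.M halM l (G.mem_IF.1 hi l hl)
    · intro i _; exact ⟨0, G.B_zero i, _, ⟨_, G.hai i, rfl⟩, by simp⟩
    · intro i hi; rw [bc_cz, hψ0 _ (G.mem_IF.1 hi _ (G.hai i)), cz_zero]
    · intro y hy hy0
      have : ∀ y ∈ VJ (B A) J1, y - bc ℝ s (bc ℝ ψ y) ∈ Submodule.span ℝ ((fun i => cz ℝ (G.ai i)) '' (I : Set ι)) := by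
        intro y hy
        rw [hVM] at hy
        induction hy using Submodule.span_induction with
        | mem z hz =>
          obtain ⟨i, hi, rfl⟩ := hz
          simp only [bc_cz, ← cz_sub]
          have := hN _ (G.mem_IF.1 hi _ (G.hai i))
          exact G.lam_real F hal _ this
        | zero => simp
        | add a b _ _ ha hb => rw [map_add, map_add, add_sub_add_comm]; exact Submodule.add_mem _ ha hb
        | smul t a _ ha => rw [map_smul, map_smul, ← smul_sub]; exact Submodule.smul_mem _ _ ha
      have h2 := this y hy
      rw [hy0, map_zero, sub_zero] at h2
      obtain ⟨t, ht⟩ := (mem_span_fin _ _ _).1 h2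
      exact ⟨t, ht.symm⟩
  have hcr := good_crit Γ (B A) (fun i => ⟨0, G.B_zero i⟩) J1 (by
    rintro i hi _ ⟨l, hl, rfl⟩
    exact (hΓ _).2 ⟨l, G.mem_IF.1 hi l hl, rfl⟩) (G.finrank_VJ G.M halM) hlift
  obtain ⟨J, h1, h2, W, hW, h3⟩ := hcr
  refine hnc ⟨J, h1, h2, W, ?_, h3⟩
  obtain ⟨l, _, rfl⟩ := (hΓ _).1 hW
  exact ⟨l, rfl⟩

theorem xm_unique (hnc : ¬ Crit (latt κ) (B A)) (lam : κ → ℤ) (h : IsAlgebraic G.K (xm G.x lam)) :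
    xm G.x lam ∈ G.K := by
  haveI := charZ E
  haveI : CharZero G.K := charZero_of_injective_algebraMap (algebraMap ℂ G.K).injective
  by_contra hn
  have hM : xm G.x lam ∈ G.M := G.mem_M.2 h
  let θ : G.M := ⟨xm G.x lam, hM⟩
  let Ω := AlgebraicClosure E
  have hinn : ∀ z : G.M, IsIntegral G.K z := fun z => by
    have := (G.mem_M.1 z.2).isIntegral
    exact (isIntegral_algebraMap_iff (algebraMap G.M E).injective).1 this
  have hspl : ∀ z : G.M, ((minpoly G.K z).map (algebraMap G.K Ω)).Splits := fun z => IsAlgClosed.splits _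
  have hdeg : (minpoly G.K θ).natDegree ≠ 1 := by
    intro h1
    have h2 := minpoly.natDegree_eq_one_iff.1 h1
    obtain ⟨y, hy⟩ := h2
    apply hn
    have : (y : E) = xm G.x lam := congrArg Subtype.val hy
    rw [← this]; exact y.2
  -- a different root
  have hroot : ∃ y : Ω, Polynomial.aeval y (minpoly G.K θ) = 0 ∧ y ≠ algebraMap E Ω (xm G.x lam) := by
    by_contra hall
    push Not at hall
    have hsep : (minpoly G.K θ).Separable := (minpoly.irreducible (hinn θ)).separable
    have h1 := Polynomial.card_rootSet_eq_natDegree hsep (hspl θ)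
    have h2 : (minpoly G.K θ).rootSet Ω ⊆ {algebraMap E Ω (xm G.x lam)} := by
      intro y hy
      exact hall y (Polynomial.mem_rootSet.1 hy).2
    have h3 : Fintype.card ((minpoly G.K θ).rootSet Ω) ≤ 1 := by
      rw [Fintype.card_le_one_iff_subsingleton]
      exact (Set.subsingleton_singleton.anti h2).coe_sort
    have h4 := minpoly.natDegree_pos (hinn θ)
    omega
  obtain ⟨y, hy, hyne⟩ := hroot
  obtain ⟨σ, hσ⟩ := IntermediateField.exists_algHom_of_splits_of_aeval
    (fun z => ⟨hinn z, hspl z⟩) hy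
  let F : IntermediateField G.K E :=
    { carrier := {z | ∃ hz : z ∈ G.M, σ ⟨z, hz⟩ = algebraMap E Ω z}
      mul_mem' := by
        rintro a b ⟨h1, h2⟩ ⟨h3, h4⟩
        exact ⟨G.M.mul_mem h1 h3, by
          have : (⟨a * b, G.M.mul_mem h1 h3⟩ : G.M) = ⟨a, h1⟩ * ⟨b, h3⟩ := rfl
          rw [this, map_mul, h2, h4, map_mul]⟩
      add_mem' := by
        rintro a b ⟨h1, h2⟩ ⟨h3, h4⟩
        exact ⟨G.M.add_mem h1 h3, by
          have : (⟨a + b, G.M.add_mem h1 h3⟩ : G.M) = ⟨a, h1⟩ + ⟨b, h3⟩ := rfl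
          rw [this, map_add, h2, h4, map_add]⟩
      algebraMap_mem' := fun r => ⟨G.M.algebraMap_mem r, σ.commutes r⟩
      inv_mem' := by
        rintro a ⟨h1, h2⟩
        exact ⟨G.M.inv_mem h1, by
          have : (⟨a⁻¹, G.M.inv_mem h1⟩ : G.M) = ⟨a, h1⟩⁻¹ := rfl
          rw [this, map_inv₀, h2, map_inv₀]⟩ }
  have hFm : ∀ z, z ∈ F ↔ ∃ hz : z ∈ G.M, σ ⟨z, hz⟩ = algebraMap E Ω z := fun z => Iff.rfl
  have hIF := G.IF_eq hnc σ.toRingHom (fun y => σ.commutes y) F hFm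
  have halF : ∀ z ∈ F, IsAlgebraic G.K z := fun z hz => G.mem_M.1 hz.1
  have h5 := G.lam_real G.M (fun z hz => G.mem_M.1 hz) lam hM
  rw [← hIF, ← G.VJ_eq F halF] at h5
  obtain ⟨_, h6⟩ := (hFm _).1 (G.sat hnc F halF lam h5)
  exact hyne (hσ.symm.trans h6)

end GP
end Khov

open Pointwise Module
namespace Khov

theorem pderiv_nilp {σ : Type} (i : σ) (p : MvPolynomial σ ℂ) : ∃ k, (MvPolynomial.pderiv i)^[k] p = 0 := by
  have h1 : ∀ m : ℕ, ∀ (s : σ →₀ ℕ) (a : ℂ), s i < m → (MvPolynomial.pderiv i)^[m] (MvPolynomial.monomial s a) = 0 := by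
    intro m
    induction m with
    | zero => intro s a h; omega
    | succ m ih =>
      intro s a h
      rw [Function.iterate_succ_apply, MvPolynomial.pderiv_monomial]
      by_cases h0 : s i = 0
      · have h00 : (MvPolynomial.pderiv i)^[m] (0 : MvPolynomial σ ℂ) = 0 := by
          rw [iterate_map_zero]
        simpa [h0] using h00
      · apply ih
        simp; omega
  have h2 : ∀ (k m : ℕ) (q : MvPolynomial σ ℂ), k ≤ m → (MvPolynomial.pderiv i)^[k] q = 0 → (MvPolynomial.pderiv i)^[m] q = 0 := by
    intro k m q hkm hq
    obtain ⟨d, rfl⟩ := Nat.exists_eq_add_of_le hkm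
    rw [add_comm, Function.iterate_add_apply, hq, iterate_map_zero]
  induction p using MvPolynomial.induction_on' with
  | monomial s a => exact ⟨s i + 1, h1 _ s a (by omega)⟩
  | add p q hp hq =>
    obtain ⟨k, hk⟩ := hp
    obtain ⟨l, hl⟩ := hq
    refine ⟨max k l, ?_⟩
    rw [iterate_map_add, h2 k _ p (le_max_left _ _) hk, h2 l _ q (le_max_right _ _) hl, add_zero]

/-- weight derivation in a polynomial ring -/
theorem weight_coeff {σ : Type} [Fintype σ] (w : σ → ℂ) (p : MvPolynomial σ ℂ) (m : σ →₀ ℕ) :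
    MvPolynomial.coeff m (∑ i, MvPolynomial.C (w i) * (MvPolynomial.X i * MvPolynomial.pderiv i p)) =
      (∑ i, w i * (m i : ℂ)) * MvPolynomial.coeff m p := by
  classical
  induction p using MvPolynomial.induction_on' with
  | monomial s a =>
    simp only [MvPolynomial.X_mul_pderiv_monomial, MvPolynomial.coeff_sum, MvPolynomial.coeff_C_mul,
      MvPolynomial.coeff_smul, MvPolynomial.coeff_monomial, Finset.sum_mul]
    refine Finset.sum_congr rfl fun i _ => ?_
    by_cases h : s = m
    · simp [h]; ring
    · simp [h]
  | add p q hp hq =>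
    simp only [map_add, mul_add, Finset.sum_add_distrib, MvPolynomial.coeff_add] at hp hq ⊢
    rw [hp, hq]

/-- quotient of weight vectors -/
theorem weight_quot {σ : Type} [Fintype σ] (w : σ → ℂ) (a b : MvPolynomial σ ℂ) (hb : b ≠ 0) (hab : IsRelPrime a b)
    (h : (∑ i, MvPolynomial.C (w i) * (MvPolynomial.X i * MvPolynomial.pderiv i a)) * b =
      a * ∑ i, MvPolynomial.C (w i) * (MvPolynomial.X i * MvPolynomial.pderiv i b)) :
    ∃ t : ℂ, (∀ m ∈ b.support, ∑ i, w i * (m i : ℂ) = t) ∧ ∀ m ∈ a.support, ∑ i, w i * (m i : ℂ) = t := by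
  set wb := ∑ i, MvPolynomial.C (w i) * (MvPolynomial.X i * MvPolynomial.pderiv i b) with hwb
  have h1 : b ∣ wb := by
    have : b ∣ a * wb := ⟨_, by rw [← h, mul_comm]⟩
    exact hab.symm.dvd_of_dvd_mul_left this
  obtain ⟨μ, hμ⟩ := h1
  have hμ0 : μ.totalDegree = 0 := by
    by_cases hz : μ = 0
    · simp [hz]
    have h2 : wb.totalDegree ≤ b.totalDegree := by
      refine MvPolynomial.totalDegree_le_of_support_subset fun m hm => ?_
      rw [MvPolynomial.mem_support_iff] at hm ⊢
      rw [hwb, weight_coeff] at hm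
      exact right_ne_zero_of_mul hm
    rw [hμ, MvPolynomial.totalDegree_mul_of_isDomain hb hz] at h2
    omega
  rw [MvPolynomial.totalDegree_eq_zero_iff_eq_C] at hμ0
  set t := MvPolynomial.coeff 0 μ
  refine ⟨t, fun m hm => ?_, fun m hm => ?_⟩
  · have h3 := congrArg (MvPolynomial.coeff m) hμ
    rw [hμ0, mul_comm, MvPolynomial.coeff_C_mul, hwb, weight_coeff] at h3
    exact mul_right_cancel₀ (MvPolynomial.mem_support_iff.1 hm) h3
  · rw [hμ, hμ0] at h
    have h4 : (∑ i, MvPolynomial.C (w i) * (MvPolynomial.X i * MvPolynomial.pderiv i a)) = MvPolynomial.C t * a := by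
      apply mul_right_cancel₀ hb; rw [h]; ring
    have h3 := congrArg (MvPolynomial.coeff m) h4
    rw [MvPolynomial.coeff_C_mul, weight_coeff] at h3
    exact mul_right_cancel₀ (MvPolynomial.mem_support_iff.1 hm) h3

theorem sat_dual {κ : Type} [Fintype κ] [DecidableEq κ] (N : Submodule ℤ (κ → ℤ))
    (h : ∀ (k : ℤ) x, k ≠ 0 → k • x ∈ N → x ∈ N) (l : κ → ℤ)
    (hl : ∀ ξ : κ → ℤ, (∀ a ∈ N, ∑ j, a j * ξ j = 0) → ∑ j, l j * ξ j = 0) : l ∈ N := by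
  obtain ⟨r, ψ, s, h1, h2, h3, h4⟩ := lattice_proj N ⊤ le_top h (fun _ _ _ _ => trivial)
  have hf : ∀ (k : Fin r) (a : κ → ℤ), ψ a k = ∑ j, a j * ψ (Pi.single j 1) k := by
    intro k a
    conv_lhs => rw [pi_eq_sum_univ' a]
    simp only [map_sum, map_smul, Finset.sum_apply, Pi.smul_apply, smul_eq_mul]
  have h5 : ψ l = 0 := by
    ext k
    rw [hf]
    exact hl _ fun a ha => by rw [← hf, h3 a ha]; rfl
  have := h4 l trivial
  rwa [h5, map_zero, sub_zero] at this

end Khov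

open Pointwise Module
namespace Khov

/-- nonconstant coefficients -/
abbrev Cp {ι κ : Type} (A : ι → Finset (κ → ℤ)) := {s : Sg A // s.2.1 ≠ 0}
abbrev SR {ι κ : Type} (A : ι → Finset (κ → ℤ)) := MvPolynomial (κ ⊕ Cp A) ℂ

/-- product of the torus variables -/
noncomputable def mX {ι κ : Type} [Fintype κ] (A : ι → Finset (κ → ℤ)) : SR A := ∏ j : κ, MvPolynomial.X (Sum.inl j)

theorem mX_ne {ι κ : Type} [Fintype κ] (A : ι → Finset (κ → ℤ)) : mX A ≠ 0 :=
  Finset.prod_ne_zero_iff.2 fun j _ => MvPolynomial.X_ne_zero _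

/-- Laurent elements -/
def Lau {ι κ : Type} [Fintype κ] (A : ι → Finset (κ → ℤ)) (E : Type) [Field E] [Algebra ℂ E]
    [Algebra (SR A) E] [IsScalarTower ℂ (SR A) E] : Subalgebra ℂ E where
  carrier := {z | ∃ (N : ℕ) (p : SR A), algebraMap (SR A) E (mX A) ^ N * z = algebraMap (SR A) E p}
  mul_mem' := by
    rintro a b ⟨N, p, h⟩ ⟨N', p', h'⟩
    exact ⟨N + N', p * p', by rw [map_mul, ← h, ← h', pow_add]; ring⟩
  add_mem' := by
    rintro a b ⟨N, p, h⟩ ⟨N', p', h'⟩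
    exact ⟨N + N', mX A ^ N' * p + mX A ^ N * p', by
      rw [map_add, map_mul, map_mul, ← h, ← h', map_pow, map_pow, pow_add]; ring⟩
  algebraMap_mem' := fun r => ⟨0, MvPolynomial.C r, by
    rw [pow_zero, one_mul, IsScalarTower.algebraMap_apply ℂ (SR A) E]; rfl⟩

namespace GP
variable {ι κ : Type} [Fintype ι] [DecidableEq ι] [Fintype κ] [DecidableEq κ] {A : ι → Finset (κ → ℤ)}
  {E : Type} [Field E] [Algebra ℂ E] (G : GP A E)

variable [Algebra (SR A) E] [IsScalarTower ℂ (SR A) E]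

/-- the generic point is the standard one -/
structure Std : Prop where
  hx : ∀ j, G.x j = algebraMap (SR A) E (MvPolynomial.X (Sum.inl j))
  hc : ∀ s : Cp A, G.c s.1 = algebraMap (SR A) E (MvPolynomial.X (Sum.inr s))

variable {G} (H : G.Std)

theorem Std.map_mX (H : G.Std) : algebraMap (SR A) E (mX A) = ∏ j, G.x j := by
  rw [mX, map_prod]; exact Finset.prod_congr rfl fun j _ => (H.hx j).symm

theorem Std.mX_ne (H : G.Std) : algebraMap (SR A) E (mX A) ≠ 0 := by
  rw [H.map_mX]; exact Finset.prod_ne_zero_iff.2 fun j _ => G.x0 j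

theorem Std.lau_alg (p : SR A) : algebraMap (SR A) E p ∈ Lau A E := ⟨0, p, by simp⟩

theorem Std.lau_x (H : G.Std) (j) : G.x j ∈ Lau A E := by rw [H.hx]; exact Std.lau_alg _

theorem Std.lau_xinv (H : G.Std) (j) : (G.x j)⁻¹ ∈ Lau A E := by
  refine ⟨1, ∏ i ∈ Finset.univ.erase j, MvPolynomial.X (Sum.inl i), ?_⟩
  rw [pow_one, H.map_mX, map_prod, ← Finset.mul_prod_erase _ _ (Finset.mem_univ j), mul_comm, ← mul_assoc,
    inv_mul_cancel₀ (G.x0 j), one_mul]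
  exact Finset.prod_congr rfl fun j _ => (H.hx j)

theorem Std.lau_xm (H : G.Std) (a : κ → ℤ) : xm G.x a ∈ Lau A E := by
  refine Subalgebra.prod_mem _ fun j _ => ?_
  rcases Int.eq_nat_or_neg (a j) with ⟨n, h | h⟩
  · rw [h, zpow_natCast]; exact pow_mem (H.lau_x j) n
  · rw [h, zpow_neg, zpow_natCast, ← inv_pow]; exact pow_mem (H.lau_xinv j) n

theorem c0_eq (G : GP A E) (i : ι) : G.c ⟨i, ⟨0, G.hA0 i⟩⟩ =
    - ∑ a ∈ Finset.univ.erase (⟨0, G.hA0 i⟩ : {a // a ∈ A i}), G.c ⟨i, a⟩ * xm G.x a.1 := by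
  have h := G.rel i
  rw [← Finset.sum_erase_add _ _ (Finset.mem_univ (⟨0, G.hA0 i⟩ : {a // a ∈ A i}))] at h
  simp only [xm_zero, mul_one] at h
  linear_combination h

theorem Std.lau_c (H : G.Std) (s) : G.c s ∈ Lau A E := by
  have h1 : ∀ s : Sg A, s.2.1 ≠ 0 → G.c s ∈ Lau A E := fun s h => by
    rw [H.hc ⟨s, h⟩]; exact Std.lau_alg _
  obtain ⟨i, ⟨a, ha⟩⟩ := s
  by_cases h : a = 0
  · subst h
    have := G.c0_eq i
    rw [this]
    refine neg_mem (Subalgebra.sum_mem _ fun b hb => mul_mem (h1 _ ?_) (H.lau_xm _))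
    intro h0; exact (Finset.mem_erase.1 hb).1 (Subtype.ext h0)
  · exact h1 _ h

theorem Std.adjoin_le (H : G.Std) : Algebra.adjoin ℂ (Set.range G.c) ≤ Lau A E :=
  Algebra.adjoin_le (by rintro _ ⟨s, rfl⟩; exact H.lau_c s)

theorem Std.lau_int [IsFractionRing (SR A) E] (H : G.Std) (z : E) (hz : IsIntegral (Lau A E) z) : z ∈ Lau A E := by
  obtain ⟨P, hP, hz⟩ := hz
  -- clear denominators
  have h1 : ∀ n : ℕ, ∃ N : ℕ, ∀ i < n, ∃ p : SR A, algebraMap (SR A) E (mX A) ^ N * (P.coeff i).1 = algebraMap (SR A) E p := by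
    intro n
    induction n with
    | zero => exact ⟨0, by simp⟩
    | succ n ih =>
      obtain ⟨N, hN⟩ := ih
      obtain ⟨N', p', hp'⟩ := (P.coeff n).2
      refine ⟨N + N', fun i hi => ?_⟩
      rcases Nat.lt_succ_iff_lt_or_eq.1 hi with hi | rfl
      · obtain ⟨p, hp⟩ := hN i hi
        exact ⟨mX A ^ N' * p, by rw [map_mul, ← hp, map_pow, pow_add]; ring⟩
      · exact ⟨mX A ^ N * p', by rw [map_mul, ← hp', map_pow, pow_add]; ring⟩
  obtain ⟨N, hN⟩ := h1 P.natDegree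
  set s : E := algebraMap (SR A) E (mX A) ^ N with hs
  let Q : Polynomial E := P.map (algebraMap (Lau A E) E)
  have hQm : Q.Monic := hP.map _
  have hQd : Q.natDegree = P.natDegree := hP.natDegree_map _
  have hQz : Polynomial.aeval z Q = 0 := by
    rw [Polynomial.aeval_map_algebraMap]; exact hz
  have h2 := Polynomial.scaleRoots_aeval_eq_zero (r := s) (a := z) (p := Q) hQz
  have hsm : (Q.scaleRoots s).Monic := (Polynomial.monic_scaleRoots_iff s).2 hQm
  have hl : Q.scaleRoots s ∈ Polynomial.lifts (algebraMap (SR A) E) := by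
    rw [Polynomial.lifts_iff_coeff_lifts]
    intro i
    rw [Polynomial.coeff_scaleRoots, hQd]
    rcases lt_trichotomy i P.natDegree with h | h | h
    · obtain ⟨p, hp⟩ := hN i h
      refine ⟨p * (mX A ^ N) ^ (P.natDegree - i - 1), ?_⟩
      rw [map_mul, ← hp, map_pow, map_pow, ← hs, Polynomial.coeff_map]
      have : P.natDegree - i = (P.natDegree - i - 1) + 1 := by omega
      rw [this, pow_succ]
      simp only [Nat.add_sub_cancel]
      show s * (P.coeff i).1 * _ = (P.coeff i).1 * _
      ring
    · refine ⟨1, ?_⟩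
      rw [h, Nat.sub_self, pow_zero, mul_one, map_one, ← hQd]; exact hQm.symm
    · refine ⟨0, ?_⟩
      rw [Polynomial.coeff_eq_zero_of_natDegree_lt (by rw [hQd]; exact h), zero_mul, map_zero]
  obtain ⟨q, hq1, hq2, hq3⟩ := Polynomial.lifts_and_natDegree_eq_and_monic hl hsm
  have hinn : IsIntegral (SR A) (s * z) := by
    refine ⟨q, hq3, ?_⟩
    rw [← Polynomial.aeval_def, ← Polynomial.aeval_map_algebraMap E, hq1]
    simpa using h2
  obtain ⟨p, hp⟩ := IsIntegrallyClosed.isIntegral_iff.1 hinn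
  exact ⟨N, p, hp.symm⟩

open scoped IntermediateField.algebraAdjoinAdjoin in
theorem Std.exists_mul_lau [IsFractionRing (SR A) E] (H : G.Std) (z : E) (hz : IsAlgebraic G.K z) :
    ∃ q ∈ G.K, q ≠ 0 ∧ q * z ∈ Lau A E := by
  let Rc := Algebra.adjoin ℂ (Set.range G.c)
  have h1 : IsAlgebraic Rc z := by
    have : IsAlgebraic (IntermediateField.adjoin ℂ (Set.range G.c)) z := hz
    exact (IsFractionRing.isAlgebraic_iff Rc (IntermediateField.adjoin ℂ (Set.range G.c)) E).2 this
  obtain ⟨q, hq, hqi⟩ := h1.exists_integral_multiple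
  refine ⟨q.1, ?_, fun h => hq (Subtype.ext h), ?_⟩
  · exact IntermediateField.algebra_adjoin_le_adjoin _ _ q.2
  · apply H.lau_int
    have : IsIntegral Rc (q.1 * z) := hqi
    obtain ⟨P, hP, h0⟩ := this
    exact ⟨P.map (Subalgebra.inclusion H.adjoin_le).toRingHom, hP.map _, by
      rw [Polynomial.eval₂_map]; exact h0⟩

end GP
end Khov

open Pointwise Module
namespace Khov
namespace GP
variable {ι κ : Type} [Fintype ι] [DecidableEq ι] [Fintype κ] [DecidableEq κ] {A : ι → Finset (κ → ℤ)}
  {E : Type} [Field E] [Algebra ℂ E] (G : GP A E)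

theorem der_eq_zero_M (D : Derivation ℂ E E) (h : ∀ s, D (G.c s) = 0) {z : E} (hz : z ∈ G.M) : D z = 0 :=
  der_alg_zero G.K D (G.der_K_zero D h) (G.mem_M.1 hz)

theorem pd_M (v) {z : E} (hz : z ∈ G.M) : G.pd v z ∈ G.M :=
  der_alg_mem G.K _ _ (G.pd_K v) (G.mem_M.1 hz) hz

theorem der_c_zero (D : Derivation ℂ E E) (hx : ∀ j, D (G.x j) = 0) (hc : ∀ s : Sg A, s.2.1 ≠ 0 → D (G.c s) = 0)
    (s : Sg A) : D (G.c s) = 0 := by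
  obtain ⟨i, ⟨a, ha⟩⟩ := s
  by_cases h : a = 0
  · subst h
    have := G.der_c0 D i
    rw [this]
    simp only [hx, zero_div, mul_zero, Finset.sum_const_zero, sub_zero, neg_eq_zero]
    refine Finset.sum_eq_zero fun b hb => ?_
    rw [hc _ (fun h0 => (Finset.mem_erase.1 hb).1 (Subtype.ext h0)), zero_mul]
  · exact hc _ h

/-- the constant slot -/
abbrev v0 (i : ι) : Sg A := ⟨i, ⟨0, G.hA0 i⟩⟩

theorem trans_M {φ : E} (hφ : φ ∉ G.M) : Transcendental G.M φ := by
  intro h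
  haveI : Algebra.IsAlgebraic G.K G.M := ⟨fun z => by
    have := G.mem_M.1 z.2
    exact (isAlgebraic_algebraMap_iff (algebraMap G.M E).injective).1 this⟩
  exact hφ (G.mem_M.2 (h.restrictScalars G.K))

variable [Algebra (SR A) E] [IsScalarTower ℂ (SR A) E]
variable {G}

theorem Std.der_alg (D : Derivation ℂ E E) (w : κ ⊕ Cp A → ℂ) (u : κ ⊕ Cp A → SR A)
    (h : ∀ s, D (algebraMap (SR A) E (MvPolynomial.X s)) = algebraMap (SR A) E (u s)) (p : SR A) :
    D (algebraMap (SR A) E p) = algebraMap (SR A) E (∑ s : κ ⊕ Cp A, u s * MvPolynomial.pderiv s p) := by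
  induction p using MvPolynomial.induction_on with
  | C r =>
    have : algebraMap (SR A) E (MvPolynomial.C r) = algebraMap ℂ E r := by
      rw [IsScalarTower.algebraMap_apply ℂ (SR A) E]; rfl
    rw [this, D.map_algebraMap]
    simp
  | add p q hp hq => simp only [map_add, hp, hq, mul_add, Finset.sum_add_distrib]
  | mul_X p s hp =>
    rw [map_mul, D.leibniz, hp, h]
    simp only [smul_eq_mul, Derivation.leibniz, mul_add, Finset.sum_add_distrib, map_add]
    congr 1
    · rw [← map_mul]
      congr 1
      rw [Finset.sum_eq_single s]
      · rw [MvPolynomial.pderiv_X_self]; ring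
      · intro t _ ht; rw [MvPolynomial.pderiv_X_of_ne ht.symm]; ring
      · simp
    · rw [← map_mul]
      congr 1
      rw [Finset.mul_sum]
      exact Finset.sum_congr rfl fun t _ => by ring

theorem Std.nilp [IsFractionRing (SR A) E] (H : G.Std) (i : ι) (hi : i ∉ G.IF G.M) (θ : E) (hθ : θ ∈ G.M) (hl : θ ∈ Lau A E) :
    ∃ k, (G.pd (G.v0 i))^[k] θ = 0 := by
  classical
  rw [mem_IF] at hi
  push Not at hi
  obtain ⟨β, hβ, hβM⟩ := hi
  have hβ0 : β ≠ 0 := by rintro rfl; exact hβM (by rw [xm_zero]; exact one_mem _)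
  set φ := xm G.x β with hφ
  let sβ : Sg A := ⟨i, ⟨β, hβ⟩⟩
  obtain ⟨D, hDx, hDc⟩ := G.der 0 (fun s => if s = sβ then 1 else 0)
  have hDx : ∀ j, D (G.x j) = 0 := hDx
  have hDm : ∀ a, D (xm G.x a) = 0 := fun a => by
    rw [der_xm D G.x0]; simp [hDx]
  -- nilpotent
  have hn : ∃ k, D^[k] θ = 0 := by
    obtain ⟨N, p, hp⟩ := hl
    have e1 : algebraMap (SR A) E (mX A) ^ N = xm G.x (fun _ => (N : ℤ)) := by
      rw [H.map_mX]; simp [xm, Finset.prod_pow]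
    have e2 : ∀ p : SR A, D (algebraMap (SR A) E p) = algebraMap (SR A) E (MvPolynomial.pderiv (Sum.inr ⟨sβ, hβ0⟩) p) := by
      intro p
      rw [Std.der_alg D 0 (fun s => if s = Sum.inr ⟨sβ, hβ0⟩ then 1 else 0)]
      · simp
      · rintro (j | s)
        · rw [← H.hx, hDx]; simp
        · rw [← H.hc, hDc _ s.2]
          by_cases h : s.1 = sβ
          · have : s = ⟨sβ, hβ0⟩ := Subtype.ext h
            simp [this]
          · have : s ≠ ⟨sβ, hβ0⟩ := fun h' => h (by rw [h'])
            simp [h, this]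
    have e3 : ∀ k, algebraMap (SR A) E (mX A) ^ N * D^[k] θ =
        algebraMap (SR A) E ((MvPolynomial.pderiv (Sum.inr ⟨sβ, hβ0⟩))^[k] p) := by
      intro k
      induction k with
      | zero => exact hp
      | succ k ih =>
        rw [Function.iterate_succ_apply', Function.iterate_succ_apply', ← e2, ← ih, D.leibniz, e1, hDm]
        simp
    obtain ⟨k, hk⟩ := pderiv_nilp (Sum.inr ⟨sβ, hβ0⟩) p
    refine ⟨k, ?_⟩
    have := e3 k
    rw [hk, map_zero] at this
    exact (mul_eq_zero.1 this).resolve_left (pow_ne_zero _ H.mX_ne)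
  have hD : ∀ z ∈ G.M, D z = G.pd sβ z - φ * G.pd (G.v0 i) z := by
    intro z hz
    have := G.der_eq_zero_M (D - G.pd sβ + φ • G.pd (G.v0 i)) (G.der_c_zero _ ?_ ?_) hz
    · simp only [Derivation.add_apply, Derivation.sub_apply, Derivation.smul_apply, smul_eq_mul] at this
      linear_combination this
    · intro j
      simp only [Derivation.add_apply, Derivation.sub_apply, Derivation.smul_apply, smul_eq_mul, hDx, pd_x, xm_zero, sβ]
      rw [← hφ]; ring
    · intro s hs
      have h2 : s ≠ G.v0 i := by rintro rfl; exact hs rfl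
      simp only [Derivation.add_apply, Derivation.sub_apply, Derivation.smul_apply, smul_eq_mul, pd_c, hDc s hs, if_neg h2]
      ring
  -- expansion
  have hexp : ∀ k, ∃ m : ℕ → E, (∀ j, m j ∈ G.M) ∧ (∀ j, k < j → m j = 0) ∧ m k = (-1) ^ k * (G.pd (G.v0 i))^[k] θ ∧
      D^[k] θ = ∑ j ∈ Finset.range (k + 1), φ ^ j * m j := by
    intro k
    induction k with
    | zero =>
      refine ⟨fun j => if j = 0 then θ else 0, fun j => ?_, fun j hj => by simp; omega, by simp, by simp⟩
      dsimp only; split_ifs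
      · exact hθ
      · exact zero_mem _
    | succ k ih =>
      obtain ⟨m, h1, h2, h3, h4⟩ := ih
      refine ⟨fun j => G.pd sβ (m j) - (if j = 0 then 0 else G.pd (G.v0 i) (m (j - 1))), fun j => ?_, fun j hj => ?_, ?_, ?_⟩
      · dsimp only; split_ifs
        · exact sub_mem (G.pd_M _ (h1 _)) (zero_mem _)
        · exact sub_mem (G.pd_M _ (h1 _)) (G.pd_M _ (h1 _))
      · dsimp only
        rw [h2 j (by omega), h2 (j - 1) (by omega)]; simp
      · dsimp only
        rw [h2 (k + 1) (by omega), if_neg (by omega), Nat.add_sub_cancel, h3, Function.iterate_succ_apply', Derivation.leibniz]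
        have : G.pd (G.v0 i) ((-1) ^ k) = 0 := by
          have := (G.pd (G.v0 i)).map_algebraMap ((-1) ^ k)
          simpa using this
        rw [this, map_zero]; simp only [smul_eq_mul]; ring
      · rw [Function.iterate_succ_apply', h4, map_sum]
        have e : ∀ j ∈ Finset.range (k + 1), D (φ ^ j * m j) = φ ^ j * G.pd sβ (m j) - φ ^ (j + 1) * G.pd (G.v0 i) (m j) := by
          intro j _
          rw [D.leibniz, D.leibniz_pow, hφ, hDm, ← hφ, hD _ (h1 j)]
          simp only [smul_eq_mul, mul_zero, smul_zero]; ring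
        rw [Finset.sum_congr rfl e, Finset.sum_sub_distrib]
        simp only [mul_sub, Finset.sum_sub_distrib]
        congr 1
        · rw [Finset.sum_range_succ _ (k + 1), h2 (k + 1) (by omega)]; simp
        · rw [Finset.sum_range_succ' _ (k + 1)]; simp
  obtain ⟨k, hk⟩ := hn
  obtain ⟨m, h1, h2, h3, h4⟩ := hexp k
  refine ⟨k, ?_⟩
  have ht := G.trans_M hβM
  rw [transcendental_iff] at ht
  have h5 := ht (∑ j ∈ Finset.range (k + 1), Polynomial.monomial j (⟨m j, h1 j⟩ : G.M)) (by
    rw [map_sum, ← hk, h4]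
    refine Finset.sum_congr rfl fun j _ => ?_
    rw [Polynomial.aeval_monomial, mul_comm]; rfl)
  have h6 := congrArg (fun q => (q.coeff k : G.M)) h5
  simp only [Polynomial.finset_sum_coeff, Polynomial.coeff_monomial, Finset.sum_ite_eq', Finset.mem_range, Polynomial.coeff_zero] at h6
  rw [if_pos (by omega)] at h6
  have h7 : m k = 0 := congrArg Subtype.val h6
  rw [h3] at h7
  exact (mul_eq_zero.1 h7).resolve_left (pow_ne_zero _ (by simp))

end GP
end Khov

open Pointwise Module
namespace Khov
namespace GP
variable {ι κ : Type} [Fintype ι] [DecidableEq ι] [Fintype κ] [DecidableEq κ] {A : ι → Finset (κ → ℤ)}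
  {E : Type} [Field E] [Algebra ℂ E] (G : GP A E)

/-- partial derivative on the algebraic closure -/
noncomputable def pdM (v : Sg A) : AddMonoid.End G.M :=
  AddMonoidHom.mk' (fun z => ⟨G.pd v z.1, G.pd_M v z.2⟩) fun a b => Subtype.ext (map_add (G.pd v) a.1 b.1)

theorem pdM_mul (v) (a b : G.M) : G.pdM v (a * b) = a * G.pdM v b + b * G.pdM v a :=
  Subtype.ext ((G.pd v).leibniz a.1 b.1)

theorem pdM_coe (v) (k : ℕ) (a : G.M) : ((G.pdM v ^ k) a).1 = (G.pd v)^[k] a.1 := by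
  induction k with
  | zero => rfl
  | succ k ih => rw [pow_succ', Function.iterate_succ_apply', ← ih]; rfl

theorem pdM_comm (v w) : Commute (G.pdM v) (G.pdM w) := by
  ext a
  have h := G.der_eq_zero_M ⁅G.pd v, G.pd w⁆ (fun s => ?_) a.2
  · rw [Derivation.commutator_apply, sub_eq_zero] at h
    exact h
  · rw [Derivation.commutator_apply, pd_c, pd_c]
    have h1 : ∀ (u : Sg A) (P : Prop) [Decidable P], G.pd u (if P then 1 else 0) = 0 := by
      intro u P _; split_ifs <;> simp
    rw [h1, h1, sub_zero]

theorem pdM_pow_mul (v) (k : ℕ) (a b : G.M) (h : G.pdM v a = 0) : (G.pdM v ^ k) (a * b) = a * (G.pdM v ^ k) b := by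
  induction k with
  | zero => rfl
  | succ k ih =>
    have e : ∀ z, (G.pdM v ^ (k + 1)) z = G.pdM v ((G.pdM v ^ k) z) := fun z => by rw [pow_succ']; rfl
    rw [e, e, ih, pdM_mul, h, mul_zero, add_zero]

theorem nilp_ind (hbase : ∀ θ ∈ G.M, (∀ i ∉ G.IF G.M, G.pd (G.v0 i) θ = 0) → θ ∈ G.K) (U : Finset ι) :
    ∀ θ : G.M, (∀ i ∈ U, ∃ k, (G.pdM (G.v0 i) ^ k) θ = 0) → (∀ i ∉ G.IF G.M, i ∉ U → G.pdM (G.v0 i) θ = 0) → θ.1 ∈ G.K := by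
  induction U using Finset.induction_on with
  | empty =>
    intro θ _ h
    exact hbase _ θ.2 fun i hi => congrArg Subtype.val (h i hi (by simp))
  | insert i U hi ih =>
    intro θ h1 h2
    obtain ⟨r, hr⟩ := h1 i (by simp)
    have h1 : ∀ l ∈ U, ∃ k, (G.pdM (G.v0 l) ^ k) θ = 0 := fun l hl => h1 l (by simp [hl])
    clear * - hr h1 h2 ih hi
    induction r generalizing θ with
    | zero =>
      have : θ = 0 := hr
      rw [this]; exact zero_mem _
    | succ r ihr =>
      haveI := charZ E
      set η := (G.pdM (G.v0 i) ^ r) θ with hη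
      have e : ∀ v w (k l : ℕ) z, (G.pdM v ^ k) ((G.pdM w ^ l) z) = (G.pdM w ^ l) ((G.pdM v ^ k) z) := fun v w k l z => by
        have := ((G.pdM_comm v w).pow_pow k l)
        exact congrArg (fun f : AddMonoid.End G.M => f z) this
      have e1 : ∀ w l z, G.pdM w ((G.pdM l ^ r) z) = (G.pdM l ^ r) (G.pdM w z) := fun w l z => by
        have := e w l 1 r z
        simpa using this
      have hηi : G.pdM (G.v0 i) η = 0 := by
        rw [pow_succ'] at hr; exact hr
      have hηK : η.1 ∈ G.K := by
        refine ih η ?_ ?_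
        · intro l hl
          obtain ⟨k, hk⟩ := h1 l hl
          exact ⟨k, by rw [hη, e, hk, map_zero]⟩
        · intro l hl hlU
          by_cases h : l = i
          · rw [h]; exact hηi
          · rw [hη, e1, h2 l hl (by simp [h, hlU]), map_zero]
      let c : G.M := ⟨G.c (G.v0 i), G.M.algebraMap_mem ⟨_, G.c_mem (G.v0 i)⟩⟩
      have hc : ∀ l, G.pdM (G.v0 l) c = if i = l then 1 else 0 := by
        intro l
        refine Subtype.ext ?_
        show G.pd (G.v0 l) (G.c (G.v0 i)) = _
        rw [pd_c]
        by_cases h : i = l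
        · subst h; simp
        · have : G.v0 i ≠ G.v0 l := fun h' => h (congrArg Sigma.fst h')
          simp [h, this]
      have hq : ∀ v, G.pdM v ((r.factorial : G.M)⁻¹) = 0 := by
        intro v
        refine Subtype.ext ?_
        have := (G.pd v).map_algebraMap ((r.factorial : ℂ)⁻¹)
        rw [map_inv₀, map_natCast] at this
        show G.pd v ((r.factorial : E)⁻¹) = 0
        exact this
      have hcp : ∀ v (n : ℕ), G.pdM v (c ^ n) = n * c ^ (n - 1) * G.pdM v c := by
        intro v n
        induction n with
        | zero =>
          rw [pow_zero]
          refine Subtype.ext ?_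
          show G.pd v 1 = _
          simp
        | succ n ih =>
          rw [pow_succ, pdM_mul, ih]
          rcases n with _ | n
          · simp
          · simp only [Nat.add_sub_cancel, Nat.cast_add, Nat.cast_one]; ring
      have hfac : ∀ n, (G.pdM (G.v0 i) ^ n) (c ^ n * η) = (n.factorial : G.M) * η := by
        intro n
        induction n with
        | zero => simp
        | succ n ih =>
          have : G.pdM (G.v0 i) (c ^ (n + 1) * η) = (n + 1) • (c ^ n * η) := by
            rw [pdM_mul, hηi, hcp, hc, if_pos rfl]
            simp; ring
          rw [pow_succ]
          show (G.pdM (G.v0 i) ^ n) (G.pdM (G.v0 i) (c ^ (n + 1) * η)) = _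
          rw [this, map_nsmul, ih, Nat.factorial_succ]
          push_cast; rw [nsmul_eq_mul]; push_cast; ring
      set θ' := θ - (r.factorial : G.M)⁻¹ * (c ^ r * η) with hθ'
      have hcl : ∀ l, l ≠ i → G.pdM (G.v0 l) (c ^ r) = 0 := fun l hl => by
        rw [hcp, hc, if_neg (Ne.symm hl), mul_zero]
      have hK : θ'.1 ∈ G.K := by
        refine ihr θ' ?_ ?_ ?_
        · intro l hl hlU
          have hli : l ≠ i := by rintro rfl; exact hlU (by simp)
          rw [hθ', map_sub, h2 l hl hlU, pdM_mul, hq, pdM_mul, hcl l hli, hη, e1, h2 l hl hlU, map_zero]; simp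
        · rw [hθ', map_sub, pdM_pow_mul _ _ _ _ _ (hq _), hfac, ← hη, ← mul_assoc, inv_mul_cancel₀, one_mul, sub_self]
          intro h0
          have h0' : (r.factorial : E) = 0 := congrArg Subtype.val h0
          exact (Nat.cast_ne_zero.2 r.factorial_ne_zero) h0'
        · intro l hl
          have hli : l ≠ i := by rintro rfl; exact hi hl
          obtain ⟨k, hk⟩ := h1 l hl
          refine ⟨k, ?_⟩
          rw [hθ', map_sub, hk, pdM_pow_mul _ _ _ _ _ (hq _), pdM_pow_mul _ _ _ _ _ (hcl l hli), hη, e, hk, map_zero]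
          simp
      have : θ.1 = θ'.1 + (r.factorial : E)⁻¹ * (G.c (G.v0 i) ^ r * η.1) := by
        have : θ = θ' + (r.factorial : G.M)⁻¹ * (c ^ r * η) := by rw [hθ']; ring
        exact congrArg Subtype.val this
      rw [this]
      exact add_mem hK (mul_mem (inv_mem (natCast_mem _ _)) (mul_mem (pow_mem (G.c_mem _) _) hηK))

variable [Algebra (SR A) E] [IsScalarTower ℂ (SR A) E]
variable {G}

theorem Std.xc_mem (H : G.Std) (a : SR A) (m0 : κ → ℤ) (h : ∀ m ∈ a.support, xm G.x ((fun j => (m (Sum.inl j) : ℤ)) - m0) ∈ G.K) :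
    algebraMap (SR A) E a / xm G.x m0 ∈ G.K := by
  rw [← MvPolynomial.support_sum_monomial_coeff a, map_sum, Finset.sum_div]
  refine sum_mem fun m hm => ?_
  have h1 := h m hm
  rw [xm_sub G.x0] at h1
  rw [MvPolynomial.monomial_eq, map_mul, Finsupp.prod_fintype _ _ (by simp), Fintype.prod_sum_type, map_mul, map_prod, map_prod]
  simp only [map_pow, ← H.hx, ← H.hc]
  have e : ∏ j, G.x j ^ (m (Sum.inl j)) = xm G.x (fun j => (m (Sum.inl j) : ℤ)) := by simp [xm]
  rw [e]
  have e2 : algebraMap (SR A) E (MvPolynomial.C (a.coeff m)) = algebraMap ℂ E (a.coeff m) := by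
    rw [IsScalarTower.algebraMap_apply ℂ (SR A) E]; rfl
  rw [e2]
  have e3 : ∀ p q r s : E, p * (q * r) / s = p * r * (q / s) := fun p q r s => by ring
  rw [e3]
  exact mul_mem (mul_mem (G.K.algebraMap_mem _) (prod_mem fun s _ => pow_mem (G.c_mem _) _)) h1

theorem Std.base [IsFractionRing (SR A) E] (H : G.Std) (hnc : ¬ Crit (latt κ) (B A)) (θ : E) (hθ : θ ∈ G.M)
    (h0 : ∀ i ∉ G.IF G.M, G.pd (G.v0 i) θ = 0) : θ ∈ G.K := by
  classical
  haveI := charZ E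
  obtain ⟨a, b, hab, hq⟩ := IsFractionRing.exists_reduced_fraction (A := SR A) (K := E) θ
  have hb : (b : SR A) ≠ 0 := nonZeroDivisors.ne_zero b.2
  have hinj : Function.Injective (algebraMap (SR A) E) := IsFractionRing.injective _ _
  have hbE : algebraMap (SR A) E b ≠ 0 := fun h => hb (hinj (by rw [h, map_zero]))
  have hθe : θ * algebraMap (SR A) E b = algebraMap (SR A) E a := by
    rw [← hq]; exact IsLocalization.mk'_spec E a b
  obtain ⟨m0, hm0⟩ := MvPolynomial.support_nonempty.2 hb
  let f : (κ ⊕ Cp A →₀ ℕ) → κ → ℤ := fun m j => (m (Sum.inl j) : ℤ)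
  have key : ∀ ξ : κ → ℤ, (∀ l ∈ G.Lat G.M, ∑ j, l j * ξ j = 0) → 
      (∀ m ∈ b.1.support, ∑ j, (f m - f m0) j * ξ j = 0) ∧ (∀ m ∈ a.support, ∑ j, (f m - f m0) j * ξ j = 0) := by
    intro ξ hξ
    obtain ⟨D, hDx, hDc⟩ := G.der (fun j => (ξ j : E) * G.x j) 0
    have hdx : ∀ j, D (G.x j) / G.x j = ξ j := fun j => by rw [hDx, mul_div_assoc, div_self (G.x0 j), mul_one]
    have hD0 : ∀ i ∈ G.IF G.M, D (G.c (G.v0 i)) = 0 := by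
      intro i hi
      rw [G.der_c0 D i]
      simp only [hdx]
      rw [gh_dot]
      rw [Finset.sum_eq_zero, Finset.sum_eq_zero]
      · simp
      · intro a _
        have := hξ a.1 (G.mem_IF.1 hi a.1 a.2)
        have h2 : ∑ j, (a.1 j : E) * (ξ j : E) = 0 := by exact_mod_cast congrArg (Int.cast : ℤ → E) this
        rw [h2, mul_zero]
      · intro b hb
        have := hDc ⟨i, b⟩ (fun h0 => (Finset.mem_erase.1 hb).1 (Subtype.ext h0))
        rw [this]; simp
    have hDθ : D θ = 0 := by
      have hz := G.der_eq_zero_M (D - ∑ i ∈ Finset.univ.filter (fun i => i ∉ G.IF G.M), D (G.c (G.v0 i)) • G.pd (G.v0 i)) (fun s => ?_) hθ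
      · rw [Derivation.sub_apply] at hz
        have hs : (∑ i ∈ Finset.univ.filter (fun i => i ∉ G.IF G.M), D (G.c (G.v0 i)) • G.pd (G.v0 i)) θ = 0 := by
          rw [← Derivation.coeFnAddMonoidHom_apply, map_sum, Finset.sum_apply]
          refine Finset.sum_eq_zero fun i hi => ?_
          rw [Derivation.coeFnAddMonoidHom_apply, Derivation.smul_apply, h0 i (Finset.mem_filter.1 hi).2, smul_zero]
        rw [hs, sub_zero] at hz
        exact hz
      · rw [Derivation.sub_apply, ← Derivation.coeFnAddMonoidHom_apply (∑ i ∈ _, _), map_sum, Finset.sum_apply]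
        simp only [Derivation.coeFnAddMonoidHom_apply, Derivation.smul_apply, pd_c]
        obtain ⟨l, ⟨a, ha⟩⟩ := s
        by_cases h : a = 0
        · subst h
          by_cases hl : l ∈ G.IF G.M
          · rw [Finset.sum_eq_zero, sub_zero]
            · exact hD0 l hl
            · intro i hi
              rw [if_neg, smul_zero]
              intro h'
              have : l = i := congrArg Sigma.fst h'
              exact (Finset.mem_filter.1 hi).2 (this ▸ hl)
          · rw [Finset.sum_eq_single l]
            · simp
            · intro i _ hi
              rw [if_neg, smul_zero]
              intro h'; exact hi (congrArg Sigma.fst h').symm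
            · intro h'; exact absurd (by simp [hl]) h'
        · have := hDc ⟨l, ⟨a, ha⟩⟩ h
          rw [this, Finset.sum_eq_zero]
          · simp
          · intro i _
            rw [if_neg, smul_zero]
            intro h'
            have : ((⟨l, ⟨a, ha⟩⟩ : Sg A).2.1) = (G.v0 i).2.1 := by rw [h']
            exact h this
    have hDa : ∀ p : SR A, D (algebraMap (SR A) E p) = algebraMap (SR A) E
        (∑ s, MvPolynomial.C (Sum.elim (fun j => (ξ j : ℂ)) 0 s) * (MvPolynomial.X s * MvPolynomial.pderiv s p)) := by
      intro p
      rw [Std.der_alg D 0 (fun s => MvPolynomial.C (Sum.elim (fun j => (ξ j : ℂ)) 0 s) * MvPolynomial.X s)]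
      · simp only [mul_assoc]
      · rintro (j | s)
        · rw [← H.hx, hDx, map_mul, ← H.hx]
          congr 1
          simp
        · rw [← H.hc, hDc _ s.2]; simp
    obtain ⟨t, ht1, ht2⟩ := weight_quot (Sum.elim (fun j => (ξ j : ℂ)) 0) a b.1 hb hab (by
      apply hinj
      rw [map_mul, map_mul, ← hDa, ← hDa, ← hθe, D.leibniz, hDθ]
      simp only [smul_eq_mul]; ring)
    have e : ∀ m : κ ⊕ Cp A →₀ ℕ, ∑ i, (Sum.elim (fun j => (ξ j : ℂ)) 0 i) * (m i : ℂ) = ((∑ j, f m j * ξ j : ℤ) : ℂ) := by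
      intro m
      simp [f, mul_comm]
    have e2 : ∀ m : κ ⊕ Cp A →₀ ℕ, ∑ i, (Sum.elim (fun j => (ξ j : ℂ)) 0 i) * (m i : ℂ) = t → ∑ j, (f m - f m0) j * ξ j = 0 := by
      intro m hm
      have h1 := ht1 m0 hm0
      rw [← hm, e, e, Int.cast_inj] at h1
      simp only [Pi.sub_apply, sub_mul, Finset.sum_sub_distrib, h1, sub_self]
    exact ⟨fun m hm => e2 m (ht1 m hm), fun m hm => e2 m (ht2 m hm)⟩
  have hal : ∀ z ∈ G.M, IsAlgebraic G.K z := fun z hz => G.mem_M.1 hz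
  have key2 : ∀ m : κ ⊕ Cp A →₀ ℕ, (∀ ξ : κ → ℤ, (∀ l ∈ G.Lat G.M, ∑ j, l j * ξ j = 0) → ∑ j, (f m - f m0) j * ξ j = 0) →
      xm G.x (f m - f m0) ∈ G.K := fun m hm =>
    G.xm_unique hnc _ (hal _ (sat_dual (G.Lat G.M) (G.lat_F_sat hnc G.M hal) (f m - f m0) hm))
  have h1 := H.xc_mem a (f m0) fun m hm => key2 m fun ξ hξ => (key ξ hξ).2 m hm
  have h2 := H.xc_mem b.1 (f m0) fun m hm => key2 m fun ξ hξ => (key ξ hξ).1 m hm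
  have h3 : θ = (algebraMap (SR A) E a / xm G.x (f m0)) / (algebraMap (SR A) E b / xm G.x (f m0)) := by
    rw [← hθe]; have := xm_ne G.x0 (f m0); field_simp
  rw [h3]; exact div_mem h1 h2

/-- `K` is algebraically closed in `E` -/
theorem Std.K_closed [IsFractionRing (SR A) E] (H : G.Std) (hnc : ¬ Crit (latt κ) (B A)) (θ : E) (hθ : IsAlgebraic G.K θ) :
    θ ∈ G.K := by
  obtain ⟨q, hqK, hq0, hql⟩ := H.exists_mul_lau θ hθ
  have hM : q * θ ∈ G.M := mul_mem (G.M.algebraMap_mem ⟨q, hqK⟩) (G.mem_M.2 hθ)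
  have h1 := G.nilp_ind (H.base hnc) (Finset.univ.filter (fun i => i ∉ G.IF G.M)) ⟨q * θ, hM⟩ (by
    intro i hi
    obtain ⟨k, hk⟩ := H.nilp i (Finset.mem_filter.1 hi).2 _ hM hql
    exact ⟨k, Subtype.ext (by rw [pdM_coe, hk]; rfl)⟩) (by
    intro i hi hi'; exact absurd (by simp [hi]) hi')
  have : θ = (q * θ) / q := by field_simp
  rw [this]; exact div_mem h1 hqK

end GP
end Khov

open Pointwise Module
namespace Khov

theorem elim {σ U I : Type} [Finite U] (Q : I → MvPolynomial U (MvPolynomial σ ℂ))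
    (h : ∀ (L : Type) [Field L] [Algebra (FractionRing (MvPolynomial σ ℂ)) L] [FiniteDimensional (FractionRing (MvPolynomial σ ℂ)) L]
      (u : U → L), ¬ ∀ i, MvPolynomial.eval₂ ((algebraMap (FractionRing (MvPolynomial σ ℂ)) L).comp
        (algebraMap (MvPolynomial σ ℂ) (FractionRing (MvPolynomial σ ℂ)))) u (Q i) = 0) :
    ∃ p : MvPolynomial σ ℂ, p ≠ 0 ∧ ∀ c, MvPolynomial.eval c p ≠ 0 → ∀ u : U → ℂ,
      ¬ ∀ i, MvPolynomial.eval₂ (MvPolynomial.eval c) u (Q i) = 0 := by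
  let C := MvPolynomial σ ℂ
  let K := FractionRing C
  letI : Algebra (MvPolynomial U C) (MvPolynomial U K) := MvPolynomial.algebraMvPolynomial
  let I0 : Ideal (MvPolynomial U C) := Ideal.span (Set.range Q)
  by_cases htop : I0.map (algebraMap (MvPolynomial U C) (MvPolynomial U K)) = ⊤
  · have h1 : (1 : MvPolynomial U K) ∈ I0.map (algebraMap (MvPolynomial U C) (MvPolynomial U K)) := by
      rw [htop]; trivial
    rw [IsLocalization.mem_map_algebraMap_iff ((nonZeroDivisors C).map (MvPolynomial.C (σ := U)))] at h1
    obtain ⟨⟨⟨z, hz⟩, ⟨_, ⟨p, hp, rfl⟩⟩⟩, h2⟩ := h1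
    rw [one_mul] at h2
    have hinj : Function.Injective (algebraMap (MvPolynomial U C) (MvPolynomial U K)) := by
      rw [MvPolynomial.algebraMap_def]
      exact MvPolynomial.map_injective _ (IsFractionRing.injective C K)
    have h3 := hinj h2
    simp only at h3
    refine ⟨p, nonZeroDivisors.ne_zero hp, fun c hc u hu => hc ?_⟩
    have h4 : I0 ≤ RingHom.ker (MvPolynomial.eval₂Hom (MvPolynomial.eval c) u) := by
      refine Ideal.span_le.2 ?_
      rintro _ ⟨i, rfl⟩
      exact hu i
    have h5 : MvPolynomial.eval₂Hom (MvPolynomial.eval c) u (MvPolynomial.C p) = 0 := by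
      rw [MvPolynomial.coe_eval₂Hom]
      have := h4 hz
      rw [← h3] at this
      exact this
    simpa using h5
  · exfalso
    obtain ⟨m, hm, hle⟩ := Ideal.exists_le_maximal _ htop
    letI : Field (MvPolynomial U K ⧸ m) := Ideal.Quotient.field m
    haveI : Algebra.FiniteType K (MvPolynomial U K ⧸ m) := inferInstance
    haveI : Module.Finite K (MvPolynomial U K ⧸ m) :=
      finite_of_algHom_finiteType_of_isJacobsonRing (AlgHom.id K (MvPolynomial U K ⧸ m))
    refine h (MvPolynomial U K ⧸ m) (fun i => Ideal.Quotient.mk m (MvPolynomial.X i)) fun i => ?_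
    have h1 : algebraMap (MvPolynomial U C) (MvPolynomial U K) (Q i) ∈ m :=
      hle (Ideal.mem_map_of_mem _ (Ideal.subset_span ⟨i, rfl⟩))
    rw [← Ideal.Quotient.eq_zero_iff_mem] at h1
    have h2 : (MvPolynomial.eval₂Hom ((algebraMap K (MvPolynomial U K ⧸ m)).comp (algebraMap C K))
        (fun i => Ideal.Quotient.mk m (MvPolynomial.X i))) =
        (Ideal.Quotient.mk m).comp (algebraMap (MvPolynomial U C) (MvPolynomial U K)) := by
      refine MvPolynomial.ringHom_ext (fun r => ?_) (fun i => ?_)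
      · rw [RingHom.comp_apply, MvPolynomial.algebraMap_def, MvPolynomial.map_C, MvPolynomial.eval₂Hom_C]; rfl
      · rw [RingHom.comp_apply, MvPolynomial.algebraMap_def, MvPolynomial.map_X, MvPolynomial.eval₂Hom_X']
    have h3 := congrArg (fun f => f (Q i)) h2
    simp only [RingHom.comp_apply] at h3
    rw [h1] at h3
    exact h3

theorem der_fin {K L : Type} [Field K] [Field L] [Algebra ℂ K] [Algebra ℂ L] [Algebra K L] [IsScalarTower ℂ K L]
    [FiniteDimensional K L] (D0 : Derivation ℂ K K) :
    ∃ D : Derivation ℂ L L, ∀ z, D (algebraMap K L z) = algebraMap K L (D0 z) := by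
  haveI : CharZero K := GP.charZ K
  letI : Differential K := ⟨D0.restrictScalars ℤ⟩
  letI := Differential.differentialFiniteDimensional K L
  have h : DifferentialAlgebra K L := Differential.differentialAlgebraFiniteDimensional
  have h1 : ∀ z, Differential.deriv (algebraMap K L z) = algebraMap K L (D0 z) := fun z => h.deriv_algebraMap z
  refine ⟨Derivation.mk' { toFun := fun z => (Differential.deriv z : L), map_add' := fun a b => map_add _ a b, map_smul' := fun r z => ?_ } ?_, ?_⟩
  · rw [Algebra.smul_def, Derivation.leibniz, IsScalarTower.algebraMap_apply ℂ K L, h1, D0.map_algebraMap]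
    simp only [smul_eq_mul, map_zero, mul_zero, add_zero, RingHom.id_apply]
    rw [Algebra.smul_def, IsScalarTower.algebraMap_apply ℂ K L]
  · intro a b
    exact Derivation.leibniz _ a b
  · exact h1

section E3
variable {ι κ : Type} [Fintype ι] [DecidableEq ι] [Fintype κ] [DecidableEq κ] (A : ι → Finset (κ → ℤ))

/-- zero set in the torus -/
def Zc (c : Sg A → ℂ) : Set (κ → ℂ) :=
  {x | (∀ j, x j ≠ 0) ∧ ∀ i, ∑ a : {a // a ∈ A i}, c ⟨i, a⟩ * xm x a.1 = 0}

/-- logarithmic gradient -/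
def gr {F : Type} [Field F] (c : Sg A → F) (x : κ → F) (i : ι) : κ → F :=
  ∑ a : {a // a ∈ A i}, (c ⟨i, a⟩ * xm x a.1) • cz F a.1

variable {A}
theorem gr_dot {F : Type} [Field F] (c : Sg A → F) (x : κ → F) (i : ι) (η : κ → F) : ∑ j, gr A c x i j * η j =
    ∑ a : {a // a ∈ A i}, (c ⟨i, a⟩ * xm x a.1) * ∑ j, (a.1 j : F) * η j := by
  simp only [gr, Finset.sum_apply, Pi.smul_apply, smul_eq_mul, Finset.sum_mul, Finset.mul_sum, cz]
  rw [Finset.sum_comm]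
  simp only [mul_assoc]

theorem smooth_gen (hA0 : ∀ i, (0 : κ → ℤ) ∈ A i) {L : Type} [Field L] [Algebra (FractionRing (MvPolynomial (Sg A) ℂ)) L]
    [FiniteDimensional (FractionRing (MvPolynomial (Sg A) ℂ)) L] (c : Sg A → L)
    (hc : ∀ s, c s = algebraMap (FractionRing (MvPolynomial (Sg A) ℂ)) L (algebraMap (MvPolynomial (Sg A) ℂ) _ (MvPolynomial.X s)))
    (x : κ → L) (hx : ∀ j, x j ≠ 0) (h : ∀ i, ∑ a : {a // a ∈ A i}, c ⟨i, a⟩ * xm x a.1 = 0)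
    (η : ι → L) (hη : ∀ j, ∑ i, η i * gr A c x i j = 0) (i : ι) : η i = 0 := by
  let C := MvPolynomial (Sg A) ℂ
  let K := FractionRing C
  letI : Algebra ℂ L := ((algebraMap K L).comp (algebraMap ℂ K)).toAlgebra
  haveI : IsScalarTower ℂ K L := IsScalarTower.of_algebraMap_eq fun _ => rfl
  obtain ⟨D0, hD0⟩ := exists_der (σ := Sg A) (E := K) (fun s => if s = ⟨i, ⟨0, hA0 i⟩⟩ then 1 else 0)
  obtain ⟨D, hD⟩ := der_fin (L := L) D0
  have hDc : ∀ s, D (c s) = if s = ⟨i, ⟨0, hA0 i⟩⟩ then 1 else 0 := by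
    intro s
    rw [hc, hD, hD0]; split_ifs <;> simp
  have h1 : ∀ l, (∑ a : {a // a ∈ A l}, D (c ⟨l, a⟩) * xm x a.1) + ∑ j, gr A c x l j * (D (x j) / x j) = 0 := by
    intro l
    have h' := congrArg D (h l)
    rw [map_sum, map_zero] at h'
    rw [gr_dot, ← Finset.sum_add_distrib, ← h']
    refine Finset.sum_congr rfl fun a _ => ?_
    rw [D.leibniz, der_xm D hx]
    simp only [smul_eq_mul]; ring
  have h2 : ∀ l, (∑ a : {a // a ∈ A l}, D (c ⟨l, a⟩) * xm x a.1) = if l = i then 1 else 0 := by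
    intro l
    simp only [hDc]
    by_cases hl : l = i
    · subst hl
      rw [Finset.sum_eq_single ⟨0, hA0 l⟩]
      · simp [xm_zero]
      · intro b _ hb
        rw [if_neg, zero_mul]
        intro h'
        simp only [Sigma.mk.injEq, heq_eq_eq, true_and] at h'
        exact hb h'
      · simp
    · rw [if_neg hl]
      refine Finset.sum_eq_zero fun a _ => ?_
      rw [if_neg, zero_mul]
      intro h'; exact hl (congrArg Sigma.fst h')
  have h3 : ∑ l, η l * ((∑ a : {a // a ∈ A l}, D (c ⟨l, a⟩) * xm x a.1) + ∑ j, gr A c x l j * (D (x j) / x j)) = 0 :=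
    Finset.sum_eq_zero fun l _ => by rw [h1, mul_zero]
  simp only [h2, mul_add, Finset.sum_add_distrib, mul_ite, mul_one, mul_zero, Finset.sum_ite_eq', Finset.mem_univ, if_true] at h3
  have h4 : ∑ l, η l * ∑ j, gr A c x l j * (D (x j) / x j) = 0 := by
    simp only [Finset.mul_sum]
    rw [Finset.sum_comm]
    refine Finset.sum_eq_zero fun j _ => ?_
    have := hη j
    simp only [← mul_assoc]
    rw [← Finset.sum_mul, this, zero_mul]
  rw [h4, add_zero] at h3
  exact h3

/-- formal Laurent monomial -/
noncomputable def mon (R : Type) [CommRing R] (ν : Type) (a : κ → ℤ) : MvPolynomial (κ ⊕ κ ⊕ ν) R :=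
  ∏ j, MvPolynomial.X (Sum.inl j) ^ (a j).toNat * MvPolynomial.X (Sum.inr (Sum.inl j)) ^ (-a j).toNat

theorem eval_mon {R : Type} [CommRing R] {ν F : Type} [Field F] (φ : R →+* F) (u : κ ⊕ κ ⊕ ν → F)
    (hu : ∀ j, u (Sum.inl j) * u (Sum.inr (Sum.inl j)) = 1) (a : κ → ℤ) :
    MvPolynomial.eval₂ φ u (mon R ν a) = xm (fun j => u (Sum.inl j)) a := by
  rw [← MvPolynomial.coe_eval₂Hom, mon, map_prod, xm]
  refine Finset.prod_congr rfl fun j _ => ?_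
  rw [map_mul, map_pow, map_pow, MvPolynomial.eval₂Hom_X', MvPolynomial.eval₂Hom_X']
  have h : u (Sum.inr (Sum.inl j)) = (u (Sum.inl j))⁻¹ := eq_inv_of_mul_eq_one_right (hu j)
  rw [h]
  rcases Int.eq_nat_or_neg (a j) with ⟨n, h | h⟩
  · rw [h]; simp
  · rw [h]; simp

theorem E3 (hA0 : ∀ i, (0 : κ → ℤ) ∈ A i) : ∃ p : MvPolynomial (Sg A) ℂ, p ≠ 0 ∧ ∀ c, MvPolynomial.eval c p ≠ 0 →
    ∀ x ∈ Zc A c, LinearIndependent ℂ (gr A c x) := by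
  classical
  let C := MvPolynomial (Sg A) ℂ
  let Qf : ι → MvPolynomial (κ ⊕ κ ⊕ ι) C := fun i => ∑ a : {a // a ∈ A i}, MvPolynomial.C (MvPolynomial.X ⟨i, a⟩) * mon C ι a.1
  let Qg : κ → MvPolynomial (κ ⊕ κ ⊕ ι) C := fun j => ∑ i, MvPolynomial.X (Sum.inr (Sum.inr i)) *
    ∑ a : {a // a ∈ A i}, MvPolynomial.C (MvPolynomial.X ⟨i, a⟩) * mon C ι a.1 * MvPolynomial.C (MvPolynomial.C (a.1 j : ℂ))
  let Qx : κ → MvPolynomial (κ ⊕ κ ⊕ ι) C := fun j => MvPolynomial.X (Sum.inl j) * MvPolynomial.X (Sum.inr (Sum.inl j)) - 1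
  let Qh : ι → MvPolynomial (κ ⊕ κ ⊕ ι) C := fun i => MvPolynomial.X (Sum.inr (Sum.inr i)) - 1
  let Q : ι → (κ ⊕ ι ⊕ κ ⊕ Unit) → MvPolynomial (κ ⊕ κ ⊕ ι) C := fun i =>
    Sum.elim Qx (Sum.elim Qf (Sum.elim Qg fun _ => Qh i))
  have hQx : ∀ {F : Type} [Field F] (φ : C →+* F) (u : κ ⊕ κ ⊕ ι → F) (j), MvPolynomial.eval₂ φ u (Qx j) =
      u (Sum.inl j) * u (Sum.inr (Sum.inl j)) - 1 := by
    intro F _ φ u j; simp [Qx, ← MvPolynomial.coe_eval₂Hom]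
  have hQf : ∀ {F : Type} [Field F] (φ : C →+* F) (u : κ ⊕ κ ⊕ ι → F)
      (hu : ∀ j, u (Sum.inl j) * u (Sum.inr (Sum.inl j)) = 1) (i), MvPolynomial.eval₂ φ u (Qf i) =
      ∑ a : {a // a ∈ A i}, φ (MvPolynomial.X ⟨i, a⟩) * xm (fun j => u (Sum.inl j)) a.1 := by
    intro F _ φ u hu i
    simp only [Qf]
    rw [← MvPolynomial.coe_eval₂Hom, map_sum]
    refine Finset.sum_congr rfl fun a _ => ?_
    rw [map_mul, MvPolynomial.coe_eval₂Hom, eval_mon φ u hu, MvPolynomial.eval₂_C]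
  have hQg : ∀ {F : Type} [Field F] (φ : C →+* F) (u : κ ⊕ κ ⊕ ι → F)
      (hu : ∀ j, u (Sum.inl j) * u (Sum.inr (Sum.inl j)) = 1) (j), MvPolynomial.eval₂ φ u (Qg j) =
      ∑ i, u (Sum.inr (Sum.inr i)) * gr A (fun s => φ (MvPolynomial.X s)) (fun j => u (Sum.inl j)) i j := by
    intro F _ φ u hu j
    simp only [Qg]
    rw [← MvPolynomial.coe_eval₂Hom, map_sum]
    refine Finset.sum_congr rfl fun i _ => ?_
    rw [map_mul, MvPolynomial.eval₂Hom_X', map_sum]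
    congr 1
    simp only [gr, Finset.sum_apply, Pi.smul_apply, smul_eq_mul, cz]
    refine Finset.sum_congr rfl fun a _ => ?_
    rw [map_mul, map_mul, MvPolynomial.coe_eval₂Hom, eval_mon φ u hu, MvPolynomial.eval₂_C, MvPolynomial.eval₂_C]
    congr 1
    simp
  have hQh : ∀ {F : Type} [Field F] (φ : C →+* F) (u : κ ⊕ κ ⊕ ι → F) (i), MvPolynomial.eval₂ φ u (Qh i) =
      u (Sum.inr (Sum.inr i)) - 1 := by
    intro F _ φ u j; simp [Qh, ← MvPolynomial.coe_eval₂Hom]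
  have key : ∀ i, ∃ p : MvPolynomial (Sg A) ℂ, p ≠ 0 ∧ ∀ c, MvPolynomial.eval c p ≠ 0 → ∀ u : κ ⊕ κ ⊕ ι → ℂ,
      ¬ ∀ r, MvPolynomial.eval₂ (MvPolynomial.eval c) u (Q i r) = 0 := by
    intro i
    refine elim (Q i) ?_
    intro L _ _ _ u hu
    have h1 : ∀ j, u (Sum.inl j) * u (Sum.inr (Sum.inl j)) = 1 := fun j => by
      have := hu (Sum.inl j)
      simp only [Q, Sum.elim_inl] at this
      rw [hQx] at this
      exact sub_eq_zero.1 this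
    have h2 := smooth_gen hA0 (L := L) (fun s => algebraMap (FractionRing C) L (algebraMap _ _ (MvPolynomial.X s))) (fun _ => rfl)
      (fun j => u (Sum.inl j)) (fun j h0 => by have := h1 j; rw [h0, zero_mul] at this; exact zero_ne_one this)
      (fun l => by
        have := hu (Sum.inr (Sum.inl l))
        simp only [Q, Sum.elim_inl, Sum.elim_inr] at this
        rw [hQf _ _ h1] at this
        exact this)
      (fun l => u (Sum.inr (Sum.inr l)))
      (fun j => by
        have := hu (Sum.inr (Sum.inr (Sum.inl j)))
        simp only [Q, Sum.elim_inl, Sum.elim_inr] at this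
        rw [hQg _ _ h1] at this
        exact this) i
    have h3 := hu (Sum.inr (Sum.inr (Sum.inr ())))
    simp only [Q, Sum.elim_inr] at h3
    rw [hQh, h2] at h3
    simp at h3
  choose p hp hpc using key
  refine ⟨∏ i, p i, Finset.prod_ne_zero_iff.2 fun i _ => hp i, fun c hc x hx => ?_⟩
  rw [map_prod] at hc
  have hc' := fun i => Finset.prod_ne_zero_iff.1 hc i (Finset.mem_univ i)
  rw [Fintype.linearIndependent_iff]
  intro η hη i
  by_contra hne
  let u : κ ⊕ κ ⊕ ι → ℂ := Sum.elim x (Sum.elim (fun j => (x j)⁻¹) fun l => η l / η i)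
  have h1 : ∀ j, u (Sum.inl j) * u (Sum.inr (Sum.inl j)) = 1 := fun j => mul_inv_cancel₀ (hx.1 j)
  refine hpc i c (hc' i) u ?_
  rintro (j | l | j | _)
  · simp only [Q, Sum.elim_inl]; rw [hQx, h1, sub_self]
  · simp only [Q, Sum.elim_inl, Sum.elim_inr]; rw [hQf _ _ h1]
    have := hx.2 l
    have e : ∀ s, (MvPolynomial.eval c) (MvPolynomial.X s : C) = c s := fun s => MvPolynomial.eval_X s
    simp only [e]
    exact this
  · simp only [Q, Sum.elim_inl, Sum.elim_inr]; rw [hQg _ _ h1]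
    have := congrFun hη j
    simp only [Finset.sum_apply, Pi.smul_apply, smul_eq_mul, Pi.zero_apply] at this
    have h5 : ∑ l, (η l / η i) * gr A c x l j = 0 := by
      have : ∑ l, (η l / η i) * gr A c x l j = (∑ l, η l * gr A c x l j) / η i := by
        rw [Finset.sum_div]; exact Finset.sum_congr rfl fun l _ => by ring
      rw [this, ‹∑ l, η l * gr A c x l j = 0›, zero_div]
    have e : ∀ s, (MvPolynomial.eval c) (MvPolynomial.X s : C) = c s := fun s => MvPolynomial.eval_X s
    simp only [e]
    exact h5
  · simp only [Q, Sum.elim_inr]; rw [hQh]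
    simp [u, hne]
end E3
end Khov

open Pointwise Module
namespace Khov
variable {ι κ : Type} [Fintype ι] [DecidableEq ι] [Fintype κ] [DecidableEq κ] {A : ι → Finset (κ → ℤ)}

theorem xm_deriv (x : κ → ℂ) (hx : ∀ j, x j ≠ 0) (a : κ → ℤ) :
    HasStrictFDerivAt (fun x : κ → ℂ => xm x a)
      (xm x a • ∑ j, ((a j : ℂ) / x j) • (ContinuousLinearMap.proj j : (κ → ℂ) →L[ℂ] ℂ)) x := by
  have key : ∀ s : Finset κ, HasStrictFDerivAt (fun x : κ → ℂ => ∏ j ∈ s, x j ^ a j)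
      ((∏ j ∈ s, x j ^ a j) • ∑ j ∈ s, ((a j : ℂ) / x j) • (ContinuousLinearMap.proj j : (κ → ℂ) →L[ℂ] ℂ)) x := by
    intro s
    induction s using Finset.induction_on with
    | empty =>
      simp only [Finset.prod_empty, Finset.sum_empty, smul_zero]
      exact hasStrictFDerivAt_const _ _
    | insert l s hl ih =>
      have h1 : HasStrictFDerivAt (fun x : κ → ℂ => x l ^ a l)
          (((a l : ℂ) * x l ^ (a l - 1)) • (ContinuousLinearMap.proj l : (κ → ℂ) →L[ℂ] ℂ)) x :=
        HasStrictDerivAt.comp_hasStrictFDerivAt (h₂ := fun z : ℂ => z ^ a l) (f := fun x : κ → ℂ => x l) x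
          (hasStrictDerivAt_zpow (a l) (x l) (Or.inl (hx l)))
          (hasStrictFDerivAt_apply (𝕜 := ℂ) (F' := fun _ : κ => ℂ) l x)
      have h2 := h1.mul ih
      simp only [Finset.prod_insert hl, Finset.sum_insert hl]
      refine h2.congr_fderiv ?_
      ext v
      simp only [zpow_sub_one₀ (hx l), ContinuousLinearMap.add_apply, ContinuousLinearMap.smul_apply, smul_eq_mul,
        ContinuousLinearMap.proj_apply]
      ring
  exact key Finset.univ

theorem open_at {c : Sg A → ℂ} {x : κ → ℂ} (hxZ : x ∈ Zc A c) (lam : κ → ℂ)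
    (hli : ∀ (η : ι → ℂ) (t : ℂ), (∀ j, t * (lam j * x j) + ∑ i, η i * gr A c x i j = 0) → t = 0 ∧ ∀ i, η i = 0)
    {W : Set (κ → ℂ)} (hW : W ∈ nhds x) :
    ∀ᶠ t in nhds (∑ j, lam j * x j), ∃ x' ∈ W, x' ∈ Zc A c ∧ ∑ j, lam j * x' j = t := by
  obtain ⟨hx, hz⟩ := hxZ
  let f : (κ → ℂ) → (ι → ℂ) × ℂ := fun x => (fun i => ∑ a : {a // a ∈ A i}, c ⟨i, a⟩ * xm x a.1, ∑ j, lam j * x j)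
  let g : ι → ((κ → ℂ) →L[ℂ] ℂ) := fun i => ∑ a : {a // a ∈ A i}, c ⟨i, a⟩ •
    (xm x a.1 • ∑ j, ((a.1 j : ℂ) / x j) • (ContinuousLinearMap.proj j : (κ → ℂ) →L[ℂ] ℂ))
  let ll : (κ → ℂ) →L[ℂ] ℂ := ∑ j, lam j • (ContinuousLinearMap.proj j : (κ → ℂ) →L[ℂ] ℂ)
  have hf : HasStrictFDerivAt f ((ContinuousLinearMap.pi g).prod ll) x := by
    refine HasStrictFDerivAt.prodMk ?_ ?_
    · rw [hasStrictFDerivAt_pi]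
      intro i
      exact HasStrictFDerivAt.fun_sum fun a _ => (xm_deriv x hx a.1).const_mul _
    · exact HasStrictFDerivAt.fun_sum fun a _ => (hasStrictFDerivAt_apply (𝕜 := ℂ) (F' := fun _ : κ => ℂ) a x).const_mul _
  have hg : ∀ i j, g i (Pi.single j (x j)) = gr A c x i j := by
    intro i j
    simp only [g, gr, ContinuousLinearMap.sum_apply, ContinuousLinearMap.smul_apply, smul_eq_mul,
        ContinuousLinearMap.proj_apply, Finset.sum_apply, Pi.smul_apply, cz, ]
    refine Finset.sum_congr rfl fun a _ => ?_
    rw [Finset.sum_eq_single j]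
    · simp only [Pi.single_eq_same]
      have := hx j
      field_simp
    · intro b _ hb; simp [Pi.single_eq_of_ne hb]
    · simp
  have hl : ∀ j, ll (Pi.single j (x j)) = lam j * x j := by
    intro j
    simp only [ll, ContinuousLinearMap.sum_apply, ContinuousLinearMap.smul_apply, smul_eq_mul, ContinuousLinearMap.proj_apply]
    rw [Finset.sum_eq_single j]
    · simp
    · intro b _ hb; simp [Pi.single_eq_of_ne hb]
    · simp
  have hsurj : ((ContinuousLinearMap.pi g).prod ll).range = ⊤ := by
    by_contra hne
    obtain ⟨φ, hφ0, hφ⟩ := Submodule.exists_le_ker_of_lt_top _ (lt_top_iff_ne_top.2 hne)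
    have hφe : ∀ (u : ι → ℂ) (t : ℂ), φ (u, t) = (∑ i, u i * φ (Pi.single i 1, 0)) + t * φ (0, 1) := by
      intro u t
      have : (u, t) = (∑ i, u i • ((Pi.single i 1, 0) : (ι → ℂ) × ℂ)) + t • ((0, 1) : (ι → ℂ) × ℂ) := by
        ext i
        · simp [Prod.fst_sum, Finset.sum_apply, Pi.single_apply]
        · simp [Prod.snd_sum]
      rw [this, map_add, map_sum, map_smul, smul_eq_mul]
      simp only [map_smul, smul_eq_mul]
    have h1 := hli (fun i => φ (Pi.single i 1, 0)) (φ (0, 1)) (fun j => by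
      have h2 : φ (((ContinuousLinearMap.pi g).prod ll) (Pi.single j (x j))) = 0 := hφ ⟨_, rfl⟩
      have h3 : ((ContinuousLinearMap.pi g).prod ll) (Pi.single j (x j)) = (fun i => gr A c x i j, lam j * x j) := by
        ext i
        · exact hg i j
        · exact hl j
      rw [h3, hφe] at h2
      refine Eq.trans ?_ h2
      rw [add_comm]
      congr 1
      · exact Finset.sum_congr rfl fun i _ => mul_comm _ _
      · ring)
    apply hφ0
    ext u
    · simp [h1.2 u]
    · simp [h1.1]
  have hmap := hf.map_nhds_eq_of_surj hsurj
  have hU : {y : κ → ℂ | ∀ j, y j ≠ 0} ∈ nhds x := by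
    have : IsOpen {y : κ → ℂ | ∀ j, y j ≠ 0} := by
      simp only [Set.setOf_forall]
      exact isOpen_iInter_of_finite fun j => isOpen_ne_fun (continuous_apply j) continuous_const
    exact this.mem_nhds hx
  have h1 : f '' (W ∩ {y : κ → ℂ | ∀ j, y j ≠ 0}) ∈ nhds (f x) := by
    rw [← hmap]; exact Filter.image_mem_map (Filter.inter_mem hW hU)
  have hfx : f x = ((0 : ι → ℂ), ∑ j, lam j * x j) := by
    ext i
    · exact hz i
    · rfl
  rw [hfx] at h1
  have hcont : Filter.Tendsto (fun t : ℂ => ((0 : ι → ℂ), t)) (nhds (∑ j, lam j * x j)) (nhds ((0 : ι → ℂ), ∑ j, lam j * x j)) :=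
    (Continuous.prodMk continuous_const continuous_id).tendsto _
  filter_upwards [hcont h1] with t ht
  obtain ⟨x', ⟨hx'W, hx'0⟩, hx'⟩ := ht
  refine ⟨x', hx'W, ⟨hx'0, fun i => ?_⟩, ?_⟩
  · exact congrFun (congrArg Prod.fst hx') i
  · exact congrArg Prod.snd hx'

end Khov

open Pointwise Module
namespace Khov
variable {ι κ : Type} [Fintype ι] [DecidableEq ι] [Fintype κ] [DecidableEq κ] {A : ι → Finset (κ → ℤ)}

/-- independence of the supports -/
def Ind (A : ι → Finset (κ → ℤ)) : Prop := ∀ J : Finset ι, J.card ≤ finrank ℝ (VJ (GP.B A) J)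

theorem exists_ai (hA0 : ∀ i, (0 : κ → ℤ) ∈ A i) (hind : Ind A) :
    ∃ ai : ι → κ → ℤ, (∀ i, ai i ∈ A i) ∧ LinearIndependent ℤ ai := by
  classical
  obtain ⟨s, hs, hli⟩ := rado (V := κ → ℝ) (∑ i, ((A i).image (cz ℝ)).card) (fun i => (A i).image (cz ℝ)) rfl (fun J => by
    refine (hind J).trans (Submodule.finrank_mono ?_)
    refine Submodule.span_le.2 ?_
    rintro v ⟨i, hi, a, ⟨a', ha', rfl⟩, b, ⟨b', hb', rfl⟩, rfl⟩
    refine Submodule.sub_mem _ ?_ ?_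
    · refine Submodule.subset_span (Set.mem_biUnion hi ?_)
      exact Finset.mem_coe.2 (Finset.mem_image_of_mem _ hb')
    · refine Submodule.subset_span (Set.mem_biUnion hi ?_)
      exact Finset.mem_coe.2 (Finset.mem_image_of_mem _ ha'))
  simp only [Finset.mem_image] at hs
  choose ai hai h2 using hs
  refine ⟨ai, hai, ?_⟩
  have h3 := li_of_cz ℝ ai Finset.univ (by
    have : (fun i => cz ℝ (ai i)) = s := funext h2
    rw [this, Finset.coe_univ, linearIndepOn_univ]; exact hli)
  rwa [Finset.coe_univ, linearIndepOn_univ] at h3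

theorem exists_gp (hA0 : ∀ i, (0 : κ → ℤ) ∈ A i) (hind : Ind A) : ∃ G : GP A (FractionRing (SR A)), G.Std := by
  obtain ⟨ai, hai, hli⟩ := exists_ai hA0 hind
  let E := FractionRing (SR A)
  let x : κ → E := fun j => algebraMap (SR A) E (MvPolynomial.X (Sum.inl j))
  let c1 : Sg A → E := fun s => if h : s.2.1 ≠ 0 then algebraMap (SR A) E (MvPolynomial.X (Sum.inr ⟨s, h⟩)) else 0
  let c : Sg A → E := fun s => if s.2.1 ≠ 0 then c1 s else - ∑ a : {a // a ∈ A s.1}, c1 ⟨s.1, a⟩ * xm x a.1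
  have hc : ∀ s : Cp A, c s.1 = algebraMap (SR A) E (MvPolynomial.X (Sum.inr s)) := by
    rintro ⟨s, hs⟩
    simp only [c, c1, if_pos hs, dif_pos hs]
  refine ⟨⟨x, c, ?_, ?_, ?_, hA0, ai, hai, hli⟩, ⟨fun j => rfl, hc⟩⟩
  · intro j h
    exact MvPolynomial.X_ne_zero (R := ℂ) (Sum.inl j : κ ⊕ Cp A) ((IsFractionRing.injective (SR A) E) (by rw [map_zero]; exact h))
  · intro i
    have h1 : ∀ a : {a // a ∈ A i}, a ≠ ⟨0, hA0 i⟩ → c ⟨i, a⟩ = c1 ⟨i, a⟩ := by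
      intro a ha
      have : a.1 ≠ 0 := fun h => ha (Subtype.ext h)
      simp only [c, if_pos this]
    have h0 : c ⟨i, ⟨0, hA0 i⟩⟩ = - ∑ a : {a // a ∈ A i}, c1 ⟨i, a⟩ * xm x a.1 := by
      simp [c]
    have h10 : c1 ⟨i, ⟨0, hA0 i⟩⟩ = 0 := by simp [c1]
    rw [← Finset.add_sum_erase _ _ (Finset.mem_univ ⟨0, hA0 i⟩), h0, xm_zero, mul_one,
      ← Finset.add_sum_erase _ _ (Finset.mem_univ ⟨0, hA0 i⟩), h10, zero_mul, zero_add, neg_add_eq_zero]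
    exact Finset.sum_congr rfl fun a ha => by rw [h1 a (Finset.ne_of_mem_erase ha)]
  · intro u w
    obtain ⟨D, hD⟩ := exists_der (σ := κ ⊕ Cp A) (E := E) (Sum.elim u fun s => w s.1)
    refine ⟨D, fun j => hD (Sum.inl j), fun s hs => ?_⟩
    rw [hc ⟨s, hs⟩]
    exact hD (Sum.inr ⟨s, hs⟩)

theorem card_Sg (hA0 : ∀ i, (0 : κ → ℤ) ∈ A i) : Fintype.card (Sg A) = Fintype.card ι + Fintype.card (Cp A) := by
  let e : {s : Sg A // ¬ s.2.1 ≠ 0} ≃ ι :=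
    { toFun := fun s => s.1.1
      invFun := fun i => ⟨⟨i, ⟨0, hA0 i⟩⟩, by simp⟩
      left_inv := by
        rintro ⟨⟨i, ⟨a, ha⟩⟩, h⟩
        simp only [ne_eq, not_not] at h
        subst h
        rfl
      right_inv := fun i => rfl }
  rw [← Fintype.card_congr e, Fintype.card_subtype_compl]
  have h1 := Fintype.card_subtype_le (fun s : Sg A => s.2.1 ≠ 0)
  have h2 : Fintype.card (Cp A) = Fintype.card {x : Sg A // x.2.1 ≠ 0} := Fintype.card_congr (Equiv.refl _)
  omega

namespace GP
variable {E : Type} [Field E] [Algebra ℂ E] (G : GP A E)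

theorem c_ai : AlgebraicIndependent ℂ G.c := by
  have key : ∀ (N : ℕ) (P : MvPolynomial (Sg A) ℂ), (∀ m : Sg A →₀ ℕ, N ≤ m.degree → P.coeff m = 0) →
      MvPolynomial.aeval G.c P = 0 → P = 0 := by
    intro N
    induction N with
    | zero => intro P h _; ext m; rw [h m (Nat.zero_le _), MvPolynomial.coeff_zero]
    | succ N ih =>
      intro P h hP
      have h1 : ∀ v, MvPolynomial.pderiv v P = 0 := by
        intro v
        refine ih _ ?_ ?_
        · intro m hm
          rw [MvPolynomial.coeff_pderiv, h, zero_mul]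
          rw [map_add, Finsupp.degree_single]; omega
        · have h2 : ∀ Q : MvPolynomial (Sg A) ℂ, MvPolynomial.aeval G.c (MvPolynomial.pderiv v Q) =
              G.pd v (MvPolynomial.aeval G.c Q) := by
            intro Q
            induction Q using MvPolynomial.induction_on with
            | C a => simp
            | add p q hp hq => simp [hp, hq]
            | mul_X p s hp =>
              rw [MvPolynomial.pderiv_mul, map_add, map_mul, map_mul, hp, map_mul, Derivation.leibniz, MvPolynomial.aeval_X,
                MvPolynomial.pderiv_X, G.pd_c, Pi.single_apply]
              simp only [smul_eq_mul]
              split_ifs <;> simp <;> ring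
          rw [h2, hP, map_zero]
      have h3 : P = MvPolynomial.C (P.coeff 0) := by
        ext m
        rw [MvPolynomial.coeff_C]
        split_ifs with hm
        · rw [hm]
        · obtain ⟨v, hv⟩ : ∃ v, m v ≠ 0 := by
            by_contra hne; push Not at hne; exact hm (by ext v; simp [hne v])
          have h4 := congrArg (MvPolynomial.coeff (m - Finsupp.single v 1)) (h1 v)
          rw [MvPolynomial.coeff_pderiv, MvPolynomial.coeff_zero] at h4
          have h5 : m - Finsupp.single v 1 + Finsupp.single v 1 = m := by
            ext w; by_cases hw : w = v
            · subst hw; simp; omega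
            · simp [Finsupp.single_apply, Ne.symm hw]
          rw [h5] at h4
          rcases mul_eq_zero.1 h4 with h | h
          · exact h
          · exfalso; norm_cast at h
      rw [h3, MvPolynomial.aeval_C] at hP
      have := (FaithfulSMul.algebraMap_injective ℂ E) (hP.trans (map_zero _).symm)
      rw [h3, this, map_zero]
  rw [algebraicIndependent_iff]
  intro P hP
  refine key (P.totalDegree + 1) P (fun m hm => ?_) hP
  refine MvPolynomial.coeff_eq_zero_of_totalDegree_lt ?_
  have : m.degree = ∑ i ∈ m.support, m i := rfl
  omega

variable [Algebra (SR A) E] [IsScalarTower ℂ (SR A) E]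

theorem trd_le [IsFractionRing (SR A) E] : Algebra.trdeg ℂ E ≤ (Fintype.card κ + Fintype.card (Cp A) : ℕ) := by
  let X : κ ⊕ Cp A → E := fun v => algebraMap (SR A) E (MvPolynomial.X v)
  have hmem : ∀ p : SR A, algebraMap (SR A) E p ∈ Algebra.adjoin ℂ (Set.range X) := by
    intro p
    induction p using MvPolynomial.induction_on with
    | C a =>
      have : algebraMap (SR A) E (MvPolynomial.C a) = algebraMap ℂ E a := by
        rw [IsScalarTower.algebraMap_apply ℂ (SR A) E]; rfl
      rw [this]; exact Subalgebra.algebraMap_mem _ _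
    | add p q hp hq => rw [map_add]; exact Subalgebra.add_mem _ hp hq
    | mul_X p s hp => rw [map_mul]; exact Subalgebra.mul_mem _ hp (Algebra.subset_adjoin ⟨s, rfl⟩)
  have halg : Algebra.IsAlgebraic (Algebra.adjoin ℂ (Set.range X)) E := by
    constructor
    intro z
    obtain ⟨p, q, hq, rfl⟩ := IsFractionRing.div_surjective (A := SR A) z
    rw [div_eq_mul_inv]
    exact (isAlgebraic_algebraMap (⟨_, hmem p⟩ : Algebra.adjoin ℂ (Set.range X))).mul
      (isAlgebraic_algebraMap (⟨_, hmem q⟩ : Algebra.adjoin ℂ (Set.range X))).inv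
  have h1 := Algebra.IsAlgebraic.trdeg_le_cardinalMk ℂ (Set.range X)
  refine h1.trans (Cardinal.mk_range_le.trans ?_)
  simp

theorem le_trd [IsFractionRing (SR A) E] : ((Fintype.card κ + Fintype.card (Cp A) : ℕ) : Cardinal) ≤ Algebra.trdeg ℂ E := by
  let X : κ ⊕ Cp A → E := fun v => algebraMap (SR A) E (MvPolynomial.X v)
  have h1 : AlgebraicIndependent ℂ X := by
    rw [algebraicIndependent_iff]
    intro P hP
    have h2 : MvPolynomial.aeval X P = algebraMap (SR A) E P := by
      have := MvPolynomial.aeval_algebraMap_apply E (fun v : κ ⊕ Cp A => (MvPolynomial.X v : SR A)) P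
      rw [MvPolynomial.aeval_X_left_apply] at this
      exact this
    rw [h2] at hP
    exact IsFractionRing.injective (SR A) E (hP.trans (map_zero _).symm)
  have := h1.cardinalMk_le_trdeg
  simpa using this

theorem adj_alg_K {z : E} (h : IsAlgebraic (Algebra.adjoin ℂ (Set.range G.c)) z) : IsAlgebraic G.K z := by
  obtain ⟨p, hp0, hp⟩ := h
  have hle : Algebra.adjoin ℂ (Set.range G.c) ≤ G.K.toSubalgebra := Algebra.adjoin_le (by rintro _ ⟨s, rfl⟩; exact G.c_mem s)
  refine ⟨p.map (Subalgebra.inclusion hle).toRingHom, ?_, ?_⟩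
  · exact (Polynomial.map_ne_zero_iff (Subalgebra.inclusion_injective hle)).2 hp0
  · rw [Polynomial.aeval_def, Polynomial.eval₂_map]; exact hp

theorem tb0 [IsFractionRing (SR A) E] (h : Fintype.card κ = Fintype.card ι) (z : E) : IsAlgebraic G.K z := by
  have h1 : IsTranscendenceBasis ℂ G.c := AlgebraicIndependent.isTranscendenceBasis_of_trdeg_le_of_finite G.c_ai (by
    refine (trd_le (A := A)).trans ?_
    rw [Cardinal.mk_fintype, card_Sg G.hA0, h])
  exact G.adj_alg_K (h1.isAlgebraic.isAlgebraic z)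

theorem tb1_ai {y : E} (hy : Transcendental G.K y) : AlgebraicIndependent ℂ (fun o : Option (Sg A) => o.elim y G.c) :=
  (G.c_ai.option_iff_transcendental y).2 fun h => hy (G.adj_alg_K h)

theorem tb1 [IsFractionRing (SR A) E] (h : Fintype.card κ = Fintype.card ι + 1) {y : E} (hy : Transcendental G.K y) :
    IsTranscendenceBasis ℂ (fun o : Option (Sg A) => o.elim y G.c) :=
  AlgebraicIndependent.isTranscendenceBasis_of_trdeg_le_of_finite (G.tb1_ai hy) (by
    refine (trd_le (A := A)).trans ?_
    rw [Cardinal.mk_fintype, Fintype.card_option, card_Sg G.hA0, h]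
    norm_cast; omega)

theorem tb1_ex [IsFractionRing (SR A) E] (H : G.Std) (h : Fintype.card κ = Fintype.card ι + 1) :
    ∃ j, Transcendental G.K (G.x j) := by
  by_contra hne
  simp only [Transcendental, not_exists, not_not] at hne
  have hX : ∀ p : SR A, IsAlgebraic G.K (algebraMap (SR A) E p) := by
    intro p
    induction p using MvPolynomial.induction_on with
    | C a =>
      have : algebraMap (SR A) E (MvPolynomial.C a) = algebraMap ℂ E a := by
        rw [IsScalarTower.algebraMap_apply ℂ (SR A) E]; rfl
      rw [this, IsScalarTower.algebraMap_apply ℂ G.K E]; exact isAlgebraic_algebraMap _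
    | add p q hp hq => rw [map_add]; exact hp.add hq
    | mul_X p s hp =>
      rw [map_mul]
      refine hp.mul ?_
      rcases s with j | s
      · rw [← H.hx]; exact hne j
      · rw [← H.hc]; exact isAlgebraic_algebraMap (⟨_, G.c_mem s.1⟩ : G.K)
  have halgK : ∀ z : E, IsAlgebraic G.K z := by
    intro z
    obtain ⟨p, q, hq, rfl⟩ := IsFractionRing.div_surjective (A := SR A) z
    rw [div_eq_mul_inv]
    exact (hX p).mul (hX q).inv
  have halg : Algebra.IsAlgebraic (Algebra.adjoin ℂ (Set.range G.c)) E := by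
    constructor
    intro z
    open scoped IntermediateField.algebraAdjoinAdjoin in
    exact (IsFractionRing.isAlgebraic_iff (Algebra.adjoin ℂ (Set.range G.c)) (IntermediateField.adjoin ℂ (Set.range G.c)) E).2 (halgK z)
  have h1 := Algebra.IsAlgebraic.trdeg_le_cardinalMk ℂ (Set.range G.c)
  have h2 := (le_trd (A := A) (E := E)).trans (h1.trans Cardinal.mk_range_le)
  rw [Cardinal.mk_fintype, card_Sg G.hA0, h] at h2
  norm_cast at h2; omega

end GP
end Khov

open Pointwise Module
namespace Khov
variable {ι κ : Type} [Fintype ι] [DecidableEq ι] [Fintype κ] [DecidableEq κ] {A : ι → Finset (κ → ℤ)}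

section Gph
variable {R E : Type} [CommRing R] [Field E]

/-- graph of the partial evaluation -/
def Gph (inc : R →+* E) (e : R →+* ℂ) (q : R) : Subring (E × ℂ) where
  carrier := {z | ∃ (N : ℕ) (r : R), z.1 * inc q ^ N = inc r ∧ z.2 * e q ^ N = e r}
  mul_mem' := by
    rintro a b ⟨N, p, h1, h2⟩ ⟨N', p', h1', h2'⟩
    exact ⟨N + N', p * p', by rw [map_mul, ← h1, ← h1', pow_add]; simp; ring, by rw [map_mul, ← h2, ← h2', pow_add]; simp; ring⟩
  add_mem' := by
    rintro a b ⟨N, p, h1, h2⟩ ⟨N', p', h1', h2'⟩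
    exact ⟨N + N', q ^ N' * p + q ^ N * p', by
      rw [map_add, map_mul, map_mul, ← h1, ← h1', map_pow, map_pow, pow_add]; simp; ring, by
      rw [map_add, map_mul, map_mul, ← h2, ← h2', map_pow, map_pow, pow_add]; simp; ring⟩
  neg_mem' := by
    rintro a ⟨N, p, h1, h2⟩
    exact ⟨N, -p, by rw [map_neg, ← h1]; simp, by rw [map_neg, ← h2]; simp⟩
  zero_mem' := ⟨0, 0, by simp, by simp⟩
  one_mem' := ⟨0, 1, by simp, by simp⟩

variable {inc : R →+* E} {e : R →+* ℂ} {q : R}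

theorem Gph.inc_mem (r : R) : (inc r, e r) ∈ Gph inc e q := ⟨0, r, by simp, by simp⟩

theorem Gph.ex (hq : e q ≠ 0) {z : E} (h : ∃ (N : ℕ) (r : R), z * inc q ^ N = inc r) : ∃ z0, (z, z0) ∈ Gph inc e q := by
  obtain ⟨N, r, h⟩ := h
  exact ⟨e r / e q ^ N, N, r, h, by simp [hq]⟩

theorem Gph.frac (hq : e q ≠ 0) {z : E} {r s : R} (hs : s ∣ q) (h : z * inc s = inc r) : (z, e r / e s) ∈ Gph inc e q := by
  obtain ⟨t, rfl⟩ := hs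
  rw [map_mul] at hq
  refine ⟨1, r * t, ?_, ?_⟩
  · simp only [pow_one, map_mul, ← mul_assoc, h]
  · simp only [pow_one, map_mul]
    have := left_ne_zero_of_mul hq
    field_simp

theorem Gph.zero (hk : ∀ r, inc r = 0 → e r = 0) (hq : e q ≠ 0) {z0 : ℂ} (h : ((0 : E), z0) ∈ Gph inc e q) : z0 = 0 := by
  obtain ⟨N, r, h1, h2⟩ := h
  simp only [zero_mul] at h1
  rw [hk r h1.symm] at h2
  exact (mul_eq_zero.1 h2).resolve_right (pow_ne_zero _ hq)

theorem Gph.uniq (hk : ∀ r, inc r = 0 → e r = 0) (hq : e q ≠ 0) {z : E} {z0 z1 : ℂ} (h : (z, z0) ∈ Gph inc e q)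
    (h' : (z, z1) ∈ Gph inc e q) : z0 = z1 := by
  have := (Gph inc e q).sub_mem h h'
  rw [Prod.mk_sub_mk, sub_self] at this
  exact sub_eq_zero.1 (Gph.zero hk hq this)

theorem Gph.inv (hk : ∀ r, inc r = 0 → e r = 0) (hq : e q ≠ 0) {z : E} (hz : z ≠ 0) {z0 z1 : ℂ} (h : (z, z0) ∈ Gph inc e q)
    (h' : (z⁻¹, z1) ∈ Gph inc e q) : z0 ≠ 0 ∧ (z⁻¹, z0⁻¹) ∈ Gph inc e q := by
  have h1 := (Gph inc e q).mul_mem h h'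
  rw [Prod.mk_mul_mk, mul_inv_cancel₀ hz] at h1
  have h2 := Gph.uniq hk hq h1 (Gph inc e q).one_mem
  refine ⟨fun h0 => ?_, ?_⟩
  · rw [h0, zero_mul] at h2; exact zero_ne_one h2
  · rw [← eq_inv_of_mul_eq_one_right h2]; exact h'

theorem mem_xm {T : Subring (E × ℂ)} {x : κ → E} {x0 : κ → ℂ} (h : ∀ j, (x j, x0 j) ∈ T) (h' : ∀ j, ((x j)⁻¹, (x0 j)⁻¹) ∈ T)
    (a : κ → ℤ) : (xm x a, xm x0 a) ∈ T := by
  have h1 : (xm x a, xm x0 a) = ∏ j, (x j ^ a j, x0 j ^ a j) := by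
    ext
    · rw [Prod.fst_prod]; rfl
    · rw [Prod.snd_prod]; rfl
  rw [h1]
  refine Subring.prod_mem _ fun j _ => ?_
  rcases Int.eq_nat_or_neg (a j) with ⟨n, h2 | h2⟩
  · rw [h2, zpow_natCast, zpow_natCast]; exact T.pow_mem (h j) n
  · rw [h2, zpow_neg, zpow_neg, zpow_natCast, zpow_natCast, ← inv_pow, ← inv_pow]; exact T.pow_mem (h' j) n

theorem mem_rel {T : Subring (E × ℂ)} {x : κ → E} {x0 : κ → ℂ} (h : ∀ j, (x j, x0 j) ∈ T) (h' : ∀ j, ((x j)⁻¹, (x0 j)⁻¹) ∈ T)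
    {c : Sg A → E} {c0 : Sg A → ℂ} (hc : ∀ s, (c s, c0 s) ∈ T) (i : ι) :
    (∑ a : {a // a ∈ A i}, c ⟨i, a⟩ * xm x a.1, ∑ a : {a // a ∈ A i}, c0 ⟨i, a⟩ * xm x0 a.1) ∈ T := by
  have h1 : (∑ a : {a // a ∈ A i}, c ⟨i, a⟩ * xm x a.1, ∑ a : {a // a ∈ A i}, c0 ⟨i, a⟩ * xm x0 a.1) =
      ∑ a : {a // a ∈ A i}, (c ⟨i, a⟩, c0 ⟨i, a⟩) * (xm x a.1, xm x0 a.1) := by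
    ext
    · rw [Prod.fst_sum]; rfl
    · rw [Prod.snd_sum]; rfl
  rw [h1]
  exact Subring.sum_mem _ fun a _ => T.mul_mem (hc _) (mem_xm h h' _)

theorem Gph.point (hk : ∀ r, inc r = 0 → e r = 0) (hq : e q ≠ 0) {x : κ → E} (hx : ∀ j, x j ≠ 0) {x0 : κ → ℂ}
    (h : ∀ j, (x j, x0 j) ∈ Gph inc e q) (h' : ∀ j, ∃ w, ((x j)⁻¹, w) ∈ Gph inc e q)
    {c : Sg A → E} {c0 : Sg A → ℂ} (hc : ∀ s, (c s, c0 s) ∈ Gph inc e q)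
    (hrel : ∀ i, ∑ a : {a // a ∈ A i}, c ⟨i, a⟩ * xm x a.1 = 0) : x0 ∈ Zc A c0 := by
  have h1 : ∀ j, x0 j ≠ 0 ∧ ((x j)⁻¹, (x0 j)⁻¹) ∈ Gph inc e q := fun j => by
    obtain ⟨w, hw⟩ := h' j
    exact Gph.inv hk hq (hx j) (h j) hw
  refine ⟨fun j => (h1 j).1, fun i => ?_⟩
  have h2 := mem_rel (A := A) h (fun j => (h1 j).2) hc i
  rw [hrel] at h2
  exact Gph.zero hk hq h2

theorem mem_aeval [Algebra ℂ E] {T : Subring (E × ℂ)} (hT : ∀ a : ℂ, (algebraMap ℂ E a, a) ∈ T)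
    {σ : Type} {c : σ → E} {c0 : σ → ℂ} (hc : ∀ s, (c s, c0 s) ∈ T) (P : MvPolynomial σ ℂ) :
    (MvPolynomial.aeval c P, MvPolynomial.eval c0 P) ∈ T := by
  induction P using MvPolynomial.induction_on with
  | C a => simpa using hT a
  | add p q hp hq => rw [map_add, map_add]; exact T.add_mem hp hq
  | mul_X p s hp =>
    rw [map_mul, map_mul, MvPolynomial.aeval_X, MvPolynomial.eval_X]; exact T.mul_mem hp (hc s)

end Gph

namespace GP
variable {E : Type} [Field E] [Algebra ℂ E] (G : GP A E)
variable [Algebra (SR A) E] [IsScalarTower ℂ (SR A) E]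

/-- evaluation of Laurent elements at a point -/
noncomputable def ev (A : ι → Finset (κ → ℤ)) (E : Type) [Field E] [Algebra ℂ E] [Algebra (SR A) E] (c0 : Sg A → ℂ) (x0 : κ → ℂ) :
    Subring (E × ℂ) :=
  Gph (algebraMap (SR A) E) (MvPolynomial.eval (Sum.elim x0 fun s => c0 s.1)) (mX A)

variable {G}
variable {c0 : Sg A → ℂ} {x0 : κ → ℂ}

theorem ev_q (hx0 : x0 ∈ Zc A c0) : MvPolynomial.eval (Sum.elim x0 fun s : Cp A => c0 s.1) (mX A) ≠ 0 := by
  rw [mX, map_prod]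
  exact Finset.prod_ne_zero_iff.2 fun j _ => by simpa using hx0.1 j

theorem ev_k [IsFractionRing (SR A) E] (r : SR A) (h : algebraMap (SR A) E r = 0) :
    MvPolynomial.eval (Sum.elim x0 fun s : Cp A => c0 s.1) r = 0 := by
  rw [IsFractionRing.injective (SR A) E (h.trans (map_zero _).symm), map_zero]

theorem ev_uniq [IsFractionRing (SR A) E] (hx0 : x0 ∈ Zc A c0) {z : E} {z0 z1 : ℂ} (h : (z, z0) ∈ ev A E c0 x0)
    (h' : (z, z1) ∈ ev A E c0 x0) : z0 = z1 := Gph.uniq ev_k (ev_q hx0) h h'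

theorem ev_lau (hx0 : x0 ∈ Zc A c0) {z : E} (h : z ∈ Lau A E) : ∃ z0, (z, z0) ∈ ev A E c0 x0 := by
  refine Gph.ex (ev_q hx0) ?_
  obtain ⟨N, p, h⟩ := h
  exact ⟨N, p, by rw [← h, mul_comm]⟩

theorem ev_C (a : ℂ) : (algebraMap ℂ E a, a) ∈ ev A E c0 x0 := by
  have := Gph.inc_mem (inc := algebraMap (SR A) E) (e := MvPolynomial.eval (Sum.elim x0 fun s : Cp A => c0 s.1)) (q := mX A)
    (MvPolynomial.C a)
  rw [MvPolynomial.eval_C] at this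
  rw [IsScalarTower.algebraMap_apply ℂ (SR A) E]; exact this

theorem ev_x (H : G.Std) (j) : (G.x j, x0 j) ∈ ev A E c0 x0 := by
  have := Gph.inc_mem (inc := algebraMap (SR A) E) (e := MvPolynomial.eval (Sum.elim x0 fun s : Cp A => c0 s.1)) (q := mX A)
    (MvPolynomial.X (Sum.inl j))
  rw [MvPolynomial.eval_X] at this
  rw [H.hx]; exact this

theorem ev_xinv [IsFractionRing (SR A) E] (hx0 : x0 ∈ Zc A c0) (H : G.Std) (j) : ((G.x j)⁻¹, (x0 j)⁻¹) ∈ ev A E c0 x0 := by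
  obtain ⟨w, hw⟩ := ev_lau hx0 (H.lau_xinv j)
  exact (Gph.inv ev_k (ev_q hx0) (G.x0 j) (ev_x H j) hw).2

theorem ev_c [IsFractionRing (SR A) E] (hx0 : x0 ∈ Zc A c0) (H : G.Std) (s : Sg A) : (G.c s, c0 s) ∈ ev A E c0 x0 := by
  have h1 : ∀ s : Cp A, (G.c s.1, c0 s.1) ∈ ev A E c0 x0 := by
    intro s
    have := Gph.inc_mem (inc := algebraMap (SR A) E) (e := MvPolynomial.eval (Sum.elim x0 fun s : Cp A => c0 s.1)) (q := mX A)
      (MvPolynomial.X (Sum.inr s))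
    rw [MvPolynomial.eval_X] at this
    rw [H.hc]; exact this
  by_cases hs : s.2.1 ≠ 0
  · exact h1 ⟨s, hs⟩
  · obtain ⟨i, ⟨a, ha⟩⟩ := s
    simp only [ne_eq, not_not] at hs
    subst hs
    have e1 : (∑ a : {a // a ∈ A i}, G.c ⟨i, a⟩ * xm G.x a.1) = 0 := G.rel i
    have e2 := hx0.2 i
    rw [← Finset.add_sum_erase _ _ (Finset.mem_univ ⟨0, ha⟩), xm_zero, mul_one, add_eq_zero_iff_eq_neg] at e1 e2
    rw [e1, e2, ← Prod.neg_mk]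
    refine Subring.neg_mem _ ?_
    have h2 : (∑ a ∈ Finset.univ.erase (⟨0, ha⟩ : {a // a ∈ A i}), G.c ⟨i, a⟩ * xm G.x a.1,
        ∑ a ∈ Finset.univ.erase (⟨0, ha⟩ : {a // a ∈ A i}), c0 ⟨i, a⟩ * xm x0 a.1) =
        ∑ a ∈ Finset.univ.erase (⟨0, ha⟩ : {a // a ∈ A i}), (G.c ⟨i, a⟩, c0 ⟨i, a⟩) * (xm G.x a.1, xm x0 a.1) := by
      ext
      · rw [Prod.fst_sum]; rfl
      · rw [Prod.snd_sum]; rfl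
    rw [h2]
    refine Subring.sum_mem _ fun a ha' => Subring.mul_mem _ (h1 ⟨⟨i, a⟩, fun h => ?_⟩) (mem_xm (ev_x H) (ev_xinv hx0 H) _)
    exact Finset.ne_of_mem_erase ha' (Subtype.ext h)

theorem ev_P [IsFractionRing (SR A) E] (hx0 : x0 ∈ Zc A c0) (H : G.Std) (P : MvPolynomial (Sg A) ℂ) :
    (MvPolynomial.aeval G.c P, MvPolynomial.eval c0 P) ∈ ev A E c0 x0 := mem_aeval ev_C (ev_c hx0 H) P

theorem K_frac (G : GP A E) {z : E} (hz : z ∈ G.K) : ∃ r s : MvPolynomial (Sg A) ℂ, s ≠ 0 ∧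
    z * MvPolynomial.aeval G.c s = MvPolynomial.aeval G.c r := by
  obtain ⟨r, s, h⟩ := (IntermediateField.mem_adjoin_range_iff ℂ G.c z).1 hz
  by_cases hs : MvPolynomial.aeval G.c s = 0
  · rw [hs, div_zero] at h
    exact ⟨0, 1, one_ne_zero, by simp [h]⟩
  · refine ⟨r, s, fun h0 => hs (by rw [h0, map_zero]), ?_⟩
    rw [h, div_mul_cancel₀ _ hs]

end GP

/-- generic connectedness -/
def Gen (A : ι → Finset (κ → ℤ)) : Prop := ∃ p : MvPolynomial (Sg A) ℂ, p ≠ 0 ∧ ∀ c, MvPolynomial.eval c p ≠ 0 → IsConnected (Zc A c)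

theorem gen_zero (hA0 : ∀ i, (0 : κ → ℤ) ∈ A i) (hind : Ind A) (hnc : ¬ Crit (latt κ) (GP.B A))
    (h : Fintype.card κ = Fintype.card ι) : Gen A := by
  obtain ⟨G, H⟩ := exists_gp hA0 hind
  have hx : ∀ j, G.x j ∈ G.K := fun j => H.K_closed hnc _ (G.tb0 h _)
  have hxi : ∀ j, (G.x j)⁻¹ ∈ G.K := fun j => H.K_closed hnc _ (G.tb0 h _)
  choose r s hs h1 using fun j => G.K_frac (hx j)
  choose r' s' hs' h1' using fun j => G.K_frac (hxi j)
  let q : MvPolynomial (Sg A) ℂ := (∏ j, s j) * ∏ j, s' j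
  have hq : q ≠ 0 := mul_ne_zero (Finset.prod_ne_zero_iff.2 fun j _ => hs j) (Finset.prod_ne_zero_iff.2 fun j _ => hs' j)
  refine ⟨q, hq, fun c0 hc0 => ?_⟩
  have hsq : ∀ j, s j ∣ q := fun j => Dvd.dvd.mul_right (Finset.dvd_prod_of_mem _ (Finset.mem_univ j)) _
  have hsq' : ∀ j, s' j ∣ q := fun j => Dvd.dvd.mul_left (Finset.dvd_prod_of_mem _ (Finset.mem_univ j)) _
  have hse : ∀ j, MvPolynomial.eval c0 (s j) ≠ 0 := fun j h0 => hc0 (by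
    obtain ⟨t, ht⟩ := hsq j; rw [ht, map_mul, h0, zero_mul])
  let inc : MvPolynomial (Sg A) ℂ →+* FractionRing (SR A) := (MvPolynomial.aeval G.c).toRingHom
  have hpt : (fun j => MvPolynomial.eval c0 (r j) / MvPolynomial.eval c0 (s j)) ∈ Zc A c0 := by
    refine Gph.point (inc := inc) (e := MvPolynomial.eval c0) (q := q) ?_ hc0 G.x0 ?_ ?_ (c := G.c) ?_ G.rel
    · intro r hr
      have : r = 0 := algebraicIndependent_iff.1 G.c_ai r hr
      rw [this, map_zero]
    · intro j; exact Gph.frac hc0 (hsq j) (h1 j)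
    · intro j; exact ⟨_, Gph.frac hc0 (hsq' j) (h1' j)⟩
    · intro s
      have := Gph.inc_mem (inc := inc) (e := MvPolynomial.eval c0) (q := q) (MvPolynomial.X s)
      simpa [inc] using this
  have : Zc A c0 = {fun j => MvPolynomial.eval c0 (r j) / MvPolynomial.eval c0 (s j)} := by
    refine Set.eq_singleton_iff_unique_mem.2 ⟨hpt, fun y hy => ?_⟩
    ext j
    have h2 := Subring.mul_mem _ (GP.ev_x (x0 := y) (c0 := c0) H j) (GP.ev_P hy H (s j))
    rw [Prod.mk_mul_mk, h1] at h2
    have h3 := GP.ev_uniq hy h2 (GP.ev_P hy H (r j))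
    rw [eq_div_iff (hse j)]; exact h3
  rw [this]
  exact isConnected_singleton

end Khov

open Pointwise Module
namespace Khov

open Polynomial in
theorem prim_el {R0 E : Type} [CommRing R0] [IsDomain R0] [IsIntegrallyClosed R0] [Field E] [CharZero E] [Algebra R0 E]
    (hinj : Function.Injective (algebraMap R0 E)) (S : Set E) [Finite S] (halg : ∀ z : E, IsAlgebraic R0 z)
    (hgen : ∀ T : Subfield E, (∀ r, algebraMap R0 E r ∈ T) → S ⊆ T → T = ⊤) :
    ∃ (h : E) (P : R0[X]), IsIntegral R0 h ∧ P.Monic ∧ aeval h P = 0 ∧ (∀ r : R0[X], aeval h r = 0 → P ∣ r) ∧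
      ∀ z : E, ∃ q : R0, q ≠ 0 ∧ ∃ r : R0[X], z * algebraMap R0 E q = aeval h r := by
  haveI : FaithfulSMul R0 E := (faithfulSMul_iff_algebraMap_injective R0 E).2 hinj
  let F := FractionRing R0
  letI : Algebra F E := FractionRing.liftAlgebra R0 E
  haveI : IsScalarTower R0 F E := FractionRing.isScalarTower_liftAlgebra R0 E
  haveI : CharZero F := ((algebraMap F E).charZero_iff (algebraMap F E).injective).2 inferInstance
  have halgF : ∀ z : E, IsAlgebraic F z := fun z => (IsFractionRing.isAlgebraic_iff R0 F E).1 (halg z)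
  have htop : IntermediateField.adjoin F S = ⊤ := by
    have h1 := hgen (IntermediateField.adjoin F S).toSubfield (fun r => by
      rw [IsScalarTower.algebraMap_apply R0 F E]; exact (IntermediateField.adjoin F S).algebraMap_mem _)
      (IntermediateField.subset_adjoin F S)
    refine IntermediateField.ext fun z => ⟨fun _ => trivial, fun _ => ?_⟩
    change z ∈ (IntermediateField.adjoin F S).toSubfield
    rw [h1]; trivial
  haveI h2 : FiniteDimensional F (IntermediateField.adjoin F S) :=
    IntermediateField.finiteDimensional_adjoin fun x _ => (halgF x).isIntegral
  haveI : FiniteDimensional F E := by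
    rw [htop] at h2
    exact IntermediateField.topEquiv.toLinearEquiv.finiteDimensional
  obtain ⟨α, hα⟩ := Field.exists_primitive_element F E
  obtain ⟨a, ha0, ha⟩ := (halg α).exists_integral_multiple
  have haE : algebraMap R0 E a ≠ 0 := fun h => ha0 (hinj (h.trans (map_zero _).symm))
  have hh : IntermediateField.adjoin F {a • α} = ⊤ := by
    rw [eq_top_iff, ← hα, IntermediateField.adjoin_simple_le_iff]
    have h3 : α = (algebraMap F E (algebraMap R0 F a))⁻¹ * (a • α) := by
      rw [← IsScalarTower.algebraMap_apply, Algebra.smul_def, ← mul_assoc, inv_mul_cancel₀ haE, one_mul]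
    have h4 : (algebraMap F E (algebraMap R0 F a))⁻¹ * (a • α) ∈ IntermediateField.adjoin F {a • α} := mul_mem (inv_mem (IntermediateField.algebraMap_mem _ _)) (IntermediateField.mem_adjoin_simple_self F _)
    rwa [← h3] at h4
  refine ⟨a • α, minpoly R0 (a • α), ha, minpoly.monic ha, minpoly.aeval _ _, fun r hr => minpoly.isIntegrallyClosed_dvd ha hr, fun z => ?_⟩
  have hz : z ∈ IntermediateField.adjoin F {a • α} := by rw [hh]; trivial
  rw [← IntermediateField.mem_toSubalgebra, IntermediateField.adjoin_simple_toSubalgebra_of_isAlgebraic (halgF _), Algebra.adjoin_singleton_eq_range_aeval] at hz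
  obtain ⟨p, rfl⟩ := hz
  obtain ⟨b, hb, hbp⟩ := IsLocalization.integerNormalization_spec (nonZeroDivisors R0) p
  refine ⟨b, nonZeroDivisors.ne_zero hb, IsLocalization.integerNormalization (nonZeroDivisors R0) p, ?_⟩
  have h4 := congrArg (aeval (a • α)) hbp
  rw [aeval_map_algebraMap] at h4
  rw [h4, ← IsScalarTower.algebraMap_smul F b p, map_smul, algebraMap_smul, Algebra.smul_def b, mul_comm]
  rfl

/-- linear disjointness from algebraic closedness -/
theorem disj {K E L Ω : Type} [Field K] [Field E] [Field L] [Field Ω] [CharZero K] [Algebra K E] [Algebra K L] [Algebra K Ω]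
    [Algebra E Ω] [Algebra L Ω] [IsScalarTower K E Ω] [IsScalarTower K L Ω] [FiniteDimensional K L]
    (hcl : ∀ z : E, IsAlgebraic K z → ∃ a, algebraMap K E a = z) :
    ∃ τ : Ω →ₗ[E] E, τ 1 = 1 ∧ ∀ l : L, ∃ a : K, τ (algebraMap L Ω l) = algebraMap K E a := by
  obtain ⟨α, hα⟩ := Field.exists_primitive_element K L
  have hαi : IsIntegral K α := IsIntegral.of_finite K α
  let β : Ω := algebraMap L Ω α
  let f := minpoly K α
  have hβ : minpoly K β = f := minpoly.algebraMap_eq (algebraMap L Ω).injective α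
  have hβi : IsIntegral K β := hαi.map (IsScalarTower.toAlgHom K L Ω)
  have hβE : IsIntegral E β := hβi.tower_top
  have hdvd : minpoly E β ∣ f.map (algebraMap K E) := by
    rw [← hβ]; exact minpoly.dvd_map_of_isScalarTower K E β
  have hfm : f.Monic := minpoly.monic hαi
  have hdeg : (minpoly E β).natDegree = f.natDegree := by
    have h1 := integralClosure.mem_lifts_of_monic_of_dvd_map E hfm (minpoly.monic hβE) hdvd
    rw [Polynomial.lifts_iff_coeff_lifts] at h1
    have h2 : ∀ n, ∃ a, algebraMap K E a = (minpoly E β).coeff n := by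
      intro n
      obtain ⟨w, hw⟩ := h1 n
      rw [← hw]
      exact hcl _ (w.2 : IsIntegral K w.1).isAlgebraic
    have h3 : minpoly E β ∈ Polynomial.lifts (algebraMap K E) := by
      rw [Polynomial.lifts_iff_coeff_lifts]; intro n; obtain ⟨a, ha⟩ := h2 n; exact ⟨a, ha⟩
    obtain ⟨g, hg, hgd, hgm⟩ := Polynomial.lifts_and_natDegree_eq_and_monic h3 (minpoly.monic hβE)
    have h4 : Polynomial.aeval β g = 0 := by
      have := minpoly.aeval E β
      rw [← hg, Polynomial.aeval_map_algebraMap] at this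
      exact this
    have h5 := Polynomial.natDegree_le_of_dvd (minpoly.dvd K β h4) hgm.ne_zero
    rw [hβ, hgd] at h5
    refine le_antisymm ?_ h5
    refine (Polynomial.natDegree_le_of_dvd hdvd (hfm.map _).ne_zero).trans ?_
    rw [hfm.natDegree_map]
  have hli : LinearIndependent E (fun m : Fin f.natDegree => β ^ (m : ℕ)) := by
    rw [← hdeg]
    exact linearIndependent_pow β
  have hpos : 0 < f.natDegree := minpoly.natDegree_pos hαi
  let b := Basis.extend hli.linearIndepOn_id
  obtain ⟨τ, hτ⟩ : ∃ τ : Ω →ₗ[E] E, ∀ m : Fin f.natDegree, τ (β ^ (m : ℕ)) = if (m : ℕ) = 0 then 1 else 0 := by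
    obtain ⟨g, hg⟩ := LinearMap.exists_leftInverse_of_injective (Fintype.linearCombination E (fun m : Fin f.natDegree => β ^ (m : ℕ)))
      (LinearMap.ker_eq_bot.2 (linearIndependent_iff_injective_fintypeLinearCombination.1 hli))
    refine ⟨(LinearMap.proj ⟨0, hpos⟩).comp g, fun m => ?_⟩
    have h1 := congrArg (fun φ => φ (Pi.single m 1)) hg
    simp only [LinearMap.comp_apply, LinearMap.id_apply] at h1
    rw [Fintype.linearCombination_apply_single, one_smul] at h1
    rw [LinearMap.comp_apply, h1, LinearMap.proj_apply, Pi.single_apply]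
    simp only [Fin.ext_iff, eq_comm]
  refine ⟨τ, ?_, fun l => ?_⟩
  · simpa using hτ ⟨0, hpos⟩
  · have hl : l ∈ IntermediateField.adjoin K {α} := by rw [hα]; trivial
    rw [← IntermediateField.mem_toSubalgebra, IntermediateField.adjoin_simple_toSubalgebra_of_isAlgebraic hαi.isAlgebraic, Algebra.adjoin_singleton_eq_range_aeval] at hl
    obtain ⟨p, rfl⟩ := hl
    have h1 : Polynomial.aeval α p = Polynomial.aeval α (p %ₘ f) := by
      conv_lhs => rw [← Polynomial.modByMonic_add_div p f]
      rw [map_add, map_mul, minpoly.aeval, zero_mul, add_zero]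
    have h2 : (p %ₘ f).natDegree < f.natDegree := Polynomial.natDegree_modByMonic_lt _ hfm (fun h => by rw [h] at hpos; simp at hpos)
    refine ⟨(p %ₘ f).coeff 0, ?_⟩
    have h3 : algebraMap L Ω (Polynomial.aeval α p) = ∑ m : Fin f.natDegree, algebraMap K E ((p %ₘ f).coeff m) • β ^ (m : ℕ) := by
      rw [h1, ← Polynomial.aeval_algebraMap_apply, Polynomial.aeval_eq_sum_range' h2, Finset.sum_range]
      refine Finset.sum_congr rfl fun m _ => ?_
      rw [IsScalarTower.algebraMap_smul]
    change τ (algebraMap L Ω (Polynomial.aeval α p)) = _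
    rw [h3, map_sum]
    simp only [map_smul, hτ, smul_eq_mul, mul_ite, mul_one, mul_zero]
    rw [Finset.sum_eq_single ⟨0, hpos⟩]
    · simp
    · intro m _ hm
      rw [if_neg]; intro h; exact hm (Fin.ext h)
    · simp

end Khov

open Pointwise Module
namespace Khov
variable {ι κ : Type} [Fintype ι] [DecidableEq ι] [Fintype κ] [DecidableEq κ] {A : ι → Finset (κ → ℤ)}

/-- the coefficient ring -/
abbrev CR (A : ι → Finset (κ → ℤ)) : Type := MvPolynomial (Sg A) ℂ

namespace GP
variable {E : Type} [Field E] [Algebra ℂ E] (G : GP A E)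

/-- evaluation of a one-variable polynomial at `(c, y)` -/
noncomputable def inc0 (y : E) : Polynomial (CR A) →+* E :=
  Polynomial.eval₂RingHom (MvPolynomial.aeval G.c).toRingHom y

/-- evaluation of a two-variable polynomial at `(c, y, h)` -/
noncomputable def inc1 (y h : E) : Polynomial (Polynomial (CR A)) →+* E :=
  Polynomial.eval₂RingHom (G.inc0 y) h

@[simp] theorem inc0_C (y : E) (p) : G.inc0 y (Polynomial.C p) = MvPolynomial.aeval G.c p := by simp [inc0]
@[simp] theorem inc0_X (y : E) : G.inc0 y Polynomial.X = y := by simp [inc0]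
@[simp] theorem inc1_C (y h : E) (p) : G.inc1 y h (Polynomial.C p) = G.inc0 y p := by simp [inc1]
@[simp] theorem inc1_X (y h : E) : G.inc1 y h Polynomial.X = h := by simp [inc1]

theorem inc0_opt (y : E) (p : MvPolynomial (Option (Sg A)) ℂ) : G.inc0 y (MvPolynomial.optionEquivLeft ℂ (Sg A) p) =
    MvPolynomial.aeval (fun o : Option (Sg A) => o.elim y G.c) p := by
  have : (G.inc0 y).comp (MvPolynomial.optionEquivLeft ℂ (Sg A)).toAlgHom.toRingHom =
      (MvPolynomial.aeval (fun o : Option (Sg A) => o.elim y G.c)).toRingHom := by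
    apply MvPolynomial.ringHom_ext
    · intro r; simp
    · intro i; cases i <;> simp
  exact congrArg (fun f => f p) this

variable [Algebra (SR A) E] [IsScalarTower ℂ (SR A) E]

theorem inc0_inj {y : E} (hy : Transcendental G.K y) : Function.Injective (G.inc0 y) := by
  rw [injective_iff_map_eq_zero]
  intro p hp
  obtain ⟨p, rfl⟩ := (MvPolynomial.optionEquivLeft ℂ (Sg A)).surjective p
  rw [inc0_opt] at hp
  rw [algebraicIndependent_iff.1 (G.tb1_ai hy) p hp, map_zero]

theorem fld_top [IsFractionRing (SR A) E] {G : GP A E} (H : G.Std) (T : Subfield E) (hC : ∀ a : ℂ, algebraMap ℂ E a ∈ T)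
    (hx : ∀ j, G.x j ∈ T) (hc : ∀ s, G.c s ∈ T) : T = ⊤ := by
  have h1 : ∀ p : SR A, algebraMap (SR A) E p ∈ T := by
    intro p
    induction p using MvPolynomial.induction_on with
    | C a =>
      have := hC a
      rw [IsScalarTower.algebraMap_apply ℂ (SR A) E] at this; exact this
    | add p q hp hq => rw [map_add]; exact T.add_mem hp hq
    | mul_X p i hp =>
      rw [map_mul]
      refine T.mul_mem hp ?_
      rcases i with j | s
      · rw [← H.hx]; exact hx j
      · rw [← H.hc]; exact hc _
  rw [eq_top_iff]
  intro z _
  obtain ⟨a, b, _, rfl⟩ := IsFractionRing.div_surjective (A := SR A) z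
  exact T.div_mem (h1 a) (h1 b)

theorem curve [IsFractionRing (SR A) E] (H : G.Std) (hcard : Fintype.card κ = Fintype.card ι + 1) {j : κ}
    (hy : Transcendental G.K (G.x j)) : ∃ (h : E) (P : Polynomial (Polynomial (CR A))), h ∈ Lau A E ∧ P.Monic ∧
    G.inc1 (G.x j) h P = 0 ∧ (∀ r, G.inc1 (G.x j) h r = 0 → P ∣ r) ∧
    ∀ z : E, ∃ q : Polynomial (CR A), q ≠ 0 ∧ ∃ r, z * G.inc0 (G.x j) q = G.inc1 (G.x j) h r := by
  letI : Algebra (Polynomial (CR A)) E := (G.inc0 (G.x j)).toAlgebra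
  have e0 : ∀ p, algebraMap (Polynomial (CR A)) E p = G.inc0 (G.x j) p := fun _ => rfl
  haveI : CharZero E := charZ E
  have halg : ∀ z : E, IsAlgebraic (Polynomial (CR A)) z := by
    intro z
    have h1 := (G.tb1 hcard hy).isAlgebraic.isAlgebraic z
    refine IsAlgebraic.of_ringHom_of_comp_eq
      (((G.tb1_ai hy).aevalEquiv.toAlgHom.comp (MvPolynomial.optionEquivLeft ℂ (Sg A)).symm.toAlgHom).toRingHom)
      (RingHom.id E) h1 ?_ (fun _ _ h => h) ?_
    · exact (G.tb1_ai hy).aevalEquiv.surjective.comp (MvPolynomial.optionEquivLeft ℂ (Sg A)).symm.surjective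
    · refine RingHom.ext fun p => ?_
      obtain ⟨p, rfl⟩ := (MvPolynomial.optionEquivLeft ℂ (Sg A)).surjective p
      simp only [RingHom.comp_apply, RingHom.id_apply, e0, inc0_opt]
      simp
      rfl
  obtain ⟨h, P, h1, h2, h3, h4, h5⟩ := prim_el (R0 := Polynomial (CR A)) (E := E) (by
      rw [show (algebraMap (Polynomial (CR A)) E : Polynomial (CR A) → E) = G.inc0 (G.x j) from rfl]
      exact G.inc0_inj hy) (Set.range G.x) halg (by
    intro T hT hS
    refine fld_top H T ?_ (fun j => hS ⟨j, rfl⟩) ?_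
    · intro a
      have := hT (Polynomial.C (MvPolynomial.C a))
      rw [e0, inc0_C, MvPolynomial.aeval_C] at this; exact this
    · intro s
      have := hT (Polynomial.C (MvPolynomial.X s))
      rw [e0, inc0_C, MvPolynomial.aeval_X] at this; exact this)
  refine ⟨h, P, ?_, h2, h3, h4, h5⟩
  apply H.lau_int
  obtain ⟨p, hp, hp'⟩ := h1
  have hL : ∀ r : Polynomial (CR A), G.inc0 (G.x j) r ∈ Lau A E := by
    intro r
    induction r using Polynomial.induction_on' with
    | add p q hp hq => rw [map_add]; exact add_mem hp hq
    | monomial n a =>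
      rw [← Polynomial.C_mul_X_pow_eq_monomial, map_mul, map_pow, inc0_C, inc0_X]
      refine mul_mem (H.adjoin_le ?_) (pow_mem (H.lau_x j) _)
      rw [Algebra.adjoin_range_eq_range_aeval]; exact ⟨a, rfl⟩
  let f : Polynomial (CR A) →+* Lau A E := (G.inc0 (G.x j)).codRestrict (Lau A E) hL
  refine ⟨p.map f, hp.map f, ?_⟩
  rw [Polynomial.eval₂_map]
  exact hp'

/-- separability certificate -/
theorem curve_sep {y h : E} (hinj : Function.Injective (G.inc0 y)) {P : Polynomial (Polynomial (CR A))} (hP : P.Monic) (hP0 : G.inc1 y h P = 0)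
    (hd : ∀ r, G.inc1 y h r = 0 → P ∣ r)
    (hz : ∀ z : E, ∃ q : Polynomial (CR A), q ≠ 0 ∧ ∃ r, z * G.inc0 y q = G.inc1 y h r) :
    ∃ q : Polynomial (CR A), q ≠ 0 ∧ ∃ r, P ∣ Polynomial.derivative P * r - Polynomial.C q := by
  have hN : P.natDegree ≠ 0 := by
    intro h0
    rw [hP.natDegree_eq_zero] at h0
    rw [h0, map_one] at hP0; exact one_ne_zero hP0
  have h1 : G.inc1 y h (Polynomial.derivative P) ≠ 0 := by
    intro h0
    have h2 := hd _ h0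
    exact hP.not_dvd_of_natDegree_lt (by
      intro h3
      have h4 := Polynomial.natDegree_eq_zero_of_derivative_eq_zero h3
      exact hN h4) (Polynomial.natDegree_derivative_lt hN) h2
  obtain ⟨q, hq, r, hr⟩ := hz (G.inc1 y h (Polynomial.derivative P))⁻¹
  refine ⟨q, hq, r, hd _ ?_⟩
  rw [map_sub (G.inc1 y h) (Polynomial.derivative P * r) (Polynomial.C q), map_mul, ← hr, inc1_C, ← mul_assoc, mul_inv_cancel₀ h1, one_mul, sub_self]

end GP
end Khov

open Pointwise Module
namespace Khov

section uni
open Polynomial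
variable {S T : Type} [CommRing S] [CommRing T]

/-- universal polynomial of degree `r` with leading coefficient `b` -/
noncomputable def uni {r M : ℕ} (b : S) (u : Fin r × Fin M → S) : S[X][X] :=
  C (C b) * X ^ r + ∑ p : Fin r × Fin M, C (C (u p) * X ^ (p.2 : ℕ)) * X ^ (p.1 : ℕ)

/-- evaluation of two-variable polynomials -/
noncomputable def ev2 (f : S →+* T) (y h : T) : S[X][X] →+* T := eval₂RingHom (eval₂RingHom f y) h

variable {r M : ℕ}

theorem ev2_uni (f : S →+* T) (y h : T) (b : S) (u : Fin r × Fin M → S) :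
    ev2 f y h (uni b u) = f b * h ^ r + ∑ p : Fin r × Fin M, f (u p) * (y ^ (p.2 : ℕ) * h ^ (p.1 : ℕ)) := by
  simp only [ev2, uni, map_add, map_sum, map_mul, map_pow, coe_eval₂RingHom, eval₂_C, eval₂_X, mul_assoc]

theorem map_uni (f : S →+* T) (b : S) (u : Fin r × Fin M → S) :
    (uni b u).map (mapRingHom f) = uni (f b) (fun p => f (u p)) := by
  simp only [uni, Polynomial.map_add, Polynomial.map_mul, Polynomial.map_pow, map_C, map_X, Polynomial.map_sum, coe_mapRingHom,
    Polynomial.map_mul, Polynomial.map_pow]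

theorem ev2_map {S' : Type} [CommRing S'] (g : S' →+* S) (f : S →+* T) (y h : T) (p : S'[X][X]) :
    ev2 f y h (p.map (mapRingHom g)) = ev2 (f.comp g) y h p := by
  simp only [ev2, coe_eval₂RingHom, eval₂_map]
  congr 1
  refine RingHom.ext fun q => ?_
  simp [eval₂_map]

theorem uni_coeff (b : S) (u : Fin r × Fin M → S) : (uni b u).coeff r = C b := by
  rw [uni, coeff_add, coeff_C_mul_X_pow, if_pos rfl, finset_sum_coeff, Finset.sum_eq_zero, add_zero]
  intro p _
  rw [coeff_C_mul_X_pow, if_neg (ne_of_gt p.1.2)]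

theorem uni_natDegree (b : S) (u : Fin r × Fin M → S) : (uni b u).natDegree ≤ r := by
  refine natDegree_add_le_of_degree_le (natDegree_C_mul_X_pow_le _ _) (natDegree_sum_le_of_forall_le _ _ fun p _ => ?_)
  exact (natDegree_C_mul_X_pow_le _ _).trans p.1.2.le

theorem eq_uni {p : S[X][X]} (hp : p.Monic) (hr : p.natDegree = r) (hM : ∀ m, (p.coeff m).natDegree < M) :
    p = uni 1 (fun q : Fin r × Fin M => (p.coeff q.1).coeff q.2) := by
  conv_lhs => rw [hp.as_sum, hr]
  rw [uni, map_one, map_one, one_mul, Fintype.sum_prod_type, Finset.sum_range]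
  congr 1
  refine Finset.sum_congr rfl fun i _ => ?_
  dsimp only
  rw [← Finset.sum_mul, ← map_sum]
  congr 2
  have := as_sum_range_C_mul_X_pow' (p := p.coeff i) (hM i)
  rw [Finset.sum_range] at this
  exact this

end uni

variable {ι κ : Type} [Fintype ι] [DecidableEq ι] [Fintype κ] [DecidableEq κ] {A : ι → Finset (κ → ℤ)}
namespace GP
variable {E : Type} [Field E] [Algebra ℂ E] (G : GP A E)

theorem inc1_eq (y h : E) : G.inc1 y h = ev2 (MvPolynomial.aeval G.c).toRingHom y h := rfl

variable [Algebra (SR A) E] [IsScalarTower ℂ (SR A) E]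

/-- the fraction field of the coefficient ring -/
abbrev CK (A : ι → Finset (κ → ℤ)) : Type := FractionRing (CR A)

theorem aeval_inj : Function.Injective (MvPolynomial.aeval G.c : CR A →ₐ[ℂ] E).toRingHom := G.c_ai

/-- embedding of the fraction field -/
noncomputable def phi : CK A →+* E := IsFractionRing.lift G.aeval_inj

theorem phi_alg (p : CR A) : G.phi (algebraMap (CR A) (CK A) p) = MvPolynomial.aeval G.c p :=
  IsFractionRing.lift_algebraMap G.aeval_inj p

theorem phi_cl (hcl : ∀ θ : E, IsAlgebraic G.K θ → θ ∈ G.K) (z : E)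
    (hz : letI := G.phi.toAlgebra; IsAlgebraic (CK A) z) : ∃ a, G.phi a = z := by
  letI := G.phi.toAlgebra
  letI : Algebra (CR A) E := (MvPolynomial.aeval G.c : CR A →ₐ[ℂ] E).toRingHom.toAlgebra
  haveI : IsScalarTower (CR A) (CK A) E := IsScalarTower.of_algebraMap_eq fun p => (G.phi_alg p).symm
  have h1 : IsAlgebraic (CR A) z := (IsFractionRing.isAlgebraic_iff (CR A) (CK A) E).2 hz
  have h2 : IsAlgebraic (Algebra.adjoin ℂ (Set.range G.c)) z := by
    refine h1.ringHom_of_comp_eq (G.c_ai.aevalEquiv.toAlgHom.toRingHom) (RingHom.id E) G.c_ai.aevalEquiv.injective ?_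
    refine RingHom.ext fun p => ?_
    change ((G.c_ai.aevalEquiv p : Algebra.adjoin ℂ (Set.range G.c)) : E) = MvPolynomial.aeval G.c p
    simp
  obtain ⟨r, s, hs, h3⟩ := G.K_frac (hcl z (G.adj_alg_K h2))
  refine ⟨algebraMap _ _ r / algebraMap _ _ s, ?_⟩
  rw [map_div₀, phi_alg, phi_alg, ← h3, mul_div_cancel_right₀]
  intro h0
  exact hs (algebraicIndependent_iff.1 G.c_ai s h0)

theorem irr_aux (hcl : ∀ θ : E, IsAlgebraic G.K θ → θ ∈ G.K) {y h : E} {P : Polynomial (Polynomial (CR A))} (hP : P.Monic)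
    (hP0 : G.inc1 y h P = 0) (hd : ∀ r, G.inc1 y h r = 0 → P ∣ r) {r s M : ℕ} (hr : r < P.natDegree) (hs : s < P.natDegree)
    (L : Type) [Field L] [Algebra (CK A) L] [FiniteDimensional (CK A) L] (u : Fin r × Fin M → L) (v : Fin s × Fin M → L) :
    P.map (Polynomial.mapRingHom ((algebraMap (CK A) L).comp (algebraMap (CR A) (CK A)))) ≠ uni 1 u * uni 1 v := by
  intro heq
  letI : Algebra (CK A) E := G.phi.toAlgebra
  have ephi : ∀ a, algebraMap (CK A) E a = G.phi a := fun _ => rfl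
  let Ω := AlgebraicClosure E
  let f : L →ₐ[CK A] Ω := IsAlgClosed.lift
  letI : Algebra L Ω := f.toRingHom.toAlgebra
  haveI : IsScalarTower (CK A) L Ω := IsScalarTower.of_algebraMap_eq fun a => (f.commutes a).symm
  haveI : CharZero (CK A) := charZ (CK A)
  obtain ⟨τ, h1, hτ⟩ := disj (K := CK A) (E := E) (L := L) (Ω := Ω) (fun z hz => G.phi_cl hcl z hz)
  have key : ∀ (r : ℕ) (hr : r < P.natDegree) (u : Fin r × Fin M → L),
      ev2 (algebraMap L Ω) (algebraMap E Ω y) (algebraMap E Ω h) (uni 1 u) ≠ 0 := by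
    intro r hr u h0
    rw [ev2_uni] at h0
    choose a ha using fun p => hτ (u p)
    have h2 : h ^ r + ∑ p : Fin r × Fin M, G.phi (a p) * (y ^ (p.2 : ℕ) * h ^ (p.1 : ℕ)) = 0 := by
      have h3 := congrArg τ h0
      rw [map_zero, map_add, map_sum, map_one, one_mul] at h3
      rw [← h3]
      congr 1
      · rw [← map_pow, Algebra.algebraMap_eq_smul_one, map_smul, h1, smul_eq_mul, mul_one]
      · refine Finset.sum_congr rfl fun p _ => ?_
        rw [← ephi, ← ha, ← map_pow, ← map_pow, ← map_mul, mul_comm (algebraMap L Ω (u p)), ← Algebra.smul_def, map_smul, smul_eq_mul, mul_comm]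
    obtain ⟨b, hb⟩ := IsLocalization.exist_integer_multiples_of_finite (nonZeroDivisors (CR A)) a
    choose d hd' using hb
    have hb0 : (b : CR A) ≠ 0 := nonZeroDivisors.coe_ne_zero b
    have h4 : G.inc1 y h (uni (b : CR A) d) = 0 := by
      rw [inc1_eq, ev2_uni]
      have : ∀ p, (MvPolynomial.aeval G.c).toRingHom (d p) = (MvPolynomial.aeval G.c).toRingHom (b : CR A) * G.phi (a p) := by
        intro p
        have := congrArg G.phi (hd' p)
        rw [phi_alg, Algebra.smul_def, map_mul, phi_alg] at this
        exact this
      simp only [this, mul_assoc, ← Finset.mul_sum, ← mul_add]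
      rw [h2, mul_zero]
    have h5 := hd _ h4
    refine hP.not_dvd_of_natDegree_lt ?_ ((uni_natDegree _ _).trans_lt hr) h5
    intro h6
    have := uni_coeff (b : CR A) d
    rw [h6, Polynomial.coeff_zero] at this
    exact hb0 (Polynomial.C_eq_zero.1 this.symm)
  have h2 : ev2 (algebraMap L Ω) (algebraMap E Ω y) (algebraMap E Ω h)
      (P.map (Polynomial.mapRingHom ((algebraMap (CK A) L).comp (algebraMap (CR A) (CK A))))) = 0 := by
    rw [ev2_map]
    have h3 := congrArg (algebraMap E Ω) hP0
    rw [map_zero, inc1_eq] at h3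
    rw [← h3]
    have h4 : (algebraMap L Ω).comp ((algebraMap (CK A) L).comp (algebraMap (CR A) (CK A))) =
        (algebraMap E Ω).comp (MvPolynomial.aeval G.c : CR A →ₐ[ℂ] E).toRingHom := by
      refine RingHom.ext fun p => ?_
      rw [RingHom.comp_apply, RingHom.comp_apply, ← IsScalarTower.algebraMap_apply, IsScalarTower.algebraMap_apply (CK A) E Ω]
      exact congrArg (algebraMap E Ω) (G.phi_alg p)
    rw [h4]
    simp only [ev2, Polynomial.coe_eval₂RingHom]
    rw [Polynomial.hom_eval₂]
    congr 1
    refine RingHom.ext fun q => ?_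
    simp only [RingHom.comp_apply, Polynomial.coe_eval₂RingHom]
    rw [Polynomial.hom_eval₂]
  rw [heq, map_mul] at h2
  rcases mul_eq_zero.1 h2 with h3 | h3
  · exact key r hr u h3
  · exact key s hs v h3

theorem irr_rs (hcl : ∀ θ : E, IsAlgebraic G.K θ → θ ∈ G.K) {y h : E} {P : Polynomial (Polynomial (CR A))} (hP : P.Monic)
    (hP0 : G.inc1 y h P = 0) (hd : ∀ r, G.inc1 y h r = 0 → P ∣ r) {r s : ℕ} (M : ℕ) (hr : r < P.natDegree) (hs : s < P.natDegree) :
    ∃ p : CR A, p ≠ 0 ∧ ∀ c, MvPolynomial.eval c p ≠ 0 → ∀ (u : Fin r × Fin M → ℂ) (v : Fin s × Fin M → ℂ),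
    P.map (Polynomial.mapRingHom (MvPolynomial.eval c)) ≠ uni 1 u * uni 1 v := by
  let U := (Fin r × Fin M) ⊕ (Fin s × Fin M)
  let X1 : Polynomial (Polynomial (MvPolynomial U (CR A))) := P.map (Polynomial.mapRingHom MvPolynomial.C)
  let X2 : Polynomial (Polynomial (MvPolynomial U (CR A))) := uni 1 (fun p : Fin r × Fin M => MvPolynomial.X (Sum.inl p)) *
    uni 1 (fun p : Fin s × Fin M => MvPolynomial.X (Sum.inr p))
  let Q : ℕ × ℕ → MvPolynomial U (CR A) := fun ab => (X1.coeff ab.1).coeff ab.2 - (X2.coeff ab.1).coeff ab.2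
  have hQ : ∀ (L : Type) [Field L] (f : CR A →+* L) (u : U → L), (∀ i, MvPolynomial.eval₂ f u (Q i) = 0) ↔
      P.map (Polynomial.mapRingHom f) = uni 1 (fun p => u (Sum.inl p)) * uni 1 (fun p => u (Sum.inr p)) := by
    intro L _ f u
    have e1 : X1.map (Polynomial.mapRingHom (MvPolynomial.eval₂Hom f u)) = P.map (Polynomial.mapRingHom f) := by
      simp only [X1]
      rw [Polynomial.map_map, Polynomial.mapRingHom_comp]
      congr 2
      exact RingHom.ext fun p => by simp
    have e2 : X2.map (Polynomial.mapRingHom (MvPolynomial.eval₂Hom f u)) =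
        uni 1 (fun p => u (Sum.inl p)) * uni 1 (fun p => u (Sum.inr p)) := by
      simp only [X2]
      rw [Polynomial.map_mul, map_uni, map_uni]
      simp
    rw [← e1, ← e2]
    have e3 : ∀ i : ℕ × ℕ, MvPolynomial.eval₂ f u (Q i) = 0 ↔
        ((X1.map (Polynomial.mapRingHom (MvPolynomial.eval₂Hom f u))).coeff i.1).coeff i.2 =
        ((X2.map (Polynomial.mapRingHom (MvPolynomial.eval₂Hom f u))).coeff i.1).coeff i.2 := by
      intro i
      have e4 : MvPolynomial.eval₂ f u (Q i) = MvPolynomial.eval₂Hom f u ((X1.coeff i.1).coeff i.2) -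
        MvPolynomial.eval₂Hom f u ((X2.coeff i.1).coeff i.2) := map_sub (MvPolynomial.eval₂Hom f u) _ _
      have e5 : ∀ Y : Polynomial (Polynomial (MvPolynomial U (CR A))),
          ((Y.map (Polynomial.mapRingHom (MvPolynomial.eval₂Hom f u))).coeff i.1).coeff i.2 =
          MvPolynomial.eval₂Hom f u ((Y.coeff i.1).coeff i.2) := by
        intro Y
        rw [Polynomial.coeff_map, Polynomial.coe_mapRingHom, Polynomial.coeff_map]
      rw [e4, sub_eq_zero, e5, e5]
    constructor
    · intro hh
      ext a b
      exact (e3 (a, b)).1 (hh _)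
    · intro hh i
      rw [e3, hh]
  obtain ⟨p, hp, h1⟩ := elim Q (by
    intro L _ _ _ u hu
    rw [hQ] at hu
    exact G.irr_aux hcl hP hP0 hd hr hs L _ _ hu)
  refine ⟨p, hp, fun c hc u v heq => h1 c hc (Sum.elim u v) ?_⟩
  rw [hQ]
  exact heq

theorem irr (hcl : ∀ θ : E, IsAlgebraic G.K θ → θ ∈ G.K) {y h : E} {P : Polynomial (Polynomial (CR A))} (hP : P.Monic)
    (hP0 : G.inc1 y h P = 0) (hd : ∀ r, G.inc1 y h r = 0 → P ∣ r) (M : ℕ) :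
    ∃ p : CR A, p ≠ 0 ∧ ∀ c, MvPolynomial.eval c p ≠ 0 → ∀ G' H' : Polynomial (Polynomial ℂ), G'.Monic → H'.Monic →
    (∀ m, (G'.coeff m).natDegree ≤ M) → (∀ m, (H'.coeff m).natDegree ≤ M) →
    P.map (Polynomial.mapRingHom (MvPolynomial.eval c)) = G' * H' → G'.natDegree = 0 ∨ H'.natDegree = 0 := by
  choose p hp h1 using fun rs : Fin P.natDegree × Fin P.natDegree => G.irr_rs hcl hP hP0 hd (M + 1) rs.1.2 rs.2.2
  refine ⟨∏ rs, p rs, Finset.prod_ne_zero_iff.2 fun rs _ => hp rs, fun c hc G' H' hG hH hGM hHM heq => ?_⟩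
  rw [map_prod] at hc
  have hc' := fun rs => Finset.prod_ne_zero_iff.1 hc rs (Finset.mem_univ rs)
  have hN : P.natDegree = G'.natDegree + H'.natDegree := by
    rw [← hG.natDegree_mul hH, ← heq, hP.natDegree_map]
  by_contra! hcon
  have a1 : G'.natDegree < P.natDegree := by omega
  have a2 : H'.natDegree < P.natDegree := by omega
  have b1 := eq_uni hG rfl fun m => Nat.lt_succ_of_le (hGM m)
  have b2 := eq_uni hH rfl fun m => Nat.lt_succ_of_le (hHM m)
  have b3 := congrArg₂ (fun a b => a * b) b1 b2
  exact h1 (⟨_, a1⟩, ⟨_, a2⟩) c (hc' _) _ _ (heq.trans b3)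

end GP
end Khov

open Pointwise Module
namespace Khov

section
open Polynomial
variable {S : Type} [CommRing S]

theorem ev2_eq (f : S →+* ℂ) (y h : ℂ) (R : S[X][X]) :
    ev2 f y h R = ((R.map (mapRingHom f)).map (evalRingHom y)).eval h := by
  rw [ev2, coe_eval₂RingHom, Polynomial.map_map, eval_map]
  congr 1
  refine RingHom.ext fun q => ?_
  simp [eval_map]

theorem ev2_C (f : S →+* ℂ) (y h : ℂ) (q : S[X]) : ev2 f y h (C q) = (q.map f).eval y := by
  rw [ev2, coe_eval₂RingHom, eval₂_C, coe_eval₂RingHom, eval_map]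

theorem ev2_cont (f : S →+* ℂ) (R : S[X][X]) : Continuous fun z : ℂ × ℂ => ev2 f z.1 z.2 R := by
  induction R using Polynomial.induction_on' with
  | add p q hp hq => simp only [map_add]; exact hp.add hq
  | monomial n a =>
    have : ∀ z : ℂ × ℂ, ev2 f z.1 z.2 (monomial n a) = (a.map f).eval z.1 * z.2 ^ n := by
      intro z
      rw [← C_mul_X_pow_eq_monomial, map_mul, map_pow, ev2_C]
      congr 2
      rw [ev2, coe_eval₂RingHom, eval₂_X]
    simp only [this]
    exact ((a.map f).continuous.comp continuous_fst).mul (continuous_snd.pow n)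

theorem lead_gen {σ : Type} {q : (MvPolynomial σ ℂ)[X]} {c : σ → ℂ} (h : MvPolynomial.eval c q.leadingCoeff ≠ 0) :
    q.map (MvPolynomial.eval c) ≠ 0 := by
  intro h0
  apply h
  have := congrArg (fun p => p.coeff q.natDegree) h0
  simpa [coeff_map] using this

end

variable {ι κ : Type} [Fintype ι] [DecidableEq ι] [Fintype κ] [DecidableEq κ] {A : ι → Finset (κ → ℤ)}

/-- the open part of the zero set lying over a principal open set of the `j`-th coordinate -/
def Uj (A : ι → Finset (κ → ℤ)) (c0 : Sg A → ℂ) (j : κ) (q : Polynomial (CR A)) : Set (κ → ℂ) :=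
  {x | x ∈ Zc A c0 ∧ (q.map (MvPolynomial.eval c0)).eval (x j) ≠ 0}

namespace GP
variable {E : Type} [Field E] [Algebra ℂ E] (G : GP A E)
variable [Algebra (SR A) E] [IsScalarTower ℂ (SR A) E]

theorem ev_inc0 [IsFractionRing (SR A) E] (H : G.Std) {c0 : Sg A → ℂ} {x0 : κ → ℂ} (hx0 : x0 ∈ Zc A c0) (j : κ)
    (R : Polynomial (CR A)) : (G.inc0 (G.x j) R, (R.map (MvPolynomial.eval c0)).eval (x0 j)) ∈ ev A E c0 x0 := by
  induction R using Polynomial.induction_on' with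
  | add p q hp hq =>
    rw [map_add, Polynomial.map_add, Polynomial.eval_add]; exact Subring.add_mem _ hp hq
  | monomial n a =>
    rw [← Polynomial.C_mul_X_pow_eq_monomial, map_mul, map_pow, inc0_C, inc0_X, Polynomial.map_mul, Polynomial.map_pow,
      Polynomial.map_C, Polynomial.map_X, Polynomial.eval_mul, Polynomial.eval_pow, Polynomial.eval_C, Polynomial.eval_X]
    exact Subring.mul_mem _ (ev_P hx0 H a) (Subring.pow_mem _ (ev_x H j) n)

theorem ev_inc1 [IsFractionRing (SR A) E] (H : G.Std) {c0 : Sg A → ℂ} {x0 : κ → ℂ} (hx0 : x0 ∈ Zc A c0) (j : κ)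
    {h : E} {h0 : ℂ} (hh : (h, h0) ∈ ev A E c0 x0) (R : Polynomial (Polynomial (CR A))) :
    (G.inc1 (G.x j) h R, ev2 (MvPolynomial.eval c0) (x0 j) h0 R) ∈ ev A E c0 x0 := by
  induction R using Polynomial.induction_on' with
  | add p q hp hq => rw [map_add, map_add]; exact Subring.add_mem _ hp hq
  | monomial n a =>
    rw [← Polynomial.C_mul_X_pow_eq_monomial, map_mul, map_pow, inc1_C, inc1_X, map_mul, map_pow, ev2_C]
    have : ev2 (MvPolynomial.eval c0) (x0 j) h0 Polynomial.X = h0 := by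
      rw [ev2, Polynomial.coe_eval₂RingHom, Polynomial.eval₂_X]
    rw [this]
    exact Subring.mul_mem _ (G.ev_inc0 H hx0 j a) (Subring.pow_mem _ hh n)

theorem curve_pc [IsFractionRing (SR A) E] (H : G.Std) (hcard : Fintype.card κ = Fintype.card ι + 1)
    (hcl : ∀ θ : E, IsAlgebraic G.K θ → θ ∈ G.K) {j : κ} (hy : Transcendental G.K (G.x j)) :
    ∃ q : Polynomial (CR A), q ≠ 0 ∧ (∃ p : CR A, p ≠ 0 ∧ ∀ c0, MvPolynomial.eval c0 p ≠ 0 →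
      q.map (MvPolynomial.eval c0) ≠ 0 ∧ IsPreconnected (Uj A c0 j q)) ∧
      ∀ F : E, F ≠ 0 → ∃ p : CR A, p ≠ 0 ∧ ∀ c0, MvPolynomial.eval c0 p ≠ 0 →
        ∃ x ∈ Uj A c0 j q, ∀ z0, (F, z0) ∈ ev A E c0 x → z0 ≠ 0 := by
  obtain ⟨h, P, hL, hP, hP0, hd, hz⟩ := G.curve H hcard hy
  have hinj := G.inc0_inj hy
  obtain ⟨q1, hq1, rs, hrs⟩ := G.curve_sep hinj hP hP0 hd hz
  choose q2 hq2 r2 hr2 using fun l => hz (G.x l)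
  choose q3 hq3 r3 hr3 using fun l => hz (G.x l)⁻¹
  let q := (∏ l, q2 l) * (∏ l, q3 l) * q1
  have hq : q ≠ 0 := mul_ne_zero (mul_ne_zero (Finset.prod_ne_zero_iff.2 fun l _ => hq2 l)
    (Finset.prod_ne_zero_iff.2 fun l _ => hq3 l)) hq1
  have hdv1 : q1 ∣ q := Dvd.intro_left _ rfl
  have hdv2 : ∀ l, q2 l ∣ q := fun l => Dvd.dvd.mul_right (Dvd.dvd.mul_right (Finset.dvd_prod_of_mem _ (Finset.mem_univ l)) _) _
  have hdv3 : ∀ l, q3 l ∣ q := fun l => Dvd.dvd.mul_right (Dvd.dvd.mul_left (Finset.dvd_prod_of_mem _ (Finset.mem_univ l)) _) _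
  have hN : P.natDegree ≠ 0 := by
    intro h0
    rw [hP.natDegree_eq_zero] at h0
    rw [h0, map_one] at hP0; exact one_ne_zero hP0
  -- the dividing lemma
  have hne : ∀ (c0 : Sg A → ℂ) (y0 : ℂ) (s : Polynomial (CR A)), s ∣ q → (q.map (MvPolynomial.eval c0)).eval y0 ≠ 0 →
      (s.map (MvPolynomial.eval c0)).eval y0 ≠ 0 := by
    rintro c0 y0 s ⟨t, ht⟩ h1 h2
    rw [ht, Polynomial.map_mul, Polynomial.eval_mul, h2, zero_mul] at h1
    exact h1 rfl
  -- the point map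
  let pt : (Sg A → ℂ) → ℂ × ℂ → κ → ℂ := fun c0 z l =>
    ev2 (MvPolynomial.eval c0) z.1 z.2 (r2 l) / ev2 (MvPolynomial.eval c0) z.1 z.2 (Polynomial.C (q2 l))
  have hpt : ∀ (c0 : Sg A → ℂ) (z : ℂ × ℂ), (q.map (MvPolynomial.eval c0)).eval z.1 ≠ 0 →
      ev2 (MvPolynomial.eval c0) z.1 z.2 P = 0 → pt c0 z ∈ Zc A c0 ∧ pt c0 z j = z.1 := by
    intro c0 z hqz hPz
    have hk : ∀ r, G.inc1 (G.x j) h r = 0 → ev2 (MvPolynomial.eval c0) z.1 z.2 r = 0 := by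
      intro r hr
      obtain ⟨t, rfl⟩ := hd r hr
      rw [map_mul, hPz, zero_mul]
    have hq' : ev2 (MvPolynomial.eval c0) z.1 z.2 (Polynomial.C q) ≠ 0 := by rw [ev2_C]; exact hqz
    have m2 : ∀ l, (G.x l, pt c0 z l) ∈ Gph (G.inc1 (G.x j) h) (ev2 (MvPolynomial.eval c0) z.1 z.2) (Polynomial.C q) := by
      intro l
      exact Gph.frac hq' (map_dvd Polynomial.C (hdv2 l)) (by rw [inc1_C]; exact hr2 l)
    constructor
    · refine Gph.point hk hq' G.x0 m2 ?_ (c := G.c) ?_ G.rel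
      · intro l
        exact ⟨_, Gph.frac (r := r3 l) hq' (map_dvd Polynomial.C (hdv3 l)) (by rw [inc1_C]; exact hr3 l)⟩
      · intro s
        have := Gph.inc_mem (inc := G.inc1 (G.x j) h) (e := ev2 (MvPolynomial.eval c0) z.1 z.2) (q := Polynomial.C q)
          (Polynomial.C (Polynomial.C (MvPolynomial.X s)))
        rw [inc1_C, inc0_C, MvPolynomial.aeval_X, ev2_C, Polynomial.map_C, Polynomial.eval_C, MvPolynomial.eval_X] at this
        exact this
    · have := Gph.inc_mem (inc := G.inc1 (G.x j) h) (e := ev2 (MvPolynomial.eval c0) z.1 z.2) (q := Polynomial.C q)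
          (Polynomial.C Polynomial.X)
      rw [inc1_C, inc0_X, ev2_C, Polynomial.map_X, Polynomial.eval_X] at this
      exact Gph.uniq hk hq' (m2 j) this
  refine ⟨q, hq, ?_, ?_⟩
  · let D := ∑ i ∈ Finset.range (P.natDegree + 1), (P.coeff i).natDegree
    have hD : ∀ i, (P.coeff i).natDegree ≤ D := by
      intro i
      by_cases hi : i < P.natDegree + 1
      · exact Finset.single_le_sum (f := fun i => (P.coeff i).natDegree) (fun _ _ => Nat.zero_le _) (Finset.mem_range.2 hi)
      · rw [Polynomial.coeff_eq_zero_of_natDegree_lt (by omega)]; simp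
    obtain ⟨p, hp, hirr⟩ := G.irr hcl hP hP0 hd (P.natDegree * D)
    refine ⟨p * q.leadingCoeff, mul_ne_zero hp (Polynomial.leadingCoeff_ne_zero.2 hq), fun c0 hc0 => ?_⟩
    rw [map_mul] at hc0
    have hq0 := lead_gen (right_ne_zero_of_mul hc0)
    refine ⟨hq0, ?_⟩
    have hND : (P.map (Polynomial.mapRingHom (MvPolynomial.eval c0))).natDegree = P.natDegree := hP.natDegree_map _
    have hS := AN_lemma (P.map (Polynomial.mapRingHom (MvPolynomial.eval c0))) (hP.map _) (q.map (MvPolynomial.eval c0)) hq0 D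
      (by
        intro i
        rw [Polynomial.coeff_map, Polynomial.coe_mapRingHom]
        exact Polynomial.natDegree_map_le.trans (hD i))
      (by
        intro s T hs hT h0
        rw [Polynomial.derivative_map, Polynomial.derivative_map, ← ev2_eq] at h0
        rw [← ev2_eq] at hT
        obtain ⟨t, ht⟩ := hrs
        have h1 := congrArg (ev2 (MvPolynomial.eval c0) s T) ht
        rw [map_sub (ev2 (MvPolynomial.eval c0) s T) (Polynomial.derivative P * rs) (Polynomial.C q1), map_mul, map_mul, h0, hT, zero_mul, zero_mul, zero_sub, neg_eq_zero, ev2_C] at h1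
        exact hne c0 s q1 hdv1 hs h1)
      (by rw [hND]; exact hirr c0 (left_ne_zero_of_mul hc0))
    have himg : Uj A c0 j q = pt c0 '' {z : ℂ × ℂ | (q.map (MvPolynomial.eval c0)).eval z.1 ≠ 0 ∧
        ((P.map (Polynomial.mapRingHom (MvPolynomial.eval c0))).map (Polynomial.evalRingHom z.1)).eval z.2 = 0} := by
      ext x
      constructor
      · rintro ⟨hx, hxq⟩
        obtain ⟨h0, hh0⟩ := ev_lau hx hL
        refine ⟨(x j, h0), ⟨hxq, ?_⟩, ?_⟩
        · rw [← ev2_eq]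
          have h1 := G.ev_inc1 H hx j hh0 P
          rw [hP0] at h1
          exact ev_uniq hx h1 (Subring.zero_mem _)
        · ext l
          have h1 := Subring.mul_mem _ (ev_x (x0 := x) (c0 := c0) H l) (G.ev_inc0 H hx j (q2 l))
          rw [Prod.mk_mul_mk, hr2] at h1
          have h2 := ev_uniq hx h1 (G.ev_inc1 H hx j hh0 (r2 l))
          simp only [pt]
          rw [ev2_C, div_eq_iff (hne c0 _ _ (hdv2 l) hxq)]
          exact h2.symm
      · rintro ⟨z, ⟨hz1, hz2⟩, rfl⟩
        rw [← ev2_eq] at hz2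
        obtain ⟨a, b⟩ := hpt c0 z hz1 hz2
        exact ⟨a, by rw [b]; exact hz1⟩
    rw [himg]
    refine hS.image _ (continuousOn_pi.2 fun l => ?_)
    refine ContinuousOn.div (ev2_cont _ _).continuousOn (ev2_cont _ _).continuousOn ?_
    rintro z ⟨hz1, -⟩
    rw [ev2_C]; exact hne c0 _ _ (hdv2 l) hz1
  · intro F hF
    obtain ⟨q', hq', r', hr'⟩ := hz F⁻¹
    refine ⟨(q * q').leadingCoeff, Polynomial.leadingCoeff_ne_zero.2 (mul_ne_zero hq hq'), fun c0 hc0 => ?_⟩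
    have h1 := lead_gen hc0
    obtain ⟨y0, hy0⟩ : ∃ y0, ((q * q').map (MvPolynomial.eval c0)).eval y0 ≠ 0 := by
      by_contra! hcon
      exact h1 (Polynomial.funext fun y => by rw [hcon y, Polynomial.eval_zero])
    rw [Polynomial.map_mul, Polynomial.eval_mul] at hy0
    obtain ⟨h0, hh0⟩ := IsAlgClosed.exists_root
      ((P.map (Polynomial.mapRingHom (MvPolynomial.eval c0))).map (Polynomial.evalRingHom y0)) (by
        apply Polynomial.degree_ne_of_natDegree_ne
        rw [(hP.map _).natDegree_map, hP.natDegree_map]; exact hN)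
    rw [Polynomial.IsRoot.def, ← ev2_eq] at hh0
    obtain ⟨a, b⟩ := hpt c0 (y0, h0) (left_ne_zero_of_mul hy0) hh0
    refine ⟨pt c0 (y0, h0), ⟨a, by rw [b]; exact left_ne_zero_of_mul hy0⟩, ?_⟩
    intro z0 hz0 hz00
    obtain ⟨h', hh'⟩ := ev_lau a hL
    have h2 := Subring.mul_mem _ hz0 (G.ev_inc1 H a j hh' r')
    rw [Prod.mk_mul_mk, ← hr', ← mul_assoc, mul_inv_cancel₀ hF, one_mul] at h2
    have h3 := ev_uniq a h2 (G.ev_inc0 H a j q')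
    rw [hz00, zero_mul, b] at h3
    exact right_ne_zero_of_mul hy0 h3.symm

end GP
end Khov

open Pointwise Module
namespace Khov

variable {ι κ : Type} [Fintype ι] [DecidableEq ι] [Fintype κ] [DecidableEq κ] {A : ι → Finset (κ → ℤ)}

theorem lin_hli {g : ι → κ → ℂ} (hg : LinearIndependent ℂ g) {w : κ → ℂ} (hw : w ∉ Submodule.span ℂ (Set.range g))
    (η : ι → ℂ) (t : ℂ) (h : ∀ j, t * w j + ∑ i, η i * g i j = 0) : t = 0 ∧ ∀ i, η i = 0 := by
  have h1 : t • w + ∑ i, η i • g i = 0 := by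
    ext j
    simpa [Finset.sum_apply] using h j
  have ht : t = 0 := by
    by_contra ht
    apply hw
    have h2 : w = (-t⁻¹) • ∑ i, η i • g i := by
      have : ∑ i, η i • g i = -(t • w) := by rw [eq_neg_iff_add_eq_zero, add_comm]; exact h1
      rw [this, smul_neg, neg_smul, neg_neg, smul_smul, inv_mul_cancel₀ ht, one_smul]
    rw [h2]
    exact Submodule.smul_mem _ _ (Submodule.sum_mem _ fun i _ => Submodule.smul_mem _ _ (Submodule.subset_span ⟨i, rfl⟩))
  refine ⟨ht, ?_⟩
  rw [ht, zero_smul, zero_add] at h1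
  exact Fintype.linearIndependent_iff.1 hg η h1

theorem ex_single {g : ι → κ → ℂ} (hc : Fintype.card ι < Fintype.card κ) :
    ∃ j, (Pi.single j 1 : κ → ℂ) ∉ Submodule.span ℂ (Set.range g) := by
  by_contra! hcon
  have h1 : Submodule.span ℂ (Set.range g) = ⊤ := by
    rw [eq_top_iff, ← (Pi.basisFun ℂ κ).span_eq, Submodule.span_le]
    rintro _ ⟨j, rfl⟩
    rw [Pi.basisFun_apply]; exact hcon j
  have h2 := finrank_range_le_card (R := ℂ) g
  rw [Set.finrank, h1, finrank_top, finrank_fintype_fun_eq_card] at h2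
  omega

theorem gen_one (hA0 : ∀ i, (0 : κ → ℤ) ∈ A i) (hind : Ind A) (hnc : ¬ Crit (latt κ) (GP.B A))
    (hcard : Fintype.card κ = Fintype.card ι + 1) : Gen A := by
  classical
  obtain ⟨G, H⟩ := exists_gp hA0 hind
  have hcl : ∀ θ, IsAlgebraic G.K θ → θ ∈ G.K := fun θ hθ => H.K_closed hnc θ hθ
  obtain ⟨p0, hp0, hE3⟩ := E3 hA0
  choose q hq hpc hF using fun j : {j // Transcendental G.K (G.x j)} => G.curve_pc H hcard hcl j.2
  choose p1 hp1 hpc using hpc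
  choose p2 hp2 hF using fun jl : {j // Transcendental G.K (G.x j)} × {j // Transcendental G.K (G.x j)} =>
    hF jl.1 (G.inc0 (G.x jl.2) (q jl.2)) (fun h0 => hq jl.2 (G.inc0_inj jl.2.2 (h0.trans (map_zero _).symm)))
  choose r s hs hrs using fun j : {j // ¬ Transcendental G.K (G.x j)} => G.K_frac (hcl _ (not_not.1 j.2))
  refine ⟨p0 * (∏ j, p1 j) * (∏ jl, p2 jl) * ∏ j, s j, mul_ne_zero (mul_ne_zero (mul_ne_zero hp0
    (Finset.prod_ne_zero_iff.2 fun j _ => hp1 j)) (Finset.prod_ne_zero_iff.2 fun j _ => hp2 j)) (Finset.prod_ne_zero_iff.2 fun j _ => hs j),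
    fun c0 hc0 => ?_⟩
  simp only [map_mul, map_prod] at hc0
  have g0 := left_ne_zero_of_mul (left_ne_zero_of_mul (left_ne_zero_of_mul hc0))
  have g1 := fun j => Finset.prod_ne_zero_iff.1 (right_ne_zero_of_mul (left_ne_zero_of_mul (left_ne_zero_of_mul hc0))) j (Finset.mem_univ j)
  have g2 := fun j => Finset.prod_ne_zero_iff.1 (right_ne_zero_of_mul (left_ne_zero_of_mul hc0)) j (Finset.mem_univ j)
  have g3 := fun j => Finset.prod_ne_zero_iff.1 (right_ne_zero_of_mul hc0) j (Finset.mem_univ j)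
  have hinn : ∀ j l : {j // Transcendental G.K (G.x j)}, (Uj A c0 j (q j) ∩ Uj A c0 l (q l)).Nonempty := by
    intro j l
    obtain ⟨x, hx, hx'⟩ := hF (j, l) c0 (g2 _)
    exact ⟨x, hx, hx.1, hx' _ (G.ev_inc0 H hx.1 l (q l))⟩
  obtain ⟨j0, hj0⟩ := G.tb1_ex H hcard
  refine ⟨?_, ?_⟩
  · obtain ⟨x, hx, -⟩ := hinn ⟨j0, hj0⟩ ⟨j0, hj0⟩
    exact ⟨x, hx.1⟩
  have hV : IsPreconnected (⋃ j, Uj A c0 j.1 (q j)) :=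
    IsPreconnected.iUnion_of_reflTransGen (fun j => (hpc j c0 (g1 j)).2) fun i j => Relation.ReflTransGen.single (hinn i j)
  refine hV.subset_closure (Set.iUnion_subset fun j x hx => hx.1) ?_
  intro z hz
  rw [mem_closure_iff_nhds]
  intro W hW
  have hli := hE3 c0 g0 z hz
  obtain ⟨j, hj⟩ := ex_single (g := gr A c0 z) (by omega)
  have hop : ∀ {W}, W ∈ nhds z → ∀ᶠ t in nhds (z j), ∃ x' ∈ W, x' ∈ Zc A c0 ∧ x' j = t := by
    intro W hW
    have h1 := open_at hz (Pi.single j 1) (by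
      refine lin_hli (w := fun j' => (Pi.single j 1 : κ → ℂ) j' * z j') hli ?_
      intro hmem
      apply hj
      have h2 := Submodule.smul_mem _ (z j)⁻¹ hmem
      convert h2 using 1
      ext j'
      by_cases hjj : j' = j
      · subst hjj; simp [hz.1 j']
      · simp [hjj]) hW
    simpa [Pi.single_apply] using h1
  have hjT : Transcendental G.K (G.x j) := by
    by_contra hjT
    have hconst : ∀ x ∈ Zc A c0, x j * MvPolynomial.eval c0 (s ⟨j, hjT⟩) = MvPolynomial.eval c0 (r ⟨j, hjT⟩) := by
      intro x hx
      have h2 := Subring.mul_mem _ (GP.ev_x (x0 := x) (c0 := c0) H j) (GP.ev_P hx H (s ⟨j, hjT⟩))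
      rw [Prod.mk_mul_mk, hrs ⟨j, hjT⟩] at h2
      exact GP.ev_uniq hx h2 (GP.ev_P hx H (r ⟨j, hjT⟩))
    have h3 : ∀ᶠ t in nhds (z j), t = z j := by
      filter_upwards [hop Filter.univ_mem]
      rintro t ⟨x', -, hx', rfl⟩
      exact mul_right_cancel₀ (g3 ⟨j, hjT⟩) ((hconst x' hx').trans (hconst z hz).symm)
    have h4 : ∀ᶠ t in nhdsWithin (z j) {z j}ᶜ, False := by
      filter_upwards [nhdsWithin_le_nhds h3, self_mem_nhdsWithin] with t a b using b a
    obtain ⟨_, h5⟩ := h4.exists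
    exact h5
  have hroots : ∀ᶠ t in nhdsWithin (z j) {z j}ᶜ, ((q ⟨j, hjT⟩).map (MvPolynomial.eval c0)).eval t ≠ 0 := by
    have hq0 := (hpc ⟨j, hjT⟩ c0 (g1 _)).1
    have hfin : {t | ((q ⟨j, hjT⟩).map (MvPolynomial.eval c0)).eval t = 0}.Finite := by
      refine (((q ⟨j, hjT⟩).map (MvPolynomial.eval c0)).roots.toFinset.finite_toSet).subset fun t ht => ?_
      simpa [hq0] using ht
    have h6 : ({t | ((q ⟨j, hjT⟩).map (MvPolynomial.eval c0)).eval t = 0} \ {z j})ᶜ ∈ nhds (z j) :=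
      (hfin.subset Set.diff_subset).isClosed.isOpen_compl.mem_nhds (by simp)
    filter_upwards [nhdsWithin_le_nhds h6, self_mem_nhdsWithin] with t a b h7
    exact a ⟨h7, b⟩
  obtain ⟨t, ⟨x', hx'W, hx'Z, hx't⟩, ht⟩ := (Filter.Eventually.and (Filter.Eventually.filter_mono nhdsWithin_le_nhds (hop hW)) hroots).exists
  exact ⟨x', hx'W, Set.mem_iUnion.2 ⟨⟨j, hjT⟩, hx'Z, by rw [hx't]; exact ht⟩⟩

end Khov

open Pointwise Module
namespace Khov

variable {ι κ : Type} [Fintype ι] [DecidableEq ι] [Fintype κ] [DecidableEq κ] {A : ι → Finset (κ → ℤ)}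

/-- support of a generic affine function -/
def N0 (κ : Type) [Fintype κ] [DecidableEq κ] : Finset (κ → ℤ) := insert 0 (Finset.univ.image fun j : κ => Pi.single j (1 : ℤ))

/-- the system with one more affine equation -/
def Ap (A : ι → Finset (κ → ℤ)) : Option ι → Finset (κ → ℤ) := fun o => o.elim (N0 κ) A

/-- the underlying function of the enumeration of `N0` -/
def n0f (o : Option κ) : κ → ℤ := o.elim 0 fun j => Pi.single j 1

theorem n0f_mem (o : Option κ) : n0f o ∈ N0 κ := by
  cases o <;> simp [n0f, N0]

theorem n0_bij : Function.Bijective fun o : Option κ => (⟨n0f o, n0f_mem o⟩ : {a // a ∈ N0 κ}) := by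
  constructor
  · intro o o' h
    have h : n0f o = n0f o' := congrArg Subtype.val h
    cases o with
    | none =>
      cases o' with
      | none => rfl
      | some j =>
        have := congrFun h j
        simp [n0f] at this
    | some i =>
      cases o' with
      | none =>
        have := congrFun h i
        simp [n0f] at this
      | some j =>
        have := congrFun h i
        by_cases hij : i = j
        · rw [hij]
        · simp [n0f, Pi.single_apply, hij] at this
  · rintro ⟨a, ha⟩
    rcases Finset.mem_insert.1 ha with rfl | h
    · exact ⟨none, rfl⟩
    · obtain ⟨j, -, rfl⟩ := Finset.mem_image.1 h
      exact ⟨some j, rfl⟩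

/-- enumeration of `N0` -/
noncomputable def n0e (κ : Type) [Fintype κ] [DecidableEq κ] : Option κ ≃ {a // a ∈ N0 κ} := Equiv.ofBijective _ n0_bij

/-- coefficients of the extended system -/
noncomputable def cc {R : Type} [Neg R] (c : Sg A → R) (lam : κ → R) (t : R) : Sg (Ap A) → R
  | ⟨none, a⟩ => ((n0e κ).symm a).elim (-t) lam
  | ⟨some i, a⟩ => c ⟨i, a⟩

theorem cc_map {R S : Type} [Ring R] [Ring S] (φ : R →+* S) (c : Sg A → R) (lam : κ → R) (t : R) (s) :
    φ (cc c lam t s) = cc (fun s => φ (c s)) (fun j => φ (lam j)) (φ t) s := by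
  rcases s with ⟨_ | i, a⟩
  · simp only [cc]
    cases (n0e κ).symm a <;> simp
  · rfl

theorem cc_surj {R : Type} [Ring R] (c' : Sg (Ap A) → R) : ∃ (c : Sg A → R) (lam : κ → R) (t : R), c' = cc c lam t := by
  refine ⟨fun s => c' ⟨some s.1, s.2⟩, fun j => c' ⟨none, n0e κ (some j)⟩, - c' ⟨none, n0e κ none⟩, ?_⟩
  ext s
  rcases s with ⟨_ | i, a⟩
  · simp only [cc]
    obtain ⟨o, rfl⟩ := (n0e κ).surjective a
    rw [Equiv.symm_apply_apply]
    cases o <;> simp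
  · rfl

theorem cc_none_sum {R M : Type} [Ring R] [AddCommMonoid M] [Module R M] (c : Sg A → R) (lam : κ → R) (t : R) (f : (κ → ℤ) → M) :
    ∑ a : {a // a ∈ Ap A none}, cc c lam t ⟨none, a⟩ • f a.1 = (-t) • f 0 + ∑ j, lam j • f (Pi.single j 1) := by
  have : ∑ a : {a // a ∈ N0 κ}, cc c lam t ⟨none, a⟩ • f a.1 = (-t) • f 0 + ∑ j, lam j • f (Pi.single j 1) := by
    rw [← (n0e κ).sum_comp, Fintype.sum_option]
    simp only [cc, Equiv.symm_apply_apply]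
    rfl
  exact this

theorem xm_single (x : κ → ℂ) (j : κ) : xm x (Pi.single j 1) = x j := by
  rw [xm, Finset.prod_eq_single j]
  · simp
  · intro b _ hb; simp [hb]
  · simp

theorem Zc_cc (c : Sg A → ℂ) (lam : κ → ℂ) (t : ℂ) (x : κ → ℂ) :
    x ∈ Zc (Ap A) (cc c lam t) ↔ x ∈ Zc A c ∧ ∑ j, lam j * x j = t := by
  have h1 := cc_none_sum c lam t (xm x)
  simp only [smul_eq_mul, xm_zero, xm_single] at h1
  have h2 : (∑ a : {a // a ∈ Ap A none}, cc c lam t ⟨none, a⟩ * xm x a.1 = 0) ↔ ∑ j, lam j * x j = t := by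
    rw [h1]
    constructor
    · intro h; linear_combination h
    · intro h; linear_combination h
  constructor
  · rintro ⟨hx, h⟩
    exact ⟨⟨hx, fun i => h (some i)⟩, h2.1 (h none)⟩
  · rintro ⟨⟨hx, h⟩, h3⟩
    refine ⟨hx, fun o => ?_⟩
    cases o with
    | none => exact h2.2 h3
    | some i => exact h i

theorem gr_cc_none (c : Sg A → ℂ) (lam : κ → ℂ) (t : ℂ) (x : κ → ℂ) (j : κ) :
    gr (Ap A) (cc c lam t) x none j = lam j * x j := by
  have h1 := cc_none_sum c lam t (fun a => xm x a • cz ℂ a)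
  simp only [xm_single, cz_zero, smul_zero, zero_add, ← smul_assoc] at h1
  rw [gr]
  simp only [smul_eq_mul] at h1
  rw [h1, Finset.sum_apply, Finset.sum_eq_single j]
  · simp [cz]
  · intro b _ hb; simp [cz, Ne.symm hb]
  · simp

theorem B_Ap_some (i : ι) : GP.B (Ap A) (some i) = GP.B A i := rfl

theorem VJ_none {J : Finset (Option ι)} (h : none ∈ J) : VJ (GP.B (Ap A)) J = ⊤ := by
  rw [eq_top_iff, ← (Pi.basisFun ℝ κ).span_eq, Submodule.span_le]
  rintro _ ⟨j, rfl⟩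
  refine Submodule.subset_span ⟨none, h, 0, ⟨0, n0f_mem none, cz_zero ℝ⟩, cz ℝ (Pi.single j 1), ⟨_, n0f_mem (some j), rfl⟩, ?_⟩
  rw [sub_zero, Pi.basisFun_apply]
  ext l
  simp only [cz, Pi.single_apply]
  split_ifs <;> simp

theorem J_some {J : Finset (Option ι)} (h : none ∉ J) : ∃ J0 : Finset ι, J = J0.map Function.Embedding.some := by
  refine ⟨J.eraseNone, ?_⟩
  ext o
  cases o with
  | none => simp [h]
  | some i => simp

theorem VJ_some (J0 : Finset ι) : VJ (GP.B (Ap A)) (J0.map Function.Embedding.some) = VJ (GP.B A) J0 := by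
  rw [VJ, VJ]
  congr 1
  ext v
  simp only [Set.mem_setOf_eq, Finset.mem_map]
  constructor
  · rintro ⟨_, ⟨i, hi, rfl⟩, h⟩; exact ⟨i, hi, h⟩
  · rintro ⟨i, hi, h⟩; exact ⟨_, ⟨i, hi, rfl⟩, h⟩

theorem PJ_some (J0 : Finset ι) : PJ (GP.B (Ap A)) (J0.map Function.Embedding.some) = PJ (GP.B A) J0 := by
  rw [PJ, PJ, Finset.sum_map]; rfl

theorem card_opt_le (J : Finset (Option ι)) : J.card ≤ Fintype.card ι + 1 := by
  have := Finset.card_le_univ J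
  rwa [Fintype.card_option] at this

theorem Ap_zero (hA0 : ∀ i, (0 : κ → ℤ) ∈ A i) (o) : (0 : κ → ℤ) ∈ Ap A o := by
  cases o with
  | none => exact n0f_mem none
  | some i => exact hA0 i

theorem Ap_Ind (hind : Ind A) (hc : Fintype.card ι + 1 < Fintype.card κ) : Ind (Ap A) := by
  intro J
  by_cases h : none ∈ J
  · rw [VJ_none h, finrank_top, finrank_fintype_fun_eq_card]
    exact (card_opt_le J).trans hc.le
  · obtain ⟨J0, rfl⟩ := J_some h
    rw [VJ_some, Finset.card_map]; exact hind J0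

theorem Ap_Crit (hA0 : ∀ i, (0 : κ → ℤ) ∈ A i) (hnc : ¬ Crit (latt κ) (GP.B A)) (hc : Fintype.card ι + 1 < Fintype.card κ) :
    ¬ Crit (latt κ) (GP.B (Ap A)) := by
  rintro ⟨J, hJ, h1, h2⟩
  by_cases h : none ∈ J
  · rw [vectorSpan_PJ (GP.B (Ap A)) (fun o => ⟨cz ℝ 0, 0, Ap_zero hA0 o, rfl⟩), VJ_none h, finrank_top, finrank_fintype_fun_eq_card] at h1
    have := card_opt_le J
    omega
  · obtain ⟨J0, rfl⟩ := J_some h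
    rw [PJ_some] at h1 h2
    rw [Finset.card_map] at h1
    exact hnc ⟨J0, (Finset.map_nonempty).1 hJ, h1, h2⟩

end Khov

open Pointwise Module
namespace Khov

variable {ι κ : Type} [Fintype ι] [DecidableEq ι] [Fintype κ] [DecidableEq κ] {A : ι → Finset (κ → ℤ)}

theorem eval_cc {R : Type} [CommRing R] [Algebra ℂ R] (φ : R →ₐ[ℂ] ℂ) (c : Sg A → R) (lam : κ → R) (t : R) (p : CR (Ap A)) :
    φ (MvPolynomial.aeval (cc c lam t) p) =
    MvPolynomial.eval (cc (fun s => φ (c s)) (fun j => φ (lam j)) (φ t)) p := by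
  rw [← MvPolynomial.coe_aeval_eq_eval]
  rw [MvPolynomial.comp_aeval_apply]
  have : (fun s => φ (cc c lam t s)) = cc (fun s => φ (c s)) (fun j => φ (lam j)) (φ t) := by
    ext s; exact cc_map φ.toRingHom c lam t s
  rw [this]; rfl

/-- part of the zero set over a subset of the line -/
theorem fib_conn {c : Sg A → ℂ} {lam : κ → ℂ} {T : Set ℂ} (hT : IsConnected T)
    (hf : ∀ t ∈ T, IsConnected (Zc (Ap A) (cc c lam t)))
    (hs : ∀ t ∈ T, ∀ x ∈ Zc (Ap A) (cc c lam t), LinearIndependent ℂ (gr (Ap A) (cc c lam t) x)) :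
    IsConnected {x | x ∈ Zc A c ∧ ∑ j, lam j * x j ∈ T} := by
  set V := {x | x ∈ Zc A c ∧ ∑ j, lam j * x j ∈ T} with hV
  let f : V → T := fun x => ⟨∑ j, lam j * x.1 j, x.2.2⟩
  have hfc : Continuous f := by
    refine Continuous.subtype_mk ?_ _
    exact continuous_finset_sum _ fun j _ => continuous_const.mul ((continuous_apply j).comp continuous_subtype_val)
  have hfo : IsOpenMap f := by
    rw [isOpenMap_iff_nhds_le]
    rintro ⟨x, hx⟩ N hN
    rw [Filter.mem_map, nhds_subtype_eq_comap, Filter.mem_comap] at hN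
    obtain ⟨W, hW, hWN⟩ := hN
    have hx' : x ∈ Zc (Ap A) (cc c lam (∑ j, lam j * x j)) := (Zc_cc _ _ _ _).2 ⟨hx.1, rfl⟩
    have hli := hs _ hx.2 x hx'
    have h1 := open_at hx.1 lam (by
      intro η t ht
      have h2 := Fintype.linearIndependent_iff.1 hli (fun o => o.elim t η) (by
        ext j
        rw [Fintype.sum_option, Pi.add_apply, Finset.sum_apply]
        simp only [Option.elim, Pi.smul_apply, smul_eq_mul, gr_cc_none]
        exact ht j)
      exact ⟨h2 none, fun i => h2 (some i)⟩) hW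
    rw [nhds_subtype_eq_comap, Filter.mem_comap]
    refine ⟨_, h1, ?_⟩
    rintro ⟨t, ht⟩ ⟨x', hx'W, hx'Z, hx't⟩
    simp only at hx't
    subst hx't
    exact hWN (show (⟨x', hx'Z, ht⟩ : V) ∈ Subtype.val ⁻¹' W from hx'W)
  have hfib : ∀ t : T, IsConnected (f ⁻¹' {t}) := by
    rintro ⟨t, ht⟩
    have h1 := hf t ht
    have h2 : Zc (Ap A) (cc c lam t) = Subtype.val '' (f ⁻¹' {⟨t, ht⟩}) := by
      ext x
      rw [Zc_cc]
      constructor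
      · rintro ⟨hx, rfl⟩; exact ⟨⟨x, hx, ht⟩, rfl, rfl⟩
      · rintro ⟨⟨x, hx, hx'⟩, hfx, rfl⟩
        exact ⟨hx, congrArg Subtype.val hfx⟩
    rw [h2] at h1
    exact ⟨Set.image_nonempty.1 h1.1, (Topology.IsInducing.subtypeVal.isPreconnected_image).1 h1.2⟩
  have hsurj : Function.Surjective f := fun t => (hfib t).1
  have hq : Topology.IsQuotientMap f := hfo.isQuotientMap hfc hsurj
  haveI : ConnectedSpace T := isConnected_iff_connectedSpace.1 hT
  have h3 := hq.isCoinducing.isConnected_preimage_of_isClosed hfib isClosed_univ isConnected_univ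
  rw [Set.preimage_univ] at h3
  have h4 := h3.image Subtype.val continuous_subtype_val.continuousOn
  rwa [Set.image_univ, Subtype.range_coe] at h4

theorem ex_lin {g : ι → κ → ℂ} (hc : Fintype.card ι < Fintype.card κ) {x : κ → ℂ} (hx : ∀ j, x j ≠ 0) :
    ∃ P : MvPolynomial κ ℂ, P ≠ 0 ∧ ∀ lam, MvPolynomial.eval lam P ≠ 0 → (fun j => lam j * x j) ∉ Submodule.span ℂ (Set.range g) := by
  obtain ⟨j, hj⟩ := ex_single (g := g) hc
  obtain ⟨φ, hφ, hφ'⟩ := Submodule.exists_le_ker_of_notMem hj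
  refine ⟨∑ l, MvPolynomial.C (φ (Pi.single l 1) * x l) * MvPolynomial.X l, ?_, ?_⟩
  · intro h0
    have := congrArg (MvPolynomial.eval (Pi.single j 1 : κ → ℂ)) h0
    rw [map_zero, map_sum, Finset.sum_eq_single j] at this
    · simp [hx j] at this
      exact hφ this
    · intro b _ hb; simp [hb]
    · simp
  · intro lam h1 hmem
    apply h1
    have h2 := hφ' hmem
    rw [LinearMap.mem_ker, LinearMap.pi_apply_eq_sum_univ φ] at h2
    rw [map_sum, ← h2]
    refine Finset.sum_congr rfl fun l _ => ?_
    simp only [map_mul, MvPolynomial.eval_C, MvPolynomial.eval_X, smul_eq_mul]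
    have : (Pi.single l (1 : ℂ) : κ → ℂ) = fun j => if l = j then 1 else 0 := by
      ext j; simp [Pi.single_apply, eq_comm]
    rw [this]; ring

theorem gen_step (hA0 : ∀ i, (0 : κ → ℤ) ∈ A i) (hc : Fintype.card ι < Fintype.card κ) (hG : Gen (Ap A)) : Gen A := by
  obtain ⟨p1, hp1, h1⟩ := hG
  obtain ⟨p2, hp2, h2⟩ := E3 (A := Ap A) (Ap_zero hA0)
  obtain ⟨p3, hp3, h3⟩ := E3 (A := A) hA0
  obtain ⟨c', hc'⟩ : ∃ c', MvPolynomial.eval c' (p1 * p2) ≠ 0 := by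
    by_contra! hcon
    exact mul_ne_zero hp1 hp2 (MvPolynomial.funext fun c => by rw [hcon c, map_zero])
  obtain ⟨c1, lam1, t1, rfl⟩ := cc_surj c'
  let p4 : CR A := MvPolynomial.aeval (cc (MvPolynomial.X) (fun j => MvPolynomial.C (lam1 j)) (MvPolynomial.C t1)) (p1 * p2)
  have hp4 : ∀ c, MvPolynomial.eval c p4 = MvPolynomial.eval (cc c lam1 t1) (p1 * p2) := by
    intro c
    have := eval_cc (MvPolynomial.aeval c) (MvPolynomial.X) (fun j => MvPolynomial.C (lam1 j)) (MvPolynomial.C t1) (p1 * p2)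
    simp only [MvPolynomial.aeval_X, MvPolynomial.aeval_C, Algebra.algebraMap_self, RingHom.id_apply] at this
    exact this
  have hp40 : p4 ≠ 0 := by
    intro h0
    rw [← hp4, h0, map_zero] at hc'
    exact hc' rfl
  refine ⟨p3 * p4, mul_ne_zero hp3 hp40, fun c0 hc0 => ?_⟩
  rw [map_mul] at hc0
  have g3 := left_ne_zero_of_mul hc0
  have g4 := right_ne_zero_of_mul hc0
  rw [hp4] at g4
  -- good directions
  have key : ∀ lam, (∃ t, MvPolynomial.eval (cc c0 lam t) (p1 * p2) ≠ 0) → ∃ T : Set ℂ, Tᶜ.Finite ∧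
      IsConnected {x | x ∈ Zc A c0 ∧ ∑ j, lam j * x j ∈ T} := by
    rintro lam ⟨t0, ht0⟩
    let g : Polynomial ℂ := MvPolynomial.aeval (cc (fun s => Polynomial.C (c0 s)) (fun j => Polynomial.C (lam j)) Polynomial.X) (p1 * p2)
    have hg : ∀ t, g.eval t = MvPolynomial.eval (cc c0 lam t) (p1 * p2) := by
      intro t
      have := eval_cc (Polynomial.aeval t) (fun s => Polynomial.C (c0 s)) (fun j => Polynomial.C (lam j)) Polynomial.X (p1 * p2)
      simp only [Polynomial.aeval_X, Polynomial.aeval_C, Polynomial.coe_aeval_eq_eval, Algebra.algebraMap_self, RingHom.id_apply] at this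
      exact this
    have hg0 : g ≠ 0 := by
      intro h0
      rw [← hg, h0, Polynomial.eval_zero] at ht0
      exact ht0 rfl
    have hfin : {t | g.eval t = 0}.Finite := by
      refine (g.roots.toFinset.finite_toSet).subset fun t ht => ?_
      simpa [hg0] using ht
    have hTg : ∀ t ∈ {t | g.eval t = 0}ᶜ, MvPolynomial.eval (cc c0 lam t) p1 ≠ 0 ∧ MvPolynomial.eval (cc c0 lam t) p2 ≠ 0 := by
      intro t ht
      have ht' : g.eval t ≠ 0 := ht
      rw [hg, map_mul] at ht'
      exact ⟨left_ne_zero_of_mul ht', right_ne_zero_of_mul ht'⟩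
    refine ⟨{t | g.eval t = 0}ᶜ, by rw [compl_compl]; exact hfin, fib_conn ?_ (fun t ht => h1 _ (hTg t ht).1) (fun t ht => h2 _ (hTg t ht).2)⟩
    refine hfin.countable.isConnected_compl_of_one_lt_rank ?_
    rw [Complex.rank_real_complex]; norm_num
  refine ⟨?_, ?_⟩
  · obtain ⟨T, -, hT⟩ := key lam1 ⟨t1, g4⟩
    obtain ⟨x, hx, -⟩ := hT.1
    exact ⟨x, hx⟩
  refine isPreconnected_of_forall_pair fun x hx y hy => ?_
  obtain ⟨Px, hPx, hPx'⟩ := ex_lin (g := gr A c0 x) hc hx.1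
  obtain ⟨Py, hPy, hPy'⟩ := ex_lin (g := gr A c0 y) hc hy.1
  let p5 : MvPolynomial κ ℂ := MvPolynomial.aeval (cc (fun s => MvPolynomial.C (c0 s)) MvPolynomial.X (MvPolynomial.C t1)) (p1 * p2)
  have hp5 : ∀ lam, MvPolynomial.eval lam p5 = MvPolynomial.eval (cc c0 lam t1) (p1 * p2) := by
    intro lam
    have := eval_cc (MvPolynomial.aeval lam) (fun s => MvPolynomial.C (c0 s)) MvPolynomial.X (MvPolynomial.C t1) (p1 * p2)
    simp only [MvPolynomial.aeval_X, MvPolynomial.aeval_C, Algebra.algebraMap_self, RingHom.id_apply] at this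
    exact this
  have hp50 : p5 ≠ 0 := by
    intro h0
    rw [← hp5, h0, map_zero] at g4
    exact g4 rfl
  obtain ⟨lam, hlam⟩ : ∃ lam, MvPolynomial.eval lam (p5 * (Px * Py)) ≠ 0 := by
    by_contra! hcon
    exact mul_ne_zero hp50 (mul_ne_zero hPx hPy) (MvPolynomial.funext fun c => by rw [hcon c, map_zero])
  rw [map_mul, map_mul, hp5] at hlam
  have hx2 := hPx' lam (left_ne_zero_of_mul (right_ne_zero_of_mul hlam))
  have hy2 := hPy' lam (right_ne_zero_of_mul (right_ne_zero_of_mul hlam))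
  obtain ⟨T, hTf, hT⟩ := key lam ⟨t1, left_ne_zero_of_mul hlam⟩
  have hclos : ∀ z ∈ Zc A c0, (fun j => lam j * z j) ∉ Submodule.span ℂ (Set.range (gr A c0 z)) →
      z ∈ closure {x | x ∈ Zc A c0 ∧ ∑ j, lam j * x j ∈ T} := by
    intro z hz hz2
    rw [mem_closure_iff_nhds]
    intro W hW
    have h5 := open_at hz lam (lin_hli (h3 c0 g3 z hz) hz2) hW
    have h6 : (Tᶜ \ {∑ j, lam j * z j})ᶜ ∈ nhds (∑ j, lam j * z j) :=
      (hTf.subset Set.diff_subset).isClosed.isOpen_compl.mem_nhds (by simp)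
    have h7 : ∀ᶠ t in nhdsWithin (∑ j, lam j * z j) {∑ j, lam j * z j}ᶜ, t ∈ T := by
      filter_upwards [nhdsWithin_le_nhds h6, self_mem_nhdsWithin] with t a b
      by_contra hcon
      exact a ⟨hcon, b⟩
    obtain ⟨t, ⟨x', hx'W, hx'Z, hx't⟩, ht⟩ :=
      (Filter.Eventually.and (Filter.Eventually.filter_mono nhdsWithin_le_nhds h5) h7).exists
    exact ⟨x', hx'W, hx'Z, by rw [hx't]; exact ht⟩
  refine ⟨{x | x ∈ Zc A c0 ∧ ∑ j, lam j * x j ∈ T} ∪ {x, y}, ?_, Or.inr (Or.inl rfl), Or.inr (Or.inr rfl), ?_⟩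
  · rintro z (hz | rfl | rfl)
    · exact hz.1
    · exact hx
    · exact hy
  · refine hT.2.subset_closure Set.subset_union_left ?_
    rintro z (hz | rfl | rfl)
    · exact subset_closure hz
    · exact hclos _ hx hx2
    · exact hclos _ hy hy2

theorem gen_all (d : ℕ) : ∀ {ι : Type} [Fintype ι] [DecidableEq ι] {A : ι → Finset (κ → ℤ)}, (∀ i, (0 : κ → ℤ) ∈ A i) → Ind A →
    ¬ Crit (latt κ) (GP.B A) → Fintype.card κ = Fintype.card ι + d → Gen A := by
  induction d with
  | zero => intro ι _ _ A hA0 hind hnc h; exact gen_zero hA0 hind hnc h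
  | succ d ih =>
    intro ι _ _ A hA0 hind hnc h
    cases d with
    | zero => exact gen_one hA0 hind hnc h
    | succ d =>
      refine gen_step hA0 (by omega) (ih (Ap_zero hA0) (Ap_Ind hind (by omega)) (Ap_Crit hA0 hnc (by omega)) ?_)
      rw [Fintype.card_option]; omega

end Khov

open Pointwise Module
namespace Khov

section fin
variable {n k : ℕ}

theorem PJ_shift {A A' : Fin k → Finset (Fin n → ℤ)} {b : Fin k → Fin n → ℤ}
    (hA' : ∀ i, A' i = (A i).image (fun a => a - b i)) (J : Finset (Fin k)) :
    PJ (GP.B A') J = (-(cz ℝ (∑ i ∈ J, b i))) +ᵥ PJ (GP.B A) J := by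
  have h1 : ∀ i, convexHull ℝ (GP.B A' i) = {-(cz ℝ (b i))} + convexHull ℝ (GP.B A i) := by
    intro i
    have : GP.B A' i = {-(cz ℝ (b i))} + GP.B A i := by
      ext v
      simp only [GP.B, hA', Finset.coe_image, Set.image_image, Set.singleton_add, Set.mem_image, cz_sub]
      constructor
      · rintro ⟨a, ha, rfl⟩
        exact ⟨a, ha, by abel⟩
      · rintro ⟨a, ha, rfl⟩
        exact ⟨a, ha, by abel⟩
    rw [this, convexHull_add, convexHull_singleton]
  have h2 : ∑ i ∈ J, ({-(cz ℝ (b i))} : Set (Fin n → ℝ)) = {-(cz ℝ (∑ i ∈ J, b i))} := by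
    induction J using Finset.cons_induction with
    | empty => rw [Finset.sum_empty, Finset.sum_empty, cz_zero, neg_zero]; rfl
    | cons i J hi ih => rw [Finset.sum_cons, Finset.sum_cons, ih, Set.singleton_add_singleton, cz_add, neg_add]
  unfold PJ
  rw [Finset.sum_congr rfl (fun i _ => h1 i), Finset.sum_add_distrib, h2, Set.singleton_add]
  rfl

theorem main (A : Fin k → Finset (Fin n → ℤ)) (hA : ∀ i, (A i).Nonempty)
    (hindep : ∀ J : Finset (Fin k), J.Nonempty →
      J.card ≤ finrank ℝ ↥(vectorSpan ℝ (PJ (GP.B A) J)))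
    (hnoncrit : ∀ J : Finset (Fin k), J.Nonempty →
      (∃ x : Fin n → ℤ, (fun j => (x j : ℝ)) ∈ intrinsicInterior ℝ (PJ (GP.B A) J)) →
      finrank ℝ ↥(vectorSpan ℝ (PJ (GP.B A) J)) ≠ J.card) : Gen A := by
  choose b hb using hA
  let A' : Fin k → Finset (Fin n → ℤ) := fun i => (A i).image (fun a => a - b i)
  have hA' : ∀ i, A' i = (A i).image (fun a => a - b i) := fun i => rfl
  have h0 : ∀ i, (0 : Fin n → ℤ) ∈ A' i := fun i => Finset.mem_image.2 ⟨b i, hb i, sub_self _⟩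
  have hvs : ∀ J, vectorSpan ℝ (PJ (GP.B A') J) = vectorSpan ℝ (PJ (GP.B A) J) := fun J => by
    rw [PJ_shift hA', vectorSpan_vadd]
  have hind : Ind A' := by
    intro J
    rcases J.eq_empty_or_nonempty with rfl | hJ
    · simp
    rw [← vectorSpan_PJ _ (fun i => (⟨_, _, h0 i, rfl⟩ : (GP.B A' i).Nonempty)), hvs]
    exact hindep J hJ
  have hnc : ¬ Crit (latt (Fin n)) (GP.B A') := by
    rintro ⟨J, hJ, hd, W, ⟨x, rfl⟩, hW⟩
    refine hnoncrit J hJ ⟨x + ∑ i ∈ J, b i, ?_⟩ (by rw [← hvs, hd])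
    rw [PJ_shift hA'] at hW
    let φ := AffineIsometryEquiv.constVAdd ℝ (Fin n → ℝ) (-(cz ℝ (∑ i ∈ J, b i)))
    have h3 : (-(cz ℝ (∑ i ∈ J, b i))) +ᵥ PJ (GP.B A) J = φ.toAffineIsometry '' PJ (GP.B A) J := rfl
    rw [h3, AffineIsometry.intrinsicInterior_image] at hW
    obtain ⟨y, hy, hyx⟩ := hW
    have h4 : y = cz ℝ (x + ∑ i ∈ J, b i) := by
      have h5 : -(cz ℝ (∑ i ∈ J, b i)) + y = cz ℝ x := hyx
      rw [cz_add, ← h5]; abel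
    rw [h4] at hy
    exact hy
  have hkn : k ≤ n := by
    have := hind Finset.univ
    have h6 := Submodule.finrank_le (VJ (GP.B A') (Finset.univ : Finset (Fin k)))
    rw [Module.finrank_fin_fun] at h6
    simp only [Finset.card_univ, Fintype.card_fin] at this
    omega
  obtain ⟨p, hp, hpc⟩ := gen_all (n - k) h0 hind hnc (by simp only [Fintype.card_fin]; omega)
  let f : Sg A' → Sg A := fun s => ⟨s.1, s.2.1 + b s.1, by
    obtain ⟨a, ha, h⟩ := Finset.mem_image.1 s.2.2
    rw [← h]; simpa using ha⟩
  have hf : Function.Injective f := by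
    rintro ⟨i, a, ha⟩ ⟨i', a', ha'⟩ h
    simp only [f, Sigma.mk.injEq] at h
    obtain ⟨rfl, h⟩ := h
    simpa using h
  refine ⟨MvPolynomial.rename f p, ?_, fun c hc => ?_⟩
  · intro h
    exact hp (MvPolynomial.rename_injective f hf (by rw [h, map_zero]))
  rw [MvPolynomial.eval_rename] at hc
  have hcon := hpc _ hc
  have : Zc A c = Zc A' (c ∘ f) := by
    ext x
    refine and_congr_right fun hx => forall_congr' fun i => ?_
    have hsum : ∑ a : {a // a ∈ A i}, c ⟨i, a⟩ * xm x a.1 =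
        xm x (b i) * ∑ a : {a // a ∈ A' i}, (c ∘ f) ⟨i, a⟩ * xm x a.1 := by
      rw [Finset.mul_sum]
      symm
      refine Fintype.sum_bijective (fun a : {a // a ∈ A' i} => (⟨a.1 + b i, (f ⟨i, a⟩).2.2⟩ : {a // a ∈ A i})) ⟨?_, ?_⟩ _ _ ?_
      · intro a a' h
        have := congrArg Subtype.val h
        exact Subtype.ext (add_right_cancel this)
      · rintro ⟨a, ha⟩
        exact ⟨⟨a - b i, Finset.mem_image_of_mem _ ha⟩, Subtype.ext (sub_add_cancel _ _)⟩
      · intro a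
        rw [xm_add hx]
        show _ * (c (f ⟨i, a⟩) * _) = c (f ⟨i, a⟩) * _
        ring
    rw [hsum]
    exact ⟨fun h => (mul_eq_zero.1 h).resolve_left (xm_ne hx _), fun h => by rw [h, mul_zero]⟩
  rw [this]
  exact hcon

end fin
end Khov

theorem stmt16 {n k : ℕ}
    (A : Fin k → Finset (Fin n → ℤ)) (hA : ∀ i, (A i).Nonempty)
    (Δ : Fin k → Set (Fin n → ℝ))
    (hΔ : ∀ i, Δ i = convexHull ℝ ↑((A i).image fun v j => (v j : ℝ)))
    (hindep : ∀ J : Finset (Fin k), J.Nonempty →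
      J.card ≤ finrank ℝ ↥(vectorSpan ℝ (∑ i ∈ J, Δ i)))
    (hnoncrit : ∀ J : Finset (Fin k), J.Nonempty →
      (∃ x : Fin n → ℤ, (fun j => (x j : ℝ)) ∈ intrinsicInterior ℝ (∑ i ∈ J, Δ i)) →
      finrank ℝ ↥(vectorSpan ℝ (∑ i ∈ J, Δ i)) ≠ J.card) :
    ∃ p : MvPolynomial ((i : Fin k) × {a // a ∈ A i}) ℂ, p ≠ 0 ∧
      ∀ c : ((i : Fin k) × {a // a ∈ A i}) → ℂ, MvPolynomial.eval c p ≠ 0 →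
        IsConnected {x : Fin n → ℂ | (∀ j, x j ≠ 0) ∧
          ∀ i : Fin k, ∑ a ∈ (A i).attach, c ⟨i, a⟩ * ∏ j, x j ^ ((a : Fin n → ℤ) j) = 0} := by
  have hD : ∀ J : Finset (Fin k), ∑ i ∈ J, Δ i = Khov.PJ (Khov.GP.B A) J := by
    intro J
    refine Finset.sum_congr rfl fun i _ => ?_
    rw [hΔ, Finset.coe_image]
    rfl
  refine Khov.main A hA (fun J hJ => ?_) (fun J hJ h => ?_)
  · rw [← hD]
    exact hindep J hJ
  · rw [← hD] at h ⊢
    exact hnoncrit J hJ h
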